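/- Let ℓ ≥ 2 and μ > 0, and suppose p = ω(n^{−1/ℓ}). Let G be an n-vertex graph with degree sequence d_1 ≤ … ≤ d_n satisfying d_i > (ℓ−1)n/(ℓ+1) + i + μn for every i ≤ n/(ℓ+1). Then the random sparsification G_p contains the ℓth power of a Hamilton cycle with high probability. -/

import Mathlib

/-- `G` is a `k`-uniform hypergraph on vertex set `Fin n` (graphs: `k = 2`). -/
def IsHG (k n : ℕ) (G : Finset (Finset (Fin n))) : Prop := ∀ e ∈ G, e.card = k

/-- The degree of a vertex `v` in the edge set `G`. -/
def degOf {n : ℕ} (G : Finset (Finset (Fin n))) (v : Fin n) : ℕ :=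
  (G.filter (fun e => v ∈ e)).card

open Classical in
/-- Probability that the random sparsification of `G` (each edge kept
independently with probability `p`) satisfies `Q`. -/
noncomputable def sparsProb {α : Type*} [DecidableEq α] (G : Finset α) (p : ℝ)
    (Q : Finset α → Prop) : ℝ :=
  ∑ E ∈ G.powerset, if Q E then p ^ E.card * (1 - p) ^ (G.card - E.card) else 0

/-- The edge set `E` on `Fin n` contains the `ℓ`-th power of a Hamilton cycle. -/
def HasPowHamCycle (ℓ n : ℕ) (E : Finset (Finset (Fin n))) : Prop :=
  ∃ f : ℕ → Fin n, (∀ i, f (i + n) = f i) ∧ Set.InjOn f (Set.Iio n) ∧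
    (∀ v : Fin n, ∃ i < n, f i = v) ∧
    ∀ i j : ℕ, 1 ≤ j → j ≤ ℓ → ({f i, f (i + j)} : Finset (Fin n)) ∈ E

namespace PowHam

open Finset

/-- The probability of the outcome `W` of the `p`-random subset of `E`. -/
noncomputable def wt {α : Type*} (E : Finset α) (p : ℝ) (W : Finset α) : ℝ :=
  p ^ #W * (1 - p) ^ (#E - #W)

section threshold

variable {α : Type*}

lemma wt_nonneg {E W : Finset α} {p : ℝ} (h0 : 0 ≤ p) (h1 : p ≤ 1) : 0 ≤ wt E p W :=
  mul_nonneg (pow_nonneg h0 _) (pow_nonneg (by linarith) _)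

lemma sum_wt (E : Finset α) (p : ℝ) : ∑ W ∈ E.powerset, wt E p W = 1 := by
  simp only [wt]
  rw [Finset.sum_pow_mul_eq_add_pow]
  simp

lemma sum_subset_inv_pow_le (A : Finset α) {p lam : ℝ} (hp : 0 < p) (hl : 1 ≤ lam * p) (t : ℕ) :
    ∑ T ∈ A.powerset with t ≤ #T, (p ^ #T)⁻¹ ≤ ((lam * p) ^ t)⁻¹ * (1 + lam) ^ #A := by
  have hlam : 0 ≤ lam := by
    by_contra h
    push Not at h
    nlinarith
  have h1 : (1 + lam) ^ #A = ∑ T ∈ A.powerset, lam ^ #T := by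
    rw [add_comm, ← Finset.sum_pow_mul_eq_add_pow]
    simp
  rw [h1, Finset.mul_sum]
  refine (Finset.sum_le_sum fun T hT => ?_).trans
    (Finset.sum_le_sum_of_subset_of_nonneg (Finset.filter_subset _ _) fun T _ _ => ?_)
  · have ht := (Finset.mem_filter.1 hT).2
    have h2 : (lam * p) ^ t ≤ (lam * p) ^ #T := pow_le_pow_right₀ hl ht
    have h3 : 0 < (lam * p) ^ t := by positivity
    rw [inv_le_iff_one_le_mul₀ (by positivity), mul_assoc, ← mul_pow,
      inv_mul_eq_div, le_div_iff₀ h3, one_mul]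
    exact h2
  · positivity

variable [DecidableEq α]

lemma sum_powerset_insert_wt {E : Finset α} {a : α} (ha : a ∉ E) (p : ℝ)
    (f : Finset α → ℝ) :
    ∑ W ∈ (insert a E).powerset, wt (insert a E) p W * f W
      = ∑ W ∈ E.powerset, wt E p W * ((1 - p) * f W + p * f (insert a W)) := by
  rw [Finset.sum_powerset_insert ha, ← Finset.sum_add_distrib]
  refine Finset.sum_congr rfl fun W hW => ?_
  have hWE := Finset.mem_powerset.1 hW
  have haW : a ∉ W := fun h => ha (hWE h)
  have hc := Finset.card_le_card hWE
  simp only [wt, Finset.card_insert_of_notMem ha, Finset.card_insert_of_notMem haW]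
  rw [show #E + 1 - #W = (#E - #W) + 1 by omega, show #E + 1 - (#W + 1) = #E - #W by omega]
  ring

lemma sum_wt_union (E : Finset α) (p q r : ℝ) (hr : 1 - r = (1 - p) * (1 - q))
    (f : Finset α → ℝ) :
    ∑ W₁ ∈ E.powerset, wt E p W₁ * ∑ W₂ ∈ E.powerset, wt E q W₂ * f (W₁ ∪ W₂)
      = ∑ W ∈ E.powerset, wt E r W * f W := by
  induction E using Finset.induction_on generalizing f with
  | empty => simp [wt]
  | insert a E ha ih =>
    rw [sum_powerset_insert_wt ha]
    have hr' : r = p + q - p * q := by linarith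
    rw [sum_powerset_insert_wt ha, ← ih]
    refine Finset.sum_congr rfl fun W₁ _ => ?_
    rw [sum_powerset_insert_wt ha, sum_powerset_insert_wt ha, Finset.mul_sum, Finset.mul_sum,
      ← Finset.sum_add_distrib]
    congr 1
    refine Finset.sum_congr rfl fun W₂ _ => ?_
    simp only [Finset.insert_union, Finset.union_insert, Finset.insert_idem]
    rw [hr']
    ring

lemma sum_wt_superset {E T : Finset α} (hT : T ⊆ E) (p : ℝ) :
    ∑ W ∈ E.powerset, wt E p W * (if T ⊆ W then 1 else 0) = p ^ #T := by
  induction E using Finset.induction_on generalizing T with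
  | empty => simp [wt, Finset.subset_empty.1 hT]
  | insert a E ha ih =>
    rw [sum_powerset_insert_wt ha]
    by_cases haT : a ∈ T
    · have h1 : T.erase a ⊆ E := by
        intro x hx
        rcases Finset.mem_insert.1 (hT (Finset.mem_of_mem_erase hx)) with h | h
        · exact absurd h (Finset.ne_of_mem_erase hx)
        · exact h
      have h2 : #T = #(T.erase a) + 1 := (Finset.card_erase_add_one haT).symm
      rw [h2, pow_succ, ← ih h1, Finset.sum_mul]
      refine Finset.sum_congr rfl fun W hW => ?_
      have haW : a ∉ W := fun h => ha (Finset.mem_powerset.1 hW h)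
      rw [if_neg (fun h => haW (h haT))]
      simp only [Finset.subset_insert_iff]
      ring
    · have h1 : T ⊆ E := (Finset.subset_insert_iff_of_notMem haT).1 hT
      rw [← ih h1]
      refine Finset.sum_congr rfl fun W hW => ?_
      simp only [Finset.subset_insert_iff_of_notMem haT]
      ring

variable {ι : Type*} [Fintype ι]

lemma exists_min_fragment (S : ι → Finset α) (i : ι) (W : Finset α) :
    ∃ T : Finset α, (∃ j, S j ⊆ W ∪ S i ∧ T = S j \ W) ∧
      ∀ j, S j ⊆ W ∪ S i → #T ≤ #(S j \ W) := by
  classical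
  let c : Finset ι := Finset.univ.filter fun j => S j ⊆ W ∪ S i
  have hc : c.Nonempty := ⟨i, by simp [c, Finset.subset_union_right]⟩
  obtain ⟨j, hj, hmin⟩ := Finset.exists_min_image c (fun j => #(S j \ W)) hc
  refine ⟨S j \ W, ⟨j, (Finset.mem_filter.1 hj).2, rfl⟩, fun j' hj' => hmin j' ?_⟩
  simp [c, hj']

/-- The minimum fragment of the member `S i` relative to `W`. -/
noncomputable def frag (S : ι → Finset α) (i : ι) (W : Finset α) : Finset α :=
  (exists_min_fragment S i W).choose

lemma frag_spec (S : ι → Finset α) (i : ι) (W : Finset α) :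
    ∃ j, S j ⊆ W ∪ S i ∧ frag S i W = S j \ W :=
  (exists_min_fragment S i W).choose_spec.1

lemma frag_min (S : ι → Finset α) (i : ι) (W : Finset α) {j : ι} (h : S j ⊆ W ∪ S i) :
    #(frag S i W) ≤ #(S j \ W) :=
  (exists_min_fragment S i W).choose_spec.2 j h

lemma frag_subset (S : ι → Finset α) (i : ι) (W : Finset α) : frag S i W ⊆ S i := by
  obtain ⟨j, h, e⟩ := frag_spec S i W
  rw [e]
  intro x hx
  have := h (Finset.mem_sdiff.1 hx).1
  have := (Finset.mem_sdiff.1 hx).2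
  simp_all

lemma frag_eq (S : ι → Finset α) (i : ι) (W : Finset α) {j : ι} (h : S j ⊆ W ∪ frag S i W) :
    frag S i W = S j \ W := by
  symm
  apply Finset.eq_of_subset_of_card_le
  · intro x hx
    have := h (Finset.mem_sdiff.1 hx).1
    have := (Finset.mem_sdiff.1 hx).2
    simp_all
  · exact frag_min S i W (h.trans (Finset.union_subset_union_right (frag_subset S i W)))

lemma exists_subset_frag (S : ι → Finset α) (i : ι) (W : Finset α) :
    ∃ j, S j ⊆ W ∪ frag S i W := by
  obtain ⟨j, h, e⟩ := frag_spec S i W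
  exact ⟨j, by rw [e]; intro x hx; by_cases h : x ∈ W <;> simp [h, hx]⟩

lemma wt_sdiff_le {E Z T : Finset α} (hZ : Z ⊆ E) (hT : T ⊆ Z) {p : ℝ} (hp : 0 < p)
    (hp1 : p ≤ 1) : wt E p (Z \ T) ≤ wt E p Z * (p ^ #T)⁻¹ := by
  have h1 : #(Z \ T) = #Z - #T := Finset.card_sdiff_of_subset hT
  have h2 := Finset.card_le_card hT
  have h3 := Finset.card_le_card hZ
  have h4 : p ^ #Z = p ^ (#Z - #T) * p ^ #T := by rw [← pow_add]; congr 1; omega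
  have h5 : (1 - p) ^ (#E - (#Z - #T)) ≤ (1 - p) ^ (#E - #Z) :=
    pow_le_pow_of_le_one (by linarith) (by linarith) (by omega)
  simp only [wt, h1, h4]
  have h6 : p ^ (#Z - #T) * p ^ #T * (1 - p) ^ (#E - #Z) * (p ^ #T)⁻¹
      = p ^ (#Z - #T) * (1 - p) ^ (#E - #Z) := by
    field_simp
  rw [h6]
  exact mul_le_mul_of_nonneg_left h5 (by positivity)

lemma sum_wt_large_frag_le {E : Finset α} (S : ι → Finset α) (hS : ∀ i, S i ⊆ E)
    {p lam : ℝ} (hp : 0 < p) (hp1 : p ≤ 1) (hl : 1 ≤ lam * p) (t : ℕ) (i : ι)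
    (j : Finset α → ι) (hj : ∀ Z, (∃ i, S i ⊆ Z) → S (j Z) ⊆ Z) :
    ∑ W ∈ E.powerset with t ≤ #(frag S i W), wt E p W
      ≤ ∑ Z ∈ E.powerset, wt E p Z * (((lam * p) ^ t)⁻¹ * (1 + lam) ^ #(S i ∩ S (j Z))) := by
  calc ∑ W ∈ E.powerset with t ≤ #(frag S i W), wt E p W
      ≤ ∑ W ∈ E.powerset with t ≤ #(frag S i W),
          wt E p (W ∪ frag S i W) * (p ^ #(frag S i W))⁻¹ := by
        refine Finset.sum_le_sum fun W hW => ?_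
        have hWE := Finset.mem_powerset.1 (Finset.mem_filter.1 hW).1
        obtain ⟨j', -, e⟩ := frag_spec S i W
        have hd : Disjoint W (frag S i W) := by rw [e]; exact Finset.disjoint_sdiff
        have h2 := wt_sdiff_le (E := E) (Z := W ∪ frag S i W) (T := frag S i W)
          (Finset.union_subset hWE ((frag_subset S i W).trans (hS i)))
          Finset.subset_union_right hp hp1
        rwa [Finset.union_sdiff_cancel_right hd] at h2
    _ = ∑ x ∈ (E.powerset.filter fun W => t ≤ #(frag S i W)).image
          (fun W => (⟨W ∪ frag S i W, frag S i W⟩ : (_ : Finset α) × Finset α)),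
          wt E p x.1 * (p ^ #x.2)⁻¹ := by
        rw [Finset.sum_image]
        intro W _ W' _ h
        simp only [Sigma.mk.injEq, heq_eq_eq] at h
        obtain ⟨h1, h2⟩ := h
        obtain ⟨_, -, e⟩ := frag_spec S i W
        obtain ⟨_, -, e'⟩ := frag_spec S i W'
        have hd : Disjoint W (frag S i W) := by rw [e]; exact Finset.disjoint_sdiff
        have hd' : Disjoint W' (frag S i W') := by rw [e']; exact Finset.disjoint_sdiff
        rw [← Finset.union_sdiff_cancel_right hd, ← Finset.union_sdiff_cancel_right hd', h1, h2]
    _ ≤ ∑ x ∈ E.powerset.sigma fun Z => (S i ∩ S (j Z)).powerset.filter fun T => t ≤ #T,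
          wt E p x.1 * (p ^ #x.2)⁻¹ := by
        refine Finset.sum_le_sum_of_subset_of_nonneg ?_ fun x _ _ =>
          mul_nonneg (wt_nonneg hp.le hp1) (by positivity)
        intro x hx
        obtain ⟨W, hW, rfl⟩ := Finset.mem_image.1 hx
        obtain ⟨hWE, ht⟩ := Finset.mem_filter.1 hW
        have hWE := Finset.mem_powerset.1 hWE
        have hs := frag_subset S i W
        simp only [Finset.mem_sigma, Finset.mem_powerset, Finset.mem_filter]
        refine ⟨Finset.union_subset hWE (hs.trans (hS i)), Finset.subset_inter hs ?_, ht⟩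
        have h1 := hj _ (exists_subset_frag S i W)
        conv_lhs => rw [frag_eq S i W h1]
        exact Finset.sdiff_subset
    _ = ∑ Z ∈ E.powerset, wt E p Z * ∑ T ∈ (S i ∩ S (j Z)).powerset with t ≤ #T,
          (p ^ #T)⁻¹ := by
        simp only [Finset.sum_sigma, Finset.mul_sum]
    _ ≤ _ := Finset.sum_le_sum fun Z _ => mul_le_mul_of_nonneg_left
        (sum_subset_inv_pow_le _ hp hl t) (wt_nonneg hp.le hp1)

open Classical in
lemma second_round {E : Finset α} (w : ι → ℝ) (hw : ∀ i, 0 ≤ w i) (hw1 : ∑ i, w i = 1)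
    (S : ι → Finset α) (hS : ∀ i, S i ⊆ E) {p e : ℝ} (hp : 0 < p) (hp1 : p ≤ 1) (he : 0 ≤ e)
    (t : ℕ) (H2 : ∀ i, ∀ T ⊆ S i, #T < t → ∑ j, w j * (1 + p⁻¹) ^ #(T ∩ S j) ≤ 1 + e)
    (W : Finset α) :
    1 - 2 * (∑ i with t ≤ #(frag S i W), w i) - e ≤
      ∑ W₂ ∈ E.powerset, wt E p W₂ * (if ∃ i, S i ⊆ W ∪ W₂ then 1 else 0) := by
  set a := ∑ i with t ≤ #(frag S i W), w i with ha
  set T : ι → Finset α := fun i => frag S i W with hT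
  have hTE : ∀ i, T i ⊆ E := fun i => (frag_subset S i W).trans (hS i)
  set B : Finset ι := Finset.univ.filter fun i => #(T i) < t with hB
  have hBa : ∑ i ∈ B, w i = 1 - a := by
    have := Finset.sum_filter_add_sum_filter_not Finset.univ (fun i => t ≤ #(frag S i W)) w
    rw [hw1] at this
    simp only [not_le] at this
    rw [hB, ha]
    linarith
  set X : Finset α → ℝ := fun W₂ => ∑ i ∈ B, w i * (p ^ #(T i))⁻¹ * (if T i ⊆ W₂ then 1 else 0)
    with hX
  set Y : Finset α → ℝ := fun W₂ => if ∃ i, S i ⊆ W ∪ W₂ then 1 else 0 with hY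
  have hwt : ∀ W, 0 ≤ wt E p W := fun W => wt_nonneg hp.le hp1
  have hXY : ∀ W₂, X W₂ = X W₂ * Y W₂ := by
    intro W₂
    by_cases h : ∃ i, S i ⊆ W ∪ W₂
    · simp [hY, h]
    · have : X W₂ = 0 := by
        refine Finset.sum_eq_zero fun i _ => ?_
        rw [if_neg, mul_zero]
        intro hi
        obtain ⟨j, hj⟩ := exists_subset_frag S i W
        exact h ⟨j, hj.trans (Finset.union_subset_union_right hi)⟩
      rw [this, zero_mul]
  have hEX : ∑ W₂ ∈ E.powerset, wt E p W₂ * X W₂ = 1 - a := by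
    rw [← hBa]
    simp only [hX, Finset.mul_sum]
    rw [Finset.sum_comm]
    refine Finset.sum_congr rfl fun i _ => ?_
    have h1 := sum_wt_superset (hTE i) p
    have hpos : p ^ #(T i) ≠ 0 := by positivity
    calc _ = w i * (p ^ #(T i))⁻¹ * ∑ W₂ ∈ E.powerset, wt E p W₂ * (if T i ⊆ W₂ then 1 else 0) := by
          rw [Finset.mul_sum]
          exact Finset.sum_congr rfl fun _ _ => by ring
      _ = w i := by rw [h1]; field_simp
  have hEX2 : ∑ W₂ ∈ E.powerset, wt E p W₂ * X W₂ ^ 2 ≤ 1 + e := by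
    have h1 : ∑ W₂ ∈ E.powerset, wt E p W₂ * X W₂ ^ 2
        = ∑ i ∈ B, ∑ j ∈ B, w i * w j * ((p ^ #(T i))⁻¹ * (p ^ #(T j))⁻¹ * p ^ #(T i ∪ T j)) := by
      simp only [hX, sq, Finset.sum_mul_sum]
      simp only [Finset.mul_sum]
      rw [Finset.sum_comm]
      refine Finset.sum_congr rfl fun i _ => ?_
      rw [Finset.sum_comm]
      refine Finset.sum_congr rfl fun j _ => ?_
      rw [← sum_wt_superset (Finset.union_subset (hTE i) (hTE j)) p, Finset.mul_sum, Finset.mul_sum]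
      refine Finset.sum_congr rfl fun W₂ _ => ?_
      by_cases hi : T i ⊆ W₂ <;> by_cases hj : T j ⊆ W₂ <;>
        simp [hi, hj, Finset.union_subset_iff]
      ring
    rw [h1]
    calc _ ≤ ∑ i ∈ B, w i * ∑ j, w j * (1 + p⁻¹) ^ #(T i ∩ S j) := by
          refine Finset.sum_le_sum fun i _ => ?_
          rw [Finset.mul_sum]
          refine (Finset.sum_le_sum fun j _ => ?_).trans
            (Finset.sum_le_sum_of_subset_of_nonneg (Finset.subset_univ B) fun j _ _ => ?_)
          · rw [← mul_assoc (w i) (w j)]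
            refine mul_le_mul_of_nonneg_left ?_ (mul_nonneg (hw i) (hw j))
            have h2 := Finset.card_union_add_card_inter (T i) (T j)
            have h3 : p ^ #(T i ∪ T j) * p ^ #(T i ∩ T j) = p ^ #(T i) * p ^ #(T j) := by
              rw [← pow_add, ← pow_add, h2]
            have h4 : (p ^ #(T i))⁻¹ * (p ^ #(T j))⁻¹ * p ^ #(T i ∪ T j)
                = (p⁻¹) ^ #(T i ∩ T j) := by
              rw [inv_pow, ← mul_inv, ← h3]
              have : p ^ #(T i ∪ T j) ≠ 0 := by positivity
              field_simp
            rw [h4]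
            calc (p⁻¹) ^ #(T i ∩ T j) ≤ (1 + p⁻¹) ^ #(T i ∩ T j) :=
                  pow_le_pow_left₀ (by positivity) (by linarith) _
              _ ≤ (1 + p⁻¹) ^ #(T i ∩ S j) :=
                  pow_le_pow_right₀ (by linarith [inv_pos.2 hp]) (Finset.card_le_card
                    (Finset.inter_subset_inter_left (frag_subset S j W)))
          · have := hw i
            have := hw j
            positivity
      _ ≤ ∑ i ∈ B, w i * (1 + e) := by
          refine Finset.sum_le_sum fun i hi => mul_le_mul_of_nonneg_left ?_ (hw i)
          exact H2 i _ (frag_subset S i W) (Finset.mem_filter.1 hi).2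
      _ ≤ ∑ i, w i * (1 + e) := Finset.sum_le_sum_of_subset_of_nonneg (Finset.subset_univ B)
          fun i _ _ => mul_nonneg (hw i) (by linarith)
      _ = 1 + e := by rw [← Finset.sum_mul, hw1, one_mul]
  set P := ∑ W₂ ∈ E.powerset, wt E p W₂ * Y W₂ with hP
  have hP0 : 0 ≤ P := Finset.sum_nonneg fun W₂ _ => mul_nonneg (hwt _) (by
    simp only [hY]; split_ifs <;> norm_num)
  have hCS : (1 - a) ^ 2 ≤ (1 + e) * P := by
    have h1 := Finset.sum_mul_sq_le_sq_mul_sq E.powerset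
      (fun W₂ => √(wt E p W₂) * X W₂) (fun W₂ => √(wt E p W₂) * Y W₂)
    have h2 : ∀ W₂, √(wt E p W₂) * X W₂ * (√(wt E p W₂) * Y W₂) = wt E p W₂ * X W₂ := by
      intro W₂
      rw [show √(wt E p W₂) * X W₂ * (√(wt E p W₂) * Y W₂)
        = (√(wt E p W₂) * √(wt E p W₂)) * (X W₂ * Y W₂) by ring, ← hXY, Real.mul_self_sqrt (hwt _)]
    have h3 : ∀ W₂, (√(wt E p W₂) * X W₂) ^ 2 = wt E p W₂ * X W₂ ^ 2 := by
      intro W₂; rw [mul_pow, Real.sq_sqrt (hwt _)]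
    have h4 : ∀ W₂, (√(wt E p W₂) * Y W₂) ^ 2 = wt E p W₂ * Y W₂ := by
      intro W₂; rw [mul_pow, Real.sq_sqrt (hwt _)]
      simp only [hY]; split_ifs <;> simp
    simp only [h2, h3, h4] at h1
    rw [hEX] at h1
    exact h1.trans (mul_le_mul_of_nonneg_right hEX2 hP0)
  by_contra hcon
  push Not at hcon
  have h5 := mul_lt_mul_of_pos_left hcon (show 0 < 1 + e by linarith)
  nlinarith [sq_nonneg (a + e)]

open Classical in
/-- Two rounds of exposure reach a member of a family equipped with a probability distribution,
provided the pair correlations of that distribution are small. -/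
lemma two_round {E : Finset α} (w : ι → ℝ) (hw : ∀ i, 0 ≤ w i) (hw1 : ∑ i, w i = 1)
    (S : ι → Finset α) (hS : ∀ i, S i ⊆ E) {p q lam M e : ℝ} (hp : 0 < p) (hp1 : p ≤ 1)
    (hq : 1 - q = (1 - p) * (1 - p))
    (hl : 1 ≤ lam * p) (he : 0 ≤ e) (t : ℕ)
    (H1 : ∀ j, ∑ i, w i * (1 + lam) ^ #(S i ∩ S j) ≤ M)
    (H2 : ∀ i, ∀ T ⊆ S i, #T < t → ∑ j, w j * (1 + p⁻¹) ^ #(T ∩ S j) ≤ 1 + e) :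
    1 - 2 * (((lam * p) ^ t)⁻¹ * M) - e ≤
      ∑ W ∈ E.powerset, wt E q W * (if ∃ i, S i ⊆ W then 1 else 0) := by
  have hwt : ∀ W, 0 ≤ wt E p W := fun W => wt_nonneg hp.le hp1
  rw [← sum_wt_union E p p q hq]
  have hne : Nonempty ι := by
    by_contra h
    rw [not_nonempty_iff] at h
    simp at hw1
  obtain ⟨j, hj⟩ : ∃ j : Finset α → ι, ∀ Z, (∃ i, S i ⊆ Z) → S (j Z) ⊆ Z := by
    refine ⟨fun Z => if h : ∃ i, S i ⊆ Z then h.choose else Classical.arbitrary ι, fun Z h => ?_⟩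
    simp only [dif_pos h]
    exact h.choose_spec
  have hA : ∑ W ∈ E.powerset, wt E p W * (∑ i with t ≤ #(frag S i W), w i)
      ≤ ((lam * p) ^ t)⁻¹ * M := by
    calc _ = ∑ i, w i * ∑ W ∈ E.powerset with t ≤ #(frag S i W), wt E p W := by
          simp only [Finset.sum_filter, Finset.mul_sum]
          rw [Finset.sum_comm]
          refine Finset.sum_congr rfl fun i _ => Finset.sum_congr rfl fun W _ => ?_
          split_ifs <;> ring
      _ ≤ ∑ i, w i * ∑ Z ∈ E.powerset,
            wt E p Z * (((lam * p) ^ t)⁻¹ * (1 + lam) ^ #(S i ∩ S (j Z))) :=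
          Finset.sum_le_sum fun i _ => mul_le_mul_of_nonneg_left
            (sum_wt_large_frag_le S hS hp hp1 hl t i j hj) (hw i)
      _ = ∑ Z ∈ E.powerset, wt E p Z * (((lam * p) ^ t)⁻¹ *
            ∑ i, w i * (1 + lam) ^ #(S i ∩ S (j Z))) := by
          simp only [Finset.mul_sum]
          rw [Finset.sum_comm]
          exact Finset.sum_congr rfl fun Z _ => Finset.sum_congr rfl fun i _ => by ring
      _ ≤ ∑ Z ∈ E.powerset, wt E p Z * (((lam * p) ^ t)⁻¹ * M) := by
          refine Finset.sum_le_sum fun Z _ => mul_le_mul_of_nonneg_left ?_ (hwt _)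
          exact mul_le_mul_of_nonneg_left (H1 _) (by positivity)
      _ = _ := by rw [← Finset.sum_mul, sum_wt, one_mul]
  calc _ ≤ ∑ W ∈ E.powerset, wt E p W * (1 - 2 * (∑ i with t ≤ #(frag S i W), w i) - e) := by
        have : ∑ W ∈ E.powerset, wt E p W * (1 - 2 * (∑ i with t ≤ #(frag S i W), w i) - e)
            = (1 - e) * ∑ W ∈ E.powerset, wt E p W
              - 2 * ∑ W ∈ E.powerset, wt E p W * (∑ i with t ≤ #(frag S i W), w i) := by
          rw [Finset.mul_sum, Finset.mul_sum, ← Finset.sum_sub_distrib]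
          exact Finset.sum_congr rfl fun W _ => by ring
        rw [this, sum_wt]
        linarith
    _ ≤ _ := Finset.sum_le_sum fun W _ => mul_le_mul_of_nonneg_left
        (second_round w hw hw1 S hS hp hp1 he t H2 W) (hwt _)

end threshold

section moment

variable {ι : Type*} [Fintype ι]

open Classical in
/-- The probability of the event `Q` under the weights `w`. -/
noncomputable def prob (w : ι → ℝ) (Q : ι → Prop) : ℝ := ∑ i, if Q i then w i else 0

lemma prob_mono {w : ι → ℝ} (hw : ∀ i, 0 ≤ w i) {Q R : ι → Prop} (h : ∀ i, Q i → R i) :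
    prob w Q ≤ prob w R := by
  classical
  refine Finset.sum_le_sum fun i _ => ?_
  by_cases hQ : Q i
  · simp [hQ, h i hQ]
  · simp only [hQ, if_false]
    split_ifs <;> simp [hw i]

lemma prob_nonneg {w : ι → ℝ} (hw : ∀ i, 0 ≤ w i) (Q : ι → Prop) : 0 ≤ prob w Q := by
  classical
  exact Finset.sum_nonneg fun i _ => by split_ifs <;> simp [hw i]

lemma prob_exists_le {β : Type*} {w : ι → ℝ} (hw : ∀ i, 0 ≤ w i) (B : Finset β)
    (Q : β → ι → Prop) {c : ℝ} (hc : ∀ b ∈ B, prob w (Q b) ≤ c) :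
    prob w (fun i => ∃ b ∈ B, Q b i) ≤ #B * c := by
  classical
  calc prob w (fun i => ∃ b ∈ B, Q b i) ≤ ∑ b ∈ B, prob w (Q b) := by
        simp only [prob]
        rw [Finset.sum_comm]
        refine Finset.sum_le_sum fun i _ => ?_
        have hnn : ∀ b ∈ B, (0 : ℝ) ≤ if Q b i then w i else 0 := fun b _ => by
          split_ifs <;> simp [hw i]
        split_ifs with h
        · obtain ⟨b, hb, hq⟩ := h
          have := Finset.single_le_sum hnn hb
          simpa [hq] using this
        · exact Finset.sum_nonneg hnn
    _ ≤ #B * c := by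
        rw [← nsmul_eq_mul]
        exact Finset.sum_le_card_nsmul _ _ _ hc

/-- The elements of `U` with no element of `U` among their `ℓ` predecessors. -/
def starts (ℓ : ℕ) (U : Finset ℕ) : Finset ℕ :=
  U.filter fun x => ∀ y ∈ U, y < x → y + ℓ < x

/-- The endpoints of a set of pairs. -/
def ends (I : Finset (ℕ × ℕ)) : Finset ℕ := I.image Prod.fst ∪ I.image Prod.snd

lemma mem_ends {I : Finset (ℕ × ℕ)} {x : ℕ} :
    x ∈ ends I ↔ ∃ y, (x, y) ∈ I ∨ (y, x) ∈ I := by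
  simp [ends, exists_or]

lemma card_ends_le (I : Finset (ℕ × ℕ)) : #(ends I) ≤ 2 * #I := by
  have h1 := Finset.card_union_le (I.image Prod.fst) (I.image Prod.snd)
  have h2 := Finset.card_image_le (s := I) (f := Prod.fst)
  have h3 := Finset.card_image_le (s := I) (f := Prod.snd)
  rw [ends]
  omega

lemma card_close_pairs_le {ℓ : ℕ} (hℓ : 1 ≤ ℓ) (K : Finset ℕ) (hK : 2 ≤ #K)
    (I : Finset (ℕ × ℕ)) (hI : ∀ e ∈ I, e.1 ∈ K ∧ e.2 ∈ K ∧ e.1 < e.2 ∧ e.2 ≤ e.1 + ℓ) :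
    #I + (2 * ℓ - 1) ≤ ℓ * #K := by
  induction h : #K generalizing K I with
  | zero => omega
  | succ k ih =>
    have hne : K.Nonempty := Finset.card_pos.1 (by omega)
    set x := K.max' hne with hx
    have hxK : x ∈ K := Finset.max'_mem _ _
    have hle : ∀ y ∈ K, y ≤ x := fun y hy => Finset.le_max' _ _ hy
    have hcard : #(K.erase x) = k := by rw [Finset.card_erase_of_mem hxK]; omega
    set I₁ := I.filter fun e => e.2 = x with hI₁
    set I₂ := I.filter fun e => ¬ e.2 = x with hI₂
    have hsum : #I₁ + #I₂ = #I := Finset.card_filter_add_card_filter_not _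
    have hinj : Set.InjOn Prod.fst (I₁ : Set (ℕ × ℕ)) := by
      intro a ha b hb hab
      have ha := (Finset.mem_filter.1 (Finset.mem_coe.1 ha)).2
      have hb := (Finset.mem_filter.1 (Finset.mem_coe.1 hb)).2
      exact Prod.ext hab (ha.trans hb.symm)
    have h1 : #I₁ ≤ ℓ := by
      have : I₁.image Prod.fst ⊆ Finset.Ico (x - ℓ) x := by
        intro y hy
        obtain ⟨e, he, rfl⟩ := Finset.mem_image.1 hy
        obtain ⟨he, he'⟩ := Finset.mem_filter.1 he
        have := hI e he
        rw [Finset.mem_Ico]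
        omega
      have := Finset.card_le_card this
      rw [Finset.card_image_of_injOn hinj, Nat.card_Ico] at this
      omega
    have h1' : #I₁ ≤ k := by
      have : I₁.image Prod.fst ⊆ K.erase x := by
        intro y hy
        obtain ⟨e, he, rfl⟩ := Finset.mem_image.1 hy
        obtain ⟨he, he'⟩ := Finset.mem_filter.1 he
        have := hI e he
        rw [Finset.mem_erase]
        exact ⟨by omega, this.1⟩
      have := Finset.card_le_card this
      rwa [Finset.card_image_of_injOn hinj, hcard] at this
    have hI₂' : ∀ e ∈ I₂, e.1 ∈ K.erase x ∧ e.2 ∈ K.erase x ∧ e.1 < e.2 ∧ e.2 ≤ e.1 + ℓ := by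
      intro e he
      obtain ⟨he, he'⟩ := Finset.mem_filter.1 he
      have h2 := hI e he
      have h3 := hle _ h2.2.1
      simp only [Finset.mem_erase]
      exact ⟨⟨by omega, h2.1⟩, ⟨he', h2.2.1⟩, h2.2.2⟩
    rcases Nat.lt_or_ge k 2 with hk | hk
    · have hk1 : k = 1 := by omega
      have : I₂ = ∅ := by
        rw [Finset.eq_empty_iff_forall_notMem]
        intro e he
        have h2 := hI₂' e he
        have h3 : #(K.erase x) ≤ 1 := by omega
        have := Finset.card_le_one.1 h3 _ h2.1 _ h2.2.1
        omega
      rw [this, Finset.card_empty] at hsum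
      subst hk1
      omega
    · have := ih (K.erase x) (by omega) I₂ hI₂' hcard
      rw [Nat.mul_succ]
      omega

lemma card_starts_le {ℓ : ℕ} {U K : Finset ℕ} {r : ℕ}
    (hK : ∀ x ∈ starts ℓ U, x ∈ K → x = r) :
    #(starts ℓ U) ≤ 1 + #(starts ℓ (U \ K)) := by
  have : starts ℓ U ⊆ insert r (starts ℓ (U \ K)) := by
    intro x hx
    rw [Finset.mem_insert]
    by_cases hxK : x ∈ K
    · exact Or.inl (hK x hx hxK)
    · right
      obtain ⟨h1, h2⟩ := Finset.mem_filter.1 hx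
      refine Finset.mem_filter.2 ⟨Finset.mem_sdiff.2 ⟨h1, hxK⟩, fun y hy => h2 y ?_⟩
      exact (Finset.mem_sdiff.1 hy).1
  have h1 := Finset.card_le_card this
  have h2 := Finset.card_insert_le r (starts ℓ (U \ K))
  omega

variable {P : Type*}

lemma prob_extend {w : ι → ℝ} (hw : ∀ i, 0 ≤ w i) (σ : ι → ℕ → P) (Ev : ι → Prop)
    (F : Finset ℕ) (y : ℕ) (τ : ℕ → P) (B : Finset P)
    (hB : ∀ i, (∀ v ∈ F, σ i v = τ v) → Ev i → σ i y ∈ B) (hy : y ∉ F) {c : ℝ}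
    (hc : ∀ τ : ℕ → P, prob w (fun i => (∀ v ∈ insert y F, σ i v = τ v) ∧ Ev i) ≤ c) :
    prob w (fun i => (∀ v ∈ F, σ i v = τ v) ∧ Ev i) ≤ #B * c := by
  classical
  refine le_trans (prob_mono hw (R := fun i => ∃ b ∈ B,
    (∀ v ∈ insert y F, σ i v = Function.update τ y b v) ∧ Ev i) ?_) (prob_exists_le hw B _ ?_)
  · rintro i ⟨h1, h2⟩
    refine ⟨σ i y, hB i h1 h2, fun v hv => ?_, h2⟩
    rcases Finset.mem_insert.1 hv with rfl | hvF
    · simp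
    · rw [Function.update_of_ne (by rintro rfl; exact hy hvF), h1 v hvF]
  · intro b _
    exact hc _

variable [Fintype P] (close : P → P → Prop)

/-- Adjacency in the graph with edge set `I`. -/
def PairAdj (I : Finset (ℕ × ℕ)) (x y : ℕ) : Prop := (x, y) ∈ I ∨ (y, x) ∈ I

open Classical in
lemma prob_reach {w : ι → ℝ} (hw : ∀ i, 0 ≤ w i) (σ : ι → ℕ → P) {d : ℕ}
    (hsymm : ∀ a b, close a b → close b a) (hdeg : ∀ a, #{b | close a b} ≤ d)
    (I : Finset (ℕ × ℕ)) (F K : Finset ℕ) (hFK : Disjoint F K) {r : ℕ} (hr : r ∈ K)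
    (hreach : ∀ y, y ∈ K ↔ Relation.ReflTransGen (PairAdj I) r y) {c : ℝ}
    (hc : ∀ τ : ℕ → P, prob w (fun i => (∀ v ∈ F ∪ K, σ i v = τ v) ∧
      ∀ e ∈ I, close (σ i e.1) (σ i e.2)) ≤ c) (τ : ℕ → P) :
    prob w (fun i => (∀ v ∈ F, σ i v = τ v) ∧ ∀ e ∈ I, close (σ i e.1) (σ i e.2))
      ≤ Fintype.card P * (d ^ (#K - 1) * c) := by
  have hc0 : 0 ≤ c := (prob_nonneg hw _).trans (hc τ)
  have key : ∀ m, ∀ K' ⊆ K, r ∈ K' → #K - #K' = m →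
      ∀ τ : ℕ → P, prob w (fun i => (∀ v ∈ F ∪ K', σ i v = τ v) ∧
      ∀ e ∈ I, close (σ i e.1) (σ i e.2)) ≤ d ^ m * c := by
    intro m
    induction m with
    | zero =>
      intro K' hK' _ h τ
      have : K' = K := Finset.eq_of_subset_of_card_le hK' (by omega)
      subst this
      simpa using hc τ
    | succ m ih =>
      intro K' hK' hr' h τ
      obtain ⟨u, hu, y, hy, hyK', huy⟩ : ∃ u ∈ K', ∃ y ∈ K, y ∉ K' ∧ PairAdj I u y := by
        by_contra hcon
        push Not at hcon
        have : K ⊆ K' := by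
          intro y hy
          have hy' := (hreach y).1 hy
          clear hy
          induction hy' with
          | refl => exact hr'
          | tail h1 h2 ih' =>
            by_contra h3
            exact hcon _ ih' _ ((hreach _).2 (h1.tail h2)) h3 h2
        have := Finset.card_le_card this
        omega
      have hyF : y ∉ F ∪ K' := by
        rw [Finset.mem_union]
        rintro (h1 | h1)
        · exact Finset.disjoint_left.1 hFK h1 hy
        · exact hyK' h1
      have hcard : #(insert y K') = #K' + 1 := Finset.card_insert_of_notMem hyK'
      have h5 : (0 : ℝ) ≤ d ^ m * c := by positivity
      refine (prob_extend hw σ (fun i => ∀ e ∈ I, close (σ i e.1) (σ i e.2)) (F ∪ K') y τ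
        (Finset.univ.filter fun b => close (τ u) b) (fun i h1 h2 => ?_) hyF
        (c := d ^ m * c) fun τ' => ?_).trans ?_
      · have h3 := h1 u (Finset.mem_union_right _ hu)
        rw [Finset.mem_filter, ← h3]
        refine ⟨Finset.mem_univ _, ?_⟩
        rcases huy with h4 | h4
        · exact h2 _ h4
        · exact hsymm _ _ (h2 _ h4)
      · have h4 := ih (insert y K') (Finset.insert_subset hy hK')
          (Finset.mem_insert_of_mem hr') (by omega) τ'
        rwa [Finset.union_insert] at h4
      · rw [show (d : ℝ) ^ (m + 1) * c = d * (d ^ m * c) by ring]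
        exact mul_le_mul_of_nonneg_right (by exact_mod_cast hdeg _) h5
  refine prob_extend hw σ _ F r τ Finset.univ (fun _ _ _ => Finset.mem_univ _)
    (fun h => Finset.disjoint_left.1 hFK h hr) fun τ' => ?_
  have h := key (#K - 1) {r} (by simpa using hr) (by simp) (by simp) τ'
  rw [Finset.union_comm, ← Finset.insert_eq] at h
  exact h

open Classical in
lemma prob_component_bound {w : ι → ℝ} (hw : ∀ i, 0 ≤ w i) (σ : ι → ℕ → P) {ℓ : ℕ} (hℓ : 1 ≤ ℓ)
    {n : ℕ} (hn : Fintype.card P ≤ n)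
    (hsymm : ∀ a b, close a b → close b a) (hdeg : ∀ a, #{b | close a b} ≤ 2 * ℓ)
    (I : Finset (ℕ × ℕ)) (hI : ∀ e ∈ I, e.1 < e.2 ∧ e.2 ≤ e.1 + ℓ) {c : ℝ}
    (hc : ∀ τ : ℕ → P, prob w (fun i => ∀ v ∈ ends I, σ i v = τ v) ≤ c) (hc0 : 0 ≤ c) :
    ∃ k : ℕ, #(starts ℓ (ends I)) ≤ k ∧ #I + (2 * ℓ - 1) * k ≤ ℓ * #(ends I) ∧
      prob w (fun i => ∀ e ∈ I, close (σ i e.1) (σ i e.2))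
        ≤ n ^ k * (2 * ℓ) ^ #(ends I) * c := by
  set U := ends I with hU
  have key : ∀ m, ∀ F ⊆ U, #(U \ F) = m → (∀ x y, PairAdj I x y → x ∈ F → y ∈ F) →
      ∃ k : ℕ, #(starts ℓ (U \ F)) ≤ k ∧
        #(I.filter fun e => e.1 ∉ F) + (2 * ℓ - 1) * k ≤ ℓ * #(U \ F) ∧
        ∀ τ : ℕ → P, prob w (fun i => (∀ v ∈ F, σ i v = τ v) ∧
          ∀ e ∈ I, close (σ i e.1) (σ i e.2)) ≤ n ^ k * (2 * ℓ) ^ #(U \ F) * c := by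
    intro m
    induction m using Nat.strong_induction_on with
    | _ m ih =>
    intro F hF hm hcl
    rcases Finset.eq_empty_or_nonempty (U \ F) with hemp | hne
    · have hUF : F = U := hF.antisymm (Finset.sdiff_eq_empty_iff_subset.1 hemp)
      refine ⟨0, ?_, ?_, ?_⟩
      · simp [hemp, starts]
      · rw [hemp, hUF, Finset.filter_eq_empty_iff.2]
        · simp
        · intro e he h
          exact h (mem_ends.2 ⟨e.2, Or.inl he⟩)
      · intro τ
        rw [hemp, hUF]
        simp only [pow_zero, Finset.card_empty, one_mul]
        exact (prob_mono hw fun i h => h.1).trans (hc τ)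
    · set r := (U \ F).min' hne with hr
      have hrU : r ∈ U \ F := Finset.min'_mem _ _
      obtain ⟨hrU', hrF⟩ := Finset.mem_sdiff.1 hrU
      set K := U.filter fun y => Relation.ReflTransGen (PairAdj I) r y with hK
      have hadjsymm : ∀ x y, PairAdj I x y → PairAdj I y x := fun x y h => h.symm
      have hadjU : ∀ x y, PairAdj I x y → y ∈ U := fun x y h => mem_ends.2 ⟨x, h.symm⟩
      have hreach : ∀ y, y ∈ K ↔ Relation.ReflTransGen (PairAdj I) r y := by
        intro y
        rw [hK, Finset.mem_filter]
        refine ⟨fun h => h.2, fun h => ⟨?_, h⟩⟩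
        rcases Relation.ReflTransGen.cases_tail h with h | ⟨z, -, h⟩
        · rw [← h] at hrU'; exact hrU'
        · exact hadjU _ _ h
      have hrK : r ∈ K := (hreach r).2 Relation.ReflTransGen.refl
      have hKF : ∀ y ∈ K, y ∉ F := by
        intro y hy
        have hy' := (hreach y).1 hy
        clear hy
        induction hy' with
        | refl => exact hrF
        | tail _ h2 ih' => exact fun h3 => ih' (hcl _ _ (hadjsymm _ _ h2) h3)
      have hFK : Disjoint F K := Finset.disjoint_right.2 hKF
      have hKU : K ⊆ U \ F := fun y hy =>
        Finset.mem_sdiff.2 ⟨(Finset.mem_filter.1 hy).1, hKF y hy⟩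
      have hKcl : ∀ x y, PairAdj I x y → x ∈ K → y ∈ K := fun x y h hx =>
        (hreach y).2 (((hreach x).1 hx).tail h)
      have hFKcl : ∀ x y, PairAdj I x y → x ∈ F ∪ K → y ∈ F ∪ K := fun x y h hx => by
        rcases Finset.mem_union.1 hx with hx | hx
        · exact Finset.mem_union_left _ (hcl _ _ h hx)
        · exact Finset.mem_union_right _ (hKcl _ _ h hx)
      have hsd : U \ (F ∪ K) = (U \ F) \ K := by rw [Finset.sdiff_sdiff_left']; ext; simp; tauto
      have hcard : #(U \ (F ∪ K)) + #K = #(U \ F) := by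
        rw [hsd]; exact Finset.card_sdiff_add_card_eq_card hKU
      have hK2 : 2 ≤ #K := by
        obtain ⟨y, hy⟩ := mem_ends.1 hrU'
        have hyK := hKcl r y hy hrK
        have hne : r ≠ y := by
          rcases hy with hy | hy
          · have := hI _ hy; omega
          · have := hI _ hy; omega
        exact Finset.one_lt_card.2 ⟨r, hrK, y, hyK, hne⟩
      obtain ⟨k, hk1, hk2, hk3⟩ := ih #(U \ (F ∪ K)) (by omega) (F ∪ K)
        (Finset.union_subset hF (hKU.trans Finset.sdiff_subset)) rfl hFKcl
      refine ⟨k + 1, ?_, ?_, ?_⟩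
      · rw [hsd] at hk1
        have := card_starts_le (ℓ := ℓ) (U := U \ F) (K := K) (r := r) ?_
        · omega
        intro x hx hxK
        obtain ⟨hx1, hx2⟩ := Finset.mem_filter.1 hx
        by_contra hxr
        have hrx : r < x := lt_of_le_of_ne (Finset.min'_le _ _ hx1) (Ne.symm hxr)
        have : ∀ y, Relation.ReflTransGen (PairAdj I) r y → y < x := by
          intro y hy
          induction hy with
          | refl => exact hrx
          | tail h1 h2 ih' =>
            have h3 := hx2 _ (hKU ((hreach _).2 h1)) ih'
            rcases h2 with h2 | h2
            · have := hI _ h2; simp only at this; omega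
            · have := hI _ h2; simp only at this; omega
        exact lt_irrefl _ (this x ((hreach x).1 hxK))
      · have h1 : I.filter (fun e => e.1 ∉ F)
            ⊆ I.filter (fun e => e.1 ∉ F ∪ K) ∪ I.filter (fun e => e.1 ∈ K) := by
          intro e he
          obtain ⟨h1, h2⟩ := Finset.mem_filter.1 he
          simp only [Finset.mem_union, Finset.mem_filter]
          tauto
        have h2 := (Finset.card_le_card h1).trans (Finset.card_union_le _ _)
        have h3 := card_close_pairs_le hℓ K hK2 (I.filter fun e => e.1 ∈ K) (by
          intro e he
          obtain ⟨h1, h2⟩ := Finset.mem_filter.1 he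
          exact ⟨h2, hKcl _ _ (Or.inl h1) h2, hI e h1⟩)
        rw [← hcard, Nat.mul_add, Nat.mul_add]
        omega
      · intro τ
        have h1 := prob_reach close hw σ hsymm hdeg I F K hFK hrK hreach hk3 τ
        refine h1.trans ?_
        have hd : (1 : ℝ) ≤ ((2 * ℓ : ℕ) : ℝ) := by exact_mod_cast (by omega : 1 ≤ 2 * ℓ)
        have h2 : ((2 * ℓ : ℕ) : ℝ) ^ (#K - 1) ≤ ((2 * ℓ : ℕ) : ℝ) ^ #K :=
          pow_le_pow_right₀ hd (by omega)
        have h3 : (Fintype.card P : ℝ) ≤ n := by exact_mod_cast hn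
        calc _ ≤ (n : ℝ) * (((2 * ℓ : ℕ) : ℝ) ^ #K * (n ^ k * (2 * ℓ) ^ #(U \ (F ∪ K)) * c)) := by
              gcongr
          _ = _ := by
              rw [← hcard, pow_add (2 * (ℓ : ℝ))]
              push_cast
              ring
  obtain ⟨k, h1, h2, h3⟩ := key _ ∅ (Finset.empty_subset _) rfl (by simp)
  refine ⟨k, by simpa using h1, by simpa using h2, ?_⟩
  rcases isEmpty_or_nonempty P with hP | ⟨⟨p0⟩⟩
  · have hι : IsEmpty ι := ⟨fun i => hP.elim (σ i 0)⟩
    simp only [prob, Finset.univ_eq_empty, Finset.sum_empty]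
    positivity
  · simpa using h3 fun _ => p0

/-- Total weight of the subsets of `X` below `x`. -/
noncomputable def scanTotal (ℓ : ℕ) (a θ : ℝ) (X : Finset ℕ) : ℝ :=
  ∑ U ∈ X.powerset, a ^ #U * θ ^ #(starts ℓ U)

/-- Total weight of the sets `insert x U` with `U` a subset of `X` below `x`. -/
noncomputable def scanEnd (ℓ : ℕ) (a θ : ℝ) (X : Finset ℕ) (x : ℕ) : ℝ :=
  ∑ U ∈ (X.filter (· < x)).powerset, a ^ (#U + 1) * θ ^ #(starts ℓ (insert x U))

lemma starts_insert {ℓ x : ℕ} {U : Finset ℕ} (hU : ∀ y ∈ U, y < x) :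
    #(starts ℓ (insert x U)) = #(starts ℓ U) + if ∀ y ∈ U, y + ℓ < x then 1 else 0 := by
  have hx : x ∉ U := fun h => lt_irrefl _ (hU x h)
  have h1 : ∀ z ∈ U, ((∀ y ∈ insert x U, y < z → y + ℓ < z) ↔ ∀ y ∈ U, y < z → y + ℓ < z) := by
    intro z hz
    have := hU z hz
    rw [Finset.forall_mem_insert]
    exact ⟨fun h => h.2, fun h => ⟨fun h' => by omega, h⟩⟩
  have h2 : (∀ y ∈ insert x U, y < x → y + ℓ < x) ↔ ∀ y ∈ U, y + ℓ < x := by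
    rw [Finset.forall_mem_insert]
    exact ⟨fun h y hy => h.2 y hy (hU y hy), fun h => ⟨fun h' => by omega, fun y hy _ => h y hy⟩⟩
  rw [starts, Finset.filter_insert, Finset.filter_congr h1]
  simp only [h2]
  split_ifs with h
  · rw [Finset.card_insert_of_notMem fun h => hx (Finset.mem_filter.1 h).1]
    rfl
  · rfl

lemma scanTotal_mono {ℓ : ℕ} {a θ : ℝ} (ha : 0 ≤ a) (hθ : 0 ≤ θ) {X Y : Finset ℕ} (h : X ⊆ Y) :
    scanTotal ℓ a θ X ≤ scanTotal ℓ a θ Y :=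
  Finset.sum_le_sum_of_subset_of_nonneg (Finset.powerset_mono.2 h) fun _ _ _ => by positivity

lemma scanEnd_le {ℓ : ℕ} {a θ : ℝ} (ha : 0 ≤ a) (hθ : 0 ≤ θ) (hal : 2 * a * ℓ ≤ 1)
    (X : Finset ℕ) (x : ℕ) : scanEnd ℓ a θ X x ≤ 2 * a * θ * scanTotal ℓ a θ (X.filter (· < x)) := by
  induction x using Nat.strong_induction_on with
  | _ x ih =>
  set Z := scanTotal ℓ a θ (X.filter (· < x)) with hZ
  have hZ0 : 0 ≤ Z := Finset.sum_nonneg fun _ _ => by positivity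
  set Q := (X.filter (· < x)).powerset with hQ
  have hlt : ∀ U ∈ Q, ∀ y ∈ U, y < x := fun U hU y hy =>
    (Finset.mem_filter.1 (Finset.mem_powerset.1 hU hy)).2
  set f : Finset ℕ → ℝ := fun U => a ^ (#U + 1) * θ ^ #(starts ℓ (insert x U)) with hf
  have hf0 : ∀ U, 0 ≤ f U := fun U => by positivity
  have h1 : ∑ U ∈ Q with (∀ y ∈ U, y + ℓ < x), f U ≤ a * θ * Z := by
    rw [hZ, scanTotal, Finset.mul_sum]
    refine (Finset.sum_le_sum fun U hU => ?_).trans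
      (Finset.sum_le_sum_of_subset_of_nonneg (Finset.filter_subset _ _) fun _ _ _ => by positivity)
    obtain ⟨hU1, hU2⟩ := Finset.mem_filter.1 hU
    simp only [hf]
    rw [starts_insert (hlt U hU1), if_pos hU2]
    exact le_of_eq (by ring)
  have h2 : ∑ U ∈ Q with ¬ (∀ y ∈ U, y + ℓ < x), f U
      ≤ ∑ y ∈ Finset.Ico (x - ℓ) x, a * scanEnd ℓ a θ X y := by
    set R : Finset ((_ : ℕ) × Finset ℕ) :=
      (Finset.Ico (x - ℓ) x).sigma fun y => (X.filter (· < y)).powerset with hR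
    have h3 : ∑ y ∈ Finset.Ico (x - ℓ) x, a * scanEnd ℓ a θ X y
        = ∑ q ∈ R, a * (a ^ (#q.2 + 1) * θ ^ #(starts ℓ (insert q.1 q.2))) := by
      rw [hR, Finset.sum_sigma]
      refine Finset.sum_congr rfl fun y _ => ?_
      rw [scanEnd, Finset.mul_sum]
    rw [h3]
    have hmax : ∀ U ∈ Q.filter fun U => ¬ (∀ y ∈ U, y + ℓ < x), ∃ q ∈ R, q.1 ∉ q.2 ∧
        insert q.1 q.2 = U := by
      intro U hU
      obtain ⟨hU1, hU2⟩ := Finset.mem_filter.1 hU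
      push Not at hU2
      obtain ⟨y, hy, hyx⟩ := hU2
      have hne : U.Nonempty := ⟨y, hy⟩
      have hm := Finset.max'_mem U hne
      have hym := Finset.le_max' U y hy
      refine ⟨⟨U.max' hne, U.erase (U.max' hne)⟩, ?_, by simp, Finset.insert_erase hm⟩
      rw [hR, Finset.mem_sigma, Finset.mem_Ico]
      refine ⟨⟨by simp only; omega, hlt U hU1 _ hm⟩, ?_⟩
      rw [Finset.mem_powerset]
      intro z hz
      obtain ⟨hz1, hz2⟩ := Finset.mem_erase.1 hz
      refine Finset.mem_filter.2 ⟨(Finset.mem_filter.1 (Finset.mem_powerset.1 hU1 hz2)).1, ?_⟩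
      exact lt_of_le_of_ne (Finset.le_max' U z hz2) hz1
    choose! g hg using hmax
    calc _ ≤ ∑ U ∈ Q with ¬ (∀ y ∈ U, y + ℓ < x),
          a * (a ^ (#(g U).2 + 1) * θ ^ #(starts ℓ (insert (g U).1 (g U).2))) := by
          refine Finset.sum_le_sum fun U hU => ?_
          obtain ⟨h5, h6, h7⟩ := hg U hU
          obtain ⟨hU1, hU2⟩ := Finset.mem_filter.1 hU
          have h8 : #U = #(g U).2 + 1 := by
            conv_lhs => rw [← h7]
            exact Finset.card_insert_of_notMem h6
          simp only [hf]
          rw [starts_insert (hlt U hU1), if_neg hU2, h7, ← h8]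
          exact le_of_eq (by ring)
      _ = ∑ q ∈ (Q.filter fun U => ¬ (∀ y ∈ U, y + ℓ < x)).image g,
          a * (a ^ (#q.2 + 1) * θ ^ #(starts ℓ (insert q.1 q.2))) := by
          rw [Finset.sum_image]
          intro U hU V hV h
          rw [← (hg U hU).2.2, ← (hg V hV).2.2, h]
      _ ≤ _ := by
          refine Finset.sum_le_sum_of_subset_of_nonneg ?_ fun _ _ _ => by positivity
          intro q hq
          obtain ⟨U, hU, rfl⟩ := Finset.mem_image.1 hq
          exact (hg U hU).1
  have h4 : ∑ y ∈ Finset.Ico (x - ℓ) x, a * scanEnd ℓ a θ X y ≤ ℓ * (a * (2 * a * θ * Z)) := by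
    have h5 : ∀ y ∈ Finset.Ico (x - ℓ) x, a * scanEnd ℓ a θ X y ≤ a * (2 * a * θ * Z) := by
      intro y hy
      have hyx := (Finset.mem_Ico.1 hy).2
      refine mul_le_mul_of_nonneg_left ((ih y hyx).trans ?_) ha
      refine mul_le_mul_of_nonneg_left (scanTotal_mono ha hθ ?_) (by positivity)
      intro z hz
      obtain ⟨h6, h7⟩ := Finset.mem_filter.1 hz
      exact Finset.mem_filter.2 ⟨h6, h7.trans hyx⟩
    refine (Finset.sum_le_card_nsmul _ _ _ h5).trans ?_
    rw [nsmul_eq_mul]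
    refine mul_le_mul_of_nonneg_right ?_ (by positivity)
    rw [Nat.card_Ico]
    exact_mod_cast (by omega : x - (x - ℓ) ≤ ℓ)
  have h5 : scanEnd ℓ a θ X x = ∑ U ∈ Q, f U := rfl
  rw [h5, ← Finset.sum_filter_add_sum_filter_not Q (fun U => ∀ y ∈ U, y + ℓ < x)]
  have h6 : (ℓ : ℝ) * (a * (2 * a * θ * Z)) ≤ a * θ * Z := by
    have : (ℓ : ℝ) * (a * (2 * a * θ * Z)) = (2 * a * ℓ) * (a * θ * Z) := by ring
    rw [this]
    exact mul_le_of_le_one_left (by positivity) hal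
  linarith

lemma scanTotal_le {ℓ : ℕ} {a θ : ℝ} (ha : 0 ≤ a) (hθ : 0 ≤ θ) (hal : 2 * a * ℓ ≤ 1)
    (X : Finset ℕ) : scanTotal ℓ a θ X ≤ (1 + 2 * a * θ) ^ #X := by
  induction X using Finset.induction_on_max with
  | empty => simp [scanTotal, starts]
  | insert x X hx ih =>
    have hxX : x ∉ X := fun h => lt_irrefl _ (hx x h)
    rw [Finset.card_insert_of_notMem hxX, pow_succ, scanTotal, Finset.sum_powerset_insert hxX]
    have h1 := scanEnd_le ha hθ hal X x
    rw [Finset.filter_true_of_mem hx] at h1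
    have h2 : ∑ U ∈ X.powerset, a ^ #(insert x U) * θ ^ #(starts ℓ (insert x U))
        = scanEnd ℓ a θ X x := by
      rw [scanEnd, Finset.filter_true_of_mem hx]
      refine Finset.sum_congr rfl fun U hU => ?_
      rw [Finset.card_insert_of_notMem fun h => hxX (Finset.mem_powerset.1 hU h)]
    rw [h2]
    change scanTotal ℓ a θ X + _ ≤ _
    have h3 : 0 ≤ 2 * a * θ := by positivity
    nlinarith

open Classical in
/-- Exponential moment of the number of pairs of `T` that are mapped to close positions by a
random map satisfying a spread condition. -/
lemma moment_bound {w : ι → ℝ} (hw : ∀ i, 0 ≤ w i) (σ : ι → ℕ → P) {ℓ : ℕ} (hℓ : 1 ≤ ℓ)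
    {n : ℕ} (hn : Fintype.card P ≤ n)
    (hsymm : ∀ a b, close a b → close b a) (hdeg : ∀ a, #{b | close a b} ≤ 2 * ℓ)
    (T : Finset (ℕ × ℕ)) (hT : ∀ e ∈ T, e.1 < e.2 ∧ e.2 ≤ e.1 + ℓ)
    {N s C a : ℝ} (hN : 1 ≤ N) (hNn : N ^ ℓ = n) (hs : 1 ≤ s) (hC : 0 ≤ C)
    (ha : a = 2 ^ ℓ * (2 * ℓ * C / s)) (hal : 2 * a * ℓ ≤ 1)
    (hspread : ∀ U ⊆ ends T, ∀ τ : ℕ → P, prob w (fun i => ∀ v ∈ U, σ i v = τ v) ≤ (C / n) ^ #U) :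
    ∑ i, w i * (1 + N / s ^ 2) ^ #(T.filter fun e => close (σ i e.1) (σ i e.2))
      ≤ (1 + 2 * a * (N ^ (ℓ - 1))⁻¹) ^ #(ends T) := by
  have hs0 : 0 < s := by linarith
  have hN0 : 0 < N := by linarith
  set θ := (N ^ (ℓ - 1))⁻¹ with hθ
  have hθ0 : 0 < θ := by positivity
  have hθ1 : θ ≤ 1 := inv_le_one_of_one_le₀ (one_le_pow₀ hN)
  set b := 2 * ℓ * C / s with hb
  have hb0 : 0 ≤ b := by positivity
  have hterm : ∀ I ⊆ T, (N / s ^ 2) ^ #I * prob w (fun i => ∀ e ∈ I, close (σ i e.1) (σ i e.2))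
      ≤ b ^ #(ends I) * θ ^ #(starts ℓ (ends I)) := by
    intro I hI
    have hsub : ends I ⊆ ends T :=
      Finset.union_subset_union (Finset.image_subset_image hI) (Finset.image_subset_image hI)
    obtain ⟨k, hk1, hk2, hk3⟩ := prob_component_bound close hw σ hℓ hn hsymm hdeg I
      (fun e he => hT e (hI he)) (hspread (ends I) hsub) (by positivity)
    have hv := card_ends_le I
    set v := #(ends I) with hv'
    calc (N / s ^ 2) ^ #I * prob w (fun i => ∀ e ∈ I, close (σ i e.1) (σ i e.2))
        ≤ (N / s ^ 2) ^ #I * (n ^ k * (2 * ℓ) ^ v * (C / n) ^ v) := by gcongr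
      _ = (N ^ #I * (n ^ k / n ^ v)) * (((s ^ 2) ^ #I)⁻¹ * ((2 * ℓ) ^ v * C ^ v)) := by
          rw [div_pow, div_pow]
          ring
      _ ≤ θ ^ k * ((s ^ v)⁻¹ * ((2 * ℓ) ^ v * C ^ v)) := by
          refine mul_le_mul ?_ ?_ (by positivity) (by positivity)
          · rw [← hNn, hθ, ← pow_mul, ← pow_mul, inv_pow, ← pow_mul, ← mul_div_assoc, ← pow_add,
              div_le_iff₀ (by positivity), inv_mul_eq_div, le_div_iff₀ (by positivity), ← pow_add]
            refine pow_le_pow_right₀ hN ?_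
            obtain ⟨m, rfl⟩ : ∃ m, ℓ = m + 1 := ⟨ℓ - 1, by omega⟩
            have : 2 * (m + 1) - 1 = 2 * m + 1 := by omega
            rw [this] at hk2
            simp only [Nat.add_sub_cancel]
            nlinarith
          · refine mul_le_mul_of_nonneg_right ?_ (by positivity)
            refine inv_anti₀ (by positivity) ?_
            rw [← pow_mul]
            exact pow_le_pow_right₀ hs hv
      _ = b ^ v * θ ^ k := by
          rw [hb, div_pow, mul_pow (2 * (ℓ : ℝ))]
          ring
      _ ≤ b ^ v * θ ^ #(starts ℓ (ends I)) := by
          refine mul_le_mul_of_nonneg_left ?_ (by positivity)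
          exact pow_le_pow_of_le_one hθ0.le hθ1 hk1
  have hexp : ∑ i, w i * (1 + N / s ^ 2) ^ #(T.filter fun e => close (σ i e.1) (σ i e.2))
      = ∑ I ∈ T.powerset, (N / s ^ 2) ^ #I *
        prob w (fun i => ∀ e ∈ I, close (σ i e.1) (σ i e.2)) := by
    simp only [prob, Finset.mul_sum]
    rw [Finset.sum_comm]
    refine Finset.sum_congr rfl fun i _ => ?_
    have h1 : (1 + N / s ^ 2) ^ #(T.filter fun e => close (σ i e.1) (σ i e.2))
        = ∑ I ∈ (T.filter fun e => close (σ i e.1) (σ i e.2)).powerset, (N / s ^ 2) ^ #I := by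
      rw [add_comm, ← Finset.sum_pow_mul_eq_add_pow]
      simp
    have h2 : (T.filter fun e => close (σ i e.1) (σ i e.2)).powerset
        = T.powerset.filter fun I => ∀ e ∈ I, close (σ i e.1) (σ i e.2) := by
      ext I
      simp only [Finset.mem_powerset, Finset.mem_filter, Finset.subset_iff]
      exact ⟨fun h => ⟨fun e he => (h he).1, fun e he => (h he).2⟩,
        fun h e he => ⟨h.1 he, h.2 e he⟩⟩
    rw [h1, h2, Finset.sum_filter, Finset.mul_sum]
    refine Finset.sum_congr rfl fun I _ => ?_
    split_ifs <;> ring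
  rw [hexp]
  calc _ ≤ ∑ I ∈ T.powerset, b ^ #(ends I) * θ ^ #(starts ℓ (ends I)) :=
        Finset.sum_le_sum fun I hI => hterm I (Finset.mem_powerset.1 hI)
    _ = ∑ U ∈ (ends T).powerset, ∑ I ∈ T.powerset with ends I = U,
          b ^ #(ends I) * θ ^ #(starts ℓ (ends I)) := by
        rw [Finset.sum_fiberwise_of_maps_to]
        intro I hI
        have hI := Finset.mem_powerset.1 hI
        exact Finset.mem_powerset.2 (Finset.union_subset_union (Finset.image_subset_image hI)
          (Finset.image_subset_image hI))
    _ ≤ ∑ U ∈ (ends T).powerset, a ^ #U * θ ^ #(starts ℓ U) := by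
        refine Finset.sum_le_sum fun U _ => ?_
        have h1 : ∀ I ∈ T.powerset.filter (fun I => ends I = U),
            b ^ #(ends I) * θ ^ #(starts ℓ (ends I)) ≤ b ^ #U * θ ^ #(starts ℓ U) := by
          intro I hI
          rw [(Finset.mem_filter.1 hI).2]
        refine (Finset.sum_le_card_nsmul _ _ _ h1).trans ?_
        have h2 : #(T.powerset.filter fun I => ends I = U) ≤ 2 ^ (ℓ * #U) := by
          have h3 : T.powerset.filter (fun I => ends I = U)
              ⊆ ((U ×ˢ Finset.Icc 1 ℓ).image fun q => (q.1, q.1 + q.2)).powerset := by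
            intro I hI
            obtain ⟨hI1, hI2⟩ := Finset.mem_filter.1 hI
            rw [Finset.mem_powerset]
            intro e he
            have h4 := hT e (Finset.mem_powerset.1 hI1 he)
            refine Finset.mem_image.2 ⟨(e.1, e.2 - e.1), ?_, ?_⟩
            · rw [Finset.mem_product, Finset.mem_Icc]
              refine ⟨?_, by simp only; omega, by simp only; omega⟩
              rw [← hI2]
              exact mem_ends.2 ⟨e.2, Or.inl he⟩
            · ext
              · rfl
              · simp only; omega
          refine (Finset.card_le_card h3).trans ?_
          rw [Finset.card_powerset]
          refine Nat.pow_le_pow_right (by norm_num) (Finset.card_image_le.trans ?_)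
          rw [Finset.card_product, Nat.card_Icc, mul_comm]
          simp
        rw [nsmul_eq_mul, ha, mul_pow, ← pow_mul, mul_assoc]
        refine mul_le_mul_of_nonneg_right ?_ (by positivity)
        exact_mod_cast h2
    _ ≤ _ := scanTotal_le (by rw [ha]; positivity) hθ0.le hal _

end moment

section kst

lemma sum_fin_cons {V : Type*} [Fintype V] {r : ℕ} (f : (Fin (r + 1) → V) → ℝ) :
    ∑ x, f x = ∑ v, ∑ l : Fin r → V, f (Fin.cons v l) := by
  rw [← Fintype.sum_prod_type', ← Equiv.sum_comp (Fin.consEquiv fun _ => V)]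
  rfl

lemma card_filter_eq_sum {α : Type*} [Fintype α] (p : α → Prop) [DecidablePred p] :
    (#{x | p x} : ℝ) = ∑ x, if p x then 1 else 0 := by
  rw [Finset.card_filter]
  push_cast
  rfl

open Classical in
lemma card_not_injective_le {V : Type*} [Fintype V] (b : ℕ) (hb : b ≤ Fintype.card V)
    (hV : 0 < Fintype.card V) :
    (#{f : Fin b → V | ¬ Function.Injective f} : ℝ)
      ≤ (b : ℝ) ^ 2 / Fintype.card V * (Fintype.card V : ℝ) ^ b := by
  set n := Fintype.card V
  have h1 : #{f : Fin b → V | Function.Injective f} = n.descFactorial b := by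
    rw [← Fintype.card_subtype, Fintype.card_congr (Equiv.subtypeInjectiveEquivEmbedding _ _),
      Fintype.card_embedding_eq, Fintype.card_fin]
  have h2 : #{f : Fin b → V | Function.Injective f} + #{f : Fin b → V | ¬ Function.Injective f}
      = n ^ b := by
    rw [Finset.card_filter_add_card_filter_not, Finset.card_univ, Fintype.card_fun,
      Fintype.card_fin]
  have h3 : (n - b) ^ b ≤ n.descFactorial b :=
    (Nat.pow_le_pow_left (by omega) b).trans (Nat.pow_sub_le_descFactorial n b)
  have hn : (0 : ℝ) < n := by exact_mod_cast hV
  have h4 : 1 + (b : ℝ) * (-(b / n)) ≤ (1 + -(b / n : ℝ)) ^ b := by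
    refine one_add_mul_le_pow ?_ b
    have : (b : ℝ) / n ≤ 1 := by rw [div_le_one hn]; exact_mod_cast hb
    linarith
  have h5 : ((n - b : ℕ) : ℝ) ^ b = (1 + -(b / n : ℝ)) ^ b * n ^ b := by
    rw [← mul_pow, Nat.cast_sub hb]
    congr 1
    field_simp
    ring
  have h6 : ((n - b : ℕ) : ℝ) ^ b ≤ n.descFactorial b := by exact_mod_cast h3
  have h7 : (n.descFactorial b : ℝ) + (#{f : Fin b → V | ¬ Function.Injective f} : ℝ)
      = (n : ℝ) ^ b := by exact_mod_cast h1 ▸ h2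
  have h8 : (1 + (b : ℝ) * (-(b / n))) * (n : ℝ) ^ b ≤ (1 + -(b / n : ℝ)) ^ b * n ^ b :=
    mul_le_mul_of_nonneg_right h4 (by positivity)
  have h9 : (1 + (b : ℝ) * (-(b / n))) * (n : ℝ) ^ b
      = (n : ℝ) ^ b - (b : ℝ) ^ 2 / n * (n : ℝ) ^ b := by ring
  linarith

open Classical in
/-- Dense `r`-partite structures contain complete `r`-partite substructures of bounded size. -/
theorem exists_blowup (r b : ℕ) {δ : ℝ} (hδ : 0 < δ) : ∃ n₀ : ℕ, ∀ (V : Type) [Fintype V],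
    n₀ ≤ Fintype.card V → ∀ E : (Fin r → V) → Prop,
      δ * (Fintype.card V : ℝ) ^ r ≤ #{x | E x} →
      ∃ A : Fin r → Finset V, (∀ i, #(A i) = b) ∧ ∀ x, (∀ i, x i ∈ A i) → E x := by
  induction r generalizing δ with
  | zero =>
    refine ⟨0, fun V _ _ E hE => ⟨fun _ => ∅, fun i => i.elim0, fun x _ => ?_⟩⟩
    by_contra h
    have : ∀ y : Fin 0 → V, ¬ E y := fun y hy => h (Subsingleton.elim y x ▸ hy)
    rw [Finset.filter_false_of_mem fun y _ => this y] at hE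
    simp at hE
    linarith
  | succ r ih =>
    obtain ⟨n₁, hn₁⟩ := ih (δ := δ ^ b / 2) (by positivity)
    refine ⟨max n₁ (max (b + 1) (⌈2 * (b : ℝ) ^ 2 / δ ^ b⌉₊ + 1)), fun V _ hV E hE => ?_⟩
    set n := Fintype.card V with hn
    have hV1 : n₁ ≤ n := (le_max_left _ _).trans hV
    have hV2 : b + 1 ≤ n := (le_max_left _ _).trans ((le_max_right _ _).trans hV)
    have hV3 : 2 * (b : ℝ) ^ 2 / δ ^ b < n := (Nat.le_ceil _).trans_lt
      (by exact_mod_cast (le_max_right _ _).trans ((le_max_right _ _).trans hV))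
    have hn0 : (0 : ℝ) < n := by exact_mod_cast (by omega : 0 < n)
    set e : V → (Fin r → V) → ℝ := fun v l => if E (Fin.cons v l) then 1 else 0 with he
    have he0 : ∀ v l, 0 ≤ e v l := fun v l => by simp only [he]; split_ifs <;> norm_num
    have hdeg : δ * (n : ℝ) ^ (r + 1) ≤ ∑ l, ∑ v, e v l := by
      rw [card_filter_eq_sum, sum_fin_cons, Finset.sum_comm] at hE
      exact hE
    set S : (Fin b → V) → ℝ := fun f => ∑ l, ∏ i, e (f i) l with hS
    have hSn : ∀ f, S f ≤ (n : ℝ) ^ r := fun f => by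
      refine (Finset.sum_le_card_nsmul _ _ 1 fun l _ => ?_).trans ?_
      · refine Finset.prod_le_one (fun i _ => he0 _ _) fun i _ => ?_
        simp only [he]; split_ifs <;> norm_num
      · simp [hn]
    have hpow : (δ * n) ^ b * (n : ℝ) ^ r ≤ ∑ f, S f := by
      have h1 : ∑ f, S f = ∑ l, (∑ v, e v l) ^ b := by
        simp only [hS]
        rw [Finset.sum_comm]
        exact Finset.sum_congr rfl fun l _ => (Fintype.sum_pow (fun v => e v l) b).symm
      rw [h1]
      rcases b with _ | b
      · simp [hn]
      · refine le_trans ?_ (pow_sum_div_card_le_sum_pow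
          (fun l _ => Finset.sum_nonneg fun v _ => he0 v l) b)
        have h2 : (#(Finset.univ : Finset (Fin r → V)) : ℝ) = (n : ℝ) ^ r := by simp [hn]
        rw [h2, le_div_iff₀ (by positivity)]
        refine le_trans (le_of_eq ?_) (pow_le_pow_left₀ (by positivity) hdeg (b + 1))
        ring
    have hex : ∃ f : Fin b → V, Function.Injective f ∧ δ ^ b / 2 * (n : ℝ) ^ r ≤ S f := by
      by_contra hcon
      push Not at hcon
      have h1 := Finset.sum_filter_add_sum_filter_not Finset.univ
        (fun f : Fin b → V => Function.Injective f) S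
      have h2 : ∑ f : Fin b → V with Function.Injective f, S f
          ≤ ∑ f : Fin b → V with Function.Injective f, δ ^ b / 2 * (n : ℝ) ^ r :=
        Finset.sum_le_sum fun f hf => (hcon f (Finset.mem_filter.1 hf).2).le
      have h3 := Finset.sum_le_card_nsmul (Finset.univ.filter
        fun f : Fin b → V => ¬ Function.Injective f) S _ fun f _ => hSn f
      have h4 := card_not_injective_le (V := V) b (by omega) (by omega)
      have h5 : (#{f : Fin b → V | Function.Injective f} : ℝ) ≤ (n : ℝ) ^ b := by
        have h6 : #{f : Fin b → V | Function.Injective f} ≤ n ^ b :=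
          (Finset.card_filter_le _ _).trans (by simp [hn])
        exact_mod_cast h6
      have h7 : (b : ℝ) ^ 2 / n < δ ^ b / 2 := by
        rw [div_lt_iff₀ (by positivity)] at hV3
        rw [div_lt_div_iff₀ hn0 (by norm_num)]
        linarith
      rw [Finset.sum_const, nsmul_eq_mul] at h2
      rw [nsmul_eq_mul] at h3
      have hnb : (0 : ℝ) < (n : ℝ) ^ b := by positivity
      have hnr : (0 : ℝ) < (n : ℝ) ^ r := by positivity
      have h8 := mul_le_mul_of_nonneg_right h5 (by positivity : 0 ≤ δ ^ b / 2 * (n : ℝ) ^ r)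
      have h9 := mul_le_mul_of_nonneg_right h4 hnr.le
      have h10 := mul_lt_mul_of_pos_right h7 (mul_pos hnb hnr)
      rw [mul_pow] at hpow
      rw [← hn] at h9
      linarith
    obtain ⟨f, hf, hSf⟩ := hex
    have hSf' : S f = #{l : Fin r → V | ∀ i, E (Fin.cons (f i) l)} := by
      rw [card_filter_eq_sum]
      refine Finset.sum_congr rfl fun l _ => ?_
      simp only [he]
      rw [Finset.prod_ite_zero]
      simp
    rw [hSf'] at hSf
    obtain ⟨A, hA1, hA2⟩ := hn₁ V hV1 (fun l => ∀ i, E (Fin.cons (f i) l))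
      (by convert hSf)
    refine ⟨Fin.cons (Finset.univ.image f) A, fun i => ?_, fun x hx => ?_⟩
    · refine Fin.cases ?_ (fun i => ?_) i
      · simp [Finset.card_image_of_injective _ hf]
      · simpa using hA1 i
    · have h0 := hx 0
      simp only [Fin.cons_zero, Finset.mem_image, Finset.mem_univ, true_and] at h0
      obtain ⟨i, hi⟩ := h0
      have := hA2 (Fin.tail x) (fun j => by simpa [Fin.tail] using hx j.succ) i
      rw [hi] at this
      rwa [Fin.cons_self_tail] at this

end kst

section paths

variable {V : Type} (G : SimpleGraph V) {k : ℕ}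

/-- Any two vertices at distance less than `k` on the list `l` are adjacent. -/
def IsPow (k : ℕ) (l : List V) : Prop :=
  ∀ i j x y, i < j → j < i + k → l[i]? = some x → l[j]? = some y → G.Adj x y

variable {G}

lemma isPow_append {l l' : List V} (h : IsPow G k l) (h' : IsPow G k l')
    (hc : ∀ i j x y, l[i]? = some x → l'[j]? = some y → l.length + j < i + k → G.Adj x y) :
    IsPow G k (l ++ l') := by
  intro i j x y hij hjk hx hy
  rw [List.getElem?_append] at hx hy
  split_ifs at hx hy with h1 h2 h2
  · exact h i j x y hij hjk hx hy
  · exact hc i (j - l.length) x y hx hy (by omega)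
  · omega
  · exact h' _ _ x y (by omega) (by omega) hx hy

lemma IsPow.left {l l' : List V} (h : IsPow G k (l ++ l')) : IsPow G k l := by
  intro i j x y hij hjk hx hy
  obtain ⟨hi, -⟩ := List.getElem?_eq_some_iff.1 hx
  obtain ⟨hj, -⟩ := List.getElem?_eq_some_iff.1 hy
  refine h i j x y hij hjk ?_ ?_
  · rwa [List.getElem?_append_left hi]
  · rwa [List.getElem?_append_left hj]

lemma IsPow.right {l l' : List V} (h : IsPow G k (l ++ l')) : IsPow G k l' := by
  intro i j x y hij hjk hx hy
  refine h (l.length + i) (l.length + j) x y (by omega) (by omega) ?_ ?_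
  · rwa [List.getElem?_append_right (by omega), Nat.add_sub_cancel_left]
  · rwa [List.getElem?_append_right (by omega), Nat.add_sub_cancel_left]

lemma IsPow.glue {l e r : List V} (h : IsPow G k (l ++ e)) (h' : IsPow G k (e ++ r))
    (he : k ≤ e.length + 1) : IsPow G k (l ++ e ++ r) := by
  refine isPow_append h h'.right fun i j x y hx hy hij => ?_
  rw [List.length_append] at hij
  obtain ⟨hi, -⟩ := List.getElem?_eq_some_iff.1 hx
  rw [List.length_append] at hi
  rw [List.getElem?_append_right (by omega)] at hx
  refine h' (i - l.length) (e.length + j) x y (by omega) (by omega) ?_ ?_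
  · rwa [List.getElem?_append_left (by omega)]
  · rwa [List.getElem?_append_right (by omega), Nat.add_sub_cancel_left]

/-- Vertices in different parts of `F` and `F'` are adjacent. -/
def Compat (G : SimpleGraph V) (F F' : Fin k → Finset V) : Prop :=
  ∀ p p', p ≠ p' → ∀ x ∈ F p, ∀ y ∈ F' p', G.Adj x y

lemma Compat.mono {F F' E E' : Fin k → Finset V} (h : Compat G F F') (hE : ∀ i, E i ⊆ F i)
    (hE' : ∀ i, E' i ⊆ F' i) : Compat G E E' :=
  fun p p' hp x hx y hy => h p p' hp x (hE p hx) y (hE' p' hy)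

/-- The list `l` is a power path whose first round lies in `F` and whose last round lies
in `F'`. -/
structure SegFT (G : SimpleGraph V) (F F' : Fin k → Finset V) (l : List V) : Prop where
  isPow : IsPow G k l
  length : k ≤ l.length
  first : ∀ i : Fin k, ∃ x ∈ F i, l[(i : ℕ)]? = some x
  last : ∀ i : Fin k, ∃ x ∈ F' i, l[l.length - k + i]? = some x

lemma SegFT.mono {F F' E E' : Fin k → Finset V} {l : List V} (h : SegFT G F F' l)
    (hE : ∀ i, F i ⊆ E i) (hE' : ∀ i, F' i ⊆ E' i) : SegFT G E E' l where
  isPow := h.isPow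
  length := h.length
  first i := by obtain ⟨x, hx, h⟩ := h.first i; exact ⟨x, hE i hx, h⟩
  last i := by obtain ⟨x, hx, h⟩ := h.last i; exact ⟨x, hE' i hx, h⟩

lemma SegFT.append {F₁ F₂ F₃ F₄ : Fin k → Finset V} {l l' : List V} (h : SegFT G F₁ F₂ l)
    (h' : SegFT G F₃ F₄ l') (hc : Compat G F₂ F₃) : SegFT G F₁ F₄ (l ++ l') where
  isPow := by
    refine isPow_append h.isPow h'.isPow fun i j x y hx hy hij => ?_
    obtain ⟨hi, -⟩ := List.getElem?_eq_some_iff.1 hx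
    have hl := h.length
    obtain ⟨x', hx', h1⟩ := h.last ⟨i - (l.length - k), by omega⟩
    obtain ⟨y', hy', h2⟩ := h'.first ⟨j, by omega⟩
    simp only at h1 h2
    rw [show l.length - k + (i - (l.length - k)) = i by omega, hx] at h1
    rw [hy] at h2
    obtain rfl := Option.some.inj h1
    obtain rfl := Option.some.inj h2
    refine hc _ _ ?_ x hx' y hy'
    intro he
    rw [Fin.mk.injEq] at he
    omega
  length := by
    have := h.length
    rw [List.length_append]
    omega
  first i := by
    obtain ⟨x, hx, h1⟩ := h.first i
    refine ⟨x, hx, ?_⟩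
    have := h.length
    rwa [List.getElem?_append_left (by omega)]
  last i := by
    obtain ⟨x, hx, h1⟩ := h'.last i
    refine ⟨x, hx, ?_⟩
    have := h'.length
    rw [List.length_append, List.getElem?_append_right (by omega), ← h1]
    congr 1
    omega

lemma isPow_ofFn {z : Fin k → V} (hz : ∀ i j, i ≠ j → G.Adj (z i) (z j)) :
    IsPow G k (List.ofFn z) := by
  intro i j x y hij hjk hx hy
  rw [List.getElem?_ofFn] at hx hy
  split_ifs at hx hy with h1 h2
  obtain rfl := Option.some.inj hx
  obtain rfl := Option.some.inj hy
  refine hz _ _ fun he => ?_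
  rw [Fin.mk.injEq] at he
  omega

lemma segFT_ofFn {z : Fin k → V} (hz : ∀ i j, i ≠ j → G.Adj (z i) (z j)) :
    SegFT G (fun i => {z i}) (fun i => {z i}) (List.ofFn z) where
  isPow := isPow_ofFn hz
  length := by simp
  first i := ⟨z i, by simp, by simp⟩
  last i := ⟨z i, by simp, by simp⟩

lemma segFT_insert {z z' : Fin k → V} {w : V} (hz : ∀ i j, i ≠ j → G.Adj (z i) (z j))
    (hz' : ∀ i j, i ≠ j → G.Adj (z' i) (z' j)) (hzz' : ∀ i j, i ≠ j → G.Adj (z i) (z' j))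
    (hw : ∀ i, G.Adj w (z i)) (hw' : ∀ i, G.Adj w (z' i)) :
    SegFT G (fun i => {z i}) (fun i => {z' i}) (List.ofFn z ++ [w] ++ List.ofFn z') where
  isPow := by
    refine isPow_append (isPow_append (isPow_ofFn hz) ?_ ?_) (isPow_ofFn hz') ?_
    · intro i j x y hij hjk hx hy
      obtain ⟨hi, -⟩ := List.getElem?_eq_some_iff.1 hx
      obtain ⟨hj, -⟩ := List.getElem?_eq_some_iff.1 hy
      simp only [List.length_singleton] at hi hj
      omega
    · intro i j x y hx hy hij
      rw [List.getElem?_ofFn] at hx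
      split_ifs at hx with h1
      obtain rfl := Option.some.inj hx
      obtain ⟨hj, hj'⟩ := List.getElem?_eq_some_iff.1 hy
      simp only [List.getElem_singleton] at hj'
      exact hj' ▸ (hw _).symm
    · intro i j x y hx hy hij
      rw [List.getElem?_ofFn] at hy
      split_ifs at hy with h1
      obtain rfl := Option.some.inj hy
      rw [List.getElem?_append] at hx
      simp only [List.length_append, List.length_ofFn, List.length_singleton] at hx hij
      split_ifs at hx with h2
      · rw [List.getElem?_ofFn, dif_pos h2] at hx
        obtain rfl := Option.some.inj hx
        refine hzz' _ _ fun he => ?_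
        rw [Fin.mk.injEq] at he
        omega
      · obtain ⟨hj, hj'⟩ := List.getElem?_eq_some_iff.1 hx
        simp only [List.getElem_singleton] at hj'
        exact hj' ▸ hw' _
  length := by simp
  first i := ⟨z i, by simp, by simp [List.getElem?_append]⟩
  last i := ⟨z' i, by simp, by
    rw [List.getElem?_append_right (by simp)]
    simp only [List.length_append, List.length_ofFn, List.length_singleton]
    rw [show k + 1 + k - k + (i : ℕ) - (k + 1) = i by omega]
    simp⟩

/-- Distinct parts of `F` are completely joined. -/
abbrev IsTile (G : SimpleGraph V) (F : Fin k → Finset V) : Prop := Compat G F F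

lemma coe_ofFn {n : ℕ} (z : Fin n → V) : (↑(List.ofFn z) : Multiset V) = ∑ i, {z i} := by
  induction n with
  | zero => simp
  | succ n ih => rw [List.ofFn_succ, Fin.sum_univ_succ, ← Multiset.cons_coe, ih]; rfl

/-- The multiset of vertices of a tile. -/
def tot (F : Fin k → Finset V) : Multiset V := ∑ i, (F i).val

/-- A balanced tile is exactly covered by a segment. -/
lemma exists_segFT_of_balanced {F : Fin k → Finset V} (hF : IsTile G F) {b : ℕ} (hb : 1 ≤ b)
    (hFb : ∀ i, #(F i) = b) : ∃ l, SegFT G F F l ∧ (l : Multiset V) = tot F := by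
  classical
  induction b, hb using Nat.le_induction generalizing F with
  | base =>
    choose z hz using fun i => Finset.card_eq_one.1 (hFb i)
    have hz' : F = fun i => {z i} := funext hz
    subst hz'
    refine ⟨List.ofFn z, segFT_ofFn fun i j hij => hF i j hij _ (by simp) _ (by simp), ?_⟩
    rw [coe_ofFn]
    rfl
  | succ b hb ih =>
    have hne : ∀ i, (F i).Nonempty := fun i => Finset.card_pos.1 (by rw [hFb]; omega)
    choose z hz using hne
    obtain ⟨l, hl, hl'⟩ := ih (F := fun i => (F i).erase (z i))
      (hF.mono (fun i => Finset.erase_subset _ _) fun i => Finset.erase_subset _ _)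
      (fun i => by rw [Finset.card_erase_of_mem (hz i), hFb, Nat.add_sub_cancel])
    have hzF : ∀ i, ({z i} : Finset V) ⊆ F i := fun i => Finset.singleton_subset_iff.2 (hz i)
    refine ⟨List.ofFn z ++ l, ((segFT_ofFn fun i j hij => hF i j hij _ (hz i) _ (hz j)).append hl
      (hF.mono hzF fun i => Finset.erase_subset _ _)).mono hzF fun i => Finset.erase_subset _ _, ?_⟩
    rw [← Multiset.coe_add, hl', coe_ofFn, tot, tot, ← Finset.sum_add_distrib]
    refine Finset.sum_congr rfl fun i _ => ?_
    rw [Finset.erase_val, Multiset.singleton_add, Multiset.cons_erase (hz i)]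

/-- However the holes `ℋ` are filled by segments, the result extends by `P` to a list with
property `Q`. -/
def Ctx (G : SimpleGraph V) (Q : List V → Prop) (ℋ : Multiset (Fin k → Finset V))
    (P : Multiset V) : Prop :=
  ∀ fills : Multiset (List V), Multiset.Rel (fun F l => SegFT G F F l) ℋ fills →
    ∃ ω : List V, Q ω ∧ (ω : Multiset V) = P + (fills.map (↑)).sum

variable {Q : List V → Prop} {ℋ ℋ' : Multiset (Fin k → Finset V)} {P P' : Multiset V}

lemma Ctx.replace {F : Fin k → Finset V} (h : Ctx G Q (F ::ₘ ℋ) P)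
    (h' : Ctx G (SegFT G F F) ℋ' P') : Ctx G Q (ℋ' + ℋ) (P' + P) := by
  intro fills hf
  obtain ⟨f₁, f₂, h1, h2, rfl⟩ := Multiset.rel_add_left.1 hf
  obtain ⟨l, hl, hl'⟩ := h' f₁ h1
  obtain ⟨ω, hω, hω'⟩ := h (l ::ₘ f₂) (Multiset.rel_cons_left.2 ⟨l, f₂, hl, h2, rfl⟩)
  refine ⟨ω, hω, ?_⟩
  rw [hω', Multiset.map_cons, Multiset.sum_cons, hl', Multiset.map_add, Multiset.sum_add]
  abel

lemma Ctx.mono {Q' : List V → Prop} (h : Ctx G Q ℋ P) (hQ : ∀ l, Q l → Q' l) :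
    Ctx G Q' ℋ P := fun fills hf => by
  obtain ⟨ω, hω, hω'⟩ := h fills hf
  exact ⟨ω, hQ _ hω, hω'⟩

lemma ctx_list {l : List V} (h : Q l) : Ctx (k := k) G Q 0 (l : Multiset V) := by
  intro fills hf
  rw [Multiset.rel_zero_left] at hf
  subst hf
  exact ⟨l, h, by simp⟩

lemma ctx_hole (F : Fin k → Finset V) : Ctx G (SegFT G F F) {F} 0 := by
  intro fills hf
  obtain ⟨l, f, h1, h2, rfl⟩ := Multiset.rel_cons_left.1 hf
  rw [Multiset.rel_zero_left] at h2
  subst h2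
  exact ⟨l, h1, by simp⟩

lemma Ctx.append {Q' Q'' : List V → Prop} (h : Ctx G Q ℋ P) (h' : Ctx G Q' ℋ' P')
    (hQ : ∀ l l', Q l → Q' l' → Q'' (l ++ l')) : Ctx G Q'' (ℋ + ℋ') (P + P') := by
  intro fills hf
  obtain ⟨f₁, f₂, h1, h2, rfl⟩ := Multiset.rel_add_left.1 hf
  obtain ⟨l, hl, hl1⟩ := h f₁ h1
  obtain ⟨l', hl', hl2⟩ := h' f₂ h2
  refine ⟨l ++ l', hQ _ _ hl hl', ?_⟩
  rw [← Multiset.coe_add, hl1, hl2, Multiset.map_add, Multiset.sum_add]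
  abel

lemma ctx_shrink {F F'' : Fin k → Finset V} (h : ∀ i, F'' i ⊆ F i) :
    Ctx G (SegFT G F F) {F''} 0 := (ctx_hole F'').mono fun _ hl => hl.mono h h

lemma Ctx.shrink {F F'' : Fin k → Finset V} (h : Ctx G Q (F ::ₘ ℋ) P) (hs : ∀ i, F'' i ⊆ F i) :
    Ctx G Q (F'' ::ₘ ℋ) P := by
  have := h.replace (ctx_shrink (G := G) hs)
  rwa [zero_add] at this

lemma ctx_fill {F : Fin k → Finset V} (hF : IsTile G F) {b : ℕ} (hb : 1 ≤ b)
    (hFb : ∀ i, #(F i) = b) : Ctx (k := k) G (SegFT G F F) 0 (tot F) := by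
  obtain ⟨l, hl, hl'⟩ := exists_segFT_of_balanced hF hb hFb
  rw [← hl']
  exact ctx_list hl

/-- Fill all holes that are balanced tiles. -/
lemma Ctx.fill_all (h : Ctx G Q ℋ P)
    (hℋ : ∀ F ∈ ℋ, IsTile G F ∧ ∃ b, 1 ≤ b ∧ ∀ i, #(F i) = b) :
    ∃ ω, Q ω ∧ (ω : Multiset V) = P + (ℋ.map tot).sum := by
  induction ℋ using Multiset.induction generalizing P with
  | empty =>
    obtain ⟨ω, h1, h2⟩ := h 0 (Multiset.rel_zero_left.2 rfl)
    exact ⟨ω, h1, by simpa using h2⟩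
  | cons F ℋ ih =>
    obtain ⟨hF, b, hb, hFb⟩ := hℋ F (Multiset.mem_cons_self _ _)
    have h3 := h.replace (ctx_fill hF hb hFb)
    rw [zero_add] at h3
    obtain ⟨ω, h1, h2⟩ := ih h3 fun F' hF' => hℋ F' (Multiset.mem_cons_of_mem hF')
    refine ⟨ω, h1, ?_⟩
    rw [h2, Multiset.map_cons, Multiset.sum_cons]
    abel

/-- Insert the part `W` at position `j` of a sub-tile of `F`. -/
lemma ctx_add {F F'' X : Fin k → Finset V} {W : Finset V} {j : Fin k} {z z' : Fin k → V}
    (hF : IsTile G F) (hF'' : ∀ i, F'' i ⊆ F i) (hX : ∀ i, X i ⊆ F i) (hz : ∀ i, z i ∈ F i)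
    (hz' : ∀ i, z' i ∈ F i) (hW : ∀ w ∈ W, ∀ i, i ≠ j → G.Adj w (z i) ∧ G.Adj w (z' i) ∧
      ∀ x ∈ X i, G.Adj w x) :
    Ctx G (SegFT G F F) {F'', Function.update X j W}
      (↑(List.ofFn z) + ↑(List.ofFn z')) := by
  classical
  have hzF : ∀ i, ({z i} : Finset V) ⊆ F i := fun i => Finset.singleton_subset_iff.2 (hz i)
  have hzF' : ∀ i, ({z' i} : Finset V) ⊆ F i := fun i => Finset.singleton_subset_iff.2 (hz' i)
  have h1 := (ctx_hole (G := G) F'').append (Q'' := SegFT G F'' fun i => {z i})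
    (ctx_list (G := G) (k := k) (Q := SegFT G (fun i => {z i}) (fun i => {z i}))
      (segFT_ofFn fun i j hij => hF i j hij _ (hz i) _ (hz j)))
    fun l l' hl hl' => hl.append hl' (hF.mono hF'' hzF)
  have h2 := h1.append (Q'' := SegFT G F'' (Function.update X j W))
    (ctx_hole (G := G) (Function.update X j W))
    fun l l' hl hl' => hl.append hl' (by
      intro p p' hp x hx y hy
      rw [Finset.mem_singleton] at hx
      subst hx
      by_cases hj : p' = j
      · subst hj
        rw [Function.update_self] at hy
        exact (hW y hy p hp).1.symm
      · rw [Function.update_of_ne hj] at hy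
        exact hF p p' hp _ (hz p) _ (hX p' hy))
  have h3 := h2.append (Q'' := SegFT G F F)
    (ctx_list (G := G) (k := k) (Q := SegFT G (fun i => {z' i}) (fun i => {z' i}))
      (segFT_ofFn fun i j hij => hF i j hij _ (hz' i) _ (hz' j)))
    fun l l' hl hl' => (hl.append hl' (by
      intro p p' hp x hx y hy
      rw [Finset.mem_singleton] at hy
      subst hy
      by_cases hj : p = j
      · subst hj
        rw [Function.update_self] at hx
        exact (hW x hx p' hp.symm).2.1
      · rw [Function.update_of_ne hj] at hx
        exact hF p p' hp _ (hX p hx) _ (hz' p'))).mono hF'' hzF'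
  simpa using h3

lemma ctx_insert {F F'' : Fin k → Finset V} {w : V} {z z' : Fin k → V}
    (hF : IsTile G F) (hF'' : ∀ i, F'' i ⊆ F i) (hz : ∀ i, z i ∈ F i)
    (hz' : ∀ i, z' i ∈ F i) (hW : ∀ i, G.Adj w (z i) ∧ G.Adj w (z' i)) :
    Ctx G (SegFT G F F) {F''} (↑(List.ofFn z ++ [w] ++ List.ofFn z')) := by
  have hzF : ∀ i, ({z i} : Finset V) ⊆ F i := fun i => Finset.singleton_subset_iff.2 (hz i)
  have hzF' : ∀ i, ({z' i} : Finset V) ⊆ F i := fun i => Finset.singleton_subset_iff.2 (hz' i)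
  have h1 := (ctx_hole (G := G) F'').append (Q'' := SegFT G F F)
    (ctx_list (G := G) (k := k) (segFT_insert (w := w)
      (fun i j hij => hF i j hij _ (hz i) _ (hz j)) (fun i j hij => hF i j hij _ (hz' i) _ (hz' j))
      (fun i j hij => hF i j hij _ (hz i) _ (hz' j)) (fun i => (hW i).1) fun i => (hW i).2))
    fun l l' hl hl' => (hl.append hl' (hF.mono hF'' hzF)).mono hF'' hzF'
  simpa using h1

end paths

section many

variable {V : Type}

/-- One can choose `m` vertices of `R` one after the other, with at least `d` choices each time,
so that the list of chosen vertices satisfies `P`. -/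
def Many (R : Finset V) (d : ℝ) : ℕ → (List V → Prop) → Prop
  | 0, P => P []
  | m + 1, P => ∃ S ⊆ R, d ≤ #S ∧ ∀ v ∈ S, Many R d m fun l => P (v :: l)

variable {R R' : Finset V} {d : ℝ} {m m' : ℕ} {P P' : List V → Prop}

lemma Many.mono (h : Many R d m P) (hP : ∀ l, P l → P' l) : Many R d m P' := by
  induction m generalizing P P' with
  | zero => exact hP _ h
  | succ m ih =>
    obtain ⟨S, hS, hd, h⟩ := h
    exact ⟨S, hS, hd, fun v hv => ih (h v hv) fun l => hP _⟩

lemma Many.subset (h : Many R d m P) (hR : R ⊆ R') : Many R' d m P := by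
  induction m generalizing P with
  | zero => exact h
  | succ m ih =>
    obtain ⟨S, hS, hd, h⟩ := h
    exact ⟨S, hS.trans hR, hd, fun v hv => ih (h v hv)⟩

lemma Many.mem (h : Many R d m P) :
    Many R d m fun l => P l ∧ l.length = m ∧ ∀ v ∈ l, v ∈ R := by
  induction m generalizing P with
  | zero => exact ⟨h, by simp⟩
  | succ m ih =>
    obtain ⟨S, hS, hd, h⟩ := h
    refine ⟨S, hS, hd, fun v hv => (ih (h v hv)).mono fun l hl => ⟨hl.1, by simp [hl.2.1], ?_⟩⟩
    intro u hu
    rcases List.mem_cons.1 hu with h1 | h1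
    · exact h1 ▸ hS hv
    · exact hl.2.2 u h1

lemma Many.bind (h : Many R d m P) (h' : ∀ l, P l → Many R d m' fun l' => P' (l ++ l')) :
    Many R d (m + m') P' := by
  induction m generalizing P P' with
  | zero => rw [zero_add]; exact h' [] h
  | succ m ih =>
    obtain ⟨S, hS, hd, h⟩ := h
    rw [Nat.add_right_comm]
    exact ⟨S, hS, hd, fun v hv => ih (h v hv) fun l hl => h' (v :: l) hl⟩

lemma many_one (hR : R' ⊆ R) (hd : d ≤ #R') (h : ∀ v ∈ R', P [v]) : Many R d 1 P :=
  ⟨R', hR, hd, h⟩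

open Classical in
lemma Many.count (h : Many R d m P) (hd : 0 ≤ d) :
    d ^ m ≤ #{x : Fin m → R | P (List.ofFn fun i => (x i : V))} := by
  induction m generalizing P with
  | zero =>
    have h' : P [] := h
    simp [h']
  | succ m ih =>
    obtain ⟨S, hS, hdS, h⟩ := h
    rw [card_filter_eq_sum, sum_fin_cons, pow_succ']
    have h1 : ∀ v : R, (if (v : V) ∈ S then d ^ m else 0) ≤ ∑ l : Fin m → R,
        if P (List.ofFn fun i => ((Fin.cons v l : Fin (m + 1) → R) i : V)) then (1 : ℝ) else 0 := by
      intro v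
      split_ifs with hv
      · refine (ih (h v hv)).trans (le_of_eq ?_)
        rw [card_filter_eq_sum]
        refine Finset.sum_congr rfl fun l _ => ?_
        simp
      · exact Finset.sum_nonneg fun _ _ => by split_ifs <;> norm_num
    refine le_trans ?_ (Finset.sum_le_sum fun v _ => h1 v)
    rw [← Finset.sum_filter, Finset.sum_const, nsmul_eq_mul]
    refine mul_le_mul_of_nonneg_right (hdS.trans ?_) (by positivity)
    norm_cast
    have h2 : S = (Finset.univ.filter fun v : R => (v : V) ∈ S).map (Function.Embedding.subtype _) := by
      ext v
      simp only [Finset.mem_map, Finset.mem_filter, Finset.mem_univ, true_and,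
        Function.Embedding.subtype_apply, Subtype.exists, exists_and_left, exists_prop]
      constructor
      · intro hv
        exact ⟨v, hv, hS hv, rfl⟩
      · rintro ⟨v, hv, -, rfl⟩
        exact hv
    conv_lhs => rw [h2, Finset.card_map]

end many

lemma exists_blowup_many (r b : ℕ) {δ : ℝ} (hδ : 0 < δ) (ι : Type) [Fintype ι] [Nonempty ι] :
    ∃ n₀ : ℕ, ∀ (V : Type) (R : Finset V) (P : ι → List V → Prop), n₀ ≤ #R →
      Many R (δ * #R) r (fun l => ∃ π, P π l) →
      ∃ π, ∃ A : Fin r → Finset V, (∀ i, A i ⊆ R ∧ #(A i) = b) ∧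
        ∀ x : Fin r → V, (∀ i, x i ∈ A i) → P π (List.ofFn x) := by
  classical
  obtain ⟨n₀, hn₀⟩ := exists_blowup r b (δ := δ ^ r / Fintype.card ι) (by positivity)
  refine ⟨n₀, fun V R P hR h => ?_⟩
  have h1 : (δ * #R) ^ r ≤ (#{x : Fin r → R | ∃ π, P π (List.ofFn fun i => (x i : V))} : ℝ) := by
    convert h.count (by positivity)
  have h2 : ∃ π, δ ^ r / Fintype.card ι * (#R : ℝ) ^ r ≤
      #{x : Fin r → R | P π (List.ofFn fun i => (x i : V))} := by
    by_contra hcon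
    push Not at hcon
    have h3 : (#{x : Fin r → R | ∃ π, P π (List.ofFn fun i => (x i : V))} : ℝ) ≤
        ∑ π : ι, (#{x : Fin r → R | P π (List.ofFn fun i => (x i : V))} : ℝ) := by
      norm_cast
      refine le_trans (Finset.card_le_card ?_) Finset.card_biUnion_le
      intro x hx
      simpa using hx
    have h4 := Finset.sum_lt_sum_of_nonempty Finset.univ_nonempty fun π _ => hcon π
    rw [Finset.sum_const, Finset.card_univ, nsmul_eq_mul, div_mul_eq_mul_div,
      mul_div_cancel₀ _ (by positivity), ← mul_pow] at h4
    linarith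
  obtain ⟨π, hπ⟩ := h2
  obtain ⟨A, hA, hA'⟩ := hn₀ R (by simpa using hR)
    (fun x => P π (List.ofFn fun i => (x i : V))) (by simpa using hπ)
  refine ⟨π, fun i => (A i).map (Function.Embedding.subtype _), fun i => ⟨?_, ?_⟩, ?_⟩
  · intro v hv
    simp only [Finset.mem_map, Function.Embedding.subtype_apply] at hv
    obtain ⟨u, -, rfl⟩ := hv
    exact u.2
  · rw [Finset.card_map, hA]
  · intro x hx
    simp only [Finset.mem_map, Function.Embedding.subtype_apply] at hx
    choose y hy hyx using hx
    have := hA' y hy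
    simpa [hyx] using this

section connecting

variable {V : Type} {G : SimpleGraph V} {k : ℕ}

/-- Entries of `x` and `y` in different positions are adjacent. -/
def CompatV (G : SimpleGraph V) (x y : Fin k → V) : Prop := ∀ i j, i ≠ j → G.Adj (x i) (y j)

/-- A walk of `n` steps through ordered cliques with entries in `S`. -/
inductive Walk (G : SimpleGraph V) (S : V → Prop) : ℕ → (Fin k → V) → (Fin k → V) → Prop
  | single (x) : CompatV G x x → (∀ i, S (x i)) → Walk G S 0 x x
  | cons (x x' y n) : CompatV G x x → (∀ i, S (x i)) → CompatV G x x' → Walk G S n x' y →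
      Walk G S (n + 1) x y

variable {S S' : V → Prop} {n m : ℕ} {x y x' y' : Fin k → V}

lemma Walk.mono (h : Walk G S n x y) (hS : ∀ v, S v → S' v) : Walk G S' n x y := by
  induction h with
  | single x hx hxS => exact .single x hx fun i => hS _ (hxS i)
  | cons x x' y n hx hxS hc _ ih => exact .cons x x' y n hx (fun i => hS _ (hxS i)) hc ih

lemma Walk.append (h : Walk G S n x x') (h' : Walk G S m y' y) (hc : CompatV G x' y') :
    Walk G S (n + 1 + m) x y := by
  induction h with
  | single x hx hxS =>
    rw [zero_add, add_comm]
    exact .cons x y' y m hx hxS hc h'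
  | cons x x₁ x' n hx hxS hc' _ ih =>
    rw [show n + 1 + 1 + m = n + 1 + m + 1 by omega]
    exact .cons x x₁ y _ hx hxS hc' (ih hc)

lemma compatV_cons {a b : V} (hay : ∀ i, G.Adj a (y i)) (hxb : ∀ i, G.Adj (x i) b)
    (hxy : CompatV G x y) : CompatV G (Fin.cons a x : Fin (k + 1) → V) (Fin.cons b y) := by
  intro i j hij
  cases i using Fin.cases <;> cases j using Fin.cases
  · exact absurd rfl hij
  · simpa using hay _
  · simpa using hxb _
  · simpa using hxy _ _ fun h => hij (by rw [h])

lemma compatV_snoc {a b : V} (hay : ∀ i, G.Adj a (y i)) (hxb : ∀ i, G.Adj (x i) b)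
    (hxy : CompatV G x y) :
    CompatV G (Fin.snoc x a : Fin (k + 1) → V) (Fin.snoc y b : Fin (k + 1) → V) := by
  intro i j hij
  cases i using Fin.lastCases <;> cases j using Fin.lastCases
  · exact absurd rfl hij
  · simpa using hay _
  · simpa using hxb _
  · simpa using hxy _ _ fun h => hij (by rw [h])

lemma Walk.lift {a : V} (h : Walk G S n x y) (hS : ∀ v, S v → G.Adj a v ∧ S' v) (ha : S' a) :
    Walk G S' n (Fin.cons a x : Fin (k + 1) → V) (Fin.cons a y) := by
  have key : ∀ {x y : Fin k → V}, (∀ i, S (x i)) → (∀ i, S (y i)) → CompatV G x y →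
      CompatV G (Fin.cons a x : Fin (k + 1) → V) (Fin.cons a y) := fun hx hy hc =>
    compatV_cons (fun i => (hS _ (hy i)).1) (fun i => (hS _ (hx i)).1.symm) hc
  have key' : ∀ {x : Fin k → V}, (∀ i, S (x i)) → ∀ i, S' ((Fin.cons a x : Fin (k + 1) → V) i) := by
    intro x hx i
    cases i using Fin.cases
    · simpa using ha
    · simpa using (hS _ (hx _)).2
  induction h with
  | single x hx hxS => exact .single _ (key hxS hxS hx) (key' hxS)
  | cons x x' y n hx hxS hc hw ih =>
    refine .cons _ _ _ n (key hxS hxS hx) (key' hxS) (key hxS ?_ hc) ih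
    cases hw with
    | single _ h => assumption
    | cons => assumption

lemma Walk.segFT (h : Walk G S n x y) : ∃ l, SegFT G (fun i => {x i}) (fun i => {y i}) l ∧
    l.length = k * (n + 1) ∧ ∀ v ∈ l, S v := by
  induction h with
  | single x hx hxS =>
    refine ⟨List.ofFn x, segFT_ofFn hx, by simp, fun v hv => ?_⟩
    obtain ⟨i, rfl⟩ := (List.mem_ofFn' _ _).1 hv
    exact hxS i
  | cons x x' y n hx hxS hc hw ih =>
    obtain ⟨l, hl, hlen, hlS⟩ := ih
    refine ⟨List.ofFn x ++ l, (segFT_ofFn hx).append hl fun i j hij a ha b hb => ?_, ?_, ?_⟩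
    · rw [Finset.mem_singleton] at ha hb
      subst ha hb
      exact hc i j hij
    · simp [hlen]; ring
    · intro v hv
      rcases List.mem_append.1 hv with hv | hv
      · obtain ⟨i, rfl⟩ := (List.mem_ofFn' _ _).1 hv
        exact hxS i
      · exact hlS v hv

variable {T : V → Prop} {N : Finset V} {D θ : ℝ}

lemma Many.exists_ofFn {R : Finset V} {d : ℝ} {m : ℕ} {P : List V → Prop} (h : Many R d m P) :
    Many R d m fun l => ∃ f : Fin m → V, l = List.ofFn f ∧ (∀ i, f i ∈ R) ∧ P l := by
  refine h.mem.mono fun l ⟨h1, h2, h3⟩ => ?_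
  subst h2
  exact ⟨fun i => l[i], by simp, fun i => h3 _ (by simp), h1⟩

open Classical in
lemma card_common (hT : ∀ v, T v → (#{u ∈ N | ¬ G.Adj v u} : ℝ) ≤ D) (c : List V)
    (hc : ∀ v ∈ c, T v) : (#N : ℝ) - c.length * D ≤ #{u ∈ N | ∀ v ∈ c, G.Adj v u} := by
  induction c with
  | nil => simp
  | cons a c ih =>
    have h1 := ih fun v hv => hc v (List.mem_cons_of_mem _ hv)
    have h2 := hT a (hc a List.mem_cons_self)
    have h3 : (#{u ∈ N | ∀ v ∈ c, G.Adj v u} : ℝ) ≤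
        #{u ∈ N | ∀ v ∈ a :: c, G.Adj v u} + #{u ∈ N | ¬ G.Adj a u} := by
      norm_cast
      refine le_trans (Finset.card_le_card ?_) (Finset.card_union_le _ _)
      intro u hu
      simp only [Finset.mem_union, Finset.mem_filter, List.mem_cons, forall_eq_or_imp] at hu ⊢
      tauto
    push_cast [List.length_cons]
    linarith

open Classical in
lemma many_common (hT : ∀ v, T v → (#{u ∈ N | ¬ G.Adj v u} : ℝ) ≤ D) (c : List V)
    (hc : ∀ v ∈ c, T v) (hN : c.length * D + θ ≤ #N) :
    Many N θ 1 fun l => ∃ v, l = [v] ∧ ∀ u ∈ c, G.Adj u v :=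
  many_one (Finset.filter_subset _ _) (by linarith [card_common hT c hc])
    fun v hv => ⟨v, rfl, (Finset.mem_filter.1 hv).2⟩

open Classical in
lemma many_common_T (hT : ∀ v, T v → (#{u ∈ N | ¬ G.Adj v u} : ℝ) ≤ D)
    (hL : (#{u ∈ N | ¬ T u} : ℝ) ≤ D + 2 * θ) (c : List V)
    (hc : ∀ v ∈ c, T v) (hN : (c.length + 1) * D + 3 * θ ≤ #N) :
    Many N θ 1 fun l => ∃ v, l = [v] ∧ T v ∧ ∀ u ∈ c, G.Adj u v := by
  refine many_one (R' := {u ∈ N | T u ∧ ∀ v ∈ c, G.Adj v u}) (Finset.filter_subset _ _) ?_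
    fun v hv => ⟨v, rfl, (Finset.mem_filter.1 hv).2⟩
  have h1 := card_common hT c hc
  have h3 : (#{u ∈ N | ∀ v ∈ c, G.Adj v u} : ℝ) ≤
      #{u ∈ N | T u ∧ ∀ v ∈ c, G.Adj v u} + #{u ∈ N | ¬ T u} := by
    norm_cast
    refine le_trans (Finset.card_le_card ?_) (Finset.card_union_le _ _)
    intro u hu
    simp only [Finset.mem_union, Finset.mem_filter] at hu ⊢
    tauto
  linarith

open Classical in
lemma many_clique (hD : 0 ≤ D) (hT : ∀ v, T v → (#{u ∈ N | ¬ G.Adj v u} : ℝ) ≤ D)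
    (hL : (#{u ∈ N | ¬ T u} : ℝ) ≤ D + 2 * θ) (j : ℕ) (c : List V)
    (hc : ∀ v ∈ c, T v) (hN : 1 ≤ j → (c.length + j) * D + 3 * θ ≤ #N) :
    Many N θ j fun l => (∀ v ∈ l, T v) ∧ (∀ v ∈ l, ∀ u ∈ c, G.Adj u v) ∧ l.Pairwise G.Adj := by
  induction j generalizing c with
  | zero => simp [Many]
  | succ j ih =>
    have h1 := many_common_T hT hL c hc (by
      have := hN (by omega)
      push_cast at this
      nlinarith [mul_nonneg (Nat.cast_nonneg j : (0 : ℝ) ≤ j) hD])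
    rw [add_comm]
    refine h1.bind ?_
    rintro l ⟨v, rfl, hv, hvc⟩
    refine (ih (v :: c) (by simpa [hv] using hc) fun _ => ?_).mono ?_
    · have := hN (by omega)
      push_cast [List.length_cons] at this ⊢
      linarith
    · rintro l ⟨hl1, hl2, hl3⟩
      refine ⟨by simpa [hv] using hl1, ?_, ?_⟩
      · intro u hu w hw
        rcases List.mem_cons.1 hu with rfl | hu
        · exact hvc w hw
        · exact hl2 u hu w (List.mem_cons_of_mem _ hw)
      · exact List.pairwise_cons.2 ⟨fun u hu => hl2 u hu v List.mem_cons_self, hl3⟩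

open Classical in
/-- Any two ordered cliques of vertices of large degree are connected by many walks. -/
theorem exists_walk (k : ℕ) : ∃ m s : ℕ, ∀ (V : Type) (G : SimpleGraph V) (T : V → Prop)
    (N : Finset V) (D θ : ℝ), 0 ≤ D → 0 ≤ θ → (∀ v, T v → (#{u ∈ N | ¬ G.Adj v u} : ℝ) ≤ D) →
    (#{u ∈ N | ¬ T u} : ℝ) ≤ D + 2 * θ → (k + 1) * D + 3 * θ ≤ #N →
    ∀ x y : Fin (k + 1) → V, CompatV G x x → CompatV G y y → (∀ i, T (x i)) → (∀ i, T (y i)) →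
      Many N θ m fun l => Walk G (fun v => v ∈ Set.range x ∨ v ∈ Set.range y ∨ v ∈ l) s x y := by
  induction k with
  | zero =>
    refine ⟨0, 1, fun V G T N D θ hD hθ hT hL hN x y hx hy hxT hyT => ?_⟩
    refine .cons x y y 0 hx (by simp) ?_ (.single y hy (by simp))
    intro i j hij
    exact absurd (Fin.ext (by omega)) hij
  | succ k ih =>
    obtain ⟨m, s, hms⟩ := ih
    refine ⟨k + 1 + 1 + 1 + m + m, s + 1 + 1 + 1 + s,
      fun V G T N D θ hD hθ hT hL hN x y hx hy hxT hyT => ?_⟩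
    push_cast at hN
    have hkD : 0 ≤ k * D := by positivity
    -- the recursive call in the neighbourhood of a vertex of large degree
    have link : ∀ a : V, T a → ∀ x y : Fin (k + 1) → V, CompatV G x x → CompatV G y y →
        (∀ i, T (x i)) → (∀ i, T (y i)) → (∀ i, G.Adj a (x i)) → (∀ i, G.Adj a (y i)) →
        Many N θ m fun l => Walk G (fun v => v = a ∨ v ∈ Set.range x ∨ v ∈ Set.range y ∨ v ∈ l) s
          (Fin.cons a x : Fin (k + 1 + 1) → V) (Fin.cons a y) := by
      intro a ha x y hx hy hxT hyT hax hay
      have hsub : {u ∈ N | G.Adj a u} ⊆ N := Finset.filter_subset _ _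
      have h1 : (#N : ℝ) - D ≤ #{u ∈ N | G.Adj a u} := by
        have := card_common hT [a] (by simpa using ha)
        simpa using this
      refine ((hms V G T {u ∈ N | G.Adj a u} D θ hD hθ (fun v hv => (hT v hv).trans' ?_)
        (hL.trans' ?_) (by linarith) x y hx hy hxT hyT).mem.subset hsub).mono ?_
      · exact_mod_cast Finset.card_le_card (Finset.filter_subset_filter _ hsub)
      · exact_mod_cast Finset.card_le_card (Finset.filter_subset_filter _ hsub)
      · rintro l ⟨hl, -, hlN⟩
        refine hl.lift ?_ (Or.inl rfl)
        rintro v (⟨i, rfl⟩ | ⟨i, rfl⟩ | hv)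
        · exact ⟨hax i, Or.inr (Or.inl ⟨i, rfl⟩)⟩
        · exact ⟨hay i, Or.inr (Or.inr (Or.inl ⟨i, rfl⟩))⟩
        · exact ⟨(Finset.mem_filter.1 (hlN v hv)).2, Or.inr (Or.inr (Or.inr hv))⟩
    -- choose the common part `f` of the two middle cliques, then the three completions
    have h1 := many_clique hD hT hL k [x 0, y 0] (by simp [hxT, hyT])
      (fun _ => by push_cast [List.length_cons, List.length_nil]; linarith)
    have h2 := h1.exists_ofFn.bind (m' := 1) (P' := fun l' => ∃ (f : Fin k → V) (t : V),
        l' = List.ofFn f ++ [t] ∧ (∀ i, T (f i)) ∧ CompatV G f f ∧ (∀ i, G.Adj (x 0) (f i)) ∧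
        (∀ i, G.Adj (y 0) (f i)) ∧ T t ∧ G.Adj (x 0) t ∧ ∀ i, G.Adj (f i) t) (by
      rintro l ⟨f, rfl, -, hf1, hf2, hf3⟩
      simp only [List.forall_mem_ofFn_iff] at hf1 hf2
      have hff : CompatV G f f := by
        rw [List.pairwise_ofFn] at hf3
        intro i j hij
        rcases lt_or_gt_of_ne hij with h | h
        · exact hf3 h
        · exact (hf3 h).symm
      refine (many_common_T hT hL (x 0 :: List.ofFn f) (by simpa [hxT] using hf1)
        (by push_cast [List.length_cons, List.length_ofFn]; linarith)).mono ?_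
      rintro l ⟨t, rfl, ht, hxt⟩
      simp only [List.mem_cons, forall_eq_or_imp, List.forall_mem_ofFn_iff] at hxt hf2
      exact ⟨f, t, rfl, hf1, hff, fun i => (hf2 i).1, fun i => by simpa using (hf2 i).2, ht,
        hxt.1, hxt.2⟩)
    have h3 := h2.bind (m' := 1) (P' := fun l' => ∃ (f : Fin k → V) (t t' : V),
        l' = List.ofFn f ++ [t] ++ [t'] ∧ (∀ i, T (f i)) ∧ CompatV G f f ∧
        (∀ i, G.Adj (x 0) (f i)) ∧ (∀ i, G.Adj (y 0) (f i)) ∧ T t ∧ G.Adj (x 0) t ∧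
        (∀ i, G.Adj (f i) t) ∧ T t' ∧ G.Adj (y 0) t' ∧ ∀ i, G.Adj (f i) t') (by
      rintro l ⟨f, t, rfl, hf1, hff, hxf, hyf, ht, hxt, hft⟩
      refine (many_common_T hT hL (y 0 :: List.ofFn f) (by simpa [hyT] using hf1)
        (by push_cast [List.length_cons, List.length_ofFn]; linarith)).mono ?_
      rintro l ⟨t', rfl, ht', hyt⟩
      simp only [List.mem_cons, forall_eq_or_imp, List.forall_mem_ofFn_iff] at hyt
      exact ⟨f, t, t', rfl, hf1, hff, hxf, hyf, ht, hxt, hft, ht', hyt.1, hyt.2⟩)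
    have h4 := h3.bind (m' := 1 + m + m) (P' := fun l =>
      Walk G (fun v => v ∈ Set.range x ∨ v ∈ Set.range y ∨ v ∈ l) (s + 1 + 1 + 1 + s) x y) (by
      rintro l ⟨f, t, t', rfl, hf1, hff, hxf, hyf, ht, hxt, hft, ht', hyt, hft'⟩
      have h5 := many_common (θ := θ) hT (x 0 :: y 0 :: List.ofFn f)
        (by simpa [hxT, hyT] using hf1)
        (by push_cast [List.length_cons, List.length_ofFn]; linarith)
      have h6 := h5.bind (m' := m) (P' := fun l => ∃ z l₁, l = [z] ++ l₁ ∧ G.Adj (x 0) z ∧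
        G.Adj (y 0) z ∧ (∀ i, G.Adj (f i) z) ∧ Walk G (fun v => v = x 0 ∨ v ∈ Set.range (Fin.tail x) ∨
          v ∈ Set.range (Fin.snoc f t : Fin (k + 1) → V) ∨ v ∈ l₁) s
          (Fin.cons (x 0) (Fin.tail x) : Fin (k + 1 + 1) → V)
          (Fin.cons (x 0) (Fin.snoc f t : Fin (k + 1) → V))) (by
        rintro l ⟨z, rfl, hz⟩
        simp only [List.mem_cons, forall_eq_or_imp, List.forall_mem_ofFn_iff] at hz
        refine (link (x 0) (hxT 0) (Fin.tail x) (Fin.snoc f t) ?_ ?_ ?_ ?_ ?_ ?_).mono ?_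
        · exact fun i j hij => hx _ _ fun h => hij (Fin.succ_injective _ h)
        · exact compatV_snoc (fun i => (hft i).symm) hft hff
        · exact fun i => hxT _
        · intro i
          cases i using Fin.lastCases <;> simp [ht, hf1]
        · exact fun i => hx _ _ (Fin.succ_ne_zero i).symm
        · intro i
          cases i using Fin.lastCases <;> simp [hxt, hxf]
        · exact fun l hl => ⟨z, l, rfl, hz.1, hz.2.1, hz.2.2, hl⟩)
      refine h6.bind ?_
      rintro l ⟨z, l₁, rfl, hxz, hyz, hfz, hl₁⟩
      refine (link (y 0) (hyT 0) (Fin.snoc f t') (Fin.tail y) ?_ ?_ ?_ ?_ ?_ ?_).mono ?_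
      · exact compatV_snoc (fun i => (hft' i).symm) hft' hff
      · exact fun i j hij => hy _ _ fun h => hij (Fin.succ_injective _ h)
      · intro i
        cases i using Fin.lastCases <;> simp [ht', hf1]
      · exact fun i => hyT _
      · intro i
        cases i using Fin.lastCases <;> simp [hyt, hyf]
      · exact fun i => hy _ _ (Fin.succ_ne_zero i).symm
      · intro l₂ hl₂
        rw [Fin.cons_self_tail] at hl₁ hl₂
        set S : V → Prop := fun v => v ∈ Set.range x ∨ v ∈ Set.range y ∨
          v ∈ List.ofFn f ++ [t] ++ [t'] ++ ([z] ++ l₁ ++ l₂) with hS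
        have hSx : ∀ i, S (x i) := fun i => Or.inl ⟨i, rfl⟩
        have hSy : ∀ i, S (y i) := fun i => Or.inr (Or.inl ⟨i, rfl⟩)
        have hSl : ∀ v, v ∈ List.ofFn f ++ [t] ++ [t'] ++ ([z] ++ l₁ ++ l₂) → S v :=
          fun v hv => Or.inr (Or.inr hv)
        have hSf : ∀ i, S (f i) := fun i => hSl _ (by simp)
        have hSt : S t := hSl _ (by simp)
        have hSt' : S t' := hSl _ (by simp)
        have hSz : S z := hSl _ (by simp)
        have hfz' : CompatV G (Fin.snoc f z : Fin (k + 1) → V) (Fin.snoc f z : Fin (k + 1) → V) :=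
          compatV_snoc (fun i => (hfz i).symm) hfz hff
        have hSfz : ∀ i, S ((Fin.snoc f z : Fin (k + 1) → V) i) := by
          intro i
          cases i using Fin.lastCases <;> simp [hSz, hSf]
        have hxfz : ∀ i, G.Adj (x 0) ((Fin.snoc f z : Fin (k + 1) → V) i) := by
          intro i
          cases i using Fin.lastCases <;> simp [hxz, hxf]
        have hyfz : ∀ i, G.Adj (y 0) ((Fin.snoc f z : Fin (k + 1) → V) i) := by
          intro i
          cases i using Fin.lastCases <;> simp [hyz, hyf]
        have hxft : ∀ i, G.Adj (x 0) ((Fin.snoc f t : Fin (k + 1) → V) i) := by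
          intro i
          cases i using Fin.lastCases <;> simp [hxt, hxf]
        have hyft : ∀ i, G.Adj (y 0) ((Fin.snoc f t' : Fin (k + 1) → V) i) := by
          intro i
          cases i using Fin.lastCases <;> simp [hyt, hyf]
        have hSc : ∀ {a : V}, S a → ∀ i,
            S ((Fin.cons a (Fin.snoc f z : Fin (k + 1) → V) : Fin (k + 1 + 1) → V) i) := by
          intro a ha i
          cases i using Fin.cases
          · simpa using ha
          · simpa using hSfz _
        have hw1 : Walk G S s x (Fin.cons (x 0) (Fin.snoc f t : Fin (k + 1) → V)) := by
          refine hl₁.mono ?_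
          rintro v (rfl | ⟨i, rfl⟩ | ⟨i, rfl⟩ | hv)
          · exact hSx 0
          · exact hSx _
          · cases i using Fin.lastCases <;> simp [hSt, hSf]
          · exact hSl _ (by simp [hv])
        have hw3 : Walk G S s (Fin.cons (y 0) (Fin.snoc f t' : Fin (k + 1) → V)) y := by
          refine hl₂.mono ?_
          rintro v (rfl | ⟨i, rfl⟩ | ⟨i, rfl⟩ | hv)
          · exact hSy 0
          · cases i using Fin.lastCases <;> simp [hSt', hSf]
          · exact hSy _
          · exact hSl _ (by simp [hv])
        have hw2 : Walk G S 1
            (Fin.cons (x 0) (Fin.snoc f z : Fin (k + 1) → V) : Fin (k + 1 + 1) → V)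
            (Fin.cons (y 0) (Fin.snoc f z : Fin (k + 1) → V)) :=
          .cons _ _ _ 0 (compatV_cons hxfz (fun i => (hxfz i).symm) hfz') (hSc (hSx 0))
            (compatV_cons hxfz (fun i => (hyfz i).symm) hfz')
            (.single _ (compatV_cons hyfz (fun i => (hyfz i).symm) hfz') (hSc (hSy 0)))
        refine (hw1.append hw2 ?_).append hw3 ?_
        · exact compatV_cons hxfz (fun i => (hxft i).symm)
            (compatV_snoc (fun i => (hft i).symm) hfz hff)
        · exact compatV_cons hyft (fun i => (hyfz i).symm)
            (compatV_snoc (fun i => (hfz i).symm) hft' hff))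
    rwa [show k + 1 + 1 + 1 + m + m = k + 1 + 1 + (1 + m + m) by omega]

end connecting

section connecting

variable {V : Type} {G : SimpleGraph V} {k : ℕ}
variable {T : V → Prop} {N : Finset V} {D θ : ℝ}

lemma IsPow.reverse {l : List V} (h : IsPow G k l) : IsPow G k l.reverse := by
  intro i j x y hij hjk hx hy
  obtain ⟨hi, -⟩ := List.getElem?_eq_some_iff.1 hx
  obtain ⟨hj, -⟩ := List.getElem?_eq_some_iff.1 hy
  rw [List.length_reverse] at hi hj
  rw [List.getElem?_reverse hi] at hx
  rw [List.getElem?_reverse hj] at hy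
  exact (h _ _ y x (by omega) (by omega) hy hx).symm

lemma IsPow.compatV {w : Fin k → V} (h : IsPow G k (List.ofFn w)) : CompatV G w w := by
  have key : ∀ i j : Fin k, i < j → G.Adj (w i) (w j) := fun i j hij =>
    h i j _ _ hij (by omega) (by simp) (by simp)
  intro i j hij
  rcases lt_or_gt_of_ne hij with h | h
  · exact key i j h
  · exact (key j i h).symm

lemma isPow_of_pairwise {l : List V} (h : l.Pairwise G.Adj) : IsPow G k l := by
  intro i j x y hij _ hx hy
  obtain ⟨hi, rfl⟩ := List.getElem?_eq_some_iff.1 hx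
  obtain ⟨hj, rfl⟩ := List.getElem?_eq_some_iff.1 hy
  exact List.pairwise_iff_getElem.1 h i j hi hj hij

lemma IsPow.concat {l : List V} {v : V} (h : IsPow G (k + 1) l)
    (hv : ∀ u ∈ l.drop (l.length - k), G.Adj u v) : IsPow G (k + 1) (l ++ [v]) := by
  refine isPow_append h ?_ ?_
  · intro i j x y hij hjk hx hy
    obtain ⟨hj, -⟩ := List.getElem?_eq_some_iff.1 hy
    simp only [List.length_singleton] at hj
    omega
  · intro i j x y hx hy hij
    obtain ⟨hj, hj'⟩ := List.getElem?_eq_some_iff.1 hy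
    obtain ⟨hi, hi'⟩ := List.getElem?_eq_some_iff.1 hx
    simp only [List.getElem_singleton] at hj'
    subst hj'
    simp only [List.length_singleton] at hj
    refine hv x (List.mem_iff_getElem?.2 ⟨i - (l.length - k), ?_⟩)
    rw [List.getElem?_drop, ← hx]
    congr 1
    omega

open Classical in
lemma many_extend (hD : 0 ≤ D) (hT : ∀ v, T v → (#{u ∈ N | ¬ G.Adj v u} : ℝ) ≤ D)
    (hL : (#{u ∈ N | ¬ T u} : ℝ) ≤ D + 2 * θ) (hN : (k + 1) * D + 3 * θ ≤ #N) (j : ℕ) (a : List V)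
    (ha : IsPow G (k + 1) a) (haT : ∀ v ∈ a, T v) :
    Many N θ j fun l => (∀ v ∈ l, T v) ∧ IsPow G (k + 1) (a ++ l) := by
  induction j generalizing a with
  | zero => simpa [Many] using ha
  | succ j ih =>
    have h1 := many_common_T hT hL (a.drop (a.length - k))
      (fun v hv => haT v (List.mem_of_mem_drop hv)) (by
        have h2 : ((a.drop (a.length - k)).length : ℝ) ≤ k := by
          rw [List.length_drop]
          exact_mod_cast (by omega : a.length - (a.length - k) ≤ k)
        nlinarith)
    rw [add_comm]
    refine h1.bind ?_
    rintro l ⟨v, rfl, hv, hvc⟩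
    refine (ih (a ++ [v]) (ha.concat hvc) ?_).mono ?_
    · intro u hu
      rcases List.mem_append.1 hu with hu | hu
      · exact haT u hu
      · exact (List.mem_singleton.1 hu) ▸ hv
    · rintro l ⟨hl1, hl2⟩
      exact ⟨by simpa [hv] using hl1, by simpa using hl2⟩

lemma SegFT.eq_append {x y : Fin k → V} {l : List V}
    (h : SegFT G (fun i => {x i}) (fun i => {y i}) l) :
    (∃ r, l = List.ofFn x ++ r) ∧ ∃ r, l = r ++ List.ofFn y := by
  have hk := h.length
  refine ⟨⟨l.drop k, ?_⟩, ⟨l.take (l.length - k), ?_⟩⟩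
  · conv_lhs => rw [← List.take_append_drop k l]
    congr 1
    refine List.ext_getElem? fun i => ?_
    rw [List.getElem?_take, List.getElem?_ofFn]
    split_ifs with hi
    · obtain ⟨v, hv, h1⟩ := h.first ⟨i, hi⟩
      rw [Finset.mem_singleton] at hv
      simpa [← hv] using h1
    · rfl
  · conv_lhs => rw [← List.take_append_drop (l.length - k) l]
    congr 1
    refine List.ext_getElem? fun i => ?_
    rw [List.getElem?_drop, List.getElem?_ofFn]
    split_ifs with hi
    · obtain ⟨v, hv, h1⟩ := h.last ⟨i, hi⟩
      rw [Finset.mem_singleton] at hv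
      simpa [← hv] using h1
    · exact List.getElem?_eq_none (by omega)

open Classical in
/-- Distinct representatives of the blown up vertices of a power path again form a power path. -/
lemma isPow_of_blowup {r L : ℕ} {A : Fin r → Finset V} (hA : ∀ i, #(A i) = L + 1)
    (π : Fin L → Fin r) {a e : List V}
    (h : ∀ x : Fin r → V, (∀ i, x i ∈ A i) → IsPow G k (a ++ List.ofFn (fun o => x (π o)) ++ e)) :
    ∃ v : Fin L → V, Function.Injective v ∧ (∀ o, v o ∈ A (π o)) ∧
      IsPow G k (a ++ List.ofFn v ++ e) := by
  obtain ⟨v, hv, hvA⟩ := (Finset.all_card_le_biUnion_card_iff_exists_injective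
    fun o : Fin L => A (π o)).1 (by
      intro s
      rcases s.eq_empty_or_nonempty with rfl | ⟨o, ho⟩
      · simp
      · have h1 := Finset.card_le_univ s
        have h2 := Finset.card_le_card (Finset.subset_biUnion_of_mem (fun o => A (π o)) ho)
        have h3 := hA (π o)
        simp only [Fintype.card_fin] at h1
        omega)
  refine ⟨v, hv, hvA, ?_⟩
  have hne : ∀ i, (A i).Nonempty := fun i => Finset.card_pos.1 (by rw [hA]; omega)
  choose x₀ hx₀ using hne
  have entry : ∀ (f : Fin L → V) (i : ℕ), (a ++ List.ofFn f ++ e)[i]? =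
      if i < a.length then a[i]? else if h : i - a.length < L then some (f ⟨i - a.length, h⟩)
        else e[i - a.length - L]? := by
    intro f i
    rw [List.append_assoc, List.getElem?_append]
    split_ifs with h1 h2
    · rfl
    · rw [List.getElem?_append_left (by simpa using h2), List.getElem?_ofFn, dif_pos h2]
    · rw [List.getElem?_append_right (by simpa using h2), List.length_ofFn]
  have hupd : ∀ (x : Fin r → V), (∀ i, x i ∈ A i) → ∀ o i,
      Function.update x (π o) (v o) i ∈ A i := by
    intro x hx o i
    by_cases hi : i = π o
    · subst hi
      rw [Function.update_self]
      exact hvA o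
    · rw [Function.update_of_ne hi]
      exact hx i
  intro i j x y hij hjk hx hy
  by_cases hi : ¬ i < a.length ∧ i - a.length < L
  · by_cases hj : ¬ j < a.length ∧ j - a.length < L
    · rw [entry, if_neg hi.1, dif_pos hi.2] at hx
      rw [entry, if_neg hj.1, dif_pos hj.2] at hy
      by_cases hπ : π ⟨i - a.length, hi.2⟩ = π ⟨j - a.length, hj.2⟩
      · exfalso
        have h1 := h x₀ hx₀ i j (x₀ (π ⟨i - a.length, hi.2⟩)) (x₀ (π ⟨j - a.length, hj.2⟩)) hij hjk
          (by rw [entry, if_neg hi.1, dif_pos hi.2]) (by rw [entry, if_neg hj.1, dif_pos hj.2])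
        rw [hπ] at h1
        exact G.irrefl h1
      · refine h _ (hupd _ (hupd x₀ hx₀ ⟨i - a.length, hi.2⟩) ⟨j - a.length, hj.2⟩) i j x y hij hjk
          ?_ ?_
        · rw [entry, if_neg hi.1, dif_pos hi.2, Function.update_of_ne hπ, Function.update_self, hx]
        · rw [entry, if_neg hj.1, dif_pos hj.2, Function.update_self, hy]
    · rw [entry, if_neg hi.1, dif_pos hi.2] at hx
      refine h _ (hupd x₀ hx₀ ⟨i - a.length, hi.2⟩) i j x y hij hjk ?_ ?_
      · rw [entry, if_neg hi.1, dif_pos hi.2, Function.update_self, hx]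
      · rw [entry] at hy ⊢
        split_ifs at hy ⊢ with h1 h2
        · exact hy
        · exact absurd ⟨h1, h2⟩ hj
        · exact hy
  · by_cases hj : ¬ j < a.length ∧ j - a.length < L
    · rw [entry, if_neg hj.1, dif_pos hj.2] at hy
      refine h _ (hupd x₀ hx₀ ⟨j - a.length, hj.2⟩) i j x y hij hjk ?_ ?_
      · rw [entry] at hx ⊢
        split_ifs at hx ⊢ with h1 h2
        · exact hx
        · exact absurd ⟨h1, h2⟩ hi
        · exact hx
      · rw [entry, if_neg hj.1, dif_pos hj.2, Function.update_self, hy]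
    · refine h _ hx₀ i j x y hij hjk ?_ ?_
      · rw [entry] at hx ⊢
        split_ifs at hx ⊢ with h1 h2
        · exact hx
        · exact absurd ⟨h1, h2⟩ hi
        · exact hx
      · rw [entry] at hy ⊢
        split_ifs at hy ⊢ with h1 h2
        · exact hy
        · exact absurd ⟨h1, h2⟩ hj
        · exact hy

open Classical in
/-- Two ordered cliques of vertices of large degree into `R` are connected through `R` by a power
path of bounded length. -/
theorem exists_connection (k : ℕ) (hk : 2 ≤ k) {μ : ℝ} (hμ : 0 < μ) : ∃ n₀ L : ℕ,
    ∀ (V : Type) (G : SimpleGraph V) (T : V → Prop) (R : Finset V), n₀ ≤ #R →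
      (∀ v, T v → (#{u ∈ R | ¬ G.Adj v u} : ℝ) ≤ (1 / (k + 1) - μ) * #R) →
      (#{u ∈ R | ¬ T u} : ℝ) ≤ (1 / (k + 1) + μ) * #R →
      ∀ a e : List V, IsPow G (k + 1) a → IsPow G (k + 1) e → a.length = k → e.length = k →
        (∀ v ∈ a, T v) → (∀ v ∈ e, T v) →
        ∃ l : List V, (∀ v ∈ l, v ∈ R) ∧ l.Nodup ∧ l.length = L ∧
          IsPow G (k + 1) (a ++ l ++ e) := by
  obtain ⟨m, s, hms⟩ := exists_walk k
  set r := k + 1 + (k + 1) + m with hr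
  set L := (k + 1) * (s + 1) with hL
  obtain ⟨n₀, hn₀⟩ := exists_blowup_many r (L + 1) hμ (Fin L → Fin r)
  refine ⟨n₀, L, fun V G T R hR hT hlow a e ha he hak hek haT heT => ?_⟩
  set D := (1 / (k + 1) - μ) * #R with hDdef
  set θ := μ * #R with hθdef
  have hθ : 0 ≤ θ := by positivity
  have hD : 0 ≤ D := by
    obtain ⟨v, hv⟩ := List.exists_mem_of_length_pos (l := a) (by omega)
    exact (Nat.cast_nonneg _).trans (hT v (haT v hv))
  have hN : (k + 1) * D + 3 * θ ≤ #R := by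
    have : (k + 1 : ℝ) * D = #R - (k + 1) * θ := by
      rw [hDdef, hθdef]
      field_simp
    have hk' : (2 : ℝ) ≤ k := by exact_mod_cast hk
    nlinarith
  have hlow' : (#{u ∈ R | ¬ T u} : ℝ) ≤ D + 2 * θ := hlow.trans (le_of_eq (by ring))
  have hmany : Many R θ r fun l => ∃ π : Fin L → Fin r, ∃ x : Fin r → V, l = List.ofFn x ∧
      IsPow G (k + 1) (a ++ List.ofFn (fun o => x (π o)) ++ e) := by
    have h1 := (many_extend hD hT hlow' hN (k + 1) a ha haT).exists_ofFn
    have h2 := h1.bind (m' := k + 1) (P' := fun l => ∃ w u : Fin (k + 1) → V,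
        l = List.ofFn w ++ List.ofFn u ∧ IsPow G (k + 1) (a ++ List.ofFn w) ∧ (∀ i, T (w i)) ∧
        IsPow G (k + 1) ((List.ofFn u).reverse ++ e) ∧ ∀ i, T (u i)) (by
      rintro l ⟨w, rfl, -, hw1, hw2⟩
      refine (many_extend hD hT hlow' hN (k + 1) e.reverse he.reverse
        (by simpa using heT)).exists_ofFn.mono ?_
      rintro l ⟨u, rfl, -, hu1, hu2⟩
      refine ⟨w, u, rfl, hw2, List.forall_mem_ofFn_iff.1 hw1, ?_, List.forall_mem_ofFn_iff.1 hu1⟩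
      simpa using hu2.reverse)
    refine (h2.bind (m' := m) (P' := fun l => ∃ p : List V, p.length = L ∧ (∀ v ∈ p, v ∈ l) ∧
      IsPow G (k + 1) (a ++ p ++ e)) ?_).exists_ofFn.mono ?_
    · rintro l ⟨w, u, rfl, hw1, hw2, hu1, hu2⟩
      have hrev : (List.ofFn u).reverse = List.ofFn (fun i => u (Fin.rev i)) := by
        refine List.ext_getElem (by simp) fun i h1 h2 => ?_
        simp only [List.length_reverse, List.length_ofFn] at h1
        rw [List.getElem_reverse, List.getElem_ofFn, List.getElem_ofFn]
        congr 1
        ext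
        simp only [List.length_ofFn, Fin.val_rev]
        omega
      rw [hrev] at hu1
      refine (hms V G T R D θ hD hθ hT hlow' hN w (fun i => u (Fin.rev i)) hw1.right.compatV
        hu1.left.compatV hw2 fun i => hu2 _).mono ?_
      intro l hl
      obtain ⟨p, hp, hpL, hpS⟩ := hl.segFT
      refine ⟨p, hpL, fun v hv => ?_, ?_⟩
      · rcases hpS v hv with ⟨i, rfl⟩ | ⟨i, rfl⟩ | h
        · exact List.mem_append_left _ (List.mem_append_left _ ((List.mem_ofFn' _ _).2 ⟨i, rfl⟩))
        · exact List.mem_append_left _ (List.mem_append_right _ ((List.mem_ofFn' _ _).2 ⟨_, rfl⟩))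
        · exact List.mem_append_right _ h
      · obtain ⟨⟨q, hq⟩, q', hq'⟩ := hp.eq_append
        have h3 : IsPow G (k + 1) (a ++ p) := by
          have := hw1.glue (r := q) (by rw [← hq]; exact hp.isPow) (by simp)
          rwa [List.append_assoc, ← hq] at this
        have h4 := IsPow.glue (l := a ++ q') (e := List.ofFn fun i => u (Fin.rev i)) (r := e)
          (by rwa [List.append_assoc, ← hq']) hu1 (by simp)
        rwa [List.append_assoc a, ← hq'] at h4
    · rintro l ⟨x, rfl, -, p, hpL, hpl, hp⟩
      have hidx : ∀ o : Fin L, ∃ i, x i = p[(o : ℕ)]'(by omega) := by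
        intro o
        have := hpl _ (List.getElem_mem (l := p) (n := o) (by omega))
        rwa [List.mem_ofFn'] at this
      choose π hπ using hidx
      refine ⟨π, x, rfl, ?_⟩
      have hp' : List.ofFn (fun o => x (π o)) = p := by
        refine List.ext_getElem (by rw [List.length_ofFn, hpL]) fun i h1 h2 => ?_
        rw [List.getElem_ofFn, hπ]
      rwa [hp']
  obtain ⟨π, A, hA, hA'⟩ := hn₀ V R _ hR hmany
  obtain ⟨v, hv, hvA, hv'⟩ := isPow_of_blowup (G := G) (k := k + 1) (fun i => (hA i).2) π (a := a)
    (e := e) fun x hx => by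
      obtain ⟨x', hx', h⟩ := hA' x hx
      rwa [List.ofFn_injective hx']
  refine ⟨List.ofFn v, fun u hu => ?_, List.nodup_ofFn.2 hv, List.length_ofFn, hv'⟩
  obtain ⟨o, rfl⟩ := (List.mem_ofFn' _ _).1 hu
  exact (hA _).1 (hvA o)

end connecting

section fits
open Classical

variable {V : Type} {ℓ : ℕ} {G : SimpleGraph V} {lev : V → ℕ} {β : ℝ}
  {F : Fin (ℓ + 1) → Finset V} {w : V}

/-- `X` witnesses that `w` can be put into the tile `F`, either freely (`o = none`) or in exchange
for vertices of higher level in the part `j` (`o = some j`). -/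
structure Fit (G : SimpleGraph V) (lev : V → ℕ) (β : ℝ) (F : Fin (ℓ + 1) → Finset V) (w : V)
    (o : Option (Fin (ℓ + 1))) (X : Fin (ℓ + 1) → Finset V) : Prop where
  sub : ∀ i, X i ⊆ F i
  large : ∀ i, β * #(F i) ≤ #(X i)
  adj : ∀ i, o ≠ some i → ∀ x ∈ X i, G.Adj w x
  lev : ∀ j, o = some j → ∀ y ∈ X j, lev w < lev y

def Fits (G : SimpleGraph V) (lev : V → ℕ) (β : ℝ) (F : Fin (ℓ + 1) → Finset V) (w : V) : Prop :=
  ∃ o X, Fit G lev β F w o X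

lemma countP_val (p : V → Prop) [DecidablePred p] (A : Finset V) : A.val.countP p = #(A.filter p) := by
  rw [Multiset.countP_eq_card_filter]
  rfl

lemma card_tot (F : Fin (ℓ + 1) → Finset V) : Multiset.card (tot F) = ∑ i, #(F i) := by
  simp [tot]

lemma card_tot_of_balanced {b : ℕ} (hb : ∀ i, #(F i) = b) :
    (Multiset.card (tot F) : ℝ) = (ℓ + 1) * b := by
  rw [card_tot, Finset.sum_congr rfl fun i _ => hb i]
  simp

lemma countP_tot (p : V → Prop) [DecidablePred p] (F : Fin (ℓ + 1) → Finset V) :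
    (tot F).countP p = ∑ i, #((F i).filter p) := by
  rw [tot, ← Multiset.coe_countPAddMonoidHom, map_sum]
  exact Finset.sum_congr rfl fun i _ => countP_val p _

lemma not_fits_none (h : ¬ Fits G lev β F w) :
    ∃ j, (#{u ∈ F j | G.Adj w u} : ℝ) < β * #(F j) := by
  by_contra! h'
  exact h ⟨none, fun i => {u ∈ F i | G.Adj w u}, fun i => Finset.filter_subset _ _, h',
    fun i _ x hx => (Finset.mem_filter.1 hx).2, by simp⟩

lemma deg_le_of_not_fits {b : ℕ} (hb : ∀ i, #(F i) = b) (h : ¬ Fits G lev β F w) :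
    ((tot F).countP (G.Adj w) : ℝ) ≤ (ℓ + β) / (ℓ + 1) * Multiset.card (tot F) := by
  obtain ⟨j, hj⟩ := not_fits_none h
  rw [card_tot_of_balanced hb, countP_tot]
  have h1 : (ℓ + β) / (ℓ + 1) * ((ℓ + 1 : ℝ) * b) = ℓ * b + β * b := by field_simp
  rw [h1, ← Finset.add_sum_erase _ _ (Finset.mem_univ j)]
  have h2 : ∑ i ∈ Finset.univ.erase j, #{u ∈ F i | G.Adj w u} ≤ ℓ * b := by
    refine (Finset.sum_le_card_nsmul _ _ b fun i _ =>
      (Finset.card_filter_le _ _).trans (hb i).le).trans ?_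
    simp
  have h2' : ((∑ i ∈ Finset.univ.erase j, #{u ∈ F i | G.Adj w u} : ℕ) : ℝ) ≤ ℓ * b := by
    exact_mod_cast h2
  rw [hb] at hj
  push_cast at h2' ⊢
  linarith

lemma deg_le_of_not_fits_low (hℓ : 1 ≤ ℓ) {b : ℕ} (hb : ∀ i, #(F i) = b)
    (h : ¬ Fits G lev β F w) :
    ((tot F).countP (G.Adj w) : ℝ) ≤ (ℓ - 1 + 2 * β) / (ℓ + 1) * Multiset.card (tot F) +
      (tot F).countP (fun u => lev u ≤ lev w) := by
  obtain ⟨j, hj⟩ := not_fits_none h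
  rw [card_tot_of_balanced hb, countP_tot, countP_tot]
  have h1 : (ℓ - 1 + 2 * β) / (ℓ + 1) * ((ℓ + 1 : ℝ) * b) = (ℓ - 1) * b + 2 * (β * b) := by
    field_simp
  rw [h1, ← Finset.add_sum_erase _ _ (Finset.mem_univ j)]
  rw [hb] at hj
  have hf : ∀ i, #{u ∈ F i | G.Adj w u} ≤ b := fun i => (Finset.card_filter_le _ _).trans (hb i).le
  by_cases hj' : ∃ j' ≠ j, (#{u ∈ F j' | G.Adj w u} : ℝ) < β * b
  · obtain ⟨j', hjj, hj'⟩ := hj'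
    rw [← Finset.add_sum_erase _ _ (Finset.mem_erase.2 ⟨hjj, Finset.mem_univ j'⟩)]
    have h2 : ∑ i ∈ (Finset.univ.erase j).erase j', #{u ∈ F i | G.Adj w u} ≤ (ℓ - 1) * b := by
      refine (Finset.sum_le_card_nsmul _ _ b fun i _ => hf i).trans ?_
      rw [Finset.card_erase_of_mem (Finset.mem_erase.2 ⟨hjj, Finset.mem_univ j'⟩)]
      simp
    have h2' : ((∑ i ∈ (Finset.univ.erase j).erase j', #{u ∈ F i | G.Adj w u} : ℕ) : ℝ) ≤
        (ℓ - 1) * b := by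
      have : ((ℓ - 1 : ℕ) : ℝ) = ℓ - 1 := by push_cast [hℓ]; ring
      rw [← this]
      exact_mod_cast h2
    have h3 : (0 : ℝ) ≤ ((∑ i, #{u ∈ F i | lev u ≤ lev w} : ℕ) : ℝ) := Nat.cast_nonneg _
    push_cast at h2' h3 ⊢
    linarith
  · push Not at hj'
    have h4 : (#{u ∈ F j | lev w < lev u} : ℝ) < β * b := by
      by_contra! h4
      refine h ⟨some j, fun i => if i = j then {u ∈ F i | lev w < lev u} else
        {u ∈ F i | G.Adj w u}, fun i => ?_, fun i => ?_, fun i hi x hx => ?_, fun i hi y hy => ?_⟩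
      · split_ifs <;> exact Finset.filter_subset _ _
      · rw [hb]
        by_cases hi : i = j
        · subst hi
          rwa [if_pos rfl]
        · rw [if_neg hi]
          exact hj' i hi
      · rw [if_neg fun h => hi (by rw [h])] at hx
        exact (Finset.mem_filter.1 hx).2
      · rw [if_pos (Option.some_injective _ hi).symm] at hy
        exact (Finset.mem_filter.1 hy).2
    have h5 : #{u ∈ F j | lev u ≤ lev w} + #{u ∈ F j | lev w < lev u} = b := by
      rw [← hb j, ← Finset.card_filter_add_card_filter_not (s := F j) (fun u => lev u ≤ lev w)]
      congr 3
      ext u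
      simp
    have h6 : #{u ∈ F j | lev u ≤ lev w} ≤ ∑ i, #{u ∈ F i | lev u ≤ lev w} :=
      Finset.single_le_sum (f := fun i => #{u ∈ F i | lev u ≤ lev w}) (fun _ _ => Nat.zero_le _)
        (Finset.mem_univ j)
    have h2 : ∑ i ∈ Finset.univ.erase j, #{u ∈ F i | G.Adj w u} ≤ ℓ * b := by
      refine (Finset.sum_le_card_nsmul _ _ b fun i _ => hf i).trans ?_
      simp
    have h2' : ((∑ i ∈ Finset.univ.erase j, #{u ∈ F i | G.Adj w u} : ℕ) : ℝ) ≤ ℓ * b := by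
      exact_mod_cast h2
    have h5' : (#{u ∈ F j | lev u ≤ lev w} : ℝ) + #{u ∈ F j | lev w < lev u} = b := by
      exact_mod_cast h5
    have h6' : (#{u ∈ F j | lev u ≤ lev w} : ℝ) ≤
        ((∑ i, #{u ∈ F i | lev u ≤ lev w} : ℕ) : ℝ) := by exact_mod_cast h6
    push_cast at h2' h6' ⊢
    linarith

variable {ℬ 𝒢 : Multiset (Fin (ℓ + 1) → Finset V)} {P U : Multiset V}

lemma deg_holes_le (hℬ : ∀ F ∈ ℬ, (∃ b, ∀ i, #(F i) = b) ∧ ¬ Fits G lev β F w) :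
    ((ℬ.map tot).sum.countP (G.Adj w) : ℝ) ≤
      (ℓ + β) / (ℓ + 1) * Multiset.card (ℬ.map tot).sum := by
  induction ℬ using Multiset.induction with
  | empty => simp
  | cons F ℬ ih =>
    obtain ⟨⟨b, hb⟩, h⟩ := hℬ F (Multiset.mem_cons_self _ _)
    have h1 := ih fun F' hF' => hℬ F' (Multiset.mem_cons_of_mem hF')
    have h2 := deg_le_of_not_fits hb h
    rw [Multiset.map_cons, Multiset.sum_cons, Multiset.countP_add, Multiset.card_add]
    push_cast
    linarith

lemma deg_holes_le_low (hℓ : 1 ≤ ℓ) (hℬ : ∀ F ∈ ℬ, (∃ b, ∀ i, #(F i) = b) ∧ ¬ Fits G lev β F w) :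
    ((ℬ.map tot).sum.countP (G.Adj w) : ℝ) ≤
      (ℓ - 1 + 2 * β) / (ℓ + 1) * Multiset.card (ℬ.map tot).sum +
        (ℬ.map tot).sum.countP (fun u => lev u ≤ lev w) := by
  induction ℬ using Multiset.induction with
  | empty => simp
  | cons F ℬ ih =>
    obtain ⟨⟨b, hb⟩, h⟩ := hℬ F (Multiset.mem_cons_self _ _)
    have h1 := ih fun F' hF' => hℬ F' (Multiset.mem_cons_of_mem hF')
    have h2 := deg_le_of_not_fits_low hℓ hb h
    rw [Multiset.map_cons, Multiset.sum_cons, Multiset.countP_add, Multiset.card_add,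
      Multiset.countP_add]
    push_cast
    linarith

/-- The degree conditions. -/
structure Good (G : SimpleGraph V) (lev : V → ℕ) (ℓ q : ℕ) (μ ν : ℝ) (D : V → Prop)
    (A : Finset V) : Prop where
  sub : ∀ v ∈ A, D v
  lev_le : ∀ v, lev v ≤ q
  deg : ∀ v, D v → ((ℓ - 1 : ℝ) / (ℓ + 1) + lev v / ((ℓ + 1) * q) + μ) * #A ≤ #{u ∈ A | G.Adj v u}
  low : ∀ c ≤ q, (#{v ∈ A | lev v < c} : ℝ) ≤ (c / ((ℓ + 1) * q) + ν) * #A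

variable {q : ℕ} {μ ν : ℝ} {D : V → Prop} {A : Finset V}

lemma Good.deg_top (hA : Good G lev ℓ q μ ν D A) (hq : 1 ≤ q) (hw : D w) (hl : lev w = q) :
    ((ℓ : ℝ) / (ℓ + 1) + μ) * #A ≤ #{u ∈ A | G.Adj w u} := by
  have h := hA.deg w hw
  have hq' : (q : ℝ) ≠ 0 := by positivity
  have e : (ℓ - 1 : ℝ) / (ℓ + 1) + lev w / ((ℓ + 1) * q) = ℓ / (ℓ + 1) := by
    rw [hl]; field_simp; ring
  rwa [e] at h

lemma Good.deg_top_left (hA : Good G lev ℓ q μ ν D A) (hq : 1 ≤ q) (hβ : 0 ≤ β) (hw : D w)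
    (hl : lev w = q)
    (h : A.val = P + (𝒢.map tot).sum + (ℬ.map tot).sum + U)
    (hℬ : ∀ F ∈ ℬ, (∃ b, ∀ i, #(F i) = b) ∧ ¬ Fits G lev β F w) :
    (ℓ : ℝ) / (ℓ + 1) * Multiset.card U + (μ - β) * #A ≤
      U.countP (G.Adj w) + Multiset.card P + Multiset.card (𝒢.map tot).sum := by
  have h1 := hA.deg_top hq hw hl
  have h2 := deg_holes_le hℬ
  rw [← countP_val, h, Multiset.countP_add, Multiset.countP_add, Multiset.countP_add] at h1
  have h3 := congrArg Multiset.card h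
  rw [Multiset.card_add, Multiset.card_add, Multiset.card_add] at h3
  have h3' : (#A : ℝ) = Multiset.card P + Multiset.card (𝒢.map tot).sum +
    Multiset.card (ℬ.map tot).sum + Multiset.card U := by exact_mod_cast h3
  have h4 : (P.countP (G.Adj w) : ℝ) ≤ Multiset.card P := by
    exact_mod_cast Multiset.countP_le_card _ _
  have h5 : ((𝒢.map tot).sum.countP (G.Adj w) : ℝ) ≤ Multiset.card (𝒢.map tot).sum := by
    exact_mod_cast Multiset.countP_le_card _ _
  push_cast at h1
  set x := (Multiset.card P : ℝ)
  set y := (Multiset.card (𝒢.map tot).sum : ℝ)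
  set z := (Multiset.card (ℬ.map tot).sum : ℝ)
  set u := (Multiset.card U : ℝ)
  have hx : 0 ≤ x := Nat.cast_nonneg _
  have hy : 0 ≤ y := Nat.cast_nonneg _
  have hz : 0 ≤ z := Nat.cast_nonneg _
  have hu : 0 ≤ u := Nat.cast_nonneg _
  have e1 : (ℓ + β) / (ℓ + 1) * z = (ℓ : ℝ) / (ℓ + 1) * z + β * (z / (ℓ + 1)) := by field_simp
  have e2 : z / (ℓ + 1) ≤ #A := by
    rw [div_le_iff₀ (by positivity)]
    nlinarith [Nat.cast_nonneg (α := ℝ) ℓ, Nat.cast_nonneg (α := ℝ) (#A)]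
  have e3 := mul_le_mul_of_nonneg_left e2 hβ
  have e4 : 0 ≤ (ℓ : ℝ) / (ℓ + 1) * x := by positivity
  have e5 : 0 ≤ (ℓ : ℝ) / (ℓ + 1) * y := by positivity
  have e6 : (ℓ : ℝ) / (ℓ + 1) * #A = (ℓ : ℝ) / (ℓ + 1) * x + (ℓ : ℝ) / (ℓ + 1) * y +
    (ℓ : ℝ) / (ℓ + 1) * z + (ℓ : ℝ) / (ℓ + 1) * u := by rw [h3']; ring
  linarith

lemma Good.deg_low_left (hA : Good G lev ℓ q μ ν D A) (hℓ : 1 ≤ ℓ) (hβ : 0 ≤ β) (hw : D w)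
    (hl : lev w < q)
    (h : A.val = P + (𝒢.map tot).sum + (ℬ.map tot).sum + U)
    (hℬ : ∀ F ∈ ℬ, (∃ b, ∀ i, #(F i) = b) ∧ ¬ Fits G lev β F w) :
    (ℓ - 1 : ℝ) / (ℓ + 1) * Multiset.card U + U.countP (fun u => lev u ≤ lev w) +
        (μ - 1 / ((ℓ + 1) * q) - ν - 2 * β) * #A ≤
      U.countP (G.Adj w) + Multiset.card P + Multiset.card (𝒢.map tot).sum := by
  have h1 := hA.deg w hw
  have h2 := deg_holes_le_low hℓ hℬ
  rw [← countP_val, h, Multiset.countP_add, Multiset.countP_add, Multiset.countP_add] at h1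
  have h3 := congrArg Multiset.card h
  rw [Multiset.card_add, Multiset.card_add, Multiset.card_add] at h3
  have h3' : (#A : ℝ) = Multiset.card P + Multiset.card (𝒢.map tot).sum +
    Multiset.card (ℬ.map tot).sum + Multiset.card U := by exact_mod_cast h3
  have h4 : (P.countP (G.Adj w) : ℝ) ≤ Multiset.card P := by
    exact_mod_cast Multiset.countP_le_card _ _
  have h5 : ((𝒢.map tot).sum.countP (G.Adj w) : ℝ) ≤ Multiset.card (𝒢.map tot).sum := by
    exact_mod_cast Multiset.countP_le_card _ _
  have h6 := hA.low (lev w + 1) hl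
  rw [Finset.filter_congr (q := fun u => lev u ≤ lev w) (fun u _ => Nat.lt_succ_iff),
    ← countP_val, h, Multiset.countP_add, Multiset.countP_add, Multiset.countP_add] at h6
  have h7 : (0 : ℝ) ≤ P.countP (fun u => lev u ≤ lev w) := Nat.cast_nonneg _
  have h8 : (0 : ℝ) ≤ (𝒢.map tot).sum.countP (fun u => lev u ≤ lev w) := Nat.cast_nonneg _
  push_cast at h1 h6
  have hq : (0 : ℝ) < q := by exact_mod_cast (by omega : 0 < q)
  have e0 : ((lev w : ℝ) + 1) / ((ℓ + 1) * q) = lev w / ((ℓ + 1) * q) + 1 / ((ℓ + 1) * q) := by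
    rw [add_div]
  rw [e0] at h6
  have hℓ' : (0 : ℝ) ≤ ℓ - 1 := by
    have : (1 : ℝ) ≤ ℓ := by exact_mod_cast hℓ
    linarith
  have hr : 0 ≤ (ℓ - 1 : ℝ) / (ℓ + 1) := by positivity
  set x := (Multiset.card P : ℝ)
  set y := (Multiset.card (𝒢.map tot).sum : ℝ)
  set z := (Multiset.card (ℬ.map tot).sum : ℝ)
  set u := (Multiset.card U : ℝ)
  have hx : 0 ≤ x := Nat.cast_nonneg _
  have hy : 0 ≤ y := Nat.cast_nonneg _
  have hz : 0 ≤ z := Nat.cast_nonneg _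
  have hu : 0 ≤ u := Nat.cast_nonneg _
  have e1 : (ℓ - 1 + 2 * β) / (ℓ + 1) * z = (ℓ - 1 : ℝ) / (ℓ + 1) * z + 2 * β * (z / (ℓ + 1)) := by
    field_simp
  have e2 : z / (ℓ + 1) ≤ #A := by
    rw [div_le_iff₀ (by positivity)]
    nlinarith [Nat.cast_nonneg (α := ℝ) ℓ, Nat.cast_nonneg (α := ℝ) (#A)]
  have e3 := mul_le_mul_of_nonneg_left e2 hβ
  have e4 : 0 ≤ (ℓ - 1 : ℝ) / (ℓ + 1) * x := by positivity
  have e5 : 0 ≤ (ℓ - 1 : ℝ) / (ℓ + 1) * y := by positivity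
  have e6 : (ℓ - 1 : ℝ) / (ℓ + 1) * #A = (ℓ - 1 : ℝ) / (ℓ + 1) * x + (ℓ - 1 : ℝ) / (ℓ + 1) * y +
    (ℓ - 1 : ℝ) / (ℓ + 1) * z + (ℓ - 1 : ℝ) / (ℓ + 1) * u := by rw [h3']; ring
  linarith

end fits

section tile_ops
open Classical

variable {V : Type} {ℓ : ℕ} {G : SimpleGraph V} {lev : V → ℕ}
  {F X : Fin (ℓ + 1) → Finset V} {c q b : ℕ} {o : Option (Fin (ℓ + 1))}

lemma val_eq_sdiff_add {F T : Finset V} (h : T ⊆ F) : F.val = (F \ T).val + T.val := by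
  rw [Finset.sdiff_val, tsub_add_cancel_of_le (Finset.val_le_iff.2 h)]

lemma exists_round {X : Finset V} (h : c + 2 ≤ #X) : ∃ z z' S, z ∈ X ∧ z' ∈ X ∧ S ⊆ X ∧ #S = c ∧
    z ≠ z' ∧ z ∉ S ∧ z' ∉ S := by
  obtain ⟨S, hS, hc⟩ := Finset.exists_subset_card_eq (show c ≤ #X by omega)
  have h1 : 1 < #(X \ S) := by rw [Finset.card_sdiff_of_subset hS]; omega
  obtain ⟨z, hz, z', hz', hzz⟩ := Finset.one_lt_card.1 h1
  rw [Finset.mem_sdiff] at hz hz'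
  exact ⟨z, z', S, hz.1, hz'.1, hS, hc, hzz, hz.2, hz'.2⟩

lemma tot_update (S : Fin (ℓ + 1) → Finset V) (j : Fin (ℓ + 1)) (W : Finset V) :
    tot (Function.update S j W) + (S j).val = tot S + W.val := by
  rw [tot, tot, ← Finset.add_sum_erase _ _ (Finset.mem_univ j),
    ← Finset.add_sum_erase (a := j) _ (fun i => (S i).val) (Finset.mem_univ j),
    Function.update_self, Finset.sum_congr rfl fun i hi => by
      rw [Function.update_of_ne (Finset.ne_of_mem_erase hi)]]
  abel

lemma ctx_step (hF : IsTile G F) (hXF : ∀ i, X i ⊆ F i) (hX : ∀ i, c + 2 ≤ #(X i))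
    (j : Fin (ℓ + 1)) {W : Finset V} (hW : #W = c)
    (hadj : ∀ w ∈ W, ∀ i, i ≠ j → ∀ x ∈ X i, G.Adj w x) :
    ∃ (F'' F' : Fin (ℓ + 1) → Finset V) (P : Multiset V), (∀ i, F'' i ⊆ F i) ∧ IsTile G F' ∧
      (∀ i, #(F' i) = c) ∧ (∀ i, F' i ⊆ F i ∪ W) ∧ Multiset.card P = 2 * (ℓ + 1) ∧
      Ctx G (SegFT G F F) {F'', F'} P ∧
      (∀ i, #(F'' i) + 2 + (if i = j then 0 else c) = #(F i)) ∧
      P + tot F'' + tot F' = tot F + W.val := by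
  choose z z' S hz hz' hS hSc hzz hzS hzS' using fun i => exists_round (hX i)
  set S' : Fin (ℓ + 1) → Finset V := fun i => if i = j then ∅ else S i with hS'
  have hS'S : ∀ i, S' i ⊆ S i := fun i => by
    rw [hS']; dsimp only; split_ifs; exacts [Finset.empty_subset _, Finset.Subset.refl _]
  set T : Fin (ℓ + 1) → Finset V := fun i => insert (z i) (insert (z' i) (S' i)) with hT
  have hTF : ∀ i, T i ⊆ F i := fun i => by
    rw [hT]
    refine Finset.insert_subset (hXF i (hz i)) (Finset.insert_subset (hXF i (hz' i)) ?_)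
    exact ((hS'S i).trans (hS i)).trans (hXF i)
  have hz1 : ∀ i, z' i ∉ S' i := fun i h => hzS' i (hS'S i h)
  have hz2 : ∀ i, z i ∉ insert (z' i) (S' i) := fun i h => by
    rcases Finset.mem_insert.1 h with h | h
    exacts [hzz i h, hzS i (hS'S i h)]
  have hjS : S' j = ∅ := by rw [hS']; simp
  refine ⟨fun i => F i \ T i, Function.update S' j W, ↑(List.ofFn z) + ↑(List.ofFn z'),
    fun i => Finset.sdiff_subset, ?_, fun i => ?_, fun i => ?_, ?_, ?_, fun i => ?_, ?_⟩
  · intro p p' hp x hx y hy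
    by_cases h1 : p = j
    · subst h1
      rw [Function.update_self] at hx
      rw [Function.update_of_ne hp.symm] at hy
      exact hadj x hx p' hp.symm y (hS p' (hS'S _ hy))
    · rw [Function.update_of_ne h1] at hx
      by_cases h2 : p' = j
      · subst h2
        rw [Function.update_self] at hy
        exact (hadj y hy p hp x (hS p (hS'S _ hx))).symm
      · rw [Function.update_of_ne h2] at hy
        exact hF p p' hp x (hXF _ (hS p (hS'S _ hx))) y (hXF _ (hS p' (hS'S _ hy)))
  · by_cases h : i = j
    · subst h; rw [Function.update_self, hW]
    · rw [Function.update_of_ne h, hS']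
      simp only [if_neg h, hSc]
  · by_cases h : i = j
    · subst h; rw [Function.update_self]; exact Finset.subset_union_right
    · rw [Function.update_of_ne h]
      exact (((hS'S i).trans (hS i)).trans (hXF i)).trans Finset.subset_union_left
  · rw [Multiset.card_add, Multiset.coe_card, Multiset.coe_card, List.length_ofFn,
      List.length_ofFn]
    ring
  · refine ctx_add hF (fun i => Finset.sdiff_subset)
      (fun i => ((hS'S i).trans (hS i)).trans (hXF i)) (fun i => hXF i (hz i))
      (fun i => hXF i (hz' i)) fun w hw i hi => ⟨hadj w hw i hi _ (hz i), hadj w hw i hi _ (hz' i),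
        fun x hx => hadj w hw i hi x (hS i (hS'S i hx))⟩
  · have h1 : #(T i) = (if i = j then 0 else c) + 2 := by
      rw [hT]
      dsimp only
      rw [Finset.card_insert_of_notMem (hz2 i), Finset.card_insert_of_notMem (hz1 i), hS']
      dsimp only
      split_ifs
      · simp
      · rw [hSc]
    have h2 := Finset.card_sdiff_add_card_eq_card (hTF i)
    dsimp only
    omega
  · have h1 := tot_update S' j W
    rw [hjS, Finset.empty_val, add_zero] at h1
    rw [h1, coe_ofFn, coe_ofFn]
    have h2 : tot F = ∑ i, ((F i \ T i).val + ({z i} + {z' i} + (S' i).val)) := by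
      refine Finset.sum_congr rfl fun i _ => ?_
      rw [val_eq_sdiff_add (hTF i), hT]
      dsimp only
      rw [Finset.insert_val_of_notMem (hz2 i), Finset.insert_val_of_notMem (hz1 i),
        ← Multiset.singleton_add, ← Multiset.singleton_add, add_assoc {z i}]
    rw [h2, Finset.sum_add_distrib, Finset.sum_add_distrib, Finset.sum_add_distrib]
    simp only [tot]
    abel

lemma full_steps (js : List (Fin (ℓ + 1))) (hjs : js.Nodup) {T : Finset V} :
    ∀ (F X : Fin (ℓ + 1) → Finset V) (W : Finset V), IsTile G F → (∀ i, X i ⊆ F i) →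
      (∀ i, (c + 2) * js.length ≤ #(X i)) → #W = c * js.length →
      (∀ w ∈ W, ∀ i, ∀ x ∈ X i, G.Adj w x) → (∀ i, F i ⊆ T) → W ⊆ T →
      ∃ (F'' : Fin (ℓ + 1) → Finset V) (ℋ : Multiset (Fin (ℓ + 1) → Finset V)) (P : Multiset V),
        (∀ i, F'' i ⊆ F i) ∧ Multiset.card ℋ = js.length ∧
        (∀ F' ∈ ℋ, IsTile G F' ∧ (∀ i, #(F' i) = c) ∧ ∀ i, F' i ⊆ T) ∧
        Multiset.card P = 2 * (ℓ + 1) * js.length ∧ Ctx G (SegFT G F F) (F'' ::ₘ ℋ) P ∧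
        (∀ i, #(F'' i) + 2 * js.length + c * js.length = #(F i) + if i ∈ js then c else 0) ∧
        P + tot F'' + (ℋ.map tot).sum = tot F + W.val := by
  induction js with
  | nil =>
    intro F X W hF hXF hX hW hadj hFT hWT
    obtain rfl : W = ∅ := by simpa using hW
    exact ⟨F, 0, 0, fun i => Finset.Subset.refl _, by simp, by simp, by simp, ctx_hole F, by simp,
      by simp⟩
  | cons j js ih =>
    intro F X W hF hXF hX hW hadj hFT hWT
    rw [List.nodup_cons] at hjs
    rw [List.length_cons] at *
    obtain ⟨W₁, hW₁, hW₁c⟩ := Finset.exists_subset_card_eq (show c ≤ #W by rw [hW]; nlinarith)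
    obtain ⟨F₁, F', P₁, hF₁, hF', hF'c, hF'W, hP₁, hctx, hF₁c, htot⟩ := ctx_step hF hXF
      (fun i => le_trans (by nlinarith) (hX i)) j hW₁c fun w hw i _ => hadj w (hW₁ hw) i
    have hX₁ : ∀ i, (c + 2) * js.length ≤ #(X i ∩ F₁ i) := fun i => by
      have h1 := hX i
      have h2 := hF₁c i
      have h3 : #(F i \ F₁ i) ≤ c + 2 := by
        have := Finset.card_sdiff_add_card_eq_card (hF₁ i)
        split_ifs at h2 <;> omega
      have h4 : #(X i \ F₁ i) ≤ c + 2 := (Finset.card_le_card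
        (Finset.sdiff_subset_sdiff (hXF i) (Finset.Subset.refl _))).trans h3
      have h5 := Finset.card_sdiff_add_card_inter (X i) (F₁ i)
      rw [Nat.mul_succ] at h1
      omega
    obtain ⟨F₂, ℋ, P₂, hF₂, hℋ, hℋ', hP₂, hctx₂, hF₂c, htot₂⟩ := ih hjs.2 F₁ (fun i => X i ∩ F₁ i)
      (W \ W₁) (hF.mono hF₁ hF₁) (fun i => Finset.inter_subset_right) hX₁
      (by rw [Finset.card_sdiff_of_subset hW₁, hW, hW₁c, Nat.mul_succ, Nat.add_sub_cancel])
      (fun w hw i x hx => hadj w (Finset.sdiff_subset hw) i x (Finset.mem_of_mem_inter_left hx))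
      (fun i => (hF₁ i).trans (hFT i)) (Finset.sdiff_subset.trans hWT)
    refine ⟨F₂, F' ::ₘ ℋ, P₂ + P₁, fun i => (hF₂ i).trans (hF₁ i), by simp [hℋ], ?_, ?_, ?_, ?_, ?_⟩
    · intro F₃ h3
      rcases Multiset.mem_cons.1 h3 with rfl | h3
      · exact ⟨hF', hF'c, fun i => (hF'W i).trans (Finset.union_subset (hFT i) (hW₁.trans hWT))⟩
      · exact hℋ' F₃ h3
    · rw [Multiset.card_add, hP₂, hP₁]; ring
    · have h1 : Ctx G (SegFT G F F) (F₁ ::ₘ {F'}) P₁ := hctx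
      have h2 := h1.replace hctx₂
      rwa [Multiset.cons_add, add_comm ℋ, Multiset.singleton_add] at h2
    · intro i
      have h1 := hF₁c i
      have h2 := hF₂c i
      by_cases hi : i = j
      · subst hi
        rw [if_pos rfl] at h1
        rw [if_neg hjs.1] at h2
        rw [if_pos List.mem_cons_self, Nat.mul_succ, Nat.mul_succ]
        omega
      · rw [if_neg hi] at h1
        simp only [List.mem_cons, hi, false_or]
        rw [Nat.mul_succ, Nat.mul_succ]
        omega
    · rw [Multiset.map_cons, Multiset.sum_cons, val_eq_sdiff_add hW₁]
      calc P₂ + P₁ + tot F₂ + (tot F' + (ℋ.map tot).sum)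
          = (P₂ + tot F₂ + (ℋ.map tot).sum) + (P₁ + tot F') := by abel
        _ = (P₁ + tot F₁ + tot F') + (W \ W₁).val := by rw [htot₂]; abel
        _ = _ := by rw [htot]; abel

/-- Exchange the part `j`. -/
lemma ctx_swap (hF : IsTile G F) (hFb : ∀ i, #(F i) = b) (hXF : ∀ i, X i ⊆ F i)
    (hX : ∀ i, c + 2 ≤ #(X i))
    (j : Fin (ℓ + 1)) {W : Finset V} (hW : #W = c)
    (hadj : ∀ w ∈ W, ∀ i, i ≠ j → ∀ x ∈ X i, G.Adj w x) :
    ∃ (F'' F' : Fin (ℓ + 1) → Finset V) (P : Multiset V) (Y : Finset V),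
      (∀ i, F'' i ⊆ F i) ∧ IsTile G F' ∧ Y ⊆ X j ∧ #Y = c ∧
      (∀ i, #(F' i) = c) ∧ (∀ i, F' i ⊆ F i ∪ W) ∧ Multiset.card P = 2 * (ℓ + 1) ∧
      Ctx G (SegFT G F F) {F'', F'} P ∧ (∀ i, #(F'' i) + 2 + c = b) ∧
      P + tot F'' + tot F' + Y.val = tot F + W.val := by
  obtain ⟨F₁, F', P, hF₁, hF', hF'c, hF'W, hP, hctx, hF₁c, htot⟩ := ctx_step hF hXF hX j hW hadj
  have h1 : c ≤ #(X j ∩ F₁ j) := by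
    have h1 := hX j
    have h2 := hF₁c j
    rw [if_pos rfl] at h2
    have h3 := Finset.card_sdiff_add_card_eq_card (hF₁ j)
    have h4 := Finset.card_le_card (Finset.sdiff_subset_sdiff (hXF j) (Finset.Subset.refl (F₁ j)))
    have h5 := Finset.card_sdiff_add_card_inter (X j) (F₁ j)
    omega
  obtain ⟨Y, hY, hYc⟩ := Finset.exists_subset_card_eq h1
  have hYF : Y ⊆ F₁ j := hY.trans Finset.inter_subset_right
  have hsub : ∀ i, Function.update F₁ j (F₁ j \ Y) i ⊆ F₁ i := fun i => by
    by_cases hi : i = j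
    · subst hi; rw [Function.update_self]; exact Finset.sdiff_subset
    · rw [Function.update_of_ne hi]
  refine ⟨Function.update F₁ j (F₁ j \ Y), F', P, Y, fun i => (hsub i).trans (hF₁ i), hF',
    hY.trans Finset.inter_subset_left, hYc, hF'c, hF'W, hP, Ctx.shrink hctx hsub, fun i => ?_, ?_⟩
  · have h2 := hF₁c i
    by_cases hi : i = j
    · subst hi
      rw [if_pos rfl] at h2
      rw [Function.update_self]
      have := Finset.card_sdiff_add_card_eq_card hYF
      have := hFb i
      omega
    · rw [if_neg hi] at h2
      rw [Function.update_of_ne hi, h2, hFb]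
  · have h3 := tot_update F₁ j (F₁ j \ Y)
    have h4 : tot (Function.update F₁ j (F₁ j \ Y)) + Y.val = tot F₁ := by
      rw [val_eq_sdiff_add hYF] at h3
      have h5 : (F₁ j \ Y).val + (tot (Function.update F₁ j (F₁ j \ Y)) + Y.val) =
          (F₁ j \ Y).val + tot F₁ := by
        rw [add_comm _ (tot F₁), ← h3]; abel
      exact add_left_cancel h5
    rw [← htot, ← h4]
    abel

/-- Many vertices that fit into a tile in the same way give a refinement of larger potential. -/
lemma tile_gain (hℓ : 1 ≤ ℓ) (hq : ∀ v, lev v ≤ q) (hq1 : 1 ≤ q) (hF : IsTile G F)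
    (hFb : ∀ i, #(F i) = b)
    (hXF : ∀ i, X i ⊆ F i) (hX : ∀ i, (c + 2) * (ℓ + 1) ≤ #(X i)) {W T : Finset V}
    (hW : #W = c * (ℓ + 1)) (hadj : ∀ w ∈ W, ∀ i, o ≠ some i → ∀ x ∈ X i, G.Adj w x)
    (hlev : ∀ w ∈ W, ∀ j, o = some j → ∀ y ∈ X j, lev w < lev y) (hFT : ∀ i, F i ⊆ T)
    (hWT : W ⊆ T) :
    ∃ (ℋ : Multiset (Fin (ℓ + 1) → Finset V)) (P : Multiset V) (W' : Finset V) (Y : Multiset V),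
      W' ⊆ W ∧ Ctx G (SegFT G F F) ℋ P ∧
      (∀ F' ∈ ℋ, IsTile G F' ∧ (∃ b', c ≤ b' ∧ b' ≤ b ∧ ∀ i, #(F' i) = b') ∧ ∀ i, F' i ⊆ T) ∧
      Multiset.card P + 2 * (ℓ + 1) = 2 * (ℓ + 1) * Multiset.card ℋ ∧
      P + (ℋ.map tot).sum + Y = tot F + W'.val ∧
      c + (Y.map fun v => 2 * q - lev v).sum ≤ (W'.val.map fun v => 2 * q - lev v).sum := by
  have hcb : (c + 2) * (ℓ + 1) ≤ b := by
    rw [← hFb 0]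
    exact (hX 0).trans (Finset.card_le_card (hXF 0))
  cases o with
  | none =>
    obtain ⟨F'', ℋ, P, h1, h2, h3, h4, h5, h6, h7⟩ := full_steps (G := G) (c := c) (T := T)
      (List.finRange (ℓ + 1)) (List.nodup_finRange _) F X W hF hXF (by simpa using hX)
      (by simpa using hW) (fun w hw i => hadj w hw i (by simp)) hFT hWT
    rw [List.length_finRange] at *
    refine ⟨F'' ::ₘ ℋ, P, W, 0, Finset.Subset.refl _, h5, ?_, ?_, ?_, ?_⟩
    · intro F₃ h
      rcases Multiset.mem_cons.1 h with rfl | h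
      · refine ⟨hF.mono h1 h1, ⟨#(F₃ 0), ?_, ?_, fun i => ?_⟩, fun i => (h1 i).trans (hFT i)⟩
        · have := h6 0
          rw [if_pos (List.mem_finRange _), hFb] at this
          nlinarith
        · rw [← hFb 0]; exact Finset.card_le_card (h1 0)
        · have h8 := h6 0
          have h9 := h6 i
          rw [if_pos (List.mem_finRange _), hFb] at h8 h9
          omega
      · have := h3 F₃ h
        refine ⟨this.1, ⟨c, le_rfl, ?_, this.2.1⟩, this.2.2⟩
        nlinarith
    · rw [h4, Multiset.card_cons, h2]; ring
    · rw [Multiset.map_cons, Multiset.sum_cons, add_zero, ← h7]; abel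
    · have : #W * q ≤ (W.val.map fun v => 2 * q - lev v).sum := by
        rw [← smul_eq_mul]
        refine Finset.card_nsmul_le_sum W _ q fun v _ => ?_
        have := hq v
        omega
      simp only [Multiset.map_zero, Multiset.sum_zero, add_zero]
      refine le_trans ?_ this
      rw [hW]
      calc c = c * 1 * 1 := by ring
        _ ≤ _ := Nat.mul_le_mul (Nat.mul_le_mul le_rfl (by omega)) hq1
  | some j =>
    obtain ⟨W', hW', hWc⟩ := Finset.exists_subset_card_eq (show c ≤ #W by rw [hW]; nlinarith)
    have hX' : ∀ i, c + 2 ≤ #(X i) := fun i => le_trans (by nlinarith) (hX i)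
    obtain ⟨F'', F', P, Y, h1, h2, h3, h4, h5, h6, h7, h8, h9, h10⟩ := ctx_swap hF hFb hXF hX' j
      hWc fun w hw i hi => hadj w (hW' hw) i (by simpa using hi.symm)
    refine ⟨{F'', F'}, P, W', Y.val, hW', h8, ?_, ?_, ?_, ?_⟩
    · intro F₃ h
      rw [Multiset.insert_eq_cons, Multiset.mem_cons, Multiset.mem_singleton] at h
      rcases h with rfl | rfl
      · refine ⟨hF.mono h1 h1, ⟨b - (2 + c), ?_, Nat.sub_le _ _, fun i => ?_⟩,
          fun i => (h1 i).trans (hFT i)⟩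
        · have : (c + 2) * 2 ≤ b := le_trans (Nat.mul_le_mul le_rfl (by omega)) hcb
          omega
        · have := h9 i
          omega
      · refine ⟨h2, ⟨c, le_rfl, ?_, h5⟩,
          fun i => (h6 i).trans (Finset.union_subset (hFT i) (hW'.trans hWT))⟩
        nlinarith
    · rw [h7]; simp; ring
    · rw [← h10]; simp [add_assoc]
    · rcases W'.eq_empty_or_nonempty with rfl | hne
      · rw [Finset.card_empty] at hWc
        subst hWc
        rw [Finset.card_eq_zero] at h4
        subst h4
        simp
      · obtain ⟨w, hw, hmax⟩ := W'.exists_max_image lev hne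
        have e1 : #W' * (2 * q - lev w) ≤ (W'.val.map fun v => 2 * q - lev v).sum := by
          rw [← smul_eq_mul]
          refine Finset.card_nsmul_le_sum W' _ _ fun v hv => ?_
          have := hmax v hv
          omega
        have e2 : (Y.val.map fun v => 2 * q - lev v).sum ≤ #Y * (2 * q - lev w - 1) := by
          rw [← smul_eq_mul]
          refine Finset.sum_le_card_nsmul Y _ _ fun v hv => ?_
          have := hlev w (hW' hw) j rfl v (h3 hv)
          omega
        rw [hWc] at e1
        rw [h4] at e2
        have e3 : 1 ≤ 2 * q - lev w := by have := hq w; omega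
        refine le_trans ?_ e1
        calc c + (Y.val.map fun v => 2 * q - lev v).sum ≤ c + c * (2 * q - lev w - 1) := by omega
          _ = c * (2 * q - lev w - 1 + 1) := by ring
          _ = _ := by rw [Nat.sub_add_cancel e3]

/-- Put a single vertex into a tile. -/
lemma tile_absorb (hq : ∀ v, lev v ≤ q) (hF : IsTile G F) (hFb : ∀ i, #(F i) = b)
    {w : V} (hXF : ∀ i, X i ⊆ F i) (hX : ∀ i, 3 ≤ #(X i))
    (hadj : ∀ i, o ≠ some i → ∀ x ∈ X i, G.Adj w x)
    (hlev : ∀ j, o = some j → ∀ y ∈ X j, lev w < lev y) :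
    ∃ (F'' : Fin (ℓ + 1) → Finset V) (P Y : Multiset V), (∀ i, F'' i ⊆ F i) ∧
      Ctx G (SegFT G F F) {F''} P ∧ (∃ b', b ≤ b' + 3 ∧ ∀ i, #(F'' i) = b') ∧
      Multiset.card P ≤ 3 * (ℓ + 1) ∧ P + tot F'' + Y = tot F + {w} ∧
      1 + (Y.map fun v => q + 1 - lev v).sum ≤ q + 1 - lev w := by
  cases o with
  | none =>
    choose z z' S hz hz' hS hSc hzz hzS hzS' using fun i =>
      exists_round (c := 0) (le_trans (by norm_num) (hX i))
    have hsub : ∀ i, {z i, z' i} ⊆ F i := fun i => by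
      intro x hx
      rcases Finset.mem_insert.1 hx with rfl | hx
      · exact hXF i (hz i)
      · rw [Finset.mem_singleton] at hx
        subst hx
        exact hXF i (hz' i)
    refine ⟨fun i => F i \ {z i, z' i}, _, 0, fun i => Finset.sdiff_subset,
      ctx_insert (w := w) hF (fun i => Finset.sdiff_subset) (fun i => hXF i (hz i))
      (fun i => hXF i (hz' i)) fun i => ⟨hadj i (by simp) _ (hz i), hadj i (by simp) _ (hz' i)⟩,
      ⟨b - 2, by omega, fun i => ?_⟩, ?_, ?_, ?_⟩
    · rw [Finset.card_sdiff_of_subset (hsub i), Finset.card_pair (hzz i), hFb]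
    · rw [Multiset.coe_card, List.length_append, List.length_append, List.length_ofFn,
        List.length_ofFn, List.length_singleton]
      omega
    · rw [← Multiset.coe_add, ← Multiset.coe_add, coe_ofFn, coe_ofFn, add_zero]
      have h2 : tot F = ∑ i, ((F i \ {z i, z' i}).val + ({z i} + {z' i})) := by
        refine Finset.sum_congr rfl fun i _ => ?_
        rw [val_eq_sdiff_add (hsub i), Finset.insert_val_of_notMem (by simpa using hzz i),
          ← Multiset.singleton_add, Finset.singleton_val]
      rw [h2, Finset.sum_add_distrib, Finset.sum_add_distrib]
      simp only [tot, Multiset.coe_singleton]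
      abel
    · have := hq w
      simp only [Multiset.map_zero, Multiset.sum_zero]
      omega
  | some j =>
    have hX' : ∀ i, 1 + 2 ≤ #(X i) := hX
    obtain ⟨F'', F', P, Y, h1, h2, h3, h4, h5, h6, h7, h8, h9, h10⟩ := ctx_swap (c := 1) hF hFb hXF
      hX' j (Finset.card_singleton w) fun u hu i hi => by
        rw [Finset.mem_singleton] at hu
        subst hu
        exact hadj i (by simpa using hi.symm)
    obtain ⟨y, rfl⟩ := Finset.card_eq_one.1 h4
    have h11 : Ctx G (SegFT G F F) (F' ::ₘ {F''}) P := by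
      rw [Multiset.pair_comm] at h8
      exact h8
    have h12 := h11.replace (ctx_fill h2 le_rfl h5)
    rw [zero_add] at h12
    refine ⟨F'', _, {y}, h1, h12, ⟨b - 3, by omega, fun i => by have := h9 i; omega⟩, ?_, ?_, ?_⟩
    · rw [Multiset.card_add, h7, card_tot, Finset.sum_congr rfl fun i _ => h5 i]
      simp
      omega
    · rw [Finset.singleton_val] at h10
      rw [Finset.singleton_val] at h10
      rw [← h10]; abel
    · have := hlev j rfl y (h3 (Finset.mem_singleton_self y))
      have := hq y
      simp only [Multiset.map_singleton, Multiset.sum_singleton]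
      omega

end tile_ops

section absorb
open Classical

variable {V : Type} {ℓ : ℕ} {G : SimpleGraph V} {lev : V → ℕ} {q : ℕ} {μ ν β : ℝ} {D : V → Prop}
  {A : Finset V} {Q : List V → Prop}

lemma card_holes_le {ℋ : Multiset (Fin (ℓ + 1) → Finset V)} {m : ℕ}
    (h : ∀ F ∈ ℋ, ∀ i, #(F i) ≤ m) :
    Multiset.card (ℋ.map tot).sum ≤ Multiset.card ℋ * ((ℓ + 1) * m) := by
  induction ℋ using Multiset.induction with
  | empty => simp
  | cons F ℋ ih =>
    have h1 := ih fun F' hF' => h F' (Multiset.mem_cons_of_mem hF')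
    have h2 : ∑ i, #(F i) ≤ (ℓ + 1) * m := by
      refine (Finset.sum_le_card_nsmul _ _ m fun i _ => h F (Multiset.mem_cons_self _ _) i).trans ?_
      simp
    rw [Multiset.map_cons, Multiset.sum_cons, Multiset.card_add, card_tot, Multiset.card_cons,
      Nat.succ_mul]
    omega

lemma le_card_holes {ℋ : Multiset (Fin (ℓ + 1) → Finset V)} {m : ℕ}
    (h : ∀ F ∈ ℋ, ∀ i, m ≤ #(F i)) :
    Multiset.card ℋ * ((ℓ + 1) * m) ≤ Multiset.card (ℋ.map tot).sum := by
  induction ℋ using Multiset.induction with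
  | empty => simp
  | cons F ℋ ih =>
    have h1 := ih fun F' hF' => h F' (Multiset.mem_cons_of_mem hF')
    have h2 : (ℓ + 1) * m ≤ ∑ i, #(F i) := by
      refine le_trans ?_ (Finset.card_nsmul_le_sum _ _ m fun i _ =>
        h F (Multiset.mem_cons_self _ _) i)
      simp
    rw [Multiset.map_cons, Multiset.sum_cons, Multiset.card_add, card_tot, Multiset.card_cons,
      Nat.succ_mul]
    omega

/-- Vertices outside can always be placed into the holes. -/
lemma absorb_all (hℓ : 1 ≤ ℓ) (hq1 : 1 ≤ q) (hA : Good G lev ℓ q μ ν D A) (hβ : 0 ≤ β)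
    {bm Nh B : ℕ} (hbm : 4 ≤ bm) (hβm : 3 ≤ β * bm) {δ : ℝ} (hδ1 : δ ≤ μ - β)
    (hδ2 : δ ≤ μ - 1 / ((ℓ + 1) * q) - ν - 2 * β)
    (hB : (B + Nh * ((ℓ + 1) * bm) : ℝ) < δ * #A) :
    ∀ (N : ℕ) (ℋ : Multiset (Fin (ℓ + 1) → Finset V)) (P U : Multiset V), Ctx G Q ℋ P →
      (∀ F ∈ ℋ, IsTile G F ∧ ∃ b, 1 ≤ b ∧ ∀ i, #(F i) = b) →
      A.val = P + (ℋ.map tot).sum + U → Multiset.card ℋ = Nh →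
      (U.map fun v => q + 1 - lev v).sum ≤ N →
      Multiset.card P + 3 * (ℓ + 1) * (U.map fun v => q + 1 - lev v).sum ≤ B →
      ∃ ω, Q ω ∧ (ω : Multiset V) = A.val := by
  intro N
  induction N with
  | zero =>
    intro ℋ P U h hℋ hU hN hpot hBp
    have hU0 : U = 0 := by
      by_contra hne
      obtain ⟨w, hw⟩ := Multiset.exists_mem_of_ne_zero hne
      obtain ⟨U', rfl⟩ := Multiset.exists_cons_of_mem hw
      rw [Multiset.map_cons, Multiset.sum_cons] at hpot
      have := hA.lev_le w
      omega
    subst hU0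
    obtain ⟨ω, h1, h2⟩ := h.fill_all hℋ
    exact ⟨ω, h1, by rw [h2, hU, add_zero]⟩
  | succ N ih =>
    intro ℋ P U h hℋ hU hN hpot hBp
    by_cases hU0 : U = 0
    · subst hU0
      obtain ⟨ω, h1, h2⟩ := h.fill_all hℋ
      exact ⟨ω, h1, by rw [h2, hU, add_zero]⟩
    obtain ⟨w, hw⟩ := Multiset.exists_mem_of_ne_zero hU0
    have hwA : w ∈ A := by
      rw [← Finset.mem_val, hU]
      exact Multiset.mem_add.2 (Or.inr hw)
    by_cases hF : ∃ F ∈ ℋ, bm ≤ #(F 0) ∧ Fits G lev β F w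
    · obtain ⟨F, hFℋ, hFb, o, X, hX⟩ := hF
      obtain ⟨ℋ', rfl⟩ := Multiset.exists_cons_of_mem hFℋ
      obtain ⟨U', rfl⟩ := Multiset.exists_cons_of_mem hw
      obtain ⟨hFt, b, hb1, hb⟩ := hℋ F hFℋ
      have hX3 : ∀ i, 3 ≤ #(X i) := fun i => by
        have h1 := hX.large i
        rw [hb] at h1
        rw [hb] at hFb
        have h2 : (3 : ℝ) ≤ #(X i) := hβm.trans (le_trans
          (mul_le_mul_of_nonneg_left (by exact_mod_cast hFb) hβ) h1)
        exact_mod_cast h2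
      obtain ⟨F'', P', Y, hF'', hctx, ⟨b', hb', hFb'⟩, hP', htot, hY⟩ := tile_absorb hA.lev_le hFt hb
        hX.sub hX3 hX.adj hX.lev
      have h1 := h.replace hctx
      rw [Multiset.singleton_add] at h1
      rw [Multiset.map_cons, Multiset.sum_cons] at hpot hBp
      refine ih (F'' ::ₘ ℋ') (P' + P) (U' + Y) h1 ?_ ?_ ?_ ?_ ?_
      · intro F₁ hF₁
        rcases Multiset.mem_cons.1 hF₁ with rfl | hF₁
        · exact ⟨hFt.mono hF'' hF'', b', by rw [hb] at hFb; omega, hFb'⟩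
        · exact hℋ F₁ (Multiset.mem_cons_of_mem hF₁)
      · rw [hU, Multiset.map_cons, Multiset.sum_cons, Multiset.map_cons, Multiset.sum_cons,
          ← Multiset.singleton_add]
        calc P + (tot F + (ℋ'.map tot).sum) + ({w} + U')
            = (tot F + {w}) + (P + (ℋ'.map tot).sum + U') := by abel
          _ = _ := by rw [← htot]; abel
      · rw [← hN, Multiset.card_cons, Multiset.card_cons]
      · rw [Multiset.map_add, Multiset.sum_add]; omega
      · rw [Multiset.map_add, Multiset.sum_add, Multiset.card_add]
        refine le_trans ?_ hBp
        generalize 3 * (ℓ + 1) = K at *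
        nlinarith
    · exfalso
      push Not at hF
      have hsplit := Multiset.filter_add_not (fun F : Fin (ℓ + 1) → Finset V => #(F 0) < bm) ℋ
      set 𝒢 := ℋ.filter fun F : Fin (ℓ + 1) → Finset V => #(F 0) < bm
      set ℬ := ℋ.filter fun F : Fin (ℓ + 1) → Finset V => ¬ #(F 0) < bm
      have hU' : A.val = P + (𝒢.map tot).sum + (ℬ.map tot).sum + U := by
        rw [hU, ← hsplit, Multiset.map_add, Multiset.sum_add, ← add_assoc P]
      have hℬ : ∀ F ∈ ℬ, (∃ b, ∀ i, #(F i) = b) ∧ ¬ Fits G lev β F w := fun F h1 => by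
        rw [Multiset.mem_filter] at h1
        obtain ⟨-, b, -, hb⟩ := hℋ F h1.1
        exact ⟨⟨b, hb⟩, hF F h1.1 (not_lt.1 h1.2)⟩
      have h𝒢 : Multiset.card (𝒢.map tot).sum ≤ Nh * ((ℓ + 1) * bm) := by
        refine (card_holes_le (m := bm) fun F h1 i => ?_).trans (Nat.mul_le_mul_right _ ?_)
        · rw [Multiset.mem_filter] at h1
          obtain ⟨-, b, -, hb⟩ := hℋ F h1.1
          have := h1.2
          rw [hb] at this
          rw [hb]
          exact this.le
        · rw [← hN]
          exact Multiset.card_le_card (Multiset.filter_le _ _)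
      have hUc : Multiset.card U ≤ (U.map fun v => q + 1 - lev v).sum := by
        have : ∀ U : Multiset V, Multiset.card U ≤ (U.map fun v => q + 1 - lev v).sum := by
          intro U
          induction U using Multiset.induction with
          | empty => simp
          | cons v U ih =>
            have := hA.lev_le v
            rw [Multiset.card_cons, Multiset.map_cons, Multiset.sum_cons]
            omega
        exact this U
      have hPU : Multiset.card P + Multiset.card U ≤ B := by
        refine le_trans ?_ hBp
        have : Multiset.card U ≤ 3 * (ℓ + 1) * (U.map fun v => q + 1 - lev v).sum :=
          hUc.trans (Nat.le_mul_of_pos_left _ (by positivity))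
        omega
      have hPU' : (Multiset.card P : ℝ) + Multiset.card U ≤ B := by exact_mod_cast hPU
      have h𝒢' : (Multiset.card (𝒢.map tot).sum : ℝ) ≤ Nh * ((ℓ + 1) * bm) := by exact_mod_cast h𝒢
      have hc : (U.countP (G.Adj w) : ℝ) ≤ Multiset.card U := by
        exact_mod_cast Multiset.countP_le_card _ _
      have hℓ' : (0 : ℝ) ≤ ℓ - 1 := by
        have : (1 : ℝ) ≤ ℓ := by exact_mod_cast hℓ
        linarith
      have hn : (0 : ℝ) ≤ #A := Nat.cast_nonneg _
      rcases (hA.lev_le w).eq_or_lt with hl | hl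
      · have h1 := hA.deg_top_left hq1 hβ (hA.sub w hwA) hl hU' hℬ
        have h2 : 0 ≤ (ℓ : ℝ) / (ℓ + 1) * Multiset.card U := by positivity
        have h3 := mul_le_mul_of_nonneg_right hδ1 hn
        linarith
      · have h1 := hA.deg_low_left hℓ hβ (hA.sub w hwA) hl hU' hℬ
        have h2 : 0 ≤ (ℓ - 1 : ℝ) / (ℓ + 1) * Multiset.card U := by positivity
        have h3 := mul_le_mul_of_nonneg_right hδ2 hn
        have h4 : (0 : ℝ) ≤ U.countP fun u => lev u ≤ lev w := Nat.cast_nonneg _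
        linarith

/-- A path which, together with the initial segment `s`, has final segment `e`. -/
def PathTo (G : SimpleGraph V) (ℓ : ℕ) (s e ω : List V) : Prop :=
  IsPow G (ℓ + 1) (s ++ ω) ∧ ∃ m, s ++ ω = m ++ e

lemma PathTo.append {s e e' ω r : List V} (h : PathTo G ℓ s e ω) (he : e.length = ℓ)
    (hr : PathTo G ℓ e e' r) : PathTo G ℓ s e' (ω ++ r) := by
  obtain ⟨h1, m, hm⟩ := h
  obtain ⟨h2, m', hm'⟩ := hr
  refine ⟨?_, m ++ m', ?_⟩
  · rw [← List.append_assoc, hm]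
    rw [hm] at h1
    exact h1.glue h2 (by omega)
  · rw [← List.append_assoc, hm, List.append_assoc, hm', List.append_assoc]

variable {ℋ : Multiset (Fin (ℓ + 1) → Finset V)} {P : Multiset V} {s e l : List V}

lemma ctx_append_tile {F F'' : Fin (ℓ + 1) → Finset V} {z y : Fin (ℓ + 1) → V}
    (h : Ctx G (PathTo G ℓ s e) ℋ P) (he : e.length = ℓ)
    (hF : IsTile G F) (hF'' : ∀ i, F'' i ⊆ F i) (hz : ∀ i, z i ∈ F i) (hy : ∀ i, y i ∈ F i)
    (hl : IsPow G (ℓ + 1) (e ++ l ++ List.ofFn fun i : Fin ℓ => z i.castSucc)) :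
    Ctx G (PathTo G ℓ s (List.ofFn fun i : Fin ℓ => y i.castSucc)) (F'' ::ₘ ℋ)
      (P + (↑(l ++ List.ofFn z) + ↑(List.ofFn fun i : Fin ℓ => y i.castSucc))) := by
  have h1 := ((ctx_list (G := G) (k := ℓ + 1) (Q := fun r => r = l ++ List.ofFn z) rfl).append
    (Q'' := fun r => ∃ f, SegFT G F'' F'' f ∧ r = l ++ List.ofFn z ++ f) (ctx_hole F'')
    fun l₁ f h1 h2 => ⟨f, h2, by rw [h1]⟩).append
    (Q'' := PathTo G ℓ e (List.ofFn fun i : Fin ℓ => y i.castSucc))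
    (ctx_list (G := G) (k := ℓ + 1) (Q := fun r => r = List.ofFn fun i : Fin ℓ => y i.castSucc) rfl)
    (by
      rintro _ _ ⟨f, hf, rfl⟩ rfl
      refine ⟨?_, e ++ (l ++ List.ofFn z ++ f), by simp only [List.append_assoc]⟩
      have hzF : ∀ i, ({z i} : Finset V) ⊆ F i := fun i => Finset.singleton_subset_iff.2 (hz i)
      have hyF : ∀ i, ({y i} : Finset V) ⊆ F i := fun i => Finset.singleton_subset_iff.2 (hy i)
      have h2 := (((segFT_ofFn (G := G) (z := z) fun i j hij => hF i j hij _ (hz i) _ (hz j)).append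
        hf (hF.mono hzF hF'')).append (segFT_ofFn (G := G) (z := y)
        fun i j hij => hF i j hij _ (hy i) _ (hy j)) (hF.mono hF'' hyF)).isPow
      have ez : List.ofFn z = (List.ofFn fun i : Fin ℓ => z i.castSucc) ++ [z (Fin.last ℓ)] := by
        rw [List.ofFn_succ', List.concat_eq_append]
      have ey : List.ofFn y = (List.ofFn fun i : Fin ℓ => y i.castSucc) ++ [y (Fin.last ℓ)] := by
        rw [List.ofFn_succ', List.concat_eq_append]
      rw [ey, ← List.append_assoc] at h2
      have h3 := h2.left
      rw [ez, List.append_assoc, List.append_assoc] at h3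
      have h4 := hl.glue h3 (by rw [List.length_ofFn])
      rw [ez]
      simpa only [List.append_assoc] using h4)
  have h2 := h.append h1 fun l l' hl hl' => hl.append he hl'
  simp only [zero_add, add_zero] at h2
  rwa [add_comm ℋ, Multiset.singleton_add] at h2

lemma ctx_finish {t : List V} (h : Ctx G (PathTo G ℓ s e) ℋ P) (he : e.length = ℓ)
    (hl : IsPow G (ℓ + 1) (e ++ l ++ t)) :
    Ctx G (fun ω => IsPow G (ℓ + 1) (s ++ ω ++ t)) ℋ (P + ↑l) := by
  have h1 := h.append (Q'' := fun ω => IsPow G (ℓ + 1) (s ++ ω ++ t))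
    (ctx_list (G := G) (k := ℓ + 1) (Q := fun r => r = l) rfl) (by
      rintro ω _ ⟨h1, m, hm⟩ rfl
      rw [hm] at h1
      rw [List.append_assoc] at hl
      have := h1.glue hl (by omega)
      rw [← hm] at this
      simpa only [List.append_assoc] using this)
  rwa [add_zero] at h1

end absorb

section gain
open Classical

variable {V : Type} {ℓ : ℕ} {G : SimpleGraph V} {lev : V → ℕ} {q : ℕ} {β : ℝ}

lemma exists_common_fit {F : Fin (ℓ + 1) → Finset V} {b m : ℕ} {U : Finset V}
    (hb : ∀ i, #(F i) = b) (hU : ∀ w ∈ U, Fits G lev β F w)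
    (hm : (ℓ + 2) * 2 ^ ((ℓ + 1) * b) * m ≤ #U) :
    ∃ o X, ∃ W ⊆ U, #W = m ∧ (∀ i, X i ⊆ F i) ∧
      ∀ w ∈ W, Fit G lev β F w o X := by
  choose! o X hX using hU
  have hcard : #((Finset.univ : Finset (Option (Fin (ℓ + 1)))) ×ˢ
      Fintype.piFinset fun i => (F i).powerset) = (ℓ + 2) * 2 ^ ((ℓ + 1) * b) := by
    rw [Finset.card_product, Fintype.card_piFinset, Finset.card_univ, Fintype.card_option,
      Fintype.card_fin]
    simp only [Finset.card_powerset, hb, Finset.prod_const, Finset.card_univ, Fintype.card_fin]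
    rw [← pow_mul, mul_comm b]
  have hmaps : ∀ w ∈ U, (o w, X w) ∈ (Finset.univ : Finset (Option (Fin (ℓ + 1)))) ×ˢ
      Fintype.piFinset fun i => (F i).powerset := fun w hw => by
    rw [Finset.mem_product, Fintype.mem_piFinset]
    exact ⟨Finset.mem_univ _, fun i => Finset.mem_powerset.2 ((hX w hw).sub i)⟩
  obtain ⟨⟨o', X'⟩, hy, hfib⟩ := Finset.exists_le_card_fiber_of_mul_le_card_of_maps_to hmaps
    ⟨(none, fun _ => ∅), by simp⟩ (hcard ▸ hm)
  obtain ⟨W, hW, hWm⟩ := Finset.exists_subset_card_eq hfib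
  refine ⟨o', X', W, hW.trans (Finset.filter_subset _ _), hWm, ?_, fun w hw => ?_⟩
  · rw [Finset.mem_product, Fintype.mem_piFinset] at hy
    exact fun i => Finset.mem_powerset.1 (hy.2 i)
  · have h1 := Finset.mem_filter.1 (hW hw)
    have h2 := hX w h1.1
    obtain ⟨e1, e2⟩ := Prod.mk.injEq .. ▸ h1.2
    rwa [e1, e2] at h2

/-- Tiles into which many outside vertices fit are refined so as to cover more. -/
lemma mass_gain (hℓ : 1 ≤ ℓ) (hq : ∀ v, lev v ≤ q) (hq1 : 1 ≤ q) {M lo hi θ : ℕ} (hM : 1 ≤ M)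
    (hMlo : M ≤ lo) (hβM : 2 * (ℓ + 1) ≤ β * M) (hβlo : 4 * (ℓ + 1) ≤ β * lo) {T U : Finset V}
    (hU : U ⊆ T) (ℋ : Multiset (Fin (ℓ + 1) → Finset V))
    (hℋ : ∀ F ∈ ℋ, IsTile G F ∧ (∃ b, lo ≤ b ∧ b ≤ hi ∧ ∀ i, #(F i) = b) ∧ (∀ i, F i ⊆ T) ∧
      θ ≤ #{w ∈ U | Fits G lev β F w})
    (hθ : Multiset.card (ℋ.map tot).sum + M * ((ℓ + 2) * 2 ^ ((ℓ + 1) * hi) * (hi * (ℓ + 1))) ≤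
      M * θ) :
    ∃ (ℋ' : Multiset (Fin (ℓ + 1) → Finset V)) (P : Multiset V) (W : Finset V) (Y : Multiset V)
      (g : ℕ), W ⊆ U ∧ M * #W ≤ Multiset.card (ℋ.map tot).sum ∧
      (∀ (Q : List V → Prop) ℋ₀ P₀, Ctx G Q (ℋ₀ + ℋ) P₀ → Ctx G Q (ℋ₀ + ℋ') (P₀ + P)) ∧
      (∀ F' ∈ ℋ', IsTile G F' ∧ (∃ b', lo / M ≤ b' ∧ b' ≤ hi ∧ ∀ i, #(F' i) = b') ∧
        ∀ i, F' i ⊆ T) ∧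
      Multiset.card P + 2 * (ℓ + 1) * Multiset.card ℋ = 2 * (ℓ + 1) * Multiset.card ℋ' ∧
      P + (ℋ'.map tot).sum + Y = (ℋ.map tot).sum + W.val ∧
      Multiset.card (ℋ.map tot).sum ≤ 2 * M * (ℓ + 1) * g ∧
      g + (Y.map fun v => 2 * q - lev v).sum ≤ (W.val.map fun v => 2 * q - lev v).sum := by
  induction ℋ using Multiset.induction with
  | empty =>
    refine ⟨0, 0, ∅, 0, 0, Finset.empty_subset _, by simp, fun Q ℋ₀ P₀ h => by simpa using h,
      by simp, by simp, by simp, by simp, by simp⟩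
  | cons F ℋ ih =>
    obtain ⟨hF, ⟨b, hlo, hhi, hb⟩, hFT, hFθ⟩ := hℋ F (Multiset.mem_cons_self _ _)
    have hcF : Multiset.card (tot F) = (ℓ + 1) * b := by
      rw [card_tot, Finset.sum_congr rfl fun i _ => hb i]; simp
    rw [Multiset.map_cons, Multiset.sum_cons, Multiset.card_add, hcF] at hθ ⊢
    obtain ⟨ℋ', P, W, Y, g, hW, hWc, hctx, hℋ', hP, htot, hg, hY⟩ :=
      ih (fun F' hF' => hℋ F' (Multiset.mem_cons_of_mem hF')) (by omega)
    set c := b / M with hc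
    have hcb : c * M ≤ b := Nat.div_mul_le_self b M
    have hbc : b ≤ 2 * M * c := by
      have h1 := Nat.lt_div_mul_add (a := b) (b := M) (by omega)
      have h2 : 1 ≤ c := (Nat.one_le_div_iff (by omega)).2 (by omega)
      rw [← hc] at h1
      nlinarith
    have hchi : c ≤ hi := (Nat.div_le_self _ _).trans hhi
    obtain ⟨o, X, W₁, hW₁, hW₁c, hX, hfit⟩ := exists_common_fit (m := c * (ℓ + 1))
      (U := {w ∈ U \ W | Fits G lev β F w}) hb (fun w hw => (Finset.mem_filter.1 hw).2) (by
        have h1 : #{w ∈ U | Fits G lev β F w} ≤ #{w ∈ U \ W | Fits G lev β F w} + #W := by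
          refine le_trans (Finset.card_le_card ?_) (Finset.card_union_le _ _)
          intro u hu
          simp only [Finset.mem_union, Finset.mem_filter, Finset.mem_sdiff] at hu ⊢
          tauto
        have h2 : M * ((ℓ + 2) * 2 ^ ((ℓ + 1) * b) * (c * (ℓ + 1))) ≤
            M * ((ℓ + 2) * 2 ^ ((ℓ + 1) * hi) * (hi * (ℓ + 1))) := by
          gcongr
          norm_num
        have h3 := Nat.mul_le_mul_left M (hFθ.trans h1)
        rw [mul_add] at h3
        exact Nat.le_of_mul_le_mul_left (by omega : M * _ ≤ M * _) hM)
    have hW₁U : W₁ ⊆ U \ W := hW₁.trans (Finset.filter_subset _ _)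
    have hX2 : (0 : ℝ) < c * (ℓ + 1) → ∀ i, (c + 2) * (ℓ + 1) ≤ #(X i) := fun _ i => by
      have hW₁ne : W₁.Nonempty := by
        rw [← Finset.card_pos, hW₁c]
        exact_mod_cast ‹(0 : ℝ) < c * (ℓ + 1)›
      obtain ⟨w, hw⟩ := hW₁ne
      have h1 := (hfit w hw).large i
      rw [hb] at h1
      have hβ : 0 ≤ β := by
        by_contra hneg
        have : β * M ≤ 0 := mul_nonpos_of_nonpos_of_nonneg (by linarith) (Nat.cast_nonneg _)
        have : (0 : ℝ) ≤ ℓ := Nat.cast_nonneg _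
        linarith
      have h2 : (c * M : ℝ) ≤ b := by exact_mod_cast hcb
      have h3 : (lo : ℝ) ≤ b := by exact_mod_cast hlo
      have h4 := mul_le_mul_of_nonneg_left h2 hβ
      have h5 := mul_le_mul_of_nonneg_left h3 hβ
      have h6 := mul_le_mul_of_nonneg_left hβM (Nat.cast_nonneg c : (0 : ℝ) ≤ c)
      have h7 : ((c + 2) * (ℓ + 1) : ℝ) ≤ #(X i) := by nlinarith
      exact_mod_cast h7
    have hc1 : 1 ≤ c := (Nat.one_le_div_iff (by omega)).2 (by omega)
    obtain ⟨ℋ₁, P₁, W', Y₁, hW', hctx₁, hℋ₁, hP₁, htot₁, hY₁⟩ := tile_gain hℓ hq hq1 hF hb hX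
      (hX2 (by have : (1 : ℝ) ≤ c := by exact_mod_cast hc1
               positivity)) hW₁c (fun w hw => (hfit w hw).adj)
      (fun w hw => (hfit w hw).lev) hFT ((hW₁U.trans Finset.sdiff_subset).trans hU)
    have hdisj : Disjoint W W' := by
      rw [Finset.disjoint_left]
      intro x hx hx'
      exact (Finset.mem_sdiff.1 (hW₁U (hW' hx'))).2 hx
    have hWW : (W ∪ W').val = W.val + W'.val := by
      rw [← Finset.disjUnion_eq_union _ _ hdisj]; rfl
    refine ⟨ℋ' + ℋ₁, P + P₁, W ∪ W', Y + Y₁, g + c, ?_, ?_, ?_, ?_, ?_, ?_, ?_, ?_⟩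
    · exact Finset.union_subset hW ((hW'.trans hW₁U).trans Finset.sdiff_subset)
    · have h1 : #(W ∪ W') ≤ #W + c * (ℓ + 1) :=
        (Finset.card_union_le _ _).trans
          (Nat.add_le_add_left ((Finset.card_le_card hW').trans hW₁c.le) _)
      have h2 := Nat.mul_le_mul_right (ℓ + 1) hcb
      calc M * #(W ∪ W') ≤ M * (#W + c * (ℓ + 1)) := Nat.mul_le_mul_left M h1
        _ = M * #W + c * M * (ℓ + 1) := by ring
        _ ≤ (ℓ + 1) * b + Multiset.card (ℋ.map tot).sum := by
          rw [mul_comm b] at h2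
          omega
    · intro Q ℋ₀ P₀ h
      have h1 : Ctx G Q (F ::ₘ (ℋ₀ + ℋ)) P₀ := by rwa [Multiset.add_cons] at h
      have h2 := h1.replace hctx₁
      have h3 := hctx Q (ℋ₁ + ℋ₀) (P₁ + P₀) (by rwa [add_assoc])
      have e1 : ℋ₀ + (ℋ' + ℋ₁) = ℋ₁ + ℋ₀ + ℋ' := by abel
      have e2 : P₀ + (P + P₁) = P₁ + P₀ + P := by abel
      rwa [e1, e2]
    · intro F' hF'
      rcases Multiset.mem_add.1 hF' with hF' | hF'
      · exact hℋ' F' hF'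
      · obtain ⟨h1, ⟨b', h2, h3, h4⟩, h5⟩ := hℋ₁ F' hF'
        exact ⟨h1, ⟨b', (Nat.div_le_div_right hlo).trans h2, h3.trans hhi, h4⟩, h5⟩
    · rw [Multiset.card_cons, Multiset.card_add, Multiset.card_add]
      linarith
    · rw [Multiset.map_add, Multiset.sum_add, hWW]
      calc P + P₁ + ((ℋ'.map tot).sum + (ℋ₁.map tot).sum) + (Y + Y₁)
          = (P + (ℋ'.map tot).sum + Y) + (P₁ + (ℋ₁.map tot).sum + Y₁) := by abel
        _ = _ := by rw [htot, htot₁]; abel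
    · nlinarith
    · rw [Multiset.map_add, Multiset.sum_add, hWW, Multiset.map_add, Multiset.sum_add]
      omega

lemma exists_heavy {U : Finset V} {θ : ℕ} (ℋ : Multiset (Fin (ℓ + 1) → Finset V)) :
    ∑ w ∈ U, Multiset.card ((ℋ.filter fun F => Fits G lev β F w).map tot).sum ≤
      #U * Multiset.card ((ℋ.filter fun F => θ ≤ #{w ∈ U | Fits G lev β F w}).map tot).sum +
        θ * Multiset.card (ℋ.map tot).sum := by
  induction ℋ using Multiset.induction with
  | empty => simp
  | cons F ℋ ih =>
    have h1 : ∀ w, Multiset.card (((F ::ₘ ℋ).filter fun F => Fits G lev β F w).map tot).sum =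
        (if Fits G lev β F w then Multiset.card (tot F) else 0) +
          Multiset.card ((ℋ.filter fun F => Fits G lev β F w).map tot).sum := fun w => by
      by_cases h : Fits G lev β F w
      · rw [Multiset.filter_cons_of_pos (p := fun F => Fits G lev β F w) _ h, if_pos h]; simp
      · rw [Multiset.filter_cons_of_neg (p := fun F => Fits G lev β F w) _ h, if_neg h]; simp
    have h2 : ∑ w ∈ U, (if Fits G lev β F w then Multiset.card (tot F) else 0) =
        #{w ∈ U | Fits G lev β F w} * Multiset.card (tot F) := by
      rw [← Finset.sum_filter]; simp
    rw [Finset.sum_congr rfl fun w _ => h1 w, Finset.sum_add_distrib, h2]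
    rw [Multiset.map_cons, Multiset.sum_cons, Multiset.card_add, mul_add]
    by_cases h : θ ≤ #{w ∈ U | Fits G lev β F w}
    · rw [Multiset.filter_cons_of_pos
        (p := fun F => θ ≤ #{w ∈ U | Fits G lev β F w}) _ h, Multiset.map_cons, Multiset.sum_cons, Multiset.card_add,
        mul_add]
      have := Nat.mul_le_mul_right (Multiset.card (tot F))
        (Finset.card_filter_le U fun w => Fits G lev β F w)
      omega
    · rw [Multiset.filter_cons_of_neg
        (p := fun F => θ ≤ #{w ∈ U | Fits G lev β F w}) _ h]
      have := Nat.mul_le_mul_right (Multiset.card (tot F)) (not_le.1 h).le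
      omega

end gain

section state
open Classical

variable {V : Type} {ℓ : ℕ} {G : SimpleGraph V} {lev : V → ℕ} {q : ℕ} {β : ℝ} {D : V → Prop}
  {A B : Finset V} {s e : List V} {K lo hi : ℕ} {ℋ : Multiset (Fin (ℓ + 1) → Finset V)}
  {P : Multiset V}

/-- A partially built path from `s` to `e` inside `A`, with holes `ℋ` inside `B`. -/
structure State (G : SimpleGraph V) (lev : V → ℕ) (ℓ q : ℕ) (D : V → Prop) (A B : Finset V)
    (s : List V) (K lo hi : ℕ) (ℋ : Multiset (Fin (ℓ + 1) → Finset V)) (P : Multiset V)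
    (e : List V) : Prop where
  ctx : Ctx G (PathTo G ℓ s e) ℋ P
  len : e.length = ℓ
  pow : IsPow G (ℓ + 1) e
  top : ∀ v ∈ e, D v ∧ lev v = q
  sub : P + (ℋ.map tot).sum ≤ A.val
  tile : ∀ F ∈ ℋ, IsTile G F ∧ (∃ b, lo ≤ b ∧ b ≤ hi ∧ ∀ i, #(F i) = b) ∧ ∀ i, F i ⊆ B
  cost : Multiset.card P ≤ K * Multiset.card ℋ

lemma val_eq_add_filter {τ : Multiset V} (h : τ ≤ A.val) :
    A.val = τ + (A.filter (· ∉ τ)).val := by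
  have hn : τ.Nodup := Multiset.nodup_of_le h A.nodup
  have h1 : (⟨τ, hn⟩ : Finset V) ⊆ A := fun x hx => Multiset.subset_of_le h hx
  rw [val_eq_sdiff_add h1, add_comm]
  congr 2
  ext x
  rw [Finset.mem_sdiff, Finset.mem_filter]
  rfl

lemma State.mono {lo' : ℕ} (h : State G lev ℓ q D A B s K lo hi ℋ P e) (hlo : lo' ≤ lo) :
    State G lev ℓ q D A B s K lo' hi ℋ P e :=
  ⟨h.ctx, h.len, h.pow, h.top, h.sub, fun F hF => ⟨(h.tile F hF).1,
    (h.tile F hF).2.1.imp fun _ h' => ⟨hlo.trans h'.1, h'.2⟩, (h.tile F hF).2.2⟩, h.cost⟩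

lemma State.improve (hS : State G lev ℓ q D A B s K lo hi ℋ P e) (hBA : B ⊆ A) (hℓ : 1 ≤ ℓ)
    (hq : ∀ v, lev v ≤ q) (hq1 : 1 ≤ q) {M : ℕ} (hM : 1 ≤ M) (hMlo : M ≤ lo)
    (hβM : 2 * (ℓ + 1) ≤ β * M) (hβlo : 4 * (ℓ + 1) ≤ β * lo) (hK : 2 * (ℓ + 1) ≤ K) {ζ : ℝ}
    (hMζ : 4 ≤ M * ζ)
    (hA : 4 * ((((ℓ + 2) * 2 ^ ((ℓ + 1) * hi) * (hi * (ℓ + 1)) : ℕ) : ℝ) + 1) ≤ ζ * #A)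
    (hsum : ζ * #A * #A ≤ ((∑ w ∈ B.filter (· ∉ P + (ℋ.map tot).sum),
      Multiset.card ((ℋ.filter fun F => Fits G lev β F w).map tot).sum : ℕ) : ℝ)) :
    ∃ ℋ' P', ∃ g : ℕ, State G lev ℓ q D A B s K (lo / M) hi ℋ' P' e ∧
      ((P + (ℋ.map tot).sum).map fun v => 2 * q - lev v).sum + g ≤
        ((P' + (ℋ'.map tot).sum).map fun v => 2 * q - lev v).sum ∧
      ζ * #A ≤ 4 * M * (ℓ + 1) * g := by
  set n := #A with hn
  set U := B.filter (· ∉ P + (ℋ.map tot).sum) with hU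
  set C := (ℓ + 2) * 2 ^ ((ℓ + 1) * hi) * (hi * (ℓ + 1)) with hC
  have hζn : 0 ≤ ζ * n := le_trans (by positivity) hA
  set θ := ⌊ζ * n / 2⌋₊ with hθ
  have hθ1 : (θ : ℝ) ≤ ζ * n / 2 := Nat.floor_le (by positivity)
  have hθ2 : ζ * n / 2 < θ + 1 := Nat.lt_floor_add_one _
  have hτn : Multiset.card (ℋ.map tot).sum ≤ n := by
    have := Multiset.card_le_card hS.sub
    rw [Multiset.card_add] at this
    exact le_trans (Nat.le_add_left _ _) this
  have hUn : #U ≤ n := Finset.card_le_card ((Finset.filter_subset _ _).trans hBA)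
  have hheavy := exists_heavy (G := G) (lev := lev) (β := β) (U := U) (θ := θ) ℋ
  have hsplit := Multiset.filter_add_not
    (fun F : Fin (ℓ + 1) → Finset V => θ ≤ #{w ∈ U | Fits G lev β F w}) ℋ
  set ℋ₁ := ℋ.filter fun F => θ ≤ #{w ∈ U | Fits G lev β F w} with hℋ₁
  set ℋ₀ := ℋ.filter fun F => ¬ θ ≤ #{w ∈ U | Fits G lev β F w} with hℋ₀
  have hℋ : ℋ = ℋ₀ + ℋ₁ := hsplit.symm.trans (add_comm _ _)
  have hℋ₁n : Multiset.card (ℋ₁.map tot).sum ≤ n := by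
    refine le_trans ?_ hτn
    conv_rhs => rw [hℋ, Multiset.map_add, Multiset.sum_add, Multiset.card_add]
    exact Nat.le_add_left _ _
  have hn0 : (0 : ℝ) ≤ n := Nat.cast_nonneg _
  have hnpos : (0 : ℝ) < n := by
    rcases hn0.eq_or_lt with h | h
    · rw [← h, mul_zero] at hA
      have : (0 : ℝ) ≤ C := Nat.cast_nonneg _
      linarith
    · exact h
  obtain ⟨ℋ', P', W, Y, g, hW, -, hctx, hℋ', hP', htot, hg, hY⟩ := mass_gain (G := G) (β := β) hℓ
    hq hq1 (hi := hi) (θ := θ) hM hMlo hβM hβlo (T := B) (U := U) (Finset.filter_subset _ _) ℋ₁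
    (fun F hF => by
      rw [hℋ₁, Multiset.mem_filter] at hF
      obtain ⟨h1, h2, h3⟩ := hS.tile F hF.1
      exact ⟨h1, h2, h3, hF.2⟩)
    (by
      have h1 : (Multiset.card (ℋ₁.map tot).sum : ℝ) ≤ n := by exact_mod_cast hℋ₁n
      have h2 : (Multiset.card (ℋ₁.map tot).sum + M * C : ℝ) ≤ M * θ := by
        have hM' : (1 : ℝ) ≤ M := by exact_mod_cast hM
        nlinarith [mul_le_mul_of_nonneg_right hMζ hn0]
      exact_mod_cast h2)
  have hnew : P + P' + ((ℋ₀ + ℋ').map tot).sum + Y = P + (ℋ.map tot).sum + W.val := by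
    rw [Multiset.map_add, Multiset.sum_add, hℋ, Multiset.map_add, Multiset.sum_add]
    calc P + P' + ((ℋ₀.map tot).sum + (ℋ'.map tot).sum) + Y
        = P + (ℋ₀.map tot).sum + (P' + (ℋ'.map tot).sum + Y) := by abel
      _ = _ := by rw [htot]; abel
  refine ⟨ℋ₀ + ℋ', P + P', g, ⟨hctx _ _ _ (hℋ ▸ hS.ctx), hS.len, hS.pow, hS.top, ?_, ?_, ?_⟩,
    ?_, ?_⟩
  · refine (Multiset.le_add_right _ Y).trans ?_
    rw [hnew]
    conv_rhs => rw [val_eq_add_filter hS.sub]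
    refine add_le_add_right (Finset.val_le_iff.2 fun x hx => ?_) _
    have := Finset.mem_filter.1 (hW hx)
    exact Finset.mem_filter.2 ⟨hBA this.1, this.2⟩
  · intro F hF
    rcases Multiset.mem_add.1 hF with hF | hF
    · obtain ⟨h1, ⟨b, h2, h3⟩, h4⟩ := hS.tile F (Multiset.mem_of_mem_filter hF)
      exact ⟨h1, ⟨b, (Nat.div_le_self _ _).trans h2, h3⟩, h4⟩
    · exact hℋ' F hF
  · have h1 := hS.cost
    rw [hℋ] at h1
    rw [Multiset.card_add] at h1 ⊢
    rw [Multiset.card_add]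
    have h2 : Multiset.card ℋ₁ ≤ Multiset.card ℋ' := by
      refine Nat.le_of_mul_le_mul_left (c := 2 * (ℓ + 1)) ?_ (by omega)
      omega
    obtain ⟨x, hx⟩ := Nat.exists_eq_add_of_le h2
    rw [hx, mul_add] at hP'
    rw [hx]
    have := Nat.mul_le_mul_right x hK
    nlinarith
  · have h1 := congrArg (fun S : Multiset V => (S.map fun v => 2 * q - lev v).sum) hnew
    simp only [Multiset.map_add, Multiset.sum_add] at h1 ⊢
    omega
  · have h1 : ζ * n * n ≤ (#U * Multiset.card (ℋ₁.map tot).sum +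
        θ * Multiset.card (ℋ.map tot).sum : ℝ) := hsum.trans (by exact_mod_cast hheavy)
    have h2 : (#U * Multiset.card (ℋ₁.map tot).sum : ℝ) ≤ n * Multiset.card (ℋ₁.map tot).sum := by
      gcongr
    have h3 : (θ * Multiset.card (ℋ.map tot).sum : ℝ) ≤ ζ * n / 2 * n := by
      gcongr
    have h4 : (Multiset.card (ℋ₁.map tot).sum : ℝ) ≤ 2 * M * (ℓ + 1) * g := by exact_mod_cast hg
    have h5 : ζ * n * n ≤ (4 * M * (ℓ + 1) * g) * n := by nlinarith
    exact le_of_mul_le_mul_right h5 hnpos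

lemma nodup_tot {F : Fin (ℓ + 1) → Finset V} (hF : IsTile G F) : (tot F).Nodup := by
  have hd : Set.PairwiseDisjoint ((Finset.univ : Finset (Fin (ℓ + 1))) : Set (Fin (ℓ + 1))) F := by
    intro i _ j _ hij
    refine Finset.disjoint_left.2 fun x hx hx' => (G.irrefl (hF i j hij x hx x hx'))
  exact (Finset.univ.disjiUnion F hd).nodup

lemma mem_tot {F : Fin (ℓ + 1) → Finset V} {x : V} : x ∈ tot F ↔ ∃ i, x ∈ F i := by
  simp [tot, Multiset.mem_sum]

lemma State.extend (hS : State G lev ℓ q D A B s K lo hi ℋ P e) (hBA : B ⊆ A)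
    (hq : ∀ v, lev v ≤ q) (hq1 : 1 ≤ q) (hlohi : lo ≤ hi) {F : Fin (ℓ + 1) → Finset V}
    (hF : IsTile G F) (hFU : ∀ i, F i ⊆ B.filter (· ∉ P + (ℋ.map tot).sum))
    (hFc : ∀ i, #(F i) = lo + 2) (hFT : ∀ i : Fin ℓ, ∀ x ∈ F i.castSucc, D x ∧ lev x = q) {L : ℕ}
    (hconn : ∀ e', e'.length = ℓ → IsPow G (ℓ + 1) e' → (∀ v ∈ e', D v ∧ lev v = q) →
      ∃ l : List V, (∀ v ∈ l, v ∈ A \ B ∧ v ∉ P) ∧ l.Nodup ∧ l.length = L ∧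
        IsPow G (ℓ + 1) (e ++ l ++ e')) (hK : L + 2 * ℓ + 1 ≤ K) :
    ∃ ℋ' P' e', State G lev ℓ q D A B s K lo hi ℋ' P' e' ∧
      ((P + (ℋ.map tot).sum).map fun v => 2 * q - lev v).sum <
        ((P' + (ℋ'.map tot).sum).map fun v => 2 * q - lev v).sum := by
  have hz : ∀ i, ∃ z y S, z ∈ F i ∧ y ∈ F i ∧ S ⊆ F i ∧ #S = lo ∧
      (F i).val = {z} + {y} + S.val := by
    intro i
    have h1 : 1 < #(F i) := by rw [hFc]; omega
    obtain ⟨z, hz, y, hy, hzy⟩ := Finset.one_lt_card.1 h1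
    have h2 : y ∈ (F i).erase z := Finset.mem_erase.2 ⟨hzy.symm, hy⟩
    refine ⟨z, y, ((F i).erase z).erase y, hz, hy,
      (Finset.erase_subset _ _).trans (Finset.erase_subset _ _), ?_, ?_⟩
    · rw [Finset.card_erase_of_mem h2, Finset.card_erase_of_mem hz, hFc]; omega
    · conv_lhs => rw [← Finset.insert_erase hz, Finset.insert_val_of_notMem (Finset.notMem_erase _ _),
        ← Finset.insert_erase h2, Finset.insert_val_of_notMem (Finset.notMem_erase _ _)]
      rw [← Multiset.singleton_add, ← Multiset.singleton_add, add_assoc]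
  choose z y F'' hz hy hF'' hF''c hsum using hz
  have htot : tot F = ↑(List.ofFn z) + ↑(List.ofFn y) + tot F'' := by
    rw [tot, Finset.sum_congr rfl fun i _ => hsum i, Finset.sum_add_distrib,
      Finset.sum_add_distrib, coe_ofFn, coe_ofFn]
    rfl
  have hT : ∀ x : Fin (ℓ + 1) → V, (∀ i, x i ∈ F i) →
      (List.ofFn fun i : Fin ℓ => x i.castSucc).length = ℓ ∧
      IsPow G (ℓ + 1) (List.ofFn fun i : Fin ℓ => x i.castSucc) ∧
      ∀ v ∈ List.ofFn fun i : Fin ℓ => x i.castSucc, D v ∧ lev v = q := fun x hx =>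
    ⟨List.length_ofFn, (isPow_of_pairwise (List.pairwise_ofFn.2 fun i j hij =>
      hF _ _ (by simpa using hij.ne) _ (hx _) _ (hx _))),
      by rw [List.forall_mem_ofFn_iff]; exact fun i => hFT i _ (hx _)⟩
  obtain ⟨l, hlR, hln, hlL, hlp⟩ := hconn _ (hT z hz).1 (hT z hz).2.1 (hT z hz).2.2
  have hctx := ctx_append_tile hS.ctx hS.len hF hF'' hz hy hlp
  have hy' : (↑(List.ofFn fun i : Fin ℓ => y i.castSucc) : Multiset V) + {y (Fin.last ℓ)} =
      ↑(List.ofFn y) := by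
    rw [List.ofFn_succ', List.concat_eq_append, ← Multiset.coe_add]
    rfl
  have hbig : P + (↑(l ++ List.ofFn z) + ↑(List.ofFn fun i : Fin ℓ => y i.castSucc)) +
      ((F'' ::ₘ ℋ).map tot).sum + {y (Fin.last ℓ)} = P + (ℋ.map tot).sum + (↑l + tot F) := by
    rw [htot, ← hy', Multiset.map_cons, Multiset.sum_cons, ← Multiset.coe_add]
    abel
  refine ⟨_, _, _, ⟨hctx, (hT y hy).1, (hT y hy).2.1, (hT y hy).2.2, ?_, ?_, ?_⟩, ?_⟩
  · refine (Multiset.le_add_right _ {y (Fin.last ℓ)}).trans ?_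
    rw [hbig]
    conv_rhs => rw [val_eq_add_filter hS.sub]
    refine add_le_add_right ((Multiset.le_iff_subset ?_).2 ?_) _
    · refine Multiset.nodup_add.2 ⟨hln, nodup_tot hF, Multiset.disjoint_left.2 fun {x} hx hx' => ?_⟩
      obtain ⟨i, hi⟩ := mem_tot.1 hx'
      exact (Finset.mem_sdiff.1 (hlR x hx).1).2 (Finset.mem_filter.1 (hFU i hi)).1
    · intro x hx
      rcases Multiset.mem_add.1 hx with hx | hx
      · refine Finset.mem_filter.2 ⟨(Finset.mem_sdiff.1 (hlR x hx).1).1, fun h => ?_⟩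
        rcases Multiset.mem_add.1 h with h | h
        · exact (hlR x hx).2 h
        · obtain ⟨τ, hτ, h⟩ := Multiset.mem_join.1 h
          obtain ⟨F', hF', rfl⟩ := Multiset.mem_map.1 hτ
          obtain ⟨i, hi⟩ := mem_tot.1 h
          exact (Finset.mem_sdiff.1 (hlR x hx).1).2 ((hS.tile F' hF').2.2 i hi)
      · obtain ⟨i, hi⟩ := mem_tot.1 hx
        have := Finset.mem_filter.1 (hFU i hi)
        exact Finset.mem_filter.2 ⟨hBA this.1, this.2⟩
  · intro F' hF'
    rcases Multiset.mem_cons.1 hF' with rfl | hF'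
    · exact ⟨hF.mono hF'' hF'', ⟨lo, le_rfl, hlohi, hF''c⟩, fun i =>
        (hF'' i).trans ((hFU i).trans (Finset.filter_subset _ _))⟩
    · exact hS.tile F' hF'
  · rw [Multiset.card_add, Multiset.card_add, Multiset.coe_card, Multiset.coe_card,
      List.length_append, List.length_ofFn, List.length_ofFn, Multiset.card_cons, mul_add, hlL]
    have := hS.cost
    omega
  · have h1 := congrArg (fun S : Multiset V => (S.map fun v => 2 * q - lev v).sum) hbig
    have h2 : ((tot F).map fun v => 2 * q - lev v).sum =
        ((↑(List.ofFn z) : Multiset V).map fun v => 2 * q - lev v).sum +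
        ((↑(List.ofFn fun i : Fin ℓ => y i.castSucc) : Multiset V).map fun v => 2 * q - lev v).sum +
        (2 * q - lev (y (Fin.last ℓ))) + ((tot F'').map fun v => 2 * q - lev v).sum := by
      rw [htot, ← hy']
      simp only [Multiset.map_add, Multiset.sum_add, Multiset.map_singleton, Multiset.sum_singleton]
      ring
    have h3 : 2 * q - lev (z 0) ≤
        ((↑(List.ofFn z) : Multiset V).map fun v => 2 * q - lev v).sum :=
      Multiset.le_sum_of_mem (Multiset.mem_map_of_mem (fun v => 2 * q - lev v)
        (Multiset.mem_coe.2 ((List.mem_ofFn' _ _).2 ⟨0, rfl⟩)))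
    have h4 := hq (z 0)
    simp only [Multiset.map_add, Multiset.sum_add, Multiset.map_singleton,
      Multiset.sum_singleton] at h1 ⊢
    omega

end state

section tile
open Classical

variable {V : Type} {ℓ : ℕ} {G : SimpleGraph V} {lev : V → ℕ} {q : ℕ} {β μ ν : ℝ} {D : V → Prop}
  {A B : Finset V} {s e : List V} {K lo hi : ℕ} {ℋ : Multiset (Fin (ℓ + 1) → Finset V)}
  {P : Multiset V}

lemma many_clique_of {N : Finset V} {T : V → Prop} {d θ L : ℝ} (hD : 0 ≤ d)
    (hT : ∀ v, T v → (#{u ∈ N | ¬ G.Adj v u} : ℝ) ≤ d)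
    (hL : (#{u ∈ N | ¬ T u} : ℝ) ≤ L) (j : ℕ) (c : List V)
    (hc : ∀ v ∈ c, T v) (hN : 1 ≤ j → (c.length + j) * d + L + θ ≤ #N + d) :
    Many N θ j fun l => (∀ v ∈ l, T v) ∧ (∀ v ∈ l, ∀ u ∈ c, G.Adj u v) ∧ l.Pairwise G.Adj := by
  induction j generalizing c with
  | zero => simp [Many]
  | succ j ih =>
    have h1 : Many N θ 1 fun l => ∃ v, l = [v] ∧ T v ∧ ∀ u ∈ c, G.Adj u v := by
      refine many_one (R' := {u ∈ N | T u ∧ ∀ v ∈ c, G.Adj v u}) (Finset.filter_subset _ _) ?_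
        fun v hv => ⟨v, rfl, (Finset.mem_filter.1 hv).2⟩
      have h1 := card_common hT c hc
      have h3 : (#{u ∈ N | ∀ v ∈ c, G.Adj v u} : ℝ) ≤
          #{u ∈ N | T u ∧ ∀ v ∈ c, G.Adj v u} + #{u ∈ N | ¬ T u} := by
        norm_cast
        refine le_trans (Finset.card_le_card ?_) (Finset.card_union_le _ _)
        intro u hu
        simp only [Finset.mem_union, Finset.mem_filter] at hu ⊢
        tauto
      have := hN (by omega)
      push_cast at this
      nlinarith [mul_nonneg (Nat.cast_nonneg j : (0 : ℝ) ≤ j) hD]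
    rw [add_comm]
    refine h1.bind ?_
    rintro l ⟨v, rfl, hv, hvc⟩
    refine (ih (v :: c) (by simpa [hv] using hc) fun _ => ?_).mono ?_
    · have := hN (by omega)
      push_cast [List.length_cons] at this ⊢
      linarith
    · rintro l ⟨hl1, hl2, hl3⟩
      refine ⟨by simpa [hv] using hl1, ?_, ?_⟩
      · intro u hu w hw
        rcases List.mem_cons.1 hu with rfl | hu
        · exact hvc w hw
        · exact hl2 u hu w (List.mem_cons_of_mem _ hw)
      · exact List.pairwise_cons.2 ⟨fun u hu => hl2 u hu v List.mem_cons_self, hl3⟩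

lemma isTile_of_pairwise {F : Fin (ℓ + 1) → Finset V} (hne : ∀ i, (F i).Nonempty)
    (h : ∀ x : Fin (ℓ + 1) → V, (∀ i, x i ∈ F i) → (List.ofFn x).Pairwise G.Adj) :
    IsTile G F := by
  choose z hz using hne
  intro i j hij x hx y hy
  have h1 := h (Function.update (Function.update z i x) j y) (fun p => by
    by_cases hp : p = j
    · subst hp; simpa using hy
    rw [Function.update_of_ne hp]
    by_cases hp : p = i
    · subst hp; simpa using hx
    rw [Function.update_of_ne hp]
    exact hz p)
  rw [List.pairwise_ofFn] at h1
  have ei : Function.update (Function.update z i x) j y i = x := by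
    rw [Function.update_of_ne hij, Function.update_self]
  have ej : Function.update (Function.update z i x) j y j = y := Function.update_self _ _ _
  rcases lt_or_gt_of_ne hij with hlt | hlt
  · have := h1 hlt; rwa [ei, ej] at this
  · have := h1 hlt; rw [ei, ej] at this; exact this.symm

lemma State.card_le (hS : State G lev ℓ q D A B s K lo hi ℋ P e) :
    Multiset.card ℋ * ((ℓ + 1) * lo) ≤ #A := by
  have h1 := le_card_holes (ℋ := ℋ) (m := lo) fun F hF i => by
    obtain ⟨-, ⟨b, h1, -, h2⟩, -⟩ := hS.tile F hF
    rwa [h2]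
  have h2 := Multiset.card_le_card hS.sub
  rw [Multiset.card_add] at h2
  exact h1.trans ((Nat.le_add_left _ _).trans h2)

lemma State.cost_le (hS : State G lev ℓ q D A B s K lo hi ℋ P e) {ξ : ℝ} (hlo1 : 1 ≤ lo)
    (hlo : (K : ℝ) ≤ ξ * lo) : (Multiset.card P : ℝ) ≤ ξ * #A := by
  have h1 : (Multiset.card P : ℝ) ≤ K * Multiset.card ℋ := by exact_mod_cast hS.cost
  have h2 : (Multiset.card ℋ * ((ℓ + 1) * lo) : ℝ) ≤ #A := by exact_mod_cast hS.card_le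
  have hlo' : (1 : ℝ) ≤ lo := by exact_mod_cast hlo1
  have hξ : 0 ≤ ξ := by
    by_contra h
    have : ξ * lo < 0 := mul_neg_of_neg_of_pos (by linarith) (by linarith)
    have : (0 : ℝ) ≤ K := Nat.cast_nonneg _
    linarith
  have h3 : (0 : ℝ) ≤ Multiset.card ℋ := Nat.cast_nonneg _
  have hℓ : (0 : ℝ) ≤ ℓ := Nat.cast_nonneg _
  calc (Multiset.card P : ℝ) ≤ ξ * lo * Multiset.card ℋ := h1.trans (by gcongr)
    _ = ξ * (Multiset.card ℋ * (1 * lo)) := by ring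
    _ ≤ ξ * (Multiset.card ℋ * ((ℓ + 1) * lo)) := by gcongr; linarith
    _ ≤ ξ * #A := by gcongr

lemma clique_budget {l u z d x : ℝ} (hl : 2 ≤ l) (hu : 0 ≤ u) (hz : 0 ≤ z) (hd : 0 ≤ d)
    (h1 : 2 / (l + 1) * u ≤ 2 / 3 * u) (h2 : 3 * (z + d) ≤ u) (hx : x ≤ d) :
    (l - 1) * max (u / (l + 1) - (z + d)) 0 + 2 / (l + 1) * u + z + x ≤ u ∧
      l * max (u / (l + 1) - (z + d)) 0 + x ≤ u := by
  have hl1 : 0 < l + 1 := by linarith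
  rcases max_cases (u / (l + 1) - (z + d)) 0 with ⟨h, -⟩ | ⟨h, -⟩
  · rw [h]
    have e1 : (l - 1) * (u / (l + 1)) + 2 / (l + 1) * u = u := by field_simp; ring
    have e2 : 0 ≤ u / (l + 1) := by positivity
    have e3 : l * (u / (l + 1)) + u / (l + 1) = u := by field_simp
    have e4 : z + d ≤ (l - 1) * (z + d) := by nlinarith
    constructor <;> linarith
  · rw [h]
    constructor <;> linarith

set_option maxHeartbeats 1000000 in
/-- If few outside vertices fit into many tiles, then there is a further tile outside. -/
lemma State.exists_tile (hS : State G lev ℓ q D A B s K lo hi ℋ P e)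
    (hA : Good G lev ℓ q μ ν D A) (hℓ : 2 ≤ ℓ) (hq1 : 1 ≤ q) (hβ : 0 ≤ β) (hBA : B ⊆ A)
    (hlo1 : 1 ≤ lo) {ρ ξ ζ δ η : ℝ} (hρ : (#(A \ B) : ℝ) ≤ ρ * #A) (hlo : (K : ℝ) ≤ ξ * lo)
    (hζ : 0 < ζ) (hδ : 0 < δ) (hAne : 0 < #A)
    (hμ1 : ζ + δ ≤ μ - β - ξ - ζ - ρ)
    (hμ2 : 1 / ((ℓ + 1) * q) + ν + 2 * β + ξ + ζ + 2 * ρ ≤ μ) (hη : 3 * (ζ + δ) ≤ η)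
    {U : Finset V} (hUdef : U = B.filter (· ∉ P + (ℋ.map tot).sum)) (hU : η * #A ≤ #U)
    (hsum : ((∑ w ∈ U, Multiset.card ((ℋ.filter fun F => Fits G lev β F w).map tot).sum : ℕ) : ℝ) <
      ζ * ζ * #A * #A)
    (hblow : ∀ Q : List V → Prop, Many U (δ * #U) (ℓ + 1) Q → ∃ F : Fin (ℓ + 1) → Finset V,
      (∀ i, F i ⊆ U ∧ #(F i) = lo + 2) ∧ ∀ x : Fin (ℓ + 1) → V, (∀ i, x i ∈ F i) →
        Q (List.ofFn x)) :
    ∃ F : Fin (ℓ + 1) → Finset V, IsTile G F ∧ (∀ i, F i ⊆ U) ∧ (∀ i, #(F i) = lo + 2) ∧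
      ∀ i : Fin ℓ, ∀ x ∈ F i.castSucc, D x ∧ lev x = q := by
  set n := #A with hn
  have hn0 : (0 : ℝ) < n := by exact_mod_cast hAne
  have hPξ := hS.cost_le hlo1 hlo
  have hUA : U ⊆ A := hUdef ▸ (Finset.filter_subset _ _).trans hBA
  have hUn : (#U : ℝ) ≤ n := by exact_mod_cast Finset.card_le_card hUA
  set X : V → ℕ := fun w => Multiset.card ((ℋ.filter fun F => Fits G lev β F w).map tot).sum
    with hX
  set rest := A.filter (· ∉ P + (ℋ.map tot).sum) with hrest
  have hUrest : U ⊆ rest := hUdef ▸ Finset.filter_subset_filter _ hBA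
  have hrestU : rest ⊆ U ∪ (A \ B) := by
    intro x hx
    have := Finset.mem_filter.1 hx
    by_cases hxB : x ∈ B
    · exact Finset.mem_union_left _ (hUdef ▸ Finset.mem_filter.2 ⟨hxB, this.2⟩)
    · exact Finset.mem_union_right _ (Finset.mem_sdiff.2 ⟨this.1, hxB⟩)
  have hr1 : (#U : ℝ) ≤ #rest := by exact_mod_cast Finset.card_le_card hUrest
  have hr2 : (#rest : ℝ) ≤ #U + ρ * n := by
    have : (#rest : ℝ) ≤ #U + #(A \ B) := by
      exact_mod_cast (Finset.card_le_card hrestU).trans (Finset.card_union_le _ _)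
    linarith
  have hAeq : ∀ w, A.val = P + ((ℋ.filter fun F => Fits G lev β F w).map tot).sum +
      ((ℋ.filter fun F => ¬ Fits G lev β F w).map tot).sum + rest.val := fun w => by
    have h : ((ℋ.filter fun F => Fits G lev β F w).map tot).sum +
        ((ℋ.filter fun F => ¬ Fits G lev β F w).map tot).sum = (ℋ.map tot).sum := by
      rw [← Multiset.sum_add, ← Multiset.map_add, Multiset.filter_add_not]
    rw [add_assoc P, h]
    exact val_eq_add_filter hS.sub
  have hℬ : ∀ w, ∀ F ∈ ℋ.filter fun F => ¬ Fits G lev β F w,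
      (∃ b, ∀ i, #(F i) = b) ∧ ¬ Fits G lev β F w := fun w F hF => by
    rw [Multiset.mem_filter] at hF
    obtain ⟨-, ⟨b, -, -, h⟩, -⟩ := hS.tile F hF.1
    exact ⟨⟨b, h⟩, hF.2⟩
  have hℓ' : (2 : ℝ) ≤ ℓ := by exact_mod_cast hℓ
  have hP0 : (0 : ℝ) ≤ Multiset.card P := Nat.cast_nonneg _
  have hρ0 : 0 ≤ ρ * n := le_trans (Nat.cast_nonneg _) hρ
  have hu0 : (0 : ℝ) ≤ #U := Nat.cast_nonneg _
  -- vertices outside with few available tiles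
  set T : V → Prop := fun w => w ∈ U ∧ lev w = q ∧ (X w : ℝ) < ζ * n with hT
  set d : ℝ := max (#U / (ℓ + 1) - (ζ * n + δ * n)) 0 with hd
  have hTd : ∀ w, T w → (#{u ∈ U | ¬ G.Adj w u} : ℝ) ≤ d := by
    rintro w ⟨hwU, hwl, hwX⟩
    refine le_trans ?_ (le_max_left _ _)
    have h1 := hA.deg_top_left hq1 hβ (hA.sub w (hUA hwU)) hwl (hAeq w) (hℬ w)
    rw [countP_val, Finset.card_val] at h1
    have h2 : (#{u ∈ rest | G.Adj w u} : ℝ) ≤ #{u ∈ U | G.Adj w u} + #(A \ B) := by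
      norm_cast
      refine le_trans (Finset.card_le_card ?_) (Finset.card_union_le _ _)
      intro u hu
      have := Finset.mem_filter.1 hu
      rcases Finset.mem_union.1 (hrestU this.1) with h | h
      · exact Finset.mem_union_left _ (Finset.mem_filter.2 ⟨h, this.2⟩)
      · exact Finset.mem_union_right _ h
    have h3 : (#{u ∈ U | G.Adj w u} : ℝ) + #{u ∈ U | ¬ G.Adj w u} = #U := by
      exact_mod_cast Finset.card_filter_add_card_filter_not (s := U) (fun u => G.Adj w u)
    have h4 : (ℓ : ℝ) / (ℓ + 1) * #U ≤ ℓ / (ℓ + 1) * #rest := by gcongr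
    have h5 : (ℓ : ℝ) / (ℓ + 1) * #U + #U / (ℓ + 1) = #U := by field_simp
    have h6 := mul_le_mul_of_nonneg_right hμ1 hn0.le
    linarith
  have hL : (#{w ∈ U | ¬ T w} : ℝ) ≤ 2 / (ℓ + 1) * #U + ζ * n := by
    have h1 : #{w ∈ U | ¬ T w} ≤
        #{w ∈ U | lev w < q ∧ (X w : ℝ) < ζ * n} + #{w ∈ U | ¬ (X w : ℝ) < ζ * n} := by
      refine le_trans (Finset.card_le_card ?_) (Finset.card_union_le _ _)
      intro u hu
      have h := Finset.mem_filter.1 hu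
      have hlu := hA.lev_le u
      simp only [Finset.mem_union, Finset.mem_filter, hT] at h ⊢
      by_cases hx : (X u : ℝ) < ζ * n
      · exact Or.inl ⟨h.1, lt_of_le_of_ne hlu fun hl => h.2 ⟨h.1, hl, hx⟩, hx⟩
      · exact Or.inr ⟨h.1, hx⟩
    have h2 : (#{w ∈ U | ¬ (X w : ℝ) < ζ * n} : ℝ) ≤ ζ * n := by
      have h3 : #{w ∈ U | ¬ (X w : ℝ) < ζ * n} • (ζ * n) ≤
          ∑ w ∈ {w ∈ U | ¬ (X w : ℝ) < ζ * n}, (X w : ℝ) :=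
        Finset.card_nsmul_le_sum _ _ _ fun w hw => not_lt.1 (Finset.mem_filter.1 hw).2
      have h4 : ∑ w ∈ {w ∈ U | ¬ (X w : ℝ) < ζ * n}, (X w : ℝ) ≤ ∑ w ∈ U, (X w : ℝ) :=
        Finset.sum_le_sum_of_subset_of_nonneg (Finset.filter_subset _ _)
          fun _ _ _ => Nat.cast_nonneg _
      rw [nsmul_eq_mul] at h3
      push_cast at hsum
      have h5 : (#{w ∈ U | ¬ (X w : ℝ) < ζ * n} : ℝ) * (ζ * n) ≤ ζ * n * (ζ * n) := by linarith
      exact le_of_mul_le_mul_right h5 (by positivity)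
    have h3 : (#{w ∈ U | lev w < q ∧ (X w : ℝ) < ζ * n} : ℝ) ≤ 2 / (ℓ + 1) * #U := by
      rcases Finset.eq_empty_or_nonempty {w ∈ U | lev w < q ∧ (X w : ℝ) < ζ * n} with h0 | h0
      · rw [h0]
        simp only [Finset.card_empty, Nat.cast_zero]
        positivity
      · obtain ⟨w, hw, hmax⟩ := Finset.exists_max_image _ lev h0
        obtain ⟨hwU, hwl, hwX⟩ := Finset.mem_filter.1 hw
        have h4 := hA.deg_low_left (by omega) hβ (hA.sub w (hUA hwU)) hwl (hAeq w) (hℬ w)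
        rw [countP_val, countP_val, Finset.card_val] at h4
        have h5 : (#{u ∈ rest | G.Adj w u} : ℝ) ≤ #rest := by
          exact_mod_cast Finset.card_filter_le _ _
        have h6 : (#{w ∈ U | lev w < q ∧ (X w : ℝ) < ζ * n} : ℝ) ≤
            #{u ∈ rest | lev u ≤ lev w} := by
          norm_cast
          refine Finset.card_le_card fun u hu => ?_
          exact Finset.mem_filter.2 ⟨hUrest (Finset.mem_filter.1 hu).1, hmax u hu⟩
        have h7 : (ℓ - 1 : ℝ) / (ℓ + 1) * #rest + 2 / (ℓ + 1) * #rest = #rest := by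
          field_simp; ring
        have h8 : 2 / (ℓ + 1) * (#rest : ℝ) ≤ 2 / (ℓ + 1) * #U + 2 * (ρ * n) := by
          have : 2 / (ℓ + 1 : ℝ) ≤ 2 := by
            rw [div_le_iff₀ (by positivity)]; linarith
          have h9 : 2 / (ℓ + 1) * (#rest : ℝ) ≤ 2 / (ℓ + 1) * (#U + ρ * n) := by gcongr
          nlinarith
        have h9 := mul_le_mul_of_nonneg_right hμ2 hn0.le
        linarith
    have h1' : (#{w ∈ U | ¬ T w} : ℝ) ≤
        #{w ∈ U | lev w < q ∧ (X w : ℝ) < ζ * n} + #{w ∈ U | ¬ (X w : ℝ) < ζ * n} := by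
      exact_mod_cast h1
    linarith
  have hd0 : 0 ≤ d := le_max_right _ _
  have hdel : δ * #U ≤ δ * n := by gcongr
  have hηn : 3 * (ζ + δ) * n ≤ #U := (mul_le_mul_of_nonneg_right hη hn0.le).trans hU
  have hU3 : 2 / (ℓ + 1) * (#U : ℝ) ≤ 2 / 3 * #U := by
    gcongr; linarith
  have hℓd : (ℓ - 1) * d + 2 / (ℓ + 1) * #U + ζ * n + δ * #U ≤ #U ∧ ℓ * d + δ * #U ≤ #U :=
    clique_budget hℓ' hu0 (by positivity) (by positivity) hU3 (by linarith) hdel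
  have hmany : Many U (δ * #U) (ℓ + 1) fun l => ∃ l' v, l = l' ++ [v] ∧ l'.length = ℓ ∧
      (∀ u ∈ l', T u) ∧ l.Pairwise G.Adj := by
    refine (many_clique_of (θ := δ * #U) (L := 2 / (ℓ + 1) * #U + ζ * n) hd0 hTd (by convert hL)
      ℓ [] (by simp) fun _ => ?_).mem.bind ?_
    · rw [List.length_nil]
      push_cast
      linarith [hℓd.1]
    · rintro l ⟨⟨h1, -, h3⟩, hlen, -⟩
      refine (many_common hTd l h1 (θ := δ * #U) (by rw [hlen]; exact hℓd.2)).mono ?_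
      rintro _ ⟨v, rfl, hv⟩
      refine ⟨l, v, rfl, hlen, h1, List.pairwise_append.2 ⟨h3, by simp, ?_⟩⟩
      intro a ha b hb
      rw [List.mem_singleton.1 hb]
      exact hv a ha
  obtain ⟨F, hF, hFx⟩ := hblow _ hmany
  have hne : ∀ i, (F i).Nonempty := fun i => by
    rw [← Finset.card_pos, (hF i).2]; omega
  refine ⟨F, isTile_of_pairwise hne fun x hx => ?_, fun i => (hF i).1, fun i => (hF i).2, ?_⟩
  · obtain ⟨_, _, -, -, -, h⟩ := hFx x hx
    exact h
  · intro i x hx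
    choose z hz using hne
    obtain ⟨l', v, hl, hlen, hT', -⟩ := hFx (Function.update z i.castSucc x) (fun p => by
      by_cases hp : p = i.castSucc
      · subst hp; simpa using hx
      · rw [Function.update_of_ne hp]; exact hz p)
    rw [List.ofFn_succ', List.concat_eq_append] at hl
    have h1 := (List.append_inj hl (by rw [List.length_ofFn, hlen])).1
    have h2 := hT' (Function.update z i.castSucc x i.castSucc) (by
      rw [← h1]
      exact (List.mem_ofFn' _ _).2 ⟨i, rfl⟩)
    rw [Function.update_self] at h2
    exact ⟨hA.sub x (hUA h2.1), h2.2.1⟩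

end tile

section tile
open Classical

variable {V : Type} {ℓ : ℕ} {G : SimpleGraph V} {lev : V → ℕ} {q : ℕ} {β μ ν : ℝ} {D : V → Prop}
  {A B : Finset V} {s e : List V} {K lo hi : ℕ} {ℋ : Multiset (Fin (ℓ + 1) → Finset V)}
  {P : Multiset V}

/-- The potential of a partial cover. -/
def pot (lev : V → ℕ) (q : ℕ) (ℋ : Multiset (Fin (ℓ + 1) → Finset V)) (P : Multiset V) : ℕ :=
  ((P + (ℋ.map tot).sum).map fun v => 2 * q - lev v).sum

lemma State.pot_le (hS : State G lev ℓ q D A B s K lo hi ℋ P e) : pot lev q ℋ P ≤ 2 * q * #A := by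
  have h1 : pot lev q ℋ P ≤ Multiset.card ((P + (ℋ.map tot).sum).map fun v => 2 * q - lev v) •
      (2 * q) := by
    refine Multiset.sum_le_card_nsmul _ _ fun x hx => ?_
    obtain ⟨v, -, rfl⟩ := Multiset.mem_map.1 hx
    omega
  rw [Multiset.card_map, smul_eq_mul] at h1
  have h2 := Multiset.card_le_card hS.sub
  rw [Finset.card_val] at h2
  calc _ ≤ _ := h1
    _ ≤ #A * (2 * q) := Nat.mul_le_mul_right _ h2
    _ = _ := by ring

/-- The vertices of the tile region not yet covered. -/
noncomputable def uncov (B : Finset V) (ℋ : Multiset (Fin (ℓ + 1) → Finset V)) (P : Multiset V) : Finset V :=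
  B.filter (· ∉ P + (ℋ.map tot).sum)

lemma state_init (hs : s.length = ℓ) (hsp : IsPow G (ℓ + 1) s) (hsT : ∀ v ∈ s, D v ∧ lev v = q) :
    State G lev ℓ q D A B s K lo hi 0 0 s where
  ctx := ctx_list (Q := PathTo G ℓ s s) (l := []) ⟨by simpa using hsp, [], by simp⟩
  len := hs
  pow := hsp
  top := hsT
  sub := by simp
  tile := by simp
  cost := by simp

lemma exists_almost_cover (hA : Good G lev ℓ q μ ν D A) (hℓ : 2 ≤ ℓ) (hq1 : 1 ≤ q) (hβ : 0 ≤ β)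
    (hBA : B ⊆ A) {ρ ξ ζ δ η : ℝ} (hρ : (#(A \ B) : ℝ) ≤ ρ * #A)
    (hζ : 0 < ζ) (hδ : 0 < δ) (hAne : 0 < #A) (hξ : 0 ≤ ξ)
    (hμ1 : ζ + δ ≤ μ - β - ξ - ζ - ρ)
    (hμ2 : 1 / ((ℓ + 1) * q) + ν + 2 * β + ξ + ζ + 2 * ρ ≤ μ) (hη : 3 * (ζ + δ) ≤ η)
    {M b₀ R L : ℕ} (hM : 1 ≤ M) (hβM : 2 * (ℓ + 1) ≤ β * M) (hMζ : 4 ≤ M * (ζ * ζ))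
    (hMb : M ≤ b₀) (hβb : 4 * (ℓ + 1) ≤ β * b₀) (hKb : ((L + 2 * ℓ + 2 : ℕ) : ℝ) ≤ ξ * b₀)
    (hR : 2 * q * (4 * M * (ℓ + 1)) < R * (ζ * ζ))
    (hAl : 4 * ((((ℓ + 2) * 2 ^ ((ℓ + 1) * (b₀ * M ^ R)) * (b₀ * M ^ R * (ℓ + 1)) : ℕ) : ℝ) + 1) ≤
      ζ * ζ * #A)
    (hblow : ∀ b ≤ b₀ * M ^ R, ∀ U : Finset V, η * #A ≤ #U → ∀ Q : List V → Prop,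
      Many U (δ * #U) (ℓ + 1) Q → ∃ F : Fin (ℓ + 1) → Finset V,
        (∀ i, F i ⊆ U ∧ #(F i) = b + 2) ∧ ∀ x : Fin (ℓ + 1) → V, (∀ i, x i ∈ F i) →
          Q (List.ofFn x))
    (hconn : ∀ P : Multiset V, (Multiset.card P : ℝ) ≤ ξ * #A → ∀ e e' : List V,
      e.length = ℓ → IsPow G (ℓ + 1) e → (∀ v ∈ e, D v ∧ lev v = q) →
      e'.length = ℓ → IsPow G (ℓ + 1) e' → (∀ v ∈ e', D v ∧ lev v = q) →
      ∃ l : List V, (∀ v ∈ l, v ∈ A \ B ∧ v ∉ P) ∧ l.Nodup ∧ l.length = L ∧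
        IsPow G (ℓ + 1) (e ++ l ++ e'))
    (hs : s.length = ℓ) (hsp : IsPow G (ℓ + 1) s) (hsT : ∀ v ∈ s, D v ∧ lev v = q) :
    ∃ ℋ P e, State G lev ℓ q D A B s (L + 2 * ℓ + 2) b₀ (b₀ * M ^ R) ℋ P e ∧
      (#(uncov B ℋ P) : ℝ) < η * #A := by
  set n := #A with hn
  set hi := b₀ * M ^ R with hhi
  have hn0 : (0 : ℝ) < n := by exact_mod_cast hAne
  have hb1 : 1 ≤ b₀ := hM.trans hMb
  by_contra! H
  have hlev : ∀ j ≤ R, ∃ ℋ P e, State G lev ℓ q D A B s (L + 2 * ℓ + 2) (b₀ * M ^ (R - j)) hi ℋ P e ∧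
      j * (ζ * ζ * n) ≤ 4 * M * (ℓ + 1) * pot lev q ℋ P := by
    intro j
    induction j with
    | zero => exact fun _ => ⟨0, 0, s, state_init hs hsp hsT, by simp only [Nat.cast_zero, zero_mul]; positivity⟩
    | succ j ih =>
      intro hj
      obtain ⟨ℋ₀, P₀, e₀, hS₀, hp₀⟩ := ih (by omega)
      set lo := b₀ * M ^ (R - j) with hlo
      have hblo : b₀ ≤ lo := Nat.le_mul_of_pos_right _ (by positivity)
      have hlohi : lo ≤ hi := Nat.mul_le_mul_left _ (Nat.pow_le_pow_right hM (by omega))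
      have hbloR : (b₀ : ℝ) ≤ lo := by exact_mod_cast hblo
      set S : Set ℕ := {x | ∃ ℋ P e, State G lev ℓ q D A B s (L + 2 * ℓ + 2) lo hi ℋ P e ∧
        pot lev q ℋ P = x} with hSdef
      have hSb : BddAbove S := ⟨2 * q * #A, by
        rintro _ ⟨ℋ, P, e, h, rfl⟩
        exact h.pot_le⟩
      have hSne : S.Nonempty := ⟨_, ℋ₀, P₀, e₀, hS₀, rfl⟩
      obtain ⟨ℋ, P, e, hS, hpot⟩ := Nat.sSup_mem hSne hSb
      have hmax : ∀ ℋ' P' e', State G lev ℓ q D A B s (L + 2 * ℓ + 2) lo hi ℋ' P' e' →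
          pot lev q ℋ' P' ≤ pot lev q ℋ P := fun ℋ' P' e' h => by
        rw [hpot]
        exact le_csSup hSb ⟨ℋ', P', e', h, rfl⟩
      have hU := H ℋ P e (hS.mono hblo)
      have hβlo : β * b₀ ≤ β * lo := by gcongr
      have hξlo : ξ * b₀ ≤ ξ * lo := by gcongr
      rcases lt_or_ge ((∑ w ∈ uncov B ℋ P,
          Multiset.card ((ℋ.filter fun F => Fits G lev β F w).map tot).sum : ℕ) : ℝ)
          (ζ * ζ * n * n) with hlt | hge
      · exfalso
        obtain ⟨F, hF1, hF2, hF3, hF4⟩ := hS.exists_tile hA hℓ hq1 hβ hBA (hb1.trans hblo) hρ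
          (hKb.trans hξlo) hζ hδ hAne hμ1 hμ2 hη (U := uncov B ℋ P) rfl hU hlt
          (hblow lo hlohi _ hU)
        obtain ⟨ℋ', P', e', hS', hlt'⟩ := hS.extend hBA hA.lev_le hq1 hlohi hF1 hF2 hF3 hF4
          (hconn P (hS.cost_le (hb1.trans hblo) (hKb.trans hξlo)) e · hS.len hS.pow hS.top)
          (by omega)
        exact absurd (hmax _ _ _ hS') (not_le.2 hlt')
      · obtain ⟨ℋ', P', g, hS', h1, h2⟩ := hS.improve hBA (by omega) hA.lev_le hq1 hM
          (hMb.trans hblo) hβM (hβb.trans hβlo) (by omega) hMζ hAl hge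
        have elo : lo / M = b₀ * M ^ (R - (j + 1)) := by
          rw [hlo, show R - j = R - (j + 1) + 1 by omega, pow_succ, ← mul_assoc,
            Nat.mul_div_cancel _ hM]
        rw [elo] at hS'
        refine ⟨ℋ', P', e, hS', ?_⟩
        have h3 : pot lev q ℋ₀ P₀ ≤ pot lev q ℋ P := hmax _ _ _ hS₀
        have h4 : (pot lev q ℋ₀ P₀ + g : ℝ) ≤ pot lev q ℋ' P' := by
          exact_mod_cast (Nat.add_le_add_right h3 g).trans h1
        calc ((j + 1 : ℕ) : ℝ) * (ζ * ζ * n) = j * (ζ * ζ * n) + ζ * ζ * n := by push_cast; ring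
          _ ≤ 4 * M * (ℓ + 1) * pot lev q ℋ₀ P₀ + 4 * M * (ℓ + 1) * g := add_le_add hp₀ h2
          _ = 4 * M * (ℓ + 1) * (pot lev q ℋ₀ P₀ + g) := by ring
          _ ≤ _ := by gcongr
  obtain ⟨ℋ, P, e, hS, hp⟩ := hlev R le_rfl
  have h1 : (pot lev q ℋ P : ℝ) ≤ 2 * q * n := by exact_mod_cast hS.pot_le
  have h2 : 4 * M * (ℓ + 1) * (pot lev q ℋ P : ℝ) ≤ 4 * M * (ℓ + 1) * (2 * q * n) := by gcongr
  have h3 := mul_lt_mul_of_pos_right hR hn0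
  linarith

/-- Connecting two cliques of top vertices through the unused part of a good reservoir. -/
lemma Good.connect {Rv : Finset V} {μ' ν' μc τ : ℝ} {n₀ L : ℕ} (hℓ : 2 ≤ ℓ) (hq1 : 1 ≤ q)
    (hR : Good G lev ℓ q μ' ν' D Rv) (hτ : 0 ≤ τ) (hμc : 0 ≤ μc) (hμc1 : μc ≤ 1)
    (h1 : μc + τ ≤ μ') (h2 : ν' + 2 * τ ≤ μc)
    (hconn : ∀ (T : V → Prop) (R : Finset V), n₀ ≤ #R →
      (∀ v, T v → (#{u ∈ R | ¬G.Adj v u} : ℝ) ≤ (1 / (ℓ + 1) - μc) * #R) →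
      (#{u ∈ R | ¬T u} : ℝ) ≤ (1 / (ℓ + 1) + μc) * #R →
      ∀ a e : List V, IsPow G (ℓ + 1) a → IsPow G (ℓ + 1) e → a.length = ℓ → e.length = ℓ →
        (∀ v ∈ a, T v) → (∀ v ∈ e, T v) →
        ∃ l : List V, (∀ v ∈ l, v ∈ R) ∧ l.Nodup ∧ l.length = L ∧ IsPow G (ℓ + 1) (a ++ l ++ e))
    (P : Multiset V) (hP : (Multiset.card P : ℝ) ≤ τ * #Rv) (hn₀ : n₀ ≤ (1 - τ) * #Rv)
    (e e' : List V) (he : e.length = ℓ) (hep : IsPow G (ℓ + 1) e) (heT : ∀ v ∈ e, D v ∧ lev v = q)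
    (he' : e'.length = ℓ) (hep' : IsPow G (ℓ + 1) e') (heT' : ∀ v ∈ e', D v ∧ lev v = q) :
    ∃ l : List V, (∀ v ∈ l, v ∈ Rv ∧ v ∉ P) ∧ l.Nodup ∧ l.length = L ∧
      IsPow G (ℓ + 1) (e ++ l ++ e') := by
  set R' := Rv.filter (· ∉ P) with hR'
  have hc1 : (#Rv : ℝ) ≤ #R' + τ * #Rv := by
    have h3 : #Rv ≤ #R' + #P.toFinset := by
      refine le_trans (Finset.card_le_card fun x hx => ?_) (Finset.card_union_le _ _)
      by_cases hxP : x ∈ P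
      · exact Finset.mem_union_right _ (Multiset.mem_toFinset.2 hxP)
      · exact Finset.mem_union_left _ (Finset.mem_filter.2 ⟨hx, hxP⟩)
    have h4 : (#Rv : ℝ) ≤ #R' + Multiset.card P := by
      exact_mod_cast h3.trans (Nat.add_le_add_left (Multiset.toFinset_card_le _) _)
    linarith
  have hc2 : (#R' : ℝ) ≤ #Rv := by exact_mod_cast Finset.card_filter_le _ _
  have hr0 : (0 : ℝ) ≤ #Rv := Nat.cast_nonneg _
  have hr0' : (0 : ℝ) ≤ #R' := Nat.cast_nonneg _
  have hτr : 0 ≤ τ * #Rv := by positivity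
  have hℓ0 : (0 : ℝ) ≤ 1 / (ℓ + 1) := by positivity
  have hℓ1 : (1 : ℝ) / (ℓ + 1) ≤ 1 := by
    rw [div_le_one (by positivity)]
    linarith [(Nat.cast_nonneg ℓ : (0 : ℝ) ≤ ℓ)]
  have e1 := mul_le_mul_of_nonneg_right h1 hr0
  have e2 := mul_le_mul_of_nonneg_right h2 hr0
  have e3 := mul_le_mul_of_nonneg_right hℓ1 hτr
  have e4 := mul_le_mul_of_nonneg_right hμc1 hτr
  have e5 := mul_le_mul_of_nonneg_left hc1 hℓ0
  have e6 := mul_le_mul_of_nonneg_left hc1 hμc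
  have e7 := mul_le_mul_of_nonneg_left hc2 hμc
  have hT1 : ∀ v, D v ∧ lev v = q → (#{u ∈ R' | ¬G.Adj v u} : ℝ) ≤ (1 / (ℓ + 1) - μc) * #R' := by
    intro v hv
    have h3 := hR.deg_top hq1 hv.1 hv.2
    have h4 : (#{u ∈ Rv | G.Adj v u} : ℝ) + #{u ∈ Rv | ¬ G.Adj v u} = #Rv := by
      exact_mod_cast Finset.card_filter_add_card_filter_not (s := Rv) (fun u => G.Adj v u)
    have h5 : (#{u ∈ R' | ¬ G.Adj v u} : ℝ) ≤ #{u ∈ Rv | ¬ G.Adj v u} := by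
      exact_mod_cast Finset.card_le_card (Finset.filter_subset_filter _ (Finset.filter_subset _ _))
    have h6 : (ℓ : ℝ) / (ℓ + 1) * #Rv + 1 / (ℓ + 1) * #Rv = #Rv := by field_simp
    linarith
  have hT2 : (#{u ∈ R' | ¬(D u ∧ lev u = q)} : ℝ) ≤ (1 / (ℓ + 1) + μc) * #R' := by
    have h3 := hR.low q le_rfl
    have h4 : (#{u ∈ R' | ¬ (D u ∧ lev u = q)} : ℝ) ≤ #{u ∈ Rv | lev u < q} := by
      norm_cast
      refine Finset.card_le_card fun u hu => ?_
      have hu' := Finset.mem_filter.1 hu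
      have hu1 := (Finset.mem_filter.1 hu'.1).1
      exact Finset.mem_filter.2 ⟨hu1, lt_of_le_of_ne (hR.lev_le u) fun h => hu'.2 ⟨hR.sub u hu1, h⟩⟩
    have h5 : (q : ℝ) / ((ℓ + 1) * q) = 1 / (ℓ + 1) := by
      have : (q : ℝ) ≠ 0 := by positivity
      field_simp
    rw [h5] at h3
    linarith
  obtain ⟨l, hl, hl'⟩ := hconn (fun v => D v ∧ lev v = q) R'
    (by exact_mod_cast (show (n₀ : ℝ) ≤ #R' by linarith)) hT1 (by convert hT2) e e' hep hep' he he'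
    heT heT'
  exact ⟨l, fun v hv => Finset.mem_filter.1 (hl v hv), hl'⟩

end tile

section tile
open Classical

set_option maxHeartbeats 2000000 in
/-- A vertex set with the robust degree condition, together with a reservoir inside it, is covered
by an `ℓ`th power of a path between two given cliques of top vertices. -/
theorem exists_path_of_reservoir {ℓ q : ℕ} (hℓ : 2 ≤ ℓ) (hq1 : 1 ≤ q) {μ ν ρ : ℝ} (hμ : 0 < μ)
    (hμ1 : μ ≤ 1) (hq : 1 / ((ℓ + 1) * q) ≤ μ / 32) (hν : ν ≤ μ / 32) (hρ0 : 0 < ρ)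
    (hρ : ρ ≤ μ / (48 * (ℓ + 1) * (q + 1))) :
    ∃ m₀ : ℕ, ∀ (V : Type) (G : SimpleGraph V) (lev : V → ℕ) (D : V → Prop) (A Rv : Finset V)
      (s t : List V), m₀ ≤ #A → Good G lev ℓ q μ ν D A → Rv ⊆ A →
      Good G lev ℓ q (μ / 2) (μ / 16) D Rv → ρ / 4 * #A ≤ #Rv → #Rv ≤ ρ * #A →
      s.length = ℓ → IsPow G (ℓ + 1) s → (∀ v ∈ s, D v ∧ lev v = q) →
      t.length = ℓ → IsPow G (ℓ + 1) t → (∀ v ∈ t, D v ∧ lev v = q) →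
      ∃ ω : List V, IsPow G (ℓ + 1) (s ++ ω ++ t) ∧ (ω : Multiset V) = A.val := by
  obtain ⟨n₀, L, hcon⟩ := exists_connection ℓ hℓ (μ := μ / 4) (by linarith)
  have hℓ' : (2 : ℝ) ≤ ℓ := by exact_mod_cast hℓ
  have hq' : (1 : ℝ) ≤ q := by exact_mod_cast hq1
  set η : ℝ := μ / (48 * (ℓ + 1) * (q + 1)) with hη
  have hη0 : 0 < η := by positivity
  have hη1 : 3 * (ℓ + 1) * (q + 1) * η = μ / 16 := by rw [hη]; field_simp; norm_num
  have hη2 : η ≤ μ / 288 := by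
    rw [hη]
    gcongr
    nlinarith
  set ζ := η / 6 with hζ
  set ξ := μ / 64 * ρ with hξ
  have hξ1 : ξ ≤ ρ / 64 := by
    have : μ * ρ ≤ 1 * ρ := by gcongr
    rw [hξ]; linarith
  have hξ2 : 0 < ξ := by positivity
  obtain ⟨bm, hbm⟩ := exists_nat_ge (4 + 3 / (μ / 64))
  have hbm4 : 4 ≤ bm := by
    have : (4 : ℝ) ≤ bm := le_trans (by simp; positivity) hbm
    exact_mod_cast this
  have hbm3 : 3 ≤ μ / 64 * bm := by
    have : 3 / (μ / 64) ≤ bm := by linarith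
    rwa [div_le_iff₀' (by positivity)] at this
  obtain ⟨M, hM⟩ := exists_nat_ge (1 + 2 * (ℓ + 1) / (μ / 64) + 4 / (ζ * ζ))
  have hM1 : 1 ≤ M := by
    have h1 : (0 : ℝ) ≤ 2 * (ℓ + 1) / (μ / 64) := by positivity
    have h2 : (0 : ℝ) ≤ 4 / (ζ * ζ) := by positivity
    have : (1 : ℝ) ≤ M := by linarith
    exact_mod_cast this
  have hβM : 2 * (ℓ + 1) ≤ μ / 64 * M := by
    have h2 : (0 : ℝ) ≤ 4 / (ζ * ζ) := by positivity
    have : 2 * (ℓ + 1) / (μ / 64) ≤ M := by linarith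
    rwa [div_le_iff₀' (by positivity)] at this
  have hMζ : 4 ≤ M * (ζ * ζ) := by
    have h1 : (0 : ℝ) ≤ 2 * (ℓ + 1) / (μ / 64) := by positivity
    have : 4 / (ζ * ζ) ≤ M := by linarith
    rwa [div_le_iff₀ (by positivity)] at this
  obtain ⟨b₀, hb₀⟩ := exists_nat_ge
    (M + 4 * (ℓ + 1) / (μ / 64) + ((L + 2 * ℓ + 2 : ℕ) : ℝ) / ξ + 16 * bm / μ)
  have hp1 : (0 : ℝ) ≤ 4 * (ℓ + 1) / (μ / 64) := by positivity
  have hp2 : (0 : ℝ) ≤ ((L + 2 * ℓ + 2 : ℕ) : ℝ) / ξ := by positivity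
  have hp3 : (0 : ℝ) ≤ 16 * bm / μ := by positivity
  have hp4 : (0 : ℝ) ≤ M := Nat.cast_nonneg _
  have hMb : M ≤ b₀ := by
    have : (M : ℝ) ≤ b₀ := by linarith
    exact_mod_cast this
  have hβb : 4 * (ℓ + 1) ≤ μ / 64 * b₀ := by
    have : 4 * (ℓ + 1) / (μ / 64) ≤ b₀ := by linarith
    rwa [div_le_iff₀' (by positivity)] at this
  have hKb : ((L + 2 * ℓ + 2 : ℕ) : ℝ) ≤ ξ * b₀ := by
    have : ((L + 2 * ℓ + 2 : ℕ) : ℝ) / ξ ≤ b₀ := by linarith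
    rwa [div_le_iff₀' (by positivity)] at this
  have hbmb : (bm : ℝ) ≤ μ / 16 * b₀ := by
    have : 16 * bm / μ ≤ b₀ := by linarith
    rw [div_le_iff₀' (by positivity)] at this
    linarith
  obtain ⟨R, hR⟩ := exists_nat_gt (2 * q * (4 * M * (ℓ + 1)) / (ζ * ζ) : ℝ)
  rw [div_lt_iff₀ (by positivity)] at hR
  choose nb hnb using fun b => exists_blowup_many (ℓ + 1) (b + 2) (δ := ζ) (by positivity) Unit
  set hi := b₀ * M ^ R with hhi
  set C : ℝ := 4 * ((((ℓ + 2) * 2 ^ ((ℓ + 1) * hi) * (hi * (ℓ + 1)) : ℕ) : ℝ) + 1) with hC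
  have hC0 : 0 ≤ C := by positivity
  set N := ∑ b ∈ Finset.range (hi + 1), nb b with hN
  obtain ⟨m₀, hm₀⟩ := exists_nat_ge (1 + C / (ζ * ζ) + N / η + L / (μ / 16) + n₀ / (ρ / 8))
  refine ⟨m₀, fun V G lev D A Rv s t hm hA hRA hRv hR1 hR2 hs hsp hsT ht htp htT => ?_⟩
  set n := #A with hn
  have hnm : (m₀ : ℝ) ≤ n := by exact_mod_cast hm
  have hd1 : 0 ≤ C / (ζ * ζ) := by positivity
  have hd2 : 0 ≤ N / η := by positivity
  have hd3 : 0 ≤ L / (μ / 16) := by positivity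
  have hd4 : 0 ≤ n₀ / (ρ / 8) := by positivity
  have hn1 : (1 : ℝ) ≤ n := by linarith
  have hnC : C ≤ ζ * ζ * n := by
    have : C / (ζ * ζ) ≤ n := by linarith
    rwa [div_le_iff₀' (by positivity)] at this
  have hnN : N ≤ η * n := by
    have : N / η ≤ n := by linarith
    rwa [div_le_iff₀' (by positivity)] at this
  have hnL : L ≤ μ / 16 * n := by
    have : L / (μ / 16) ≤ n := by linarith
    rwa [div_le_iff₀' (by positivity)] at this
  have hnn : n₀ ≤ ρ / 8 * n := by
    have : n₀ / (ρ / 8) ≤ n := by linarith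
    rwa [div_le_iff₀' (by positivity)] at this
  have hAB : A \ (A \ Rv) = Rv := Finset.sdiff_sdiff_eq_self hRA
  have hξR : ξ * n ≤ μ / 16 * #Rv := by
    rw [hξ]
    calc μ / 64 * ρ * n = μ / 16 * (ρ / 4 * n) := by ring
      _ ≤ _ := by gcongr
  have hconn : ∀ P : Multiset V, (Multiset.card P : ℝ) ≤ ξ * #A → ∀ e e' : List V,
      e.length = ℓ → IsPow G (ℓ + 1) e → (∀ v ∈ e, D v ∧ lev v = q) →
      e'.length = ℓ → IsPow G (ℓ + 1) e' → (∀ v ∈ e', D v ∧ lev v = q) →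
      ∃ l : List V, (∀ v ∈ l, v ∈ A \ (A \ Rv) ∧ v ∉ P) ∧ l.Nodup ∧ l.length = L ∧
        IsPow G (ℓ + 1) (e ++ l ++ e') := by
    intro P hP e e' he hep heT he' hep' heT'
    rw [hAB]
    refine hRv.connect (μc := μ / 4) (τ := μ / 16) (n₀ := n₀) hℓ hq1 (by linarith) (by linarith)
      (by linarith) (by linarith) (by linarith) (fun T R h1 h2 h3 => ?_) P (hP.trans hξR) ?_ e e' he
      hep heT he' hep' heT'
    · exact hcon V G T R h1 (by convert h2) (by convert h3)
    · have h1 : (1 - μ / 16) * (ρ / 4 * n) ≤ (1 - μ / 16) * #Rv := by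
        gcongr
        linarith
      have h2 : μ * (ρ * n) ≤ 1 * (ρ * n) := by gcongr
      linarith
  have hμρ : ρ ≤ μ / 288 := hρ.trans hη2
  obtain ⟨ℋ, P, e, hS, hU⟩ := exists_almost_cover (β := μ / 64) (B := A \ Rv) (ρ := ρ) (ξ := ξ)
    (ζ := ζ) (δ := ζ) (η := η) (M := M) (b₀ := b₀) (R := R) (L := L) (s := s) hA hℓ hq1
    (by linarith) Finset.sdiff_subset (by rw [hAB]; exact hR2) (by positivity) (by positivity)
    (by exact_mod_cast hn1) hξ2.le (by linarith) (by linarith) (by linarith) hM1 hβM hMζ hMb hβb hKb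
    hR hnC (fun b hb U hU Q hQ => by
      obtain ⟨-, F, h1, h2⟩ := hnb b V U (fun _ => Q) (by
        have h1 : nb b ≤ N := Finset.single_le_sum (f := nb) (fun _ _ => Nat.zero_le _)
          (Finset.mem_range.2 (Nat.lt_succ_of_le hb))
        have h2 : (nb b : ℝ) ≤ N := by exact_mod_cast h1
        exact_mod_cast (h2.trans hnN).trans hU) (hQ.mono fun l hl => ⟨(), hl⟩)
      exact ⟨F, h1, h2⟩) hconn hs hsp hsT
  have hb1 : 1 ≤ b₀ := hM1.trans hMb
  have hPξ := hS.cost_le hb1 hKb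
  obtain ⟨l, hl1, hl2, hl3, hl4⟩ := hconn P hPξ e t hS.len hS.pow hS.top ht htp htT
  rw [hAB] at hl1
  have hctx := ctx_finish hS.ctx hS.len hl4
  set rest := A.filter (· ∉ P + (ℋ.map tot).sum) with hrest
  have hlr : (l : Multiset V) ≤ rest.val := by
    refine (Multiset.le_iff_subset (Multiset.coe_nodup.2 hl2)).2 fun v hv => ?_
    have h1 := hl1 v (Multiset.mem_coe.1 hv)
    refine Finset.mem_filter.2 ⟨hRA h1.1, fun h => ?_⟩
    rcases Multiset.mem_add.1 h with h | h
    · exact h1.2 h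
    · obtain ⟨X, hX, hvX⟩ := Multiset.mem_join.1 h
      obtain ⟨F, hF, rfl⟩ := Multiset.mem_map.1 hX
      obtain ⟨i, hi⟩ := mem_tot.1 hvX
      exact (Finset.mem_sdiff.1 ((hS.tile F hF).2.2 i hi)).2 h1.1
  have hrc : (#rest : ℝ) ≤ η * n + ρ * n := by
    have h1 : #rest ≤ #(uncov (A \ Rv) ℋ P) + #Rv := by
      refine le_trans (Finset.card_le_card fun x hx => ?_) (Finset.card_union_le _ _)
      have hx' := Finset.mem_filter.1 hx
      by_cases hxR : x ∈ Rv
      · exact Finset.mem_union_right _ hxR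
      · exact Finset.mem_union_left _
          (Finset.mem_filter.2 ⟨Finset.mem_sdiff.2 ⟨hx'.1, hxR⟩, hx'.2⟩)
    have h2 : (#rest : ℝ) ≤ #(uncov (A \ Rv) ℋ P) + #Rv := by exact_mod_cast h1
    linarith
  have hUc : Multiset.card (rest.val - (l : Multiset V)) ≤ #rest := by
    rw [← Finset.card_val]; exact Multiset.card_le_card tsub_le_self
  have hpot : ((rest.val - (l : Multiset V)).map fun v => q + 1 - lev v).sum ≤ #rest * (q + 1) := by
    have h1 : ((rest.val - (l : Multiset V)).map fun v => q + 1 - lev v).sum ≤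
        Multiset.card ((rest.val - (l : Multiset V)).map fun v => q + 1 - lev v) • (q + 1) :=
      Multiset.sum_le_card_nsmul _ _ fun x hx => by
        obtain ⟨v, -, rfl⟩ := Multiset.mem_map.1 hx
        omega
    rw [Multiset.card_map, smul_eq_mul] at h1
    exact h1.trans (Nat.mul_le_mul_right _ hUc)
  set pt := ((rest.val - (l : Multiset V)).map fun v => q + 1 - lev v).sum with hpt
  obtain ⟨ω, h1, h2⟩ := absorb_all (by omega) hq1 hA (β := μ / 64) (by linarith) hbm4 hbm3
    (Nh := Multiset.card ℋ) (B := Multiset.card (P + (l : Multiset V)) + 3 * (ℓ + 1) * pt)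
    (δ := μ / 2) (by linarith) (by linarith) (by
      have h1 : (Multiset.card ℋ * ((ℓ + 1) * b₀) : ℝ) ≤ n := by exact_mod_cast hS.card_le
      have h2 : (Multiset.card ℋ * ((ℓ + 1) * bm) : ℝ) ≤ μ / 16 * n := by
        calc (Multiset.card ℋ * ((ℓ + 1) * bm) : ℝ) ≤
            Multiset.card ℋ * ((ℓ + 1) * (μ / 16 * b₀)) := by gcongr
          _ = μ / 16 * (Multiset.card ℋ * ((ℓ + 1) * b₀)) := by ring
          _ ≤ _ := by gcongr
      have h3 : (pt : ℝ) ≤ (η * n + η * n) * (q + 1) := by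
        have h4 : (pt : ℝ) ≤ #rest * (q + 1) := by exact_mod_cast hpot
        refine h4.trans ?_
        gcongr
        refine hrc.trans ?_
        gcongr
      have h4 : 3 * (ℓ + 1) * (pt : ℝ) ≤ μ / 8 * n := by
        calc 3 * (ℓ + 1) * (pt : ℝ) ≤ 3 * (ℓ + 1) * ((η * n + η * n) * (q + 1)) := by gcongr
          _ = 2 * (3 * (ℓ + 1) * (q + 1) * η) * n := by ring
          _ = _ := by rw [hη1]; ring
      have h5 : ξ * n ≤ μ / 64 * n := by
        gcongr
        linarith
      rw [Multiset.card_add, Multiset.coe_card, hl3]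
      push_cast
      have h6 : 0 < μ * n := by positivity
      linarith) pt ℋ _ (rest.val - (l : Multiset V)) hctx
    (fun F hF => by
      obtain ⟨h1, ⟨b, h2, -, h3⟩, -⟩ := hS.tile F hF
      exact ⟨h1, b, hb1.trans h2, h3⟩)
    (by
      have h3 := val_eq_add_filter hS.sub
      have h4 : (l : Multiset V) + (rest.val - (l : Multiset V)) = rest.val := add_tsub_cancel_of_le hlr
      rw [add_assoc P, add_comm (l : Multiset V), ← add_assoc P, add_assoc _ (l : Multiset V), h4]
      exact h3) rfl le_rfl le_rfl
  exact ⟨ω, h1, h2⟩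

end tile

section concentration
open Classical

variable {α : Type*}

lemma sum_exp_powerset_le (A N : Finset α) (hN : N ⊆ A) (t : ℝ) :
    ∑ S ∈ A.powerset, Real.exp (t * (2 * #(S ∩ N) - #N)) ≤ 2 ^ #A * Real.exp (t ^ 2 * #A / 2) := by
  have h1 : ∀ S ∈ A.powerset, Real.exp (t * (2 * #(S ∩ N) - #N)) =
      (∏ i ∈ S, if i ∈ N then Real.exp t else 1) *
        ∏ i ∈ A \ S, if i ∈ N then Real.exp (-t) else 1 := by
    intro S hS
    simp only [Finset.prod_ite, Finset.prod_const, one_pow, mul_one]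
    rw [← Real.exp_nat_mul, ← Real.exp_nat_mul,
      ← Real.exp_add, Finset.filter_mem_eq_inter, Finset.filter_mem_eq_inter]
    congr 1
    have h2 : #(S ∩ N) + #((A \ S) ∩ N) = #N := by
      rw [← Finset.card_union_of_disjoint]
      · congr 1
        ext x
        have := @hN x
        simp only [Finset.mem_union, Finset.mem_inter, Finset.mem_sdiff]
        tauto
      · exact Finset.disjoint_of_subset_left Finset.inter_subset_left
          (Finset.disjoint_of_subset_right Finset.inter_subset_left Finset.disjoint_sdiff)
    have h3 : (#(S ∩ N) : ℝ) + #((A \ S) ∩ N) = #N := by exact_mod_cast h2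
    rw [← h3]; ring
  rw [Finset.sum_congr rfl h1, ← Finset.prod_add]
  have h2 : ∀ i ∈ A, ((if i ∈ N then Real.exp t else 1) + if i ∈ N then Real.exp (-t) else 1) ≤
      2 * Real.exp (t ^ 2 / 2) := by
    intro i _
    split_ifs
    · have := Real.cosh_le_exp_half_sq t
      rw [Real.cosh_eq] at this
      linarith
    · have : 1 ≤ Real.exp (t ^ 2 / 2) := Real.one_le_exp (by positivity)
      linarith
  refine (Finset.prod_le_prod (fun i _ => ?_) h2).trans ?_
  · split_ifs <;> positivity
  · rw [Finset.prod_const, mul_pow, ← Real.exp_nat_mul]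
    refine le_of_eq ?_
    congr 2; ring

lemma card_deviation_le (A N : Finset α) (hN : N ⊆ A) {r : ℝ} (hr : 0 ≤ r) :
    (#{S ∈ A.powerset | r < |(#(S ∩ N) : ℝ) - #N / 2|} : ℝ) ≤
      2 * (2 ^ #A * Real.exp (-(2 * r ^ 2 / #A))) := by
  rcases Nat.eq_zero_or_pos #A with h0 | h0
  · rw [h0]
    have : (#{S ∈ A.powerset | r < |(#(S ∩ N) : ℝ) - #N / 2|} : ℝ) ≤ #A.powerset := by
      exact_mod_cast Finset.card_filter_le _ _
    rw [Finset.card_powerset, h0] at this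
    norm_num at this ⊢
    linarith
  have hA : (0 : ℝ) < #A := by exact_mod_cast h0
  have key : ∀ t : ℝ, |t| = 2 * r / #A →
      (#{S ∈ A.powerset | r * (2 * |t|) ≤ t * (2 * #(S ∩ N) - #N)} : ℝ) ≤
        2 ^ #A * Real.exp (-(2 * r ^ 2 / #A)) := by
    intro t ht
    have h1 : #{S ∈ A.powerset | r * (2 * |t|) ≤ t * (2 * #(S ∩ N) - #N)} •
        Real.exp (r * (2 * |t|)) ≤
        ∑ S ∈ {S ∈ A.powerset | r * (2 * |t|) ≤ t * (2 * #(S ∩ N) - #N)},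
          Real.exp (t * (2 * #(S ∩ N) - #N)) :=
      Finset.card_nsmul_le_sum _ _ _ fun S hS => Real.exp_le_exp.2 (Finset.mem_filter.1 hS).2
    have h2 : ∑ S ∈ {S ∈ A.powerset | r * (2 * |t|) ≤ t * (2 * #(S ∩ N) - #N)},
          Real.exp (t * (2 * #(S ∩ N) - #N)) ≤
        ∑ S ∈ A.powerset, Real.exp (t * (2 * #(S ∩ N) - #N)) :=
      Finset.sum_le_sum_of_subset_of_nonneg (Finset.filter_subset _ _)
        fun _ _ _ => (Real.exp_pos _).le
    have h3 := (h1.trans h2).trans (sum_exp_powerset_le A N hN t)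
    rw [nsmul_eq_mul] at h3
    have e1 : Real.exp (t ^ 2 * #A / 2) =
        Real.exp (-(2 * r ^ 2 / #A)) * Real.exp (r * (2 * |t|)) := by
      rw [← Real.exp_add, ← sq_abs, ht]
      congr 1
      field_simp; ring
    rw [e1, ← mul_assoc (2 ^ #A : ℝ)] at h3
    exact le_of_mul_le_mul_right h3 (Real.exp_pos _)
  have k1 := key (2 * r / #A) (abs_of_nonneg (by positivity))
  have k2 := key (-(2 * r / #A)) (by rw [abs_neg]; exact abs_of_nonneg (by positivity))
  have hsub : #{S ∈ A.powerset | r < |(#(S ∩ N) : ℝ) - #N / 2|} ≤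
      #{S ∈ A.powerset | r * (2 * |2 * r / #A|) ≤ 2 * r / #A * (2 * #(S ∩ N) - #N)} +
      #{S ∈ A.powerset | r * (2 * |-(2 * r / #A)|) ≤ -(2 * r / #A) * (2 * #(S ∩ N) - #N)} := by
    refine le_trans (Finset.card_le_card fun S hS => ?_) (Finset.card_union_le _ _)
    obtain ⟨hS1, hS2⟩ := Finset.mem_filter.1 hS
    have hp : 0 ≤ 2 * r / #A := by positivity
    rw [abs_neg, abs_of_nonneg hp]
    rcases lt_abs.1 hS2 with h | h
    · refine Finset.mem_union_left _ (Finset.mem_filter.2 ⟨hS1, ?_⟩)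
      have := mul_le_mul_of_nonneg_left (show 2 * r ≤ 2 * #(S ∩ N) - #N by linarith) hp
      linarith
    · refine Finset.mem_union_right _ (Finset.mem_filter.2 ⟨hS1, ?_⟩)
      have := mul_le_mul_of_nonneg_left (show 2 * r ≤ #N - 2 * #(S ∩ N) by linarith) hp
      linarith
  have hsub' : (#{S ∈ A.powerset | r < |(#(S ∩ N) : ℝ) - #N / 2|} : ℝ) ≤
      #{S ∈ A.powerset | r * (2 * |2 * r / #A|) ≤ 2 * r / #A * (2 * #(S ∩ N) - #N)} +
      #{S ∈ A.powerset | r * (2 * |-(2 * r / #A)|) ≤ -(2 * r / #A) * (2 * #(S ∩ N) - #N)} := by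
    exact_mod_cast hsub
  linarith

lemma two_pow_le_choose_half (m : ℕ) : 2 ^ m ≤ (m + 1) * m.choose (m / 2) := by
  rw [← Nat.sum_range_choose]
  refine (Finset.sum_le_card_nsmul _ _ _ fun i _ => Nat.choose_le_middle i m).trans ?_
  simp

/-- Most half-size subsets split every member of a small family almost evenly. -/
lemma card_bad_split_le (A : Finset α) (𝒩 : Finset (Finset α)) (h𝒩 : ∀ N ∈ 𝒩, N ⊆ A) {r : ℝ}
    (hr : 0 ≤ r) :
    (#{S ∈ A.powersetCard (#A / 2) | ∃ N ∈ 𝒩, r < |(#(S ∩ N) : ℝ) - #N / 2|} : ℝ) ≤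
      #𝒩 * (2 * (#A + 1) * Real.exp (-(2 * r ^ 2 / #A))) * #(A.powersetCard (#A / 2)) := by
  have h1 : #{S ∈ A.powersetCard (#A / 2) | ∃ N ∈ 𝒩, r < |(#(S ∩ N) : ℝ) - #N / 2|} ≤
      ∑ N ∈ 𝒩, #{S ∈ A.powerset | r < |(#(S ∩ N) : ℝ) - #N / 2|} := by
    refine le_trans (Finset.card_le_card fun S hS => ?_) Finset.card_biUnion_le
    obtain ⟨hS1, N, hN, hS2⟩ := Finset.mem_filter.1 hS
    exact Finset.mem_biUnion.2 ⟨N, hN, Finset.mem_filter.2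
      ⟨Finset.mem_powerset.2 (Finset.mem_powersetCard.1 hS1).1, hS2⟩⟩
  have h2 : (#{S ∈ A.powersetCard (#A / 2) | ∃ N ∈ 𝒩, r < |(#(S ∩ N) : ℝ) - #N / 2|} : ℝ) ≤
      ∑ N ∈ 𝒩, (#{S ∈ A.powerset | r < |(#(S ∩ N) : ℝ) - #N / 2|} : ℝ) := by exact_mod_cast h1
  have h3 := h2.trans (Finset.sum_le_card_nsmul _ _ _ fun N hN =>
    card_deviation_le A N (h𝒩 N hN) hr)
  rw [nsmul_eq_mul] at h3
  have h4 : (2 : ℝ) ^ #A ≤ (#A + 1) * #(A.powersetCard (#A / 2)) := by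
    rw [Finset.card_powersetCard]
    exact_mod_cast two_pow_le_choose_half #A
  refine h3.trans ?_
  calc (#𝒩 : ℝ) * (2 * (2 ^ #A * Real.exp (-(2 * r ^ 2 / #A)))) ≤
      #𝒩 * (2 * ((#A + 1) * #(A.powersetCard (#A / 2)) * Real.exp (-(2 * r ^ 2 / #A)))) := by
        gcongr
    _ = _ := by ring

end concentration

section split
open Classical

variable {V : Type} {ℓ : ℕ} {G : SimpleGraph V} {lev : V → ℕ} {q : ℕ} {μ ν : ℝ}

lemma Good.mono {μ' ν' : ℝ} {D D' : V → Prop} {A : Finset V} (h : Good G lev ℓ q μ ν D A)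
    (hD : ∀ v, D' v → D v) (hD' : ∀ v ∈ A, D' v) (hμ : μ' ≤ μ) (hν : ν ≤ ν') :
    Good G lev ℓ q μ' ν' D' A where
  sub := hD'
  lev_le := h.lev_le
  deg v hv := le_trans (by gcongr) (h.deg v (hD v hv))
  low c hc := (h.low c hc).trans (by gcongr)

/-- The fourth root. -/
noncomputable def rt (m : ℕ) : ℝ := √√(m : ℝ)

lemma rt_pow (m : ℕ) : rt m ^ 4 = m := by
  rw [rt, show (4 : ℕ) = 2 * 2 from rfl, pow_mul, Real.sq_sqrt (by positivity),
    Real.sq_sqrt (by positivity)]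

lemma rt_nonneg (m : ℕ) : 0 ≤ rt m := Real.sqrt_nonneg _

lemma rt_half {m m' : ℕ} (h : (m' : ℝ) ≤ m / 2) : rt m' ≤ 17 / 20 * rt m := by
  refine le_of_pow_le_pow_left₀ (n := 4) (by norm_num) (by have := rt_nonneg m; positivity) ?_
  rw [mul_pow, rt_pow, rt_pow]
  have : (0 : ℝ) ≤ m := Nat.cast_nonneg _
  norm_num
  linarith

lemma rt_ge {x : ℝ} {m : ℕ} (hx : x ^ 4 ≤ m) : x ≤ rt m := by
  refine le_of_pow_le_pow_left₀ (n := 4) (by norm_num) (rt_nonneg m) ?_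
  rwa [rt_pow]

/-- The condition `Good` with slack depending on the size of the set. -/
def GoodAt (G : SimpleGraph V) (lev : V → ℕ) (ℓ q : ℕ) (μ ν : ℝ) (D : V → Prop) (A : Finset V) :
    Prop :=
  Good G lev ℓ q (μ - (rt #A)⁻¹) (ν + (rt #A)⁻¹) D A

lemma goodAt_of_even {D : V → Prop} {A A' S : Finset V} (hq1 : 1 ≤ q)
    (hν0 : 0 ≤ ν) (hν1 : ν ≤ 1) (hA : GoodAt G lev ℓ q μ ν D A) (hA' : A' ⊆ A) (hAA : #A ≤ #A' + ℓ)
    (hSA : S ⊆ A') (hS1 : 2 * #S ≤ #A) (hS2 : #A ≤ 2 * #S + ℓ + 1) (hm : 100 * (ℓ + 2) ≤ rt #A)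
    (hdeg : ∀ v, D v → (#{u ∈ A' | G.Adj v u} : ℝ) / 2 - rt #A ^ 3 / 100 ≤ #{u ∈ S | G.Adj v u})
    (hlow : ∀ c ≤ q, (#{u ∈ S | lev u < c} : ℝ) ≤ (#{u ∈ A' | lev u < c} : ℝ) / 2 +
      rt #A ^ 3 / 100) : GoodAt G lev ℓ q μ ν D S := by
  set x := rt #A with hx
  set y := rt #S with hy
  have hℓ0 : (0 : ℝ) ≤ ℓ := Nat.cast_nonneg _
  have hx4 : x ^ 4 = #A := rt_pow _
  have hy4 : y ^ 4 = #S := rt_pow _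
  have hx0 : 200 ≤ x := by linarith
  have hS1' : 2 * (#S : ℝ) ≤ #A := by exact_mod_cast hS1
  have hS2' : (#A : ℝ) ≤ 2 * #S + ℓ + 1 := by exact_mod_cast hS2
  have hAA' : (#A : ℝ) ≤ #A' + ℓ := by exact_mod_cast hAA
  have hyx : y ≤ 17 / 20 * x := rt_half (by linarith)
  have hx3 : 40000 * x ≤ x ^ 3 := by nlinarith [mul_nonneg (by linarith : (0:ℝ) ≤ x) (by nlinarith : 0 ≤ x ^ 2 - 40000)]
  have hx43 : 200 * x ^ 3 ≤ x ^ 4 := by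
    have : 0 ≤ x ^ 3 := by positivity
    nlinarith
  have hy1 : 1 ≤ y := by
    refine rt_ge ?_
    nlinarith
  have hinv : 117 / 100 * x⁻¹ ≤ y⁻¹ := by
    rw [← div_eq_mul_inv, div_le_iff₀ (by linarith)]
    have h1 : y⁻¹ * y ≤ y⁻¹ * (17 / 20 * x) := by gcongr
    rw [inv_mul_cancel₀ (by linarith)] at h1
    nlinarith
  have hyi : y⁻¹ ≤ 1 := inv_le_one_of_one_le₀ hy1
  have hyi0 : 0 ≤ y⁻¹ := by positivity
  have hxA : x⁻¹ * #A = x ^ 3 := by rw [← hx4]; field_simp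
  have hgain : 117 / 100 * x ^ 3 ≤ y⁻¹ * #A := by
    rw [← hxA, ← mul_assoc]; gcongr
  refine ⟨fun v hv => hA.sub v (hA' (hSA hv)), hA.lev_le, fun v hv => ?_, fun c hc => ?_⟩
  · have h1 := hA.deg v hv
    have h2 := hdeg v hv
    have h3 : (#{u ∈ A | G.Adj v u} : ℝ) ≤ #{u ∈ A' | G.Adj v u} + ℓ := by
      have h4 : #{u ∈ A | G.Adj v u} ≤ #{u ∈ A' | G.Adj v u} + #(A \ A') := by
        refine le_trans (Finset.card_le_card fun u hu => ?_) (Finset.card_union_le _ _)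
        have hu' := Finset.mem_filter.1 hu
        by_cases hA'u : u ∈ A'
        · exact Finset.mem_union_left _ (Finset.mem_filter.2 ⟨hA'u, hu'.2⟩)
        · exact Finset.mem_union_right _ (Finset.mem_sdiff.2 ⟨hu'.1, hA'u⟩)
      have h5 : #(A \ A') ≤ ℓ := by
        rw [Finset.card_sdiff_of_subset hA']; omega
      exact_mod_cast h4.trans (Nat.add_le_add_left h5 _)
    set X : ℝ := (ℓ - 1 : ℝ) / (ℓ + 1) + lev v / ((ℓ + 1) * q) with hX
    change (X + (μ - y⁻¹)) * #S ≤ _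
    rcases le_or_gt 0 (X + (μ - y⁻¹)) with h0 | h0
    · have h6 : (X + (μ - y⁻¹)) * #S ≤ (X + (μ - y⁻¹)) * (#A / 2) := by
        gcongr
        linarith
      have h7 : (X + (μ - x⁻¹)) * #A ≤ #{u ∈ A | G.Adj v u} := h1
      nlinarith
    · have h6 : (X + (μ - y⁻¹)) * #S ≤ 0 :=
        mul_nonpos_of_nonpos_of_nonneg h0.le (Nat.cast_nonneg _)
      exact h6.trans (Nat.cast_nonneg _)
  · have h1 := hA.low c hc
    have h2 := hlow c hc
    have h3 : (#{u ∈ A' | lev u < c} : ℝ) ≤ #{u ∈ A | lev u < c} := by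
      exact_mod_cast Finset.card_le_card (Finset.filter_subset_filter _ hA')
    set Y : ℝ := c / ((ℓ + 1) * q) with hY
    have hY0 : 0 ≤ Y := by positivity
    have hY1 : Y ≤ 1 := by
      rw [hY, div_le_one (by positivity)]
      have : (c : ℝ) ≤ q := by exact_mod_cast hc
      nlinarith [(Nat.cast_nonneg q : (0 : ℝ) ≤ q)]
    change _ ≤ (Y + (ν + y⁻¹)) * #S
    have h4 : (#{u ∈ A | lev u < c} : ℝ) ≤ (Y + (ν + x⁻¹)) * #A := h1
    have h5 : (Y + (ν + y⁻¹)) * (#A - (ℓ + 1)) ≤ (Y + (ν + y⁻¹)) * (2 * #S) := by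
      gcongr
      linarith
    have h6 : (Y + (ν + y⁻¹)) * (ℓ + 1) ≤ 3 * (ℓ + 1) := by
      gcongr
      linarith
    nlinarith

lemma exists_tail_bound (C : ℝ) (hC : 0 ≤ C) : ∃ m₀ : ℕ, ∀ m : ℕ, m₀ ≤ m →
    C * m * (2 * (m + 1) * Real.exp (-(2 * (rt m ^ 3 / 100) ^ 2 / m))) ≤ 1 / m := by
  set E : ℝ := 4 * C * 5040 / (2 / 10000) ^ 7 with hE
  obtain ⟨m₀, hm₀⟩ := exists_nat_ge (1 + E ^ 2)
  refine ⟨m₀, fun m hm => ?_⟩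
  have hm' : (1 : ℝ) + E ^ 2 ≤ m := hm₀.trans (by exact_mod_cast hm)
  have hm1 : (1 : ℝ) ≤ m := by nlinarith
  set x := rt m with hx
  have hx4 : x ^ 4 = m := rt_pow m
  have hx0 : 0 ≤ x := rt_nonneg m
  have hx1 : 1 ≤ x := rt_ge (by simpa using hm1)
  have hE0 : 0 ≤ E := by positivity
  have hxE : E ≤ x ^ 2 := by
    refine le_of_pow_le_pow_left₀ (n := 2) (by norm_num) (by positivity) ?_
    rw [← pow_mul, hx4]; linarith
  have e1 : 2 * (x ^ 3 / 100) ^ 2 / (m : ℝ) = 2 / 10000 * x ^ 2 := by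
    rw [← hx4]; field_simp; ring
  rw [e1, Real.exp_neg]
  have h1 := Real.pow_div_factorial_le_exp (2 / 10000 * x ^ 2) (by positivity) 7
  have e2 : ((Nat.factorial 7 : ℕ) : ℝ) = 5040 := by norm_num [Nat.factorial]
  rw [e2, div_le_iff₀ (by norm_num)] at h1
  have hexp := Real.exp_pos (2 / 10000 * x ^ 2)
  rw [le_div_iff₀ (by linarith)]
  have h2 : C * m * (2 * (m + 1)) * m ≤ Real.exp (2 / 10000 * x ^ 2) := by
    have h3 : C * m * (2 * (m + 1)) * m ≤ C * m * (2 * (m + m)) * m := by gcongr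
    have h4 : C * m * (2 * (m + m)) * m = 4 * C * x ^ 12 := by rw [← hx4]; ring
    have h5 : E * x ^ 12 ≤ x ^ 2 * x ^ 12 := by gcongr
    have h6 : 4 * C * 5040 * x ^ 12 ≤ (2 / 10000) ^ 7 * x ^ 14 := by
      have : 4 * C * 5040 = E * (2 / 10000) ^ 7 := by rw [hE]; field_simp
      rw [this]
      calc E * (2 / 10000) ^ 7 * x ^ 12 = (2 / 10000) ^ 7 * (E * x ^ 12) := by ring
        _ ≤ (2 / 10000) ^ 7 * (x ^ 2 * x ^ 12) := by gcongr
        _ = _ := by ring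
    have h7 : (2 / 10000 * x ^ 2) ^ 7 = (2 / 10000) ^ 7 * x ^ 14 := by ring
    rw [h7] at h1
    linarith
  calc C * m * (2 * (m + 1) * (Real.exp (2 / 10000 * x ^ 2))⁻¹) * m =
      (C * m * (2 * (m + 1)) * m) * (Real.exp (2 / 10000 * x ^ 2))⁻¹ := by ring
    _ ≤ Real.exp (2 / 10000 * x ^ 2) * (Real.exp (2 / 10000 * x ^ 2))⁻¹ := by gcongr
    _ = 1 := mul_inv_cancel₀ hexp.ne'

/-- Most half-size subsets of a good set are good, together with their complements. -/
theorem exists_good_split (ℓ q : ℕ) (hq1 : 1 ≤ q) {μ ν : ℝ} (hν0 : 0 ≤ ν) (hν1 : ν ≤ 1)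
    (C : ℕ) : ∃ m₀ : ℕ, ∀ (V : Type) (G : SimpleGraph V) (lev : V → ℕ) (D A A' : Finset V),
      m₀ ≤ #A → #D ≤ C * #A → GoodAt G lev ℓ q μ ν (· ∈ D) A → A' ⊆ A → #A' < #A →
      #A ≤ #A' + ℓ →
      (1 - 1 / #A) * (#(A'.powersetCard (#A' / 2)) : ℝ) ≤
        #{S ∈ A'.powersetCard (#A' / 2) | GoodAt G lev ℓ q μ ν (· ∈ D) S ∧
          GoodAt G lev ℓ q μ ν (· ∈ D) (A' \ S)} := by
  obtain ⟨m₁, hm₁⟩ := exists_tail_bound (C + q + 1) (by positivity)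
  refine ⟨m₁ + (100 * (ℓ + 2)) ^ 4, fun V G lev D A A' hm hD hA hA' hlt hAA => ?_⟩
  set m := #A with hmdef
  set 𝒩 : Finset (Finset V) := D.image (fun v => {u ∈ A' | G.Adj v u}) ∪
    (Finset.range (q + 1)).image (fun c => {u ∈ A' | lev u < c}) with h𝒩
  have hrt : 100 * (ℓ + 2) ≤ rt m := by
    refine rt_ge ?_
    have : (100 * (ℓ + 2)) ^ 4 ≤ m := (Nat.le_add_left _ _).trans hm
    exact_mod_cast this
  have hr0 : 0 ≤ rt m ^ 3 / 100 := by have := rt_nonneg m; positivity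
  have hbad := card_bad_split_le A' 𝒩 (fun N hN => by
    rcases Finset.mem_union.1 hN with h | h
    · obtain ⟨v, -, rfl⟩ := Finset.mem_image.1 h
      exact Finset.filter_subset _ _
    · obtain ⟨v, -, rfl⟩ := Finset.mem_image.1 h
      exact Finset.filter_subset _ _) hr0
  have hm1 : 1 ≤ m := by omega
  have h𝒩c : (#𝒩 : ℝ) ≤ (C + q + 1) * m := by
    have h1 : #𝒩 ≤ C * m + (q + 1) := by
      refine (Finset.card_union_le _ _).trans (add_le_add (Finset.card_image_le.trans hD) ?_)
      exact Finset.card_image_le.trans (by simp)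
    have h2 : #𝒩 ≤ (C + q + 1) * m := by nlinarith
    exact_mod_cast h2
  have hm1' : (1 : ℝ) ≤ m := by exact_mod_cast hm1
  have hlt' : (#A' : ℝ) ≤ m := by exact_mod_cast hlt.le
  have hcoef : #𝒩 * (2 * (#A' + 1) * Real.exp (-(2 * (rt m ^ 3 / 100) ^ 2 / #A'))) ≤ 1 / m := by
    refine le_trans ?_ (hm₁ m ((Nat.le_add_right _ _).trans hm))
    have hA'0 : (0 : ℝ) < #A' := by
      have : 0 < #A' := by
        have : ℓ < m := by
          have h1 : (100 * (ℓ + 2)) ^ 4 ≤ m := (Nat.le_add_left _ _).trans hm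
          have h2 : 100 * (ℓ + 2) ≤ (100 * (ℓ + 2)) ^ 4 := Nat.le_self_pow (by norm_num) _
          omega
        omega
      exact_mod_cast this
    gcongr
  have hsub : A'.powersetCard (#A' / 2) ⊆
      {S ∈ A'.powersetCard (#A' / 2) | GoodAt G lev ℓ q μ ν (· ∈ D) S ∧
          GoodAt G lev ℓ q μ ν (· ∈ D) (A' \ S)} ∪
      {S ∈ A'.powersetCard (#A' / 2) | ∃ N ∈ 𝒩, rt m ^ 3 / 100 < |(#(S ∩ N) : ℝ) - #N / 2|} := by
    intro S hS
    by_cases hbadS : ∃ N ∈ 𝒩, rt m ^ 3 / 100 < |(#(S ∩ N) : ℝ) - #N / 2|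
    · exact Finset.mem_union_right _ (Finset.mem_filter.2 ⟨hS, hbadS⟩)
    push Not at hbadS
    obtain ⟨hSA, hSc⟩ := Finset.mem_powersetCard.1 hS
    have hSc' : #(A' \ S) = #A' - #A' / 2 := by rw [Finset.card_sdiff_of_subset hSA, hSc]
    have hint : ∀ (p : V → Prop) [DecidablePred p], S ∩ {u ∈ A' | p u} = {u ∈ S | p u} := fun p _ => by
      ext u
      have := @hSA u
      simp only [Finset.mem_inter, Finset.mem_filter]
      tauto
    have hcompl : ∀ (p : V → Prop) [DecidablePred p], (#{u ∈ S | p u} : ℝ) + #{u ∈ A' \ S | p u} =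
        #{u ∈ A' | p u} := fun p _ => by
      rw [← Nat.cast_add, ← Finset.card_union_of_disjoint, ← Finset.filter_union,
        Finset.union_sdiff_of_subset hSA]
      exact Finset.disjoint_filter_filter Finset.disjoint_sdiff
    have hdeg : ∀ v ∈ D, |(#{u ∈ S | G.Adj v u} : ℝ) - #{u ∈ A' | G.Adj v u} / 2| ≤
        rt m ^ 3 / 100 := fun v hv => by
      have := hbadS _ (Finset.mem_union_left _ (Finset.mem_image_of_mem _ hv))
      rwa [hint] at this
    have hlow : ∀ c ≤ q, |(#{u ∈ S | lev u < c} : ℝ) - #{u ∈ A' | lev u < c} / 2| ≤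
        rt m ^ 3 / 100 := fun c hc => by
      have := hbadS _ (Finset.mem_union_right _ (Finset.mem_image_of_mem _
        (Finset.mem_range.2 (Nat.lt_succ_of_le hc))))
      rwa [hint] at this
    refine Finset.mem_union_left _ (Finset.mem_filter.2 ⟨hS, ?_, ?_⟩)
    · refine goodAt_of_even hq1 hν0 hν1 hA hA' hAA hSA (by omega) (by omega) hrt
        (fun v hv => ?_) (fun c hc => ?_)
      · have := (abs_le.1 (hdeg v hv)).1
        linarith
      · have := (abs_le.1 (hlow c hc)).2
        linarith
    · refine goodAt_of_even hq1 hν0 hν1 hA hA' hAA Finset.sdiff_subset (by omega) (by omega) hrt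
        (fun v hv => ?_) (fun c hc => ?_)
      · have := (abs_le.1 (hdeg v hv)).2
        have := hcompl (G.Adj v)
        linarith
      · have := (abs_le.1 (hlow c hc)).1
        have := hcompl (lev · < c)
        linarith
  have hcard : (#(A'.powersetCard (#A' / 2)) : ℝ) ≤
      #{S ∈ A'.powersetCard (#A' / 2) | GoodAt G lev ℓ q μ ν (· ∈ D) S ∧
          GoodAt G lev ℓ q μ ν (· ∈ D) (A' \ S)} +
      #{S ∈ A'.powersetCard (#A' / 2) | ∃ N ∈ 𝒩, rt m ^ 3 / 100 < |(#(S ∩ N) : ℝ) - #N / 2|} := by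
    exact_mod_cast (Finset.card_le_card hsub).trans (Finset.card_union_le _ _)
  have h5 : #𝒩 * (2 * (#A' + 1) * Real.exp (-(2 * (rt m ^ 3 / 100) ^ 2 / #A'))) *
      #(A'.powersetCard (#A' / 2)) ≤ 1 / m * #(A'.powersetCard (#A' / 2)) := by gcongr
  linarith

end split

section frames
open Classical

variable {V : Type} {G : SimpleGraph V} {lev : V → ℕ} {ℓ q : ℕ} {μ ν : ℝ} {s t : List V}
  {A : Finset V}

lemma exists_reservoir (ℓ q : ℕ) (hℓ : 1 ≤ ℓ) (hq1 : 1 ≤ q) {μ ν : ℝ} (hν0 : 0 ≤ ν)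
    (hν1 : ν ≤ 1) (h : ℕ) : ∀ C M : ℕ, ∃ m₀ : ℕ, ∀ (V : Type) (G : SimpleGraph V) (lev : V → ℕ)
      (D A : Finset V), m₀ ≤ #A → #D ≤ C * #A → GoodAt G lev ℓ q μ ν (· ∈ D) A →
      ∃ R ⊆ A, GoodAt G lev ℓ q μ ν (· ∈ D) R ∧ M ≤ #R ∧ 2 ^ h * #R ≤ #A ∧
        #A + 2 ≤ 2 ^ h * (#R + 2) := by
  induction h with
  | zero =>
    exact fun C M => ⟨M, fun V G lev D A hA hD hg => ⟨A, Subset.rfl, hg, hA, by simp, by simp⟩⟩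
  | succ h ih =>
    intro C M
    obtain ⟨m₁, hm₁⟩ := ih (3 * C) M
    obtain ⟨m₂, hm₂⟩ := exists_good_split ℓ q hq1 hν0 hν1 C
    refine ⟨2 * m₁ + m₂ + 6, fun V G lev D A hA hD hg => ?_⟩
    obtain ⟨x, hx⟩ : A.Nonempty := Finset.card_pos.1 (by omega)
    have hc : #(A.erase x) = #A - 1 := Finset.card_erase_of_mem hx
    have h1 := hm₂ V G lev D A (A.erase x) (by omega) hD hg (Finset.erase_subset _ _) (by omega)
      (by omega)
    have h2 : 0 < #((A.erase x).powersetCard (#(A.erase x) / 2)) := by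
      rw [Finset.card_powersetCard]
      exact Nat.choose_pos (Nat.div_le_self _ _)
    have h3 : (0 : ℝ) < 1 - 1 / #A := by
      have : (2 : ℝ) ≤ #A := by exact_mod_cast (by omega : 2 ≤ #A)
      rw [sub_pos, div_lt_one (by linarith)]
      linarith
    have h4 := (mul_pos h3 (Nat.cast_pos.2 h2)).trans_le h1
    obtain ⟨S, hS⟩ := Finset.card_pos.1 (Nat.cast_pos.1 h4)
    obtain ⟨hS1, hS2, -⟩ := Finset.mem_filter.1 hS
    obtain ⟨hSA, hSc⟩ := Finset.mem_powersetCard.1 hS1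
    have h5 : #D ≤ 3 * C * #S := hD.trans (by
      calc C * #A ≤ C * (3 * #S) := Nat.mul_le_mul_left _ (by omega)
        _ = 3 * C * #S := by ring)
    obtain ⟨R, hRS, hR, hRM, hR1, hR2⟩ := hm₁ V G lev D S (by omega) h5 hS2
    refine ⟨R, hRS.trans (hSA.trans (Finset.erase_subset _ _)), hR, hRM, ?_, ?_⟩
    · rw [pow_succ']; nlinarith [(by omega : 2 * #S ≤ #A)]
    · rw [pow_succ']; nlinarith [(by omega : #A + 2 ≤ 2 * (#S + 2))]

/-- A set together with two end cliques, between which its vertices are to be arranged. -/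
structure Frame (G : SimpleGraph V) (lev : V → ℕ) (ℓ q : ℕ) (μ ν : ℝ) (s : List V) (A : Finset V)
    (t : List V) : Prop where
  len_left : s.length = ℓ
  len_right : t.length = ℓ
  pow_left : IsPow G (ℓ + 1) s
  pow_right : IsPow G (ℓ + 1) t
  top_left : ∀ v ∈ s, lev v = q
  top_right : ∀ v ∈ t, lev v = q
  good : GoodAt G lev ℓ q μ ν (· ∈ A ∪ s.toFinset ∪ t.toFinset) A

lemma Frame.card_le (h : Frame G lev ℓ q μ ν s A t) :
    #(A ∪ s.toFinset ∪ t.toFinset) ≤ #A + 2 * ℓ := by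
  refine (Finset.card_union_le _ _).trans ?_
  have h1 := Finset.card_union_le A s.toFinset
  have h2 := s.toFinset_card_le
  have h3 := t.toFinset_card_le
  rw [h.len_left] at h2
  rw [h.len_right] at h3
  omega

lemma rt_inv_le {x : ℝ} (hx : 0 < x) {m : ℕ} (hm : (x⁻¹) ^ 4 ≤ m) : (rt m)⁻¹ ≤ x := by
  have := rt_ge hm
  exact inv_le_of_inv_le₀ hx this

lemma exists_rt_inv_le {x : ℝ} (hx : 0 < x) : ∃ m₀ : ℕ, ∀ m, m₀ ≤ m → (rt m)⁻¹ ≤ x := by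
  obtain ⟨m₀, hm₀⟩ := exists_nat_ge ((x⁻¹) ^ 4)
  exact ⟨m₀, fun m hm => rt_inv_le hx (hm₀.trans (by exact_mod_cast hm))⟩

lemma exists_pow_two {ρ : ℝ} (h0 : 0 < ρ) (h1 : ρ ≤ 1) : ∃ h : ℕ, 1 ≤ ρ * 2 ^ h ∧ ρ * 2 ^ h ≤ 2 := by
  obtain ⟨n, hn1, hn2⟩ := exists_nat_pow_near (one_le_inv₀ h0 |>.2 h1) (one_lt_two)
  refine ⟨n + 1, ?_, ?_⟩
  · have := mul_le_mul_of_nonneg_left hn2.le h0.le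
    rwa [mul_inv_cancel₀ h0.ne'] at this
  · have := mul_le_mul_of_nonneg_left hn1 h0.le
    rw [mul_inv_cancel₀ h0.ne'] at this
    rw [pow_succ]; linarith

/-- A large frame admits at least one arrangement. -/
theorem Frame.exists_path {ℓ q : ℕ} (hℓ : 2 ≤ ℓ) (hq1 : 1 ≤ q) {μ ν : ℝ} (hμ : 0 < μ) (hμ1 : μ ≤ 1)
    (hν0 : 0 ≤ ν) (hν : ν ≤ μ / 128) (hqμ : 1 / (((ℓ : ℝ) + 1) * q) ≤ μ / 64) :
    ∃ m₀ : ℕ, ∀ (V : Type) (G : SimpleGraph V) (lev : V → ℕ) (s t : List V) (A : Finset V),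
      m₀ ≤ #A → Frame G lev ℓ q μ ν s A t →
      ∃ L : List V, IsPow G (ℓ + 1) (s ++ L ++ t) ∧ (L : Multiset V) = A.val := by
  set ρ : ℝ := μ / 2 / (48 * (ℓ + 1) * (q + 1)) with hρ
  have hρ0 : 0 < ρ := by positivity
  have hρ1 : ρ ≤ 1 := by
    rw [hρ, div_le_one (by positivity)]
    have h1 : (0 : ℝ) ≤ ℓ := Nat.cast_nonneg _
    have h2 : (0 : ℝ) ≤ q := Nat.cast_nonneg _
    nlinarith [mul_nonneg h1 h2]
  obtain ⟨h, hh1, hh2⟩ := exists_pow_two hρ0 hρ1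
  obtain ⟨m₁, hm₁⟩ := exists_path_of_reservoir (ℓ := ℓ) (q := q) hℓ hq1 (μ := μ / 2) (ν := μ / 64)
    (ρ := ρ) (by linarith) (by linarith) (by linarith) (by linarith) hρ0 le_rfl
  obtain ⟨m₂, hm₂⟩ := exists_rt_inv_le (x := μ / 128) (by linarith)
  obtain ⟨m₃, hm₃⟩ := exists_reservoir ℓ q (by omega) hq1 hν0 (by linarith) h (1 + 2 * ℓ) m₂
  obtain ⟨m₄, hm₄⟩ := exists_nat_ge (8 / ρ)
  refine ⟨m₁ + m₂ + m₃ + m₄ + 1, fun V G lev s t A hA hF => ?_⟩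
  have hD : #(A ∪ s.toFinset ∪ t.toFinset) ≤ (1 + 2 * ℓ) * #A := by
    have := hF.card_le
    have : 1 ≤ #A := by omega
    nlinarith
  obtain ⟨R, hRA, hR, hRM, hR1, hR2⟩ := hm₃ V G lev _ A (by omega) hD hF.good
  have hA2 : (rt #A)⁻¹ ≤ μ / 128 := hm₂ _ (by omega)
  have hR3 : (rt #R)⁻¹ ≤ μ / 128 := hm₂ _ hRM
  have hgA : Good G lev ℓ q (μ / 2) (μ / 64) (· ∈ A ∪ s.toFinset ∪ t.toFinset) A :=
    hF.good.mono (fun _ h => h) (fun v hv => by simp [hv]) (by linarith) (by linarith)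
  have hgR : Good G lev ℓ q (μ / 2 / 2) (μ / 2 / 16) (· ∈ A ∪ s.toFinset ∪ t.toFinset) R :=
    hR.mono (fun _ h => h) (fun v hv => by simp [hRA hv]) (by linarith) (by linarith)
  have hR1' : (2 : ℝ) ^ h * #R ≤ #A := by exact_mod_cast hR1
  have hR2' : (#A : ℝ) + 2 ≤ 2 ^ h * (#R + 2) := by exact_mod_cast hR2
  have hA4 : 8 ≤ ρ * #A := by
    have h1 : (8 : ℝ) / ρ ≤ #A := hm₄.trans (by exact_mod_cast (by omega : m₄ ≤ #A))
    rw [div_le_iff₀ hρ0] at h1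
    linarith
  refine hm₁ V G lev _ A R s t (by omega) hgA hRA hgR ?_ ?_ hF.len_left hF.pow_left
    (fun v hv => ⟨by simp [hv], hF.top_left v hv⟩) hF.len_right hF.pow_right
    (fun v hv => ⟨by simp [hv], hF.top_right v hv⟩)
  · have h1 := mul_le_mul_of_nonneg_left hR2' hρ0.le
    have h2 : ρ * 2 ^ h * (#R + 2) ≤ 2 * (#R + 2) := by gcongr
    nlinarith
  · have h1 := mul_le_mul_of_nonneg_left hR1' hρ0.le
    have h2 : 1 * (#R : ℝ) ≤ ρ * 2 ^ h * #R := by gcongr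
    linarith

/-- The ordered `ℓ`-cliques in `A` consisting of vertices of top level. -/
noncomputable def cliques (G : SimpleGraph V) (lev : V → ℕ) (ℓ q : ℕ) (A : Finset V) :
    Finset (Fin ℓ → V) :=
  {c ∈ Fintype.piFinset fun _ => A | (∀ i, lev (c i) = q) ∧ ∀ i j, i ≠ j → G.Adj (c i) (c j)}

lemma mem_cliques {c : Fin ℓ → V} : c ∈ cliques G lev ℓ q A ↔
    (∀ i, c i ∈ A) ∧ (∀ i, lev (c i) = q) ∧ ∀ i j, i ≠ j → G.Adj (c i) (c j) := by
  simp [cliques]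

lemma le_card_cliques (hℓ : 2 ≤ ℓ) (hq1 : 1 ≤ q) (hμ : 0 ≤ μ) (hν : ν ≤ μ) (hν' : ν ≤ 1 / 4) {D : V → Prop}
    (hA : Good G lev ℓ q μ ν D A) :
    ((#A : ℝ) / (2 * (ℓ + 1))) ^ ℓ ≤ #(cliques G lev ℓ q A) := by
  have hℓ' : (2 : ℝ) ≤ ℓ := by exact_mod_cast hℓ
  have hA0 : (0 : ℝ) ≤ #A := Nat.cast_nonneg _
  have hq0 : (0 : ℝ) < q := by exact_mod_cast hq1
  set d : ℝ := max 0 ((1 / (ℓ + 1) - μ) * #A) with hd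
  have h1 : ∀ v, (D v ∧ lev v = q) → (#{u ∈ A | ¬ G.Adj v u} : ℝ) ≤ d := by
    intro v hv
    have h2 := hA.deg_top hq1 hv.1 hv.2
    have h3 : #{u ∈ A | G.Adj v u} + #{u ∈ A | ¬ G.Adj v u} = #A :=
      Finset.card_filter_add_card_filter_not _
    have h3' : (#{u ∈ A | G.Adj v u} : ℝ) + #{u ∈ A | ¬ G.Adj v u} = #A := by exact_mod_cast h3
    refine le_trans ?_ (le_max_right _ _)
    have h4 : (ℓ : ℝ) / (ℓ + 1) = 1 - 1 / (ℓ + 1) := by field_simp; ring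
    rw [h4] at h2
    linarith
  have h2 : (#{u ∈ A | ¬ (D u ∧ lev u = q)} : ℝ) ≤ (1 / (ℓ + 1) + ν) * #A := by
    have h3 := hA.low q le_rfl
    have h4 : (q : ℝ) / ((ℓ + 1) * q) = 1 / (ℓ + 1) := by field_simp
    rw [h4] at h3
    refine le_trans ?_ h3
    refine Nat.cast_le.2 (Finset.card_le_card fun u hu => ?_)
    obtain ⟨hu1, hu2⟩ := Finset.mem_filter.1 hu
    refine Finset.mem_filter.2 ⟨hu1, ?_⟩
    have h5 := hA.lev_le u
    have h6 := hA.sub u hu1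
    by_contra h7
    exact hu2 ⟨h6, by omega⟩
  have h3 := many_clique_of (θ := (#A : ℝ) / (2 * (ℓ + 1)))
    (L := (1 / (ℓ + 1) + ν) * #A) (d := d) (le_max_left _ _) h1
    (by convert h2) ℓ [] (by simp)
    (fun _ => by
      have e1 : (1 : ℝ) / (ℓ + 1) * #A * (ℓ + 1) = #A := by field_simp
      have e2 : (#A : ℝ) / (2 * (ℓ + 1)) = 1 / (ℓ + 1) * #A / 2 := by field_simp
      rw [e2]
      set X : ℝ := 1 / (ℓ + 1) * #A with hX
      have hX0 : 0 ≤ X := by positivity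
      have hd1 : d ≤ X := max_le hX0 (by nlinarith [mul_nonneg hμ hA0])
      have hd2 : (ℓ - 1) * d ≤ (ℓ - 1) * X - μ * #A ∨ d = 0 := by
        rcases le_total ((1 / (ℓ + 1) - μ) * (#A : ℝ)) 0 with h | h
        · right; exact max_eq_left h
        · left
          rw [hd, max_eq_right h]
          have : (ℓ - 2) * (μ * #A) ≥ 0 := mul_nonneg (by linarith) (by positivity)
          rw [hX]; nlinarith
      have hνA : ν * #A ≤ μ * #A := by gcongr
      have hνA' : ν * #A ≤ 1 / 4 * #A := by gcongr
      have e3 : (1 / (ℓ + 1) + ν) * (#A : ℝ) = X + ν * #A := by rw [hX]; ring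
      rw [e3]
      simp only [List.length_nil, Nat.cast_zero, zero_add]
      rcases hd2 with h | h
      · nlinarith
      · rw [h]
        nlinarith)
  have h4 : ((#A : ℝ) / (2 * (ℓ + 1))) ^ ℓ ≤ #{x : Fin ℓ → A |
      (∀ v ∈ List.ofFn fun i => (x i : V), D v ∧ lev v = q) ∧
        (∀ v ∈ List.ofFn fun i => (x i : V), ∀ u ∈ ([] : List V), G.Adj u v) ∧
        (List.ofFn fun i => (x i : V)).Pairwise G.Adj} := by
    convert h3.count (by positivity)
  refine h4.trans (Nat.cast_le.2 ?_)
  refine Finset.card_le_card_of_injOn (fun x i => (x i : V)) (fun x hx => ?_) (fun x _ y _ h => ?_)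
  · have hx' := (Finset.mem_filter.1 (Finset.mem_coe.1 hx)).2
    obtain ⟨hx1, -, hx2⟩ := hx'
    refine Finset.mem_coe.2 (mem_cliques.2 ⟨fun i => (x i).2, fun i => ?_, ?_⟩)
    · exact (hx1 (x i) (List.mem_ofFn.2 ⟨i, rfl⟩)).2
    · have h4 := List.pairwise_ofFn.1 hx2
      intro i j hij
      rcases lt_or_gt_of_ne hij with h | h
      · exact h4 h
      · exact (h4 h).symm
  · funext i
    exact Subtype.ext (congrFun h i)

end frames

section dist
open Classical

variable {V : Type} {Φ Φ₁ Φ₂ Ψ : List V → Prop} {f f₁ f₂ g : Finset ℕ → (ℕ → V) → ℝ}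

/-- `L` has the entry `y j` in every position `j ∈ I`. -/
def Agrees (L : List V) (I : Finset ℕ) (y : ℕ → V) : Prop := ∀ j ∈ I, L[j]? = some (y j)

/-- There is a finitely supported distribution on lists satisfying `Φ` for which `f` bounds the
probability of prescribing some of the entries. -/
def HasDist (Φ : List V → Prop) (f : Finset ℕ → (ℕ → V) → ℝ) : Prop :=
  ∃ (ι : Type) (_ : Fintype ι) (w : ι → ℝ) (L : ι → List V), (∀ i, 0 ≤ w i) ∧ ∑ i, w i = 1 ∧
    (∀ i, Φ (L i)) ∧ ∀ I y, prob w (fun i => Agrees (L i) I y) ≤ f I y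

lemma HasDist.mono (h : HasDist Φ f) (hΦ : ∀ L, Φ L → Ψ L) (hg : ∀ I y, 0 ≤ g I y)
    (hfg : ∀ I y L, Φ L → Agrees L I y → f I y ≤ g I y ∨ 1 ≤ g I y) : HasDist Ψ g := by
  obtain ⟨ι, _, w, L, hw, hw1, hL, hf⟩ := h
  refine ⟨ι, _, w, L, hw, hw1, fun i => hΦ _ (hL i), fun I y => ?_⟩
  by_cases hex : ∃ i, Agrees (L i) I y
  · obtain ⟨i, hi⟩ := hex
    rcases hfg I y (L i) (hL i) hi with h | h
    · exact (hf I y).trans h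
    · refine le_trans ?_ h
      rw [← hw1]
      refine Finset.sum_le_sum fun i _ => ?_
      split_ifs
      · exact le_rfl
      · exact hw i
  · push Not at hex
    refine le_trans (le_of_eq ?_) (hg I y)
    exact Finset.sum_eq_zero fun i _ => if_neg (hex i)

lemma hasDist_single {L : List V} (hL : Φ L) :
    HasDist Φ fun I y => if Agrees L I y then 1 else 0 :=
  ⟨Unit, inferInstance, fun _ => 1, fun _ => L, fun _ => zero_le_one, by simp, fun _ => hL,
    fun I y => by simp [prob]⟩

lemma HasDist.bind {κ : Type} [Fintype κ] {u : κ → ℝ} (hu : ∀ k, 0 ≤ u k) (hu1 : ∑ k, u k = 1)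
    {f : κ → Finset ℕ → (ℕ → V) → ℝ} (h : ∀ k, HasDist Φ (f k)) :
    HasDist Φ fun I y => ∑ k, u k * f k I y := by
  choose ι hι w L hw hw1 hL hf using h
  refine ⟨Σ k, ι k, inferInstance, fun x => u x.1 * w x.1 x.2, fun x => L x.1 x.2,
    fun x => mul_nonneg (hu _) (hw _ _), ?_, fun x => hL _ _, fun I y => ?_⟩
  · rw [Fintype.sum_sigma]
    simp only [← Finset.mul_sum, hw1, mul_one, hu1]
  · rw [prob, Fintype.sum_sigma]
    refine Finset.sum_le_sum fun k _ => ?_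
    refine le_trans (le_of_eq ?_) (mul_le_mul_of_nonneg_left (hf k I y) (hu k))
    rw [prob, Finset.mul_sum]
    exact Finset.sum_congr rfl fun i _ => by simp only [mul_ite, mul_zero]

/-- Uniform mixtures. -/
lemma HasDist.bind_uniform {κ : Type} {K : Finset κ} (hK : K.Nonempty)
    {f : κ → Finset ℕ → (ℕ → V) → ℝ} (h : ∀ k ∈ K, HasDist Φ (f k)) :
    HasDist Φ fun I y => (∑ k ∈ K, f k I y) / #K := by
  have h0 : (0 : ℝ) < #K := Nat.cast_pos.2 hK.card_pos
  have h1 := HasDist.bind (κ := K) (u := fun _ => (1 : ℝ) / #K) (fun _ => by positivity)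
    (by simp [h0.ne']) (f := fun k => f k) fun k => h k k.2
  convert h1 using 3 with I y
  rw [← Finset.mul_sum, Finset.sum_coe_sort K fun k => f k I y]
  ring

/-- The part of `I` from `m` on, shifted to start at zero. -/
def shift (m : ℕ) (I : Finset ℕ) : Finset ℕ := (I.filter (m ≤ ·)).image (· - m)

lemma mem_shift {m j : ℕ} {I : Finset ℕ} : j ∈ shift m I ↔ j + m ∈ I := by
  simp only [shift, Finset.mem_image, Finset.mem_filter]
  refine ⟨?_, fun h => ⟨j + m, ⟨h, by omega⟩, by omega⟩⟩
  rintro ⟨i, ⟨hi, hm⟩, rfl⟩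
  rwa [Nat.sub_add_cancel hm]

lemma card_shift (m : ℕ) (I : Finset ℕ) : #(I.filter (· < m)) + #(shift m I) = #I := by
  rw [shift, Finset.card_image_of_injOn, ← Finset.card_filter_add_card_filter_not (s := I) (· < m)]
  · simp only [not_lt]
  · intro a ha b hb hab
    have h1 := (Finset.mem_filter.1 (Finset.mem_coe.1 ha)).2
    have h2 := (Finset.mem_filter.1 (Finset.mem_coe.1 hb)).2
    simp only at hab
    omega

lemma agrees_append {L₁ L₂ : List V} {I : Finset ℕ} {y : ℕ → V} :
    Agrees (L₁ ++ L₂) I y ↔ Agrees L₁ (I.filter (· < L₁.length)) y ∧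
      Agrees L₂ (shift L₁.length I) (fun j => y (j + L₁.length)) := by
  constructor
  · refine fun h => ⟨fun j hj => ?_, fun j hj => ?_⟩
    · obtain ⟨h1, h2⟩ := Finset.mem_filter.1 hj
      rw [← h j h1, List.getElem?_append_left h2]
    · rw [← h _ (mem_shift.1 hj), List.getElem?_append_right (by omega), Nat.add_sub_cancel]
  · rintro ⟨h1, h2⟩ j hj
    by_cases hlt : j < L₁.length
    · rw [List.getElem?_append_left hlt]
      exact h1 j (Finset.mem_filter.2 ⟨hj, hlt⟩)
    · push Not at hlt
      rw [List.getElem?_append_right hlt, h2 (j - L₁.length) (mem_shift.2 (by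
        rwa [Nat.sub_add_cancel hlt]))]
      simp only [Nat.sub_add_cancel hlt]

lemma HasDist.append {m : ℕ} (h₁ : HasDist Φ₁ f₁) (h₂ : HasDist Φ₂ f₂)
    (hm : ∀ L, Φ₁ L → L.length = m) :
    HasDist (fun L => ∃ L₁ L₂, Φ₁ L₁ ∧ Φ₂ L₂ ∧ L = L₁ ++ L₂)
      fun I y => f₁ (I.filter (· < m)) y * f₂ (shift m I) (fun j => y (j + m)) := by
  obtain ⟨ι₁, _, w₁, L₁, hw₁, hs₁, hL₁, hf₁⟩ := h₁
  obtain ⟨ι₂, _, w₂, L₂, hw₂, hs₂, hL₂, hf₂⟩ := h₂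
  refine ⟨ι₁ × ι₂, inferInstance, fun x => w₁ x.1 * w₂ x.2, fun x => L₁ x.1 ++ L₂ x.2,
    fun x => mul_nonneg (hw₁ _) (hw₂ _), ?_, fun x => ⟨_, _, hL₁ _, hL₂ _, rfl⟩, fun I y => ?_⟩
  · rw [Fintype.sum_prod_type]
    simp only [← Finset.mul_sum, hs₂, mul_one, hs₁]
  · refine le_trans (le_of_eq ?_) (mul_le_mul (hf₁ (I.filter (· < m)) y)
      (hf₂ (shift m I) fun j => y (j + m)) (prob_nonneg hw₂ _)
      ((prob_nonneg hw₁ _).trans (hf₁ (I.filter (· < m)) y)))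
    rw [prob, prob, prob, Finset.sum_mul_sum, Fintype.sum_prod_type]
    refine Finset.sum_congr rfl fun i _ => Finset.sum_congr rfl fun j _ => ?_
    simp only [agrees_append, hm _ (hL₁ i)]
    split_ifs <;> simp_all

lemma Agrees.injOn {L : List V} {I : Finset ℕ} {y : ℕ → V} (h : Agrees L I y) (hL : L.Nodup) :
    Set.InjOn y I := by
  intro i hi j hj hij
  have h1 := h i hi
  have h2 := h j hj
  obtain ⟨hi', hi''⟩ := List.getElem?_eq_some_iff.1 h1
  obtain ⟨hj', hj''⟩ := List.getElem?_eq_some_iff.1 h2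
  exact (hL.getElem_inj_iff).1 (hi''.trans (hij.trans hj''.symm))

lemma Agrees.mem {L : List V} {I : Finset ℕ} {y : ℕ → V} (h : Agrees L I y) {j : ℕ} (hj : j ∈ I) :
    y j ∈ L := List.mem_of_getElem? (h j hj)

lemma Agrees.lt {L : List V} {I : Finset ℕ} {y : ℕ → V} (h : Agrees L I y) {j : ℕ} (hj : j ∈ I) :
    j < L.length := (List.getElem?_eq_some_iff.1 (h j hj)).1

lemma Agrees.card_le {L : List V} {I : Finset ℕ} {y : ℕ → V} (h : Agrees L I y) :
    #I ≤ L.length := by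
  have : I ⊆ Finset.range L.length := fun j hj => Finset.mem_range.2 (h.lt hj)
  simpa using Finset.card_le_card this

/-- The bound satisfied by a `K`-spread random arrangement of `m` vertices. -/
noncomputable def spr (m : ℕ) (K : ℝ) (I : Finset ℕ) (_ : ℕ → V) : ℝ :=
  K ^ #I / (m.descFactorial #I : ℝ)

lemma choose_mul_descFactorial {m₁ m₂ s₁ s₂ : ℕ} (h₁ : s₁ ≤ m₁) (h₂ : s₂ ≤ m₂) :
    (m₁ + m₂ - (s₁ + s₂)).choose (m₁ - s₁) * (m₁ + m₂).descFactorial (s₁ + s₂) =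
      (m₁ + m₂).choose m₁ * (m₁.descFactorial s₁ * m₂.descFactorial s₂) := by
  have e1 := Nat.add_choose_mul_factorial_mul_factorial (m₁ - s₁) (m₂ - s₂)
  have e2 := Nat.add_choose_mul_factorial_mul_factorial m₁ m₂
  rw [← Nat.choose_symm_add] at e1 e2
  have e3 := Nat.factorial_mul_descFactorial h₁
  have e4 := Nat.factorial_mul_descFactorial h₂
  have e5 := Nat.factorial_mul_descFactorial (show s₁ + s₂ ≤ m₁ + m₂ by omega)
  rw [show m₁ - s₁ + (m₂ - s₂) = m₁ + m₂ - (s₁ + s₂) by omega] at e1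
  have hp : 0 < (m₁ - s₁).factorial * (m₂ - s₂).factorial :=
    Nat.mul_pos (Nat.factorial_pos _) (Nat.factorial_pos _)
  refine Nat.eq_of_mul_eq_mul_right hp ?_
  rw [← e1, ← e2, ← e3, ← e4] at e5
  convert e5 using 1 <;> ring

/-- Few sets of size `m₁` contain `Y₁` and avoid `Y₂`. -/
lemma card_separating_le {B Y₁ Y₂ : Finset V} {m₁ : ℕ} (hY₁ : Y₁ ⊆ B) (hY₂ : Y₂ ⊆ B)
    (hd : Disjoint Y₁ Y₂) :
    #{S ∈ B.powersetCard m₁ | Y₁ ⊆ S ∧ Disjoint Y₂ S} ≤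
      (#B - (#Y₁ + #Y₂)).choose (m₁ - #Y₁) := by
  have h1 : #(B \ (Y₁ ∪ Y₂)) = #B - (#Y₁ + #Y₂) := by
    rw [Finset.card_sdiff_of_subset (Finset.union_subset hY₁ hY₂), Finset.card_union_of_disjoint hd]
  rw [← h1, ← Finset.card_powersetCard]
  refine Finset.card_le_card_of_injOn (· \ Y₁) (fun S hS => ?_) (fun S hS S' hS' h => ?_)
  · obtain ⟨hS1, hS2, hS3⟩ := Finset.mem_filter.1 (Finset.mem_coe.1 hS)
    obtain ⟨hS4, hS5⟩ := Finset.mem_powersetCard.1 hS1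
    refine Finset.mem_coe.2 (Finset.mem_powersetCard.2 ⟨fun v hv => ?_, ?_⟩)
    · obtain ⟨hv1, hv2⟩ := Finset.mem_sdiff.1 hv
      refine Finset.mem_sdiff.2 ⟨hS4 hv1, fun hv3 => ?_⟩
      rcases Finset.mem_union.1 hv3 with h | h
      · exact hv2 h
      · exact Finset.disjoint_left.1 hS3 h hv1
    · rw [Finset.card_sdiff_of_subset hS2, hS5]
  · have h2 := (Finset.mem_filter.1 (Finset.mem_coe.1 hS)).2.1
    have h3 := (Finset.mem_filter.1 (Finset.mem_coe.1 hS')).2.1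
    rw [← Finset.sdiff_union_of_subset h2, ← Finset.sdiff_union_of_subset h3]
    simp only at h
    rw [h]

/-- Few injections with values in `A` have prescribed values `y` on `J` and avoid `Y`. -/
lemma card_prescribed_le {ℓ : ℕ} {A Y : Finset V} (J : Finset (Fin ℓ)) (y : Fin ℓ → V)
    (𝒞 : Finset (Fin ℓ → V)) (h𝒞 : ∀ c ∈ 𝒞, Function.Injective c ∧ ∀ i, c i ∈ A)
    (hJ : ∀ c ∈ 𝒞, ∀ i ∈ J, c i = y i) (hY : ∀ c ∈ 𝒞, ∀ i, i ∉ J → c i ∉ Y) (hYA : Y ⊆ A) :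
    #𝒞 ≤ (#A - #Y).descFactorial (ℓ - #J) := by
  have h1 : (#A - #Y).descFactorial (ℓ - #J) = Fintype.card ({i // i ∉ J} ↪ {v // v ∈ A \ Y}) := by
    rw [Fintype.card_embedding_eq, Fintype.card_coe, Finset.card_sdiff_of_subset hYA,
      Fintype.card_subtype_compl, Fintype.card_fin, Fintype.card_coe]
  rw [h1, ← Fintype.card_coe]
  refine Fintype.card_le_of_injective (fun c => ⟨fun i => ⟨c.1 i.1, Finset.mem_sdiff.2
    ⟨(h𝒞 c.1 c.2).2 _, hY c.1 c.2 _ i.2⟩⟩, fun i j hij => Subtype.ext ((h𝒞 c.1 c.2).1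
      (Subtype.ext_iff.1 hij))⟩) fun c c' h => Subtype.ext (funext fun i => ?_)
  by_cases hi : i ∈ J
  · rw [hJ c.1 c.2 i hi, hJ c'.1 c'.2 i hi]
  · exact Subtype.ext_iff.1 (DFunLike.congr_fun h ⟨i, hi⟩)

end dist

section step
open Classical

variable {V : Type} {ℓ : ℕ}

/-- The positions of `I` falling in the block of length `ℓ` starting at `m`. -/
def block (ℓ m : ℕ) (I : Finset ℕ) : Finset (Fin ℓ) := {i | (i : ℕ) + m ∈ I}

lemma mem_block {m : ℕ} {I : Finset ℕ} {i : Fin ℓ} : i ∈ block ℓ m I ↔ (i : ℕ) + m ∈ I := by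
  simp [block]

lemma card_block (m : ℕ) (I : Finset ℕ) : #((shift m I).filter (· < ℓ)) = #(block ℓ m I) := by
  symm
  refine Finset.card_bij (fun i _ => (i : ℕ)) (fun i hi => ?_) (fun i _ j _ h => Fin.ext h)
    (fun j hj => ?_)
  · exact Finset.mem_filter.2 ⟨mem_shift.2 (mem_block.1 hi), i.2⟩
  · obtain ⟨h1, h2⟩ := Finset.mem_filter.1 hj
    exact ⟨⟨j, h2⟩, mem_block.2 (mem_shift.1 h1), rfl⟩

/-- Placing `c` in the block starting at `m` is compatible with prescribing `y` on `I`. -/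
def Fitting (c : Fin ℓ → V) (m : ℕ) (I : Finset ℕ) (y : ℕ → V) : Prop :=
  (∀ i ∈ block ℓ m I, c i = y (i + m)) ∧
    ∀ j ∈ I, (∀ i ∈ block ℓ m I, j ≠ i + m) → ∀ i, c i ≠ y j

lemma HasDist.restrict {S : Finset V} {Φ : List V → Prop} {f : Finset ℕ → (ℕ → V) → ℝ}
    (h : HasDist (fun L => Φ L ∧ (L : Multiset V) = S.val) f) (hf : ∀ I y, 0 ≤ f I y) :
    HasDist (fun L => Φ L ∧ (L : Multiset V) = S.val)
      fun I y => if ∀ j ∈ I, y j ∈ S then f I y else 0 := by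
  refine h.mono (fun _ h => h) (fun I y => ?_) (fun I y L hL hA => Or.inl ?_)
  · split_ifs
    · exact hf I y
    · exact le_rfl
  · rw [if_pos]
    intro j hj
    rw [← Finset.mem_val, ← hL.2]
    exact hA.mem hj

set_option maxHeartbeats 1000000 in
/-- Splitting the vertices outside a fixed middle block `c` at random. -/
lemma HasDist.inner {A : Finset V} (c : Fin ℓ → V) (hcA : ∀ i, c i ∉ A) {m₁ m₂ : ℕ}
    (hA : #A = m₁ + m₂) {𝒢 : Finset (Finset V)} (h𝒢 : 𝒢 ⊆ A.powersetCard m₁) {δ : ℝ} (hδ : 0 < δ)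
    (hδ𝒢 : δ * ((m₁ + m₂).choose m₁ : ℕ) ≤ #𝒢) {Φ₁ Φ₂ : Finset V → List V → Prop} {K : ℝ}
    (hK : 0 ≤ K)
    (h₁ : ∀ S ∈ 𝒢, HasDist (fun L => Φ₁ S L ∧ (L : Multiset V) = S.val) (spr m₁ K))
    (h₂ : ∀ S ∈ 𝒢, HasDist (fun L => Φ₂ S L ∧ (L : Multiset V) = (A \ S).val) (spr m₂ K)) :
    HasDist (fun L => ∃ S ∈ 𝒢, ∃ L₁ L₂, (Φ₁ S L₁ ∧ (L₁ : Multiset V) = S.val) ∧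
        (Φ₂ S L₂ ∧ (L₂ : Multiset V) = (A \ S).val) ∧ L = L₁ ++ (List.ofFn c ++ L₂))
      fun I y => if Fitting c m₁ I y then
        K ^ (#I - #(block ℓ m₁ I)) /
          (δ * ((m₁ + m₂).descFactorial (#I - #(block ℓ m₁ I)) : ℕ)) else 0 := by
  have hspr : ∀ m I (y : ℕ → V), 0 ≤ spr m K I y := fun m I y => by unfold spr; positivity
  have hch : 0 < (m₁ + m₂).choose m₁ := Nat.choose_pos (by omega)
  have h𝒢0 : (0 : ℝ) < #𝒢 := lt_of_lt_of_le (by positivity) hδ𝒢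
  have h𝒢1 : 𝒢.Nonempty := Finset.card_pos.1 (Nat.cast_pos.1 h𝒢0)
  have hd : ∀ S ∈ 𝒢, HasDist (fun L => ∃ S ∈ 𝒢, ∃ L₁ L₂, (Φ₁ S L₁ ∧ (L₁ : Multiset V) = S.val) ∧
        (Φ₂ S L₂ ∧ (L₂ : Multiset V) = (A \ S).val) ∧ L = L₁ ++ (List.ofFn c ++ L₂))
      fun I y => (if ∀ j ∈ I.filter (· < m₁), y j ∈ S then spr m₁ K (I.filter (· < m₁)) y else 0) *
        ((if Agrees (List.ofFn c) ((shift m₁ I).filter (· < ℓ)) (fun j => y (j + m₁)) then 1 else 0) *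
          (if ∀ j ∈ shift ℓ (shift m₁ I), y (j + ℓ + m₁) ∈ A \ S then
            spr m₂ K (shift ℓ (shift m₁ I)) (fun j => y (j + ℓ + m₁)) else 0)) := by
    intro S hS
    have e1 := (h₁ S hS).restrict (hspr m₁)
    have e2 := (h₂ S hS).restrict (hspr m₂)
    have e3 := HasDist.append (hasDist_single (Φ := fun L => L = List.ofFn c) rfl) e2 (m := ℓ)
      (fun L hL => by rw [hL, List.length_ofFn])
    have e4 := HasDist.append e1 e3 (m := m₁) (fun L hL => by
      rw [← (Finset.mem_powersetCard.1 (h𝒢 hS)).2, Finset.card_def, ← hL.2, Multiset.coe_card])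
    refine e4.mono ?_ ?_ ?_
    · rintro L ⟨L₁, L', hL₁, ⟨_, L₂, rfl, hL₂, rfl⟩, rfl⟩
      exact ⟨S, hS, L₁, L₂, hL₁, hL₂, rfl⟩
    · intro I y
      refine mul_nonneg ?_ (mul_nonneg ?_ ?_) <;> split_ifs <;> first | exact hspr _ _ _ | norm_num
    · exact fun I y L _ _ => Or.inl le_rfl
  refine (HasDist.bind_uniform h𝒢1 hd).mono (fun _ h => h) (fun I y => ?_) ?_
  · split_ifs
    · positivity
    · exact le_rfl
  rintro I y L ⟨S₀, hS₀, L₁, L₂, ⟨-, hL₁⟩, ⟨-, hL₂⟩, rfl⟩ hag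
  refine Or.inl ?_
  obtain ⟨hSA, hSc⟩ := Finset.mem_powersetCard.1 (h𝒢 hS₀)
  have hl1 : L₁.length = m₁ := by
    rw [← hSc, Finset.card_def, ← hL₁, Multiset.coe_card]
  have hl2 : L₂.length = m₂ := by
    have : #(A \ S₀) = m₂ := by rw [Finset.card_sdiff_of_subset hSA, hSc, hA]; omega
    rw [← this, Finset.card_def, ← hL₂, Multiset.coe_card]
  have hn1 : L₁.Nodup := by rw [← Multiset.coe_nodup, hL₁]; exact S₀.nodup
  have hn2 : L₂.Nodup := by rw [← Multiset.coe_nodup, hL₂]; exact (A \ S₀).nodup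
  have hm1 : ∀ v, v ∈ L₁ → v ∈ S₀ := fun v hv => by rwa [← Finset.mem_val, ← hL₁]
  have hm2 : ∀ v, v ∈ L₂ → v ∈ A \ S₀ := fun v hv => by rwa [← Finset.mem_val, ← hL₂]
  obtain ⟨ha1, ha'⟩ := agrees_append.1 hag
  obtain ⟨hac, ha2⟩ := agrees_append.1 ha'
  simp only [List.length_ofFn, hl1] at ha1 hac ha2
  set I₁ := I.filter (· < m₁) with hI₁
  set I₂ := shift ℓ (shift m₁ I) with hI₂
  have hs : #I₁ + #I₂ = #I - #(block ℓ m₁ I) := by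
    have e1 := card_shift m₁ I
    have e2 := card_shift ℓ (shift m₁ I)
    rw [card_block, ← hI₂] at e2
    rw [← hI₁] at e1
    omega
  have hfit : Fitting c m₁ I y := by
    refine ⟨fun i hi => ?_, fun j hj hji i => ?_⟩
    · have := hac i (Finset.mem_filter.2 ⟨mem_shift.2 (mem_block.1 hi), i.2⟩)
      rw [List.getElem?_ofFn] at this
      simpa using this
    · have hjA : y j ∈ A := by
        by_cases h1 : j < m₁
        · exact hSA (hm1 _ (ha1.mem (Finset.mem_filter.2 ⟨hj, h1⟩)))
        · by_cases h2 : j < m₁ + ℓ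
          · exact absurd (by simp; omega) (hji ⟨j - m₁, by omega⟩ (mem_block.2 (by
              simp only; rwa [Nat.sub_add_cancel (by omega)])))
          · have h3 := ha2.mem (j := j - m₁ - ℓ) (mem_shift.2 (mem_shift.2 (by
              rwa [show j - m₁ - ℓ + ℓ + m₁ = j by omega])))
            simp only [show j - m₁ - ℓ + ℓ + m₁ = j by omega] at h3
            exact (Finset.mem_sdiff.1 (hm2 _ h3)).1
      exact fun h => hcA i (h ▸ hjA)
  rw [if_pos hfit, ← hs]
  set Y₁ := I₁.image y with hY₁
  set Y₂ := I₂.image (fun j => y (j + ℓ + m₁)) with hY₂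
  have hc1 : #Y₁ = #I₁ := Finset.card_image_of_injOn (ha1.injOn hn1)
  have hc2 : #Y₂ = #I₂ := Finset.card_image_of_injOn (ha2.injOn hn2)
  have hY1 : Y₁ ⊆ S₀ := Finset.image_subset_iff.2 fun j hj => hm1 _ (ha1.mem hj)
  have hY2 : Y₂ ⊆ A \ S₀ := Finset.image_subset_iff.2 fun j hj => hm2 _ (ha2.mem hj)
  have hcount := card_separating_le (m₁ := m₁) (hY1.trans hSA) (hY2.trans Finset.sdiff_subset)
    (Finset.disjoint_of_subset_left hY1 (Finset.disjoint_of_subset_right hY2 Finset.disjoint_sdiff))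
  rw [hc1, hc2, hA] at hcount
  set B : ℝ := spr m₁ K I₁ y * spr m₂ K I₂ (fun j => y (j + ℓ + m₁)) with hB
  have hB0 : 0 ≤ B := mul_nonneg (hspr _ _ _) (hspr _ _ _)
  have hsum : (∑ S ∈ 𝒢, (if ∀ j ∈ I₁, y j ∈ S then spr m₁ K I₁ y else 0) *
        ((if Agrees (List.ofFn c) ((shift m₁ I).filter (· < ℓ)) (fun j => y (j + m₁)) then 1 else 0) *
          (if ∀ j ∈ I₂, y (j + ℓ + m₁) ∈ A \ S then
            spr m₂ K I₂ (fun j => y (j + ℓ + m₁)) else 0))) ≤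
      ((m₁ + m₂ - (#I₁ + #I₂)).choose (m₁ - #I₁) : ℕ) * B := by
    calc _ ≤ ∑ S ∈ 𝒢, if Y₁ ⊆ S ∧ Disjoint Y₂ S then B else 0 := by
          refine Finset.sum_le_sum fun S _ => ?_
          by_cases hb1 : ∀ j ∈ I₁, y j ∈ S
          · by_cases hb2 : ∀ j ∈ I₂, y (j + ℓ + m₁) ∈ A \ S
            · rw [if_pos hb1, if_pos hb2, if_pos hac, one_mul, if_pos]
              refine ⟨Finset.image_subset_iff.2 hb1, Finset.disjoint_left.2 fun v hv => ?_⟩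
              obtain ⟨j, hj, rfl⟩ := Finset.mem_image.1 hv
              exact (Finset.mem_sdiff.1 (hb2 j hj)).2
            · rw [if_neg hb2, mul_zero, mul_zero]
              split_ifs
              · exact hB0
              · exact le_rfl
          · rw [if_neg hb1, zero_mul]
            split_ifs
            · exact hB0
            · exact le_rfl
      _ = #{S ∈ 𝒢 | Y₁ ⊆ S ∧ Disjoint Y₂ S} * B := by
          rw [← Finset.sum_filter, Finset.sum_const, nsmul_eq_mul]
      _ ≤ _ := by
          gcongr
          refine le_trans (Finset.card_le_card ?_) hcount
          exact Finset.filter_subset_filter _ h𝒢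
  have hI1 : #I₁ ≤ m₁ := hl1 ▸ ha1.card_le
  have hI2 : #I₂ ≤ m₂ := hl2 ▸ ha2.card_le
  have hid : (((m₁ + m₂ - (#I₁ + #I₂)).choose (m₁ - #I₁) : ℕ) : ℝ) *
      ((m₁ + m₂).descFactorial (#I₁ + #I₂) : ℕ) = ((m₁ + m₂).choose m₁ : ℕ) *
      ((m₁.descFactorial #I₁ : ℕ) * (m₂.descFactorial #I₂ : ℕ)) := by
    exact_mod_cast choose_mul_descFactorial hI1 hI2
  have hp0 : (0 : ℝ) < ((m₁ + m₂).descFactorial (#I₁ + #I₂) : ℕ) :=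
    Nat.cast_pos.2 (Nat.descFactorial_pos.2 (by omega))
  have hp1 : (0 : ℝ) < (m₁.descFactorial #I₁ : ℕ) := Nat.cast_pos.2 (Nat.descFactorial_pos.2 hI1)
  have hp2 : (0 : ℝ) < (m₂.descFactorial #I₂ : ℕ) := Nat.cast_pos.2 (Nat.descFactorial_pos.2 hI2)
  have hch' : (0 : ℝ) < ((m₁ + m₂).choose m₁ : ℕ) := Nat.cast_pos.2 hch
  rw [div_le_div_iff₀ h𝒢0 (by positivity)]
  have hBe : B * ((m₁.descFactorial #I₁ : ℕ) * (m₂.descFactorial #I₂ : ℕ)) = K ^ (#I₁ + #I₂) := by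
    rw [hB, spr, spr, pow_add]
    field_simp
  calc _ ≤ (((m₁ + m₂ - (#I₁ + #I₂)).choose (m₁ - #I₁) : ℕ) : ℝ) * B *
        (δ * ((m₁ + m₂).descFactorial (#I₁ + #I₂) : ℕ)) := by gcongr
    _ = K ^ (#I₁ + #I₂) * (δ * ((m₁ + m₂).choose m₁ : ℕ)) := by
        rw [← hBe]; linear_combination B * δ * hid
    _ ≤ K ^ (#I₁ + #I₂) * #𝒢 := by gcongr

end step

section step
open Classical

variable {V : Type} {ℓ : ℕ}

/-- Choosing the middle block at random. -/
lemma HasDist.outer {A : Finset V} {m m₁ : ℕ} (hA : #A = m) {𝒞 : Finset (Fin ℓ → V)}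
    (h𝒞 : ∀ c ∈ 𝒞, Function.Injective c ∧ ∀ i, c i ∈ A) (h𝒞0 : 𝒞.Nonempty) {γ δ K K' : ℝ}
    (hK : 0 ≤ K) (hcard : γ * (m.descFactorial ℓ : ℕ) ≤ #𝒞) {Φ : List V → Prop}
    (h : ∀ c ∈ 𝒞, HasDist (fun L => Φ L ∧ (L : Multiset V) = A.val)
      fun I y => if Fitting c m₁ I y then
        K' ^ (#I - #(block ℓ m₁ I)) /
          (δ * ((m - ℓ).descFactorial (#I - #(block ℓ m₁ I)) : ℕ)) else 0)
    (hnum : ∀ s₀ s' : ℕ, 1 ≤ s₀ + s' → s₀ ≤ ℓ → s' ≤ m - ℓ → ∀ N c : ℝ, 0 ≤ N → N ≤ c →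
      N ≤ ((m - (s₀ + s')).descFactorial (ℓ - s₀) : ℕ) → γ * (m.descFactorial ℓ : ℕ) ≤ c →
      N / c * (K' ^ s' / (δ * ((m - ℓ).descFactorial s' : ℕ))) ≤
        K ^ (s₀ + s') / (m.descFactorial (s₀ + s') : ℕ)) :
    HasDist (fun L => Φ L ∧ (L : Multiset V) = A.val) (spr m K) := by
  have hspr : ∀ I (y : ℕ → V), 0 ≤ spr m K I y := fun I y => by unfold spr; positivity
  refine (HasDist.bind_uniform h𝒞0 h).mono (fun _ h => h) hspr fun I y L hL hag => ?_
  rcases I.eq_empty_or_nonempty with rfl | hI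
  · right; simp [spr]
  left
  have hn : L.Nodup := by rw [← Multiset.coe_nodup, hL.2]; exact A.nodup
  have hbI : #(block ℓ m₁ I) ≤ #I := by
    have := card_shift m₁ I
    rw [← card_block]
    have := Finset.card_filter_le (shift m₁ I) (· < ℓ)
    omega
  have hbℓ : #(block ℓ m₁ I) ≤ ℓ := (Finset.card_le_univ _).trans_eq (Fintype.card_fin ℓ)
  rw [← Finset.sum_filter, Finset.sum_const, nsmul_eq_mul, mul_div_right_comm]
  set s' := #I - #(block ℓ m₁ I) with hs'
  rcases le_or_gt s' (m - ℓ) with hle | hlt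
  · have hsum : #(block ℓ m₁ I) + s' = #I := by omega
    have h1 := hnum #(block ℓ m₁ I) s' (by rw [hsum]; exact hI.card_pos) hbℓ hle
      #{c ∈ 𝒞 | Fitting c m₁ I y} #𝒞 (Nat.cast_nonneg _)
      (Nat.cast_le.2 (Finset.card_filter_le _ _)) (by
        rw [hsum]
        have h2 : #(I.image y) = #I := Finset.card_image_of_injOn (hag.injOn hn)
        rw [← h2, ← hA]
        refine Nat.cast_le.2 (card_prescribed_le (block ℓ m₁ I) (fun i => y (i + m₁)) _
          (fun c hc => h𝒞 c (Finset.mem_filter.1 hc).1)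
          (fun c hc => (Finset.mem_filter.1 hc).2.1) (fun c hc i hi hmem => ?_)
          (Finset.image_subset_iff.2 fun j hj => ?_))
        · obtain ⟨hc1, hc2, hc3⟩ := Finset.mem_filter.1 hc
          obtain ⟨j, hj, hij⟩ := Finset.mem_image.1 hmem
          refine hc3 j hj (fun i' hi' hji => ?_) i hij.symm
          have := hc2 i' hi'
          rw [← hji, hij] at this
          exact hi ((h𝒞 c hc1).1 this ▸ hi')
        · rw [← Finset.mem_val, ← hL.2]; exact hag.mem hj) hcard
    rw [hsum] at h1
    exact h1
  · rw [Nat.descFactorial_eq_zero_iff_lt.2 hlt]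
    simpa using hspr I y

lemma one_div_one_sub_le {u : ℝ} (h0 : 0 ≤ u) (h1 : u ≤ 3 / 4) : 1 / (1 - u) ≤ Real.exp (4 * u) := by
  rw [div_le_iff₀ (by linarith)]
  have := Real.add_one_le_exp (4 * u)
  have h2 : (4 * u + 1) * (1 - u) ≤ Real.exp (4 * u) * (1 - u) := by
    gcongr
    linarith
  nlinarith

set_option maxHeartbeats 1000000 in
/-- The numerical inequality behind the recursion. -/
lemma spread_step {ℓ m : ℕ} (hℓ : 1 ≤ ℓ) (hm : 4 * ℓ + 4 ≤ m) {γ K : ℝ} (hγ : 0 < γ) (hγ1 : γ ≤ 1) {a : ℝ}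
    (ha : 4 * ℓ * (ℓ + 1) + 4 + 2 * Real.log (1 / γ) ≤ a) (hK : 2 / γ ≤ K)
    {s₀ s' : ℕ} (hs : 1 ≤ s₀ + s') (hs₀ : s₀ ≤ ℓ) (hs' : s' ≤ m - ℓ) {N c : ℝ}
    (hNc : N ≤ c) (hNT : N ≤ ((m - (s₀ + s')).descFactorial (ℓ - s₀) : ℕ))
    (hc : γ * (m.descFactorial ℓ : ℕ) ≤ c) :
    N / c * ((K * Real.exp (-a / m)) ^ s' / ((1 - 1 / m) * ((m - ℓ).descFactorial s' : ℕ))) ≤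
      K ^ (s₀ + s') / (m.descFactorial (s₀ + s') : ℕ) := by
  set P : ℝ := ((m.descFactorial (s₀ + s') : ℕ) : ℝ) with hP
  set Q : ℝ := (((m - ℓ).descFactorial s' : ℕ) : ℝ) with hQ
  set R : ℝ := ((m.descFactorial ℓ : ℕ) : ℝ) with hR
  set T : ℝ := (((m - (s₀ + s')).descFactorial (ℓ - s₀) : ℕ) : ℝ) with hT
  have hP0 : 0 < P := Nat.cast_pos.2 (Nat.descFactorial_pos.2 (by omega))
  have hQ0 : 0 < Q := Nat.cast_pos.2 (Nat.descFactorial_pos.2 hs')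
  have hR0 : 0 < R := Nat.cast_pos.2 (Nat.descFactorial_pos.2 (by omega))
  have hc0 : 0 < c := (mul_pos hγ hR0).trans_le hc
  have hPT : T * P = Q * R := by
    have e1 := Nat.descFactorial_mul_descFactorial (n := m) (show s₀ + s' ≤ ℓ + s' by omega)
    have e2 := Nat.descFactorial_mul_descFactorial (n := m) (show ℓ ≤ ℓ + s' by omega)
    rw [show ℓ + s' - (s₀ + s') = ℓ - s₀ by omega] at e1
    rw [show ℓ + s' - ℓ = s' by omega] at e2
    rw [hT, hP, hQ, hR]
    exact_mod_cast e1.trans e2.symm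
  have hm0 : (8 : ℝ) ≤ m := by exact_mod_cast (by omega : 8 ≤ m)
  have hinv : (1 : ℝ) / m ≤ 1 / 8 := one_div_le_one_div_of_le (by norm_num) hm0
  have hinv0 : (0 : ℝ) < 1 / m := by positivity
  set δ : ℝ := 1 - 1 / m with hδ
  have hδ0 : 0 < δ := by linarith
  have hδ2 : 1 / δ ≤ 2 := by rw [div_le_iff₀ hδ0]; linarith
  have hlog : 0 ≤ Real.log (1 / γ) := Real.log_nonneg (by rw [le_div_iff₀ hγ]; linarith)
  have ha0 : 0 ≤ a := le_trans (by positivity) ha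
  have h2γ : 2 ≤ 2 / γ := by rw [le_div_iff₀ hγ]; linarith
  have hK1 : 1 ≤ K := by linarith
  have hexp1 : Real.exp (-a / m) ≤ 1 := Real.exp_le_one_iff.2 (by
    rw [neg_div]; have : 0 ≤ a / m := by positivity
    linarith)
  have hexp0 : 0 < Real.exp (-a / m) := Real.exp_pos _
  have hNQ : N / c ≤ Q / (γ * P) := by
    rw [div_le_div_iff₀ hc0 (by positivity)]
    calc N * (γ * P) ≤ T * (γ * P) := by gcongr
      _ = Q * (γ * R) := by linear_combination γ * hPT
      _ ≤ Q * c := by gcongr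
  have hNQ' : N / c * ((K * Real.exp (-a / m)) ^ s' / (δ * Q)) ≤
      (K * Real.exp (-a / m)) ^ s' * (1 / γ) * (1 / δ) / P := by
    calc _ ≤ Q / (γ * P) * ((K * Real.exp (-a / m)) ^ s' / (δ * Q)) := by gcongr
      _ = _ := by field_simp
  rcases Nat.eq_zero_or_pos s₀ with h0 | h0
  · subst h0
    rw [zero_add] at *
    have hs1 : (1 : ℝ) ≤ s' := by exact_mod_cast hs
    have hpow : (K * Real.exp (-a / m)) ^ s' = K ^ s' * Real.exp (-(a * (s' / m))) := by
      rw [mul_pow, ← Real.exp_nat_mul]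
      congr 2; ring
    have hδe : 1 / δ ≤ Real.exp (4 * (s' / m)) := by
      refine (one_div_one_sub_le hinv0.le (by linarith)).trans (Real.exp_le_exp.2 ?_)
      gcongr
    have hfin : ∀ X : ℝ, X ≤ Real.exp ((4 * ℓ * (ℓ + 1) + 2 * Real.log (1 / γ)) * (s' / m)) →
        (K * Real.exp (-a / m)) ^ s' * X * (1 / δ) / P ≤ K ^ s' / P := by
      intro X hX
      gcongr
      rw [hpow]
      calc K ^ s' * Real.exp (-(a * (s' / m))) * X * (1 / δ) ≤
          K ^ s' * Real.exp (-(a * (s' / m))) *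
            Real.exp ((4 * ℓ * (ℓ + 1) + 2 * Real.log (1 / γ)) * (s' / m)) *
            Real.exp (4 * (s' / m)) := by gcongr
        _ = K ^ s' * Real.exp ((4 * ℓ * (ℓ + 1) + 4 + 2 * Real.log (1 / γ) - a) * (s' / m)) := by
            rw [mul_assoc, mul_assoc, ← Real.exp_add, ← Real.exp_add]
            congr 2; ring
        _ ≤ K ^ s' * 1 := by
            gcongr
            exact Real.exp_le_one_iff.2 (mul_nonpos_of_nonpos_of_nonneg (by linarith) (by positivity))
        _ = K ^ s' := mul_one _
    rcases le_or_gt (2 * s') m with hsm | hsm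
    · have hRT : R / T ≤ Real.exp (4 * ℓ * (ℓ + 1) * (s' / m)) := by
        have hR1 : R ≤ (m : ℝ) ^ ℓ := by rw [hR]; exact_mod_cast Nat.descFactorial_le_pow m ℓ
        have hT1 : ((m - s' - ℓ : ℕ) : ℝ) ^ ℓ ≤ T := by
          rw [hT]
          have h1 : (m - s' - ℓ) ^ ℓ ≤ (m - s' + 1 - ℓ) ^ ℓ := Nat.pow_le_pow_left (by omega) _
          exact_mod_cast h1.trans (Nat.pow_sub_le_descFactorial _ _)
        have hcast : ((m - s' - ℓ : ℕ) : ℝ) = m - s' - ℓ := by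
          rw [Nat.cast_sub (by omega), Nat.cast_sub (by omega)]
        have hsm' : 2 * (s' : ℝ) ≤ m := by exact_mod_cast hsm
        have hmℓ : 4 * (ℓ : ℝ) + 4 ≤ m := by exact_mod_cast hm
        have hpos : (0 : ℝ) < m - s' - ℓ := by linarith
        have hu : (s' + ℓ : ℝ) / m ≤ 3 / 4 := by rw [div_le_iff₀ (by linarith)]; linarith
        have h1 := one_div_one_sub_le (u := (s' + ℓ : ℝ) / m) (by positivity) hu
        calc R / T ≤ (m : ℝ) ^ ℓ / (m - s' - ℓ) ^ ℓ := by
              rw [← hcast]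
              have : (0 : ℝ) < ((m - s' - ℓ : ℕ) : ℝ) := by rw [hcast]; exact hpos
              gcongr
          _ = (1 / (1 - (s' + ℓ : ℝ) / m)) ^ ℓ := by
              rw [← div_pow]
              congr 1
              rw [eq_div_iff (by
                have : 0 < 1 - (s' + ℓ : ℝ) / m := by linarith
                exact this.ne')]
              field_simp
              ring
          _ ≤ (Real.exp (4 * ((s' + ℓ : ℝ) / m))) ^ ℓ := by
              refine pow_le_pow_left₀ ?_ h1 ℓ
              have : 0 < 1 - (s' + ℓ : ℝ) / m := by linarith
              positivity
          _ = Real.exp (ℓ * (4 * ((s' + ℓ : ℝ) / m))) := by rw [← Real.exp_nat_mul]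
          _ ≤ _ := by
              refine Real.exp_le_exp.2 ?_
              have : (s' + ℓ : ℝ) ≤ (ℓ + 1) * s' := by nlinarith [(Nat.cast_nonneg ℓ : (0 : ℝ) ≤ ℓ)]
              calc (ℓ : ℝ) * (4 * ((s' + ℓ : ℝ) / m)) ≤ ℓ * (4 * (((ℓ + 1) * s') / m)) := by gcongr
                _ = _ := by ring
      have hT0 : 0 < T := Nat.cast_pos.2 (Nat.descFactorial_pos.2 (by omega))
      have hle : N / c ≤ 1 := (div_le_one hc0).2 hNc
      have h3 := hfin (R / T) (hRT.trans (Real.exp_le_exp.2 (by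
        have : 0 ≤ 2 * Real.log (1 / γ) * (s' / m) := by positivity
        linarith)))
      refine le_trans ?_ h3
      calc N / c * ((K * Real.exp (-a / m)) ^ s' / (δ * Q)) ≤
          1 * ((K * Real.exp (-a / m)) ^ s' / (δ * Q)) := by gcongr
        _ = (K * Real.exp (-a / m)) ^ s' * (1 / Q) * (1 / δ) := by field_simp
        _ = (K * Real.exp (-a / m)) ^ s' * ((R / T) / P) * (1 / δ) := by
            congr 2
            rw [div_div, div_eq_div_iff hQ0.ne' (by positivity)]
            linarith
        _ = _ := by ring
    · refine hNQ'.trans (hfin _ ?_)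
      have hsm' : (m : ℝ) ≤ 2 * s' := by exact_mod_cast hsm.le
      have h1 : 1 ≤ 2 * ((s' : ℝ) / m) := by
        rw [← mul_div_assoc, le_div_iff₀ (by linarith)]; linarith
      rw [← Real.exp_log (show 0 < 1 / γ by positivity)]
      refine Real.exp_le_exp.2 ?_
      rw [Real.log_exp]
      have h2 : 0 ≤ (4 : ℝ) * ℓ * (ℓ + 1) * (s' / m) := by positivity
      nlinarith
  · refine hNQ'.trans ?_
    gcongr
    calc (K * Real.exp (-a / m)) ^ s' * (1 / γ) * (1 / δ) ≤ (K * 1) ^ s' * (1 / γ) * 2 := by gcongr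
      _ = K ^ s' * (2 / γ) := by ring
      _ ≤ K ^ s' * K := by gcongr
      _ = K ^ (s' + 1) := (pow_succ _ _).symm
      _ ≤ K ^ (s₀ + s') := pow_le_pow_right₀ hK1 (by omega)

end step

section spread
open Classical

variable {V : Type} {G : SimpleGraph V} {lev : V → ℕ} {ℓ q : ℕ} {μ ν : ℝ} {s t : List V}
  {A : Finset V}

lemma HasDist.spr_mono {Φ : List V → Prop} {m : ℕ} {K K' : ℝ} (h : HasDist Φ (spr m K)) (hK : 0 ≤ K)
    (hKK : K ≤ K') : HasDist Φ (spr m K') := by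
  have hK' := hK.trans hKK
  refine h.mono (fun _ h => h) (fun I y => by unfold spr; positivity) fun I y L _ _ => Or.inl ?_
  unfold spr
  gcongr

lemma val_add_ofFn {c : Fin ℓ → V} (hc : Function.Injective c) (hcA : ∀ i, c i ∈ A) :
    (A \ Finset.univ.image c).val + (List.ofFn c : Multiset V) = A.val := by
  have h1 : (List.ofFn c : Multiset V) = (Finset.univ.image c).val := by
    rw [Finset.image_val_of_injOn hc.injOn, Fin.univ_val_map]
  rw [h1, Finset.sdiff_val]
  exact tsub_add_cancel_of_le (Finset.val_le_iff.2 (Finset.image_subset_iff.2 fun i _ => hcA i))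

lemma injective_of_mem_cliques {c : Fin ℓ → V} (hc : c ∈ cliques G lev ℓ q A) :
    Function.Injective c := by
  intro i j hij
  by_contra hne
  exact ((mem_cliques.1 hc).2.2 i j hne).ne hij

set_option maxHeartbeats 1000000 in
/-- One step of the recursion: a random middle clique and a random split. -/
lemma Frame.hasDist_step (hℓ : 1 ≤ ℓ) (hF : Frame G lev ℓ q μ ν s A t) (hm : 4 * ℓ + 4 ≤ #A)
    {γ a K : ℝ} (hγ : 0 < γ) (hγ1 : γ ≤ 1)
    (ha : 4 * ℓ * (ℓ + 1) + 4 + 2 * Real.log (1 / γ) ≤ a) (hK : 2 / γ ≤ K)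
    (hcard : γ * ((#A).descFactorial ℓ : ℕ) ≤ #(cliques G lev ℓ q A))
    (hsplit : ∀ A' ⊆ A, #A' < #A → #A ≤ #A' + ℓ →
      (1 - 1 / (#A : ℝ)) * #(A'.powersetCard (#A' / 2)) ≤
        #{S ∈ A'.powersetCard (#A' / 2) |
          GoodAt G lev ℓ q μ ν (fun x => x ∈ A ∪ s.toFinset ∪ t.toFinset) S ∧
          GoodAt G lev ℓ q μ ν (fun x => x ∈ A ∪ s.toFinset ∪ t.toFinset) (A' \ S)})
    (ih : ∀ (s' t' : List V) (S : Finset V), 2 * #S ≤ #A → #A ≤ 2 * #S + ℓ + 1 →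
      Frame G lev ℓ q μ ν s' S t' →
      HasDist (fun L => IsPow G (ℓ + 1) (s' ++ L ++ t') ∧ (L : Multiset V) = S.val)
        (spr #S (K * Real.exp (-a / #A)))) :
    HasDist (fun L => IsPow G (ℓ + 1) (s ++ L ++ t) ∧ (L : Multiset V) = A.val) (spr #A K) := by
  have hK0 : 0 < K := lt_of_lt_of_le (by positivity) hK
  have hm8 : (8 : ℝ) ≤ #A := by exact_mod_cast (by omega : 8 ≤ #A)
  have hδ : (0 : ℝ) < 1 - 1 / #A := by
    rw [sub_pos, div_lt_one (by linarith)]; linarith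
  have hC0 : (cliques G lev ℓ q A).Nonempty := by
    rw [← Finset.card_pos, ← Nat.cast_pos (α := ℝ)]
    refine lt_of_lt_of_le (mul_pos hγ (Nat.cast_pos.2 (Nat.descFactorial_pos.2 (by omega)))) hcard
  refine HasDist.outer rfl (m₁ := (#A - ℓ) / 2)
    (fun c hc => ⟨injective_of_mem_cliques hc, (mem_cliques.1 hc).1⟩) hC0 hK0.le hcard
    (K' := K * Real.exp (-a / #A)) (δ := 1 - 1 / #A) (fun c hc => ?_)
    (fun s₀ s' h1 h2 h3 N c _ h5 h6 h7 => spread_step hℓ hm hγ hγ1 ha hK h1 h2 h3 h5 h6 h7)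
  have hinj := injective_of_mem_cliques hc
  obtain ⟨hcA, hcq, hcadj⟩ := mem_cliques.1 hc
  set B := Finset.univ.image c with hB
  have hBA : B ⊆ A := Finset.image_subset_iff.2 fun i _ => hcA i
  have hBc : #B = ℓ := by rw [hB, Finset.card_image_of_injective _ hinj]; simp
  have hA'c : #(A \ B) = #A - ℓ := by rw [Finset.card_sdiff_of_subset hBA, hBc]
  have hcl : (List.ofFn c).length = ℓ := List.length_ofFn
  have hcp : IsPow G (ℓ + 1) (List.ofFn c) := by
    intro i j x y hij _ hx hy
    rw [List.getElem?_eq_some_iff] at hx hy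
    obtain ⟨hi, rfl⟩ := hx
    obtain ⟨hj, rfl⟩ := hy
    rw [List.getElem_ofFn, List.getElem_ofFn]
    exact hcadj _ _ (by simp; omega)
  have hct : ∀ v ∈ List.ofFn c, lev v = q := by
    simp only [List.mem_ofFn]
    rintro _ ⟨i, rfl⟩
    exact hcq i
  have hcD : ∀ v ∈ (List.ofFn c).toFinset, v ∈ A := by
    simp only [List.mem_toFinset, List.mem_ofFn]
    rintro _ ⟨i, rfl⟩
    exact hcA i
  have hsp := hsplit (A \ B) Finset.sdiff_subset (by omega) (by omega)
  rw [hA'c] at hsp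
  set m₁ := (#A - ℓ) / 2 with hm₁
  set m₂ := #A - ℓ - m₁ with hm₂
  have hmm : m₁ + m₂ = #A - ℓ := by omega
  set 𝒢 := {S ∈ (A \ B).powersetCard m₁ |
          GoodAt G lev ℓ q μ ν (fun x => x ∈ A ∪ s.toFinset ∪ t.toFinset) S ∧
          GoodAt G lev ℓ q μ ν (fun x => x ∈ A ∪ s.toFinset ∪ t.toFinset) ((A \ B) \ S)} with h𝒢
  have hmem : ∀ S ∈ 𝒢, S ⊆ A \ B ∧ #S = m₁ ∧
      GoodAt G lev ℓ q μ ν (fun x => x ∈ A ∪ s.toFinset ∪ t.toFinset) S ∧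
      GoodAt G lev ℓ q μ ν (fun x => x ∈ A ∪ s.toFinset ∪ t.toFinset) ((A \ B) \ S) := by
    intro S hS
    obtain ⟨h1, h2⟩ := Finset.mem_filter.1 hS
    obtain ⟨h3, h4⟩ := Finset.mem_powersetCard.1 h1
    exact ⟨h3, h4, h2⟩
  have hin := HasDist.inner (ℓ := ℓ) (A := A \ B) c
    (fun i hi => (Finset.mem_sdiff.1 hi).2 (Finset.mem_image_of_mem _ (Finset.mem_univ i)))
    (m₁ := m₁) (m₂ := m₂) (by omega) (𝒢 := 𝒢) (Finset.filter_subset _ _) hδ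
    (by
      rw [Finset.card_powersetCard, hA'c] at hsp
      rw [hmm]; exact hsp)
    (Φ₁ := fun _ L => IsPow G (ℓ + 1) (s ++ L ++ List.ofFn c))
    (Φ₂ := fun _ L => IsPow G (ℓ + 1) (List.ofFn c ++ L ++ t))
    (K := K * Real.exp (-a / #A)) (by positivity)
    (fun S hS => by
      obtain ⟨h1, h2, h3, -⟩ := hmem S hS
      rw [← h2]
      refine ih _ _ S (by omega) (by omega) ⟨hF.len_left, hcl, hF.pow_left, hcp, hF.top_left, hct, ?_⟩
      refine h3.mono (fun v hv => ?_) (fun v hv => by simp [hv]) le_rfl le_rfl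
      simp only [Finset.mem_union] at hv ⊢
      rcases hv with (hv | hv) | hv
      · exact Or.inl (Or.inl (Finset.mem_sdiff.1 (h1 hv)).1)
      · exact Or.inl (Or.inr hv)
      · exact Or.inl (Or.inl (hcD v hv)))
    (fun S hS => by
      obtain ⟨h1, h2, -, h3⟩ := hmem S hS
      have h4 : #((A \ B) \ S) = m₂ := by rw [Finset.card_sdiff_of_subset h1, hA'c, h2]
      rw [← h4]
      refine ih _ _ _ (by omega) (by omega)
        ⟨hcl, hF.len_right, hcp, hF.pow_right, hct, hF.top_right, ?_⟩
      refine h3.mono (fun v hv => ?_) (fun v hv => by simp [Finset.mem_sdiff.1 hv]) le_rfl le_rfl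
      simp only [Finset.mem_union] at hv ⊢
      rcases hv with (hv | hv) | hv
      · exact Or.inl (Or.inl (Finset.mem_sdiff.1 (Finset.mem_sdiff.1 hv).1).1)
      · exact Or.inl (Or.inl (hcD v hv))
      · exact Or.inr hv)
  rw [hmm] at hin
  refine hin.mono ?_ (fun I y => by split_ifs <;> positivity) (fun I y L _ _ => Or.inl le_rfl)
  rintro L ⟨S, hS, L₁, L₂, ⟨h1, h2⟩, ⟨h3, h4⟩, rfl⟩
  obtain ⟨hSA, -⟩ := hmem S hS
  constructor
  · have := IsPow.glue (l := s ++ L₁) (e := List.ofFn c) (r := L₂ ++ t) h1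
      (by rwa [← List.append_assoc]) (by rw [hcl])
    simpa [List.append_assoc] using this
  · rw [← Multiset.coe_add, ← Multiset.coe_add, h2, h4]
    have h5 : ((A \ B) \ S).val + S.val = (A \ B).val := by
      rw [Finset.sdiff_val]
      exact tsub_add_cancel_of_le (Finset.val_le_iff.2 hSA)
    rw [← val_add_ofFn hinj hcA, ← h5]
    abel

/-- The arrangements of a large frame carry a spread distribution. -/
theorem Frame.hasDist {ℓ q : ℕ} (hℓ : 2 ≤ ℓ) (hq1 : 1 ≤ q) {μ ν : ℝ} (hμ : 0 < μ) (hμ1 : μ ≤ 1)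
    (hν0 : 0 ≤ ν) (hν : ν ≤ μ / 128) (hqμ : 1 / (((ℓ : ℝ) + 1) * q) ≤ μ / 64) :
    ∃ (M : ℕ) (K : ℝ), 1 ≤ K ∧ ∀ (V : Type) (G : SimpleGraph V) (lev : V → ℕ) (s t : List V)
      (A : Finset V), M ≤ #A → Frame G lev ℓ q μ ν s A t →
      HasDist (fun L => IsPow G (ℓ + 1) (s ++ L ++ t) ∧ (L : Multiset V) = A.val) (spr #A K) := by
  obtain ⟨m₁, hm₁⟩ := Frame.exists_path hℓ hq1 hμ hμ1 hν0 hν hqμ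
  obtain ⟨m₂, hm₂⟩ := exists_rt_inv_le (x := μ / 128) (by linarith)
  obtain ⟨m₃, hm₃⟩ := exists_good_split ℓ q hq1 hν0 (by linarith) (1 + 2 * ℓ)
  set M₁ := m₁ + 1 with hM₁
  set M₂ := 2 * M₁ + m₂ + m₃ + 4 * ℓ + 4 with hM₂
  set γ : ℝ := (1 / (2 * (ℓ + 1))) ^ ℓ with hγ
  have hγ0 : 0 < γ := by positivity
  have hγ1 : γ ≤ 1 := pow_le_one₀ (by positivity) (by
    rw [div_le_one (by positivity)]; linarith [(Nat.cast_nonneg ℓ : (0 : ℝ) ≤ ℓ)])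
  set a : ℝ := 4 * ℓ * (ℓ + 1) + 4 + 2 * Real.log (1 / γ) with ha
  have hlog : 0 ≤ Real.log (1 / γ) := Real.log_nonneg (by rw [le_div_iff₀ hγ0]; linarith)
  have ha0 : 0 ≤ a := by positivity
  set K₀ : ℝ := Real.exp a * max (2 / γ) M₂ with hK₀
  have hM₂1 : (1 : ℝ) ≤ M₂ := by exact_mod_cast (by omega : 1 ≤ M₂)
  have hmax1 : 1 ≤ max (2 / γ) (M₂ : ℝ) := hM₂1.trans (le_max_right _ _)
  have hK₀1 : 1 ≤ K₀ := by
    have := Real.one_le_exp ha0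
    calc (1 : ℝ) = 1 * 1 := (one_mul 1).symm
      _ ≤ _ := mul_le_mul this hmax1 (by norm_num) (by positivity)
  have hKge : ∀ m : ℕ, 1 ≤ m → max (2 / γ) (M₂ : ℝ) ≤ K₀ * Real.exp (-a / m) := by
    intro m hm
    have hm' : (1 : ℝ) ≤ m := by exact_mod_cast hm
    have h1 : a / m ≤ a := div_le_self ha0 hm'
    calc max (2 / γ) (M₂ : ℝ) ≤ Real.exp (a + -a / m) * max (2 / γ) (M₂ : ℝ) := by
          refine le_mul_of_one_le_left (by linarith) (Real.one_le_exp ?_)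
          rw [neg_div]; linarith
      _ = _ := by rw [Real.exp_add, hK₀]; ring
  suffices h : ∀ m, M₁ ≤ m → ∀ (V : Type) (G : SimpleGraph V) (lev : V → ℕ) (s t : List V)
      (A : Finset V), #A = m → Frame G lev ℓ q μ ν s A t →
      HasDist (fun L => IsPow G (ℓ + 1) (s ++ L ++ t) ∧ (L : Multiset V) = A.val)
        (spr m (K₀ * Real.exp (-a / m))) by
    refine ⟨M₁, K₀, hK₀1, fun V G lev s t A hA hF => ?_⟩
    refine (h _ hA V G lev s t A rfl hF).spr_mono (by positivity)
      (mul_le_of_le_one_right (by linarith) (Real.exp_le_one_iff.2 ?_))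
    rw [neg_div]; have : 0 ≤ a / (#A : ℝ) := by positivity
    linarith
  intro m
  induction m using Nat.strong_induction_on with
  | _ m ih =>
    intro hm V G lev s t A hA hF
    have hKm := hKge m (by omega)
    rcases lt_or_ge m M₂ with hlt | hge
    · obtain ⟨L, hL⟩ := hm₁ V G lev s t A (by omega) hF
      refine (hasDist_single (Φ := fun L => IsPow G (ℓ + 1) (s ++ L ++ t) ∧ (L : Multiset V) = A.val)
        hL).mono (fun _ h => h) (fun I y => by unfold spr; positivity) fun I y L' hL' hag => Or.inr ?_
      have hlen : L'.length = m := by rw [← hA, ← Multiset.coe_card, hL'.2]; rfl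
      have hI : #I ≤ m := by rw [← hlen]; exact hag.card_le
      unfold spr
      rw [one_le_div (Nat.cast_pos.2 (Nat.descFactorial_pos.2 hI))]
      calc ((m.descFactorial #I : ℕ) : ℝ) ≤ (m : ℝ) ^ #I := by
            exact_mod_cast Nat.descFactorial_le_pow m #I
        _ ≤ _ := by
            refine pow_le_pow_left₀ (Nat.cast_nonneg _) ?_ _
            exact le_trans (by exact_mod_cast hlt.le) ((le_max_right _ _).trans hKm)
    · have hD : #(A ∪ s.toFinset ∪ t.toFinset) ≤ (1 + 2 * ℓ) * #A := by
        have := hF.card_le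
        have : 1 ≤ #A := by omega
        nlinarith
      have hx := hm₂ #A (by omega)
      have hcard : γ * ((#A).descFactorial ℓ : ℕ) ≤ #(cliques G lev ℓ q A) := by
        have h1 := le_card_cliques hℓ hq1 (by linarith) (by linarith) (by linarith) hF.good
        refine le_trans ?_ h1
        calc γ * ((#A).descFactorial ℓ : ℕ) ≤ γ * (#A : ℝ) ^ ℓ := by
              gcongr
              exact_mod_cast Nat.descFactorial_le_pow _ _
          _ = _ := by rw [hγ, ← mul_pow]; congr 1; ring
      subst hA
      refine hF.hasDist_step (by omega) (by omega) hγ0 hγ1 le_rfl ((le_max_left _ _).trans hKm) hcard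
        (fun A' h1 h2 h3 => by
          convert hm₃ V G lev _ A A' (by omega) hD hF.good h1 h2 h3)
        fun s' t' S h1 h2 hFS => ?_
      have hS0 : (0 : ℝ) < #S := Nat.cast_pos.2 (by omega)
      refine (ih #S (by omega) (by omega) V G lev s' t' S rfl hFS).spr_mono (by positivity) ?_
      have h3 : (2 : ℝ) * #S ≤ #A := by exact_mod_cast h1
      have h4 : Real.exp (-a / #S) ≤ Real.exp (-a / #A) * Real.exp (-a / #A) := by
        rw [← Real.exp_add]
        refine Real.exp_le_exp.2 ?_
        rw [neg_div, neg_div, ← neg_add, neg_le_neg_iff, ← add_div,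
          div_le_div_iff₀ (by linarith) hS0]
        nlinarith
      have h5 := mul_le_mul_of_nonneg_left h4 (by linarith : 0 ≤ K₀)
      rwa [← mul_assoc] at h5

end spread

lemma pow_le_exp_mul_descFactorial : ∀ n s : ℕ, s ≤ n →
    (n : ℝ) ^ s ≤ Real.exp s * (n.descFactorial s : ℕ)
  | n, 0, _ => by simp
  | 0, s + 1, h => by omega
  | n + 1, s + 1, h => by
    have ih := pow_le_exp_mul_descFactorial n s (by omega)
    have h1 : ((n + 1 : ℕ) : ℝ) ^ s ≤ Real.exp 1 * (n : ℝ) ^ s := by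
      rcases Nat.eq_zero_or_pos n with rfl | hn
      · obtain rfl : s = 0 := by omega
        simp
      · have hn' : (0 : ℝ) < n := Nat.cast_pos.2 hn
        have hsn : (s : ℝ) ≤ n := by exact_mod_cast (by omega : s ≤ n)
        calc ((n + 1 : ℕ) : ℝ) ^ s = (1 / n + 1) ^ s * (n : ℝ) ^ s := by
              rw [← mul_pow]; congr 1; push_cast; field_simp; ring
          _ ≤ (Real.exp (1 / n)) ^ s * (n : ℝ) ^ s := by
              gcongr
              exact Real.add_one_le_exp _
          _ ≤ _ := by
              rw [← Real.exp_nat_mul]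
              gcongr
              rw [mul_one_div, div_le_one hn']
              exact hsn
    rw [Nat.succ_descFactorial_succ, pow_succ]
    push_cast at h1 ⊢
    calc ((n : ℝ) + 1) ^ s * (n + 1) ≤ Real.exp 1 * (Real.exp s * (n.descFactorial s : ℕ)) * (n + 1) := by
          gcongr
          exact h1.trans (by gcongr)
      _ = _ := by rw [Real.exp_add]; ring

section cyclic
open Classical

variable {V : Type} [Fintype V] {G : SimpleGraph V} {lev : V → ℕ} {ℓ q : ℕ} {μ ν : ℝ}

lemma hasDist_nil {V : Type} (K : ℝ) : HasDist (fun L : List V => True ∧ (L : Multiset V) = (∅ : Finset V).val)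
    (spr 0 (|K|)) := by
  refine (hasDist_single (L := []) ⟨trivial, rfl⟩).mono (fun _ h => h)
    (fun I y => by unfold spr; positivity) fun I y L hL hag => Or.inr ?_
  have h1 := hag.card_le
  have h2 : L.length = 0 := by rw [← Multiset.coe_card, hL.2]; rfl
  have h3 : #I = 0 := by omega
  simp [spr, h3]

lemma Good.sdiff {B : Finset V} (hq1 : 1 ≤ q) (hℓ : 1 ≤ ℓ) (hμ : 0 < μ) (hν : 0 < ν) (hν1 : ν ≤ 1)
    (h : Good G lev ℓ q (2 * μ) (ν / 2) (fun _ => True) univ) (hB : #B = ℓ)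
    (hbig : 4 * ℓ * (μ⁻¹ + ν⁻¹) ≤ (#(univ \ B) : ℝ)) :
    Good G lev ℓ q μ ν (fun _ => True) (univ \ B) := by
  have hℓ1 : (1 : ℝ) ≤ ℓ := by exact_mod_cast hℓ
  have hq0 : (1 : ℝ) ≤ q := by exact_mod_cast hq1
  have hcard : (#(univ : Finset V) : ℝ) = #(univ \ B) + ℓ := by
    rw [← hB, ← Nat.cast_add, Finset.card_sdiff_add_card_eq_card (Finset.subset_univ B)]
  have hμn : (ℓ : ℝ) ≤ μ * #(univ \ B) := by
    have : 4 * ℓ * μ⁻¹ ≤ (#(univ \ B) : ℝ) := le_trans (by gcongr; linarith [inv_pos.2 hν]) hbig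
    have := mul_le_mul_of_nonneg_left this hμ.le
    rw [show μ * (4 * ℓ * μ⁻¹) = 4 * ℓ by field_simp] at this
    linarith
  have hνn : 4 * (ℓ : ℝ) ≤ ν * #(univ \ B) := by
    have : 4 * ℓ * ν⁻¹ ≤ (#(univ \ B) : ℝ) := le_trans (by gcongr; linarith [inv_pos.2 hμ]) hbig
    have := mul_le_mul_of_nonneg_left this hν.le
    rwa [show ν * (4 * ℓ * ν⁻¹) = 4 * ℓ by field_simp] at this
  refine ⟨fun _ _ => trivial, h.lev_le, fun v _ => ?_, fun c hc => ?_⟩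
  · have h1 := h.deg v trivial
    rw [hcard] at h1
    have h2 : #{u ∈ (univ : Finset V) | G.Adj v u} ≤ #{u ∈ univ \ B | G.Adj v u} + ℓ := by
      rw [← hB]
      refine (Finset.card_le_card fun u hu => ?_).trans (Finset.card_union_le _ _)
      simp only [Finset.mem_union, Finset.mem_filter, Finset.mem_sdiff, Finset.mem_univ,
        true_and] at hu ⊢
      tauto
    have h2' : (#{u ∈ (univ : Finset V) | G.Adj v u} : ℝ) ≤ #{u ∈ univ \ B | G.Adj v u} + ℓ := by
      exact_mod_cast h2
    have h3 : (0 : ℝ) ≤ ((ℓ : ℝ) - 1) / (ℓ + 1) + lev v / ((ℓ + 1) * q) :=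
      add_nonneg (div_nonneg (by linarith) (by linarith)) (by positivity)
    set x : ℝ := ((ℓ : ℝ) - 1) / (ℓ + 1) + lev v / ((ℓ + 1) * q)
    have h4 : 0 ≤ x * ℓ := by positivity
    have h5 : 0 ≤ μ * ℓ := by positivity
    nlinarith
  · have h1 := h.low c hc
    rw [hcard] at h1
    have h2 : (#{v ∈ univ \ B | lev v < c} : ℝ) ≤ #{v ∈ (univ : Finset V) | lev v < c} := by
      exact_mod_cast Finset.card_le_card (Finset.filter_subset_filter _ (Finset.subset_univ _))
    have h3 : (c : ℝ) / ((ℓ + 1) * q) ≤ 1 := by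
      rw [div_le_one (by positivity)]
      have : (c : ℝ) ≤ q := by exact_mod_cast hc
      nlinarith
    set x : ℝ := (c : ℝ) / ((ℓ + 1) * q)
    nlinarith

set_option maxHeartbeats 1000000 in
/-- A spread distribution on `ℓ`th powers of Hamilton cycles. -/
theorem hasDist_cycles {ℓ q : ℕ} (hℓ : 2 ≤ ℓ) (hq1 : 1 ≤ q) {μ ν : ℝ} (hμ : 0 < μ) (hμ1 : μ ≤ 1)
    (hν0 : 0 < ν) (hν : ν ≤ μ / 128) (hqμ : 1 / (((ℓ : ℝ) + 1) * q) ≤ μ / 64) :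
    ∃ (M : ℕ) (K : ℝ), 1 ≤ K ∧ ∀ (V : Type) [Fintype V] (G : SimpleGraph V) (lev : V → ℕ),
      M ≤ Fintype.card V → Good G lev ℓ q (2 * μ) (ν / 2) (fun _ => True) univ →
      HasDist (fun L => IsPow G (ℓ + 1) (L ++ L.take ℓ) ∧ (L : Multiset V) = Finset.univ.val)
        (fun I _ => (K / Fintype.card V) ^ #I) := by
  obtain ⟨m₁, K₁, hK₁, hm₁⟩ := Frame.hasDist hℓ hq1 hμ hμ1 hν0.le hν hqμ
  obtain ⟨m₂, hm₂⟩ := exists_nat_ge (4 * ℓ * (μ⁻¹ + ν⁻¹))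
  set γ : ℝ := (1 / (2 * (ℓ + 1))) ^ ℓ with hγ
  have hγ0 : 0 < γ := by positivity
  have hγ1 : γ ≤ 1 := pow_le_one₀ (by positivity) (by
    rw [div_le_one (by positivity)]; linarith [(Nat.cast_nonneg ℓ : (0 : ℝ) ≤ ℓ)])
  set a : ℝ := 4 * ℓ * (ℓ + 1) + 4 + 2 * Real.log (1 / γ) with ha
  have hlog : 0 ≤ Real.log (1 / γ) := Real.log_nonneg (by rw [le_div_iff₀ hγ0]; linarith)
  have ha0 : 0 ≤ a := by positivity
  set K : ℝ := Real.exp a * K₁ + 2 / γ with hK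
  have hK1 : 1 ≤ K := by
    have h1 := Real.one_le_exp ha0
    have h2 : 1 * 1 ≤ Real.exp a * K₁ := mul_le_mul h1 hK₁ (by norm_num) (by positivity)
    have : 0 < 2 / γ := by positivity
    linarith
  refine ⟨m₁ + m₂ + 4 * ℓ + 4, Real.exp 1 * K, ?_, fun V _ G lev hV hG => ?_⟩
  · have h1 := Real.one_le_exp (zero_le_one (α := ℝ))
    nlinarith
  set n := Fintype.card V with hn
  have hn1 : (8 : ℝ) ≤ n := by exact_mod_cast (by omega : 8 ≤ n)
  have hcu : #(univ : Finset V) = n := Finset.card_univ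
  have hcard : γ * (n.descFactorial ℓ : ℕ) ≤ #(cliques G lev ℓ q univ) := by
    have h1 := le_card_cliques hℓ hq1 (by linarith) (by linarith) (by linarith) hG
    rw [hcu] at h1
    refine le_trans ?_ h1
    calc γ * (n.descFactorial ℓ : ℕ) ≤ γ * (n : ℝ) ^ ℓ := by
          gcongr
          exact_mod_cast Nat.descFactorial_le_pow _ _
      _ = _ := by rw [hγ, ← mul_pow]; congr 1; ring
  have hδ : (0 : ℝ) < 1 - 1 / n := by
    rw [sub_pos, div_lt_one (by linarith)]; linarith
  have hC0 : (cliques G lev ℓ q univ).Nonempty := by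
    rw [← Finset.card_pos, ← Nat.cast_pos (α := ℝ)]
    refine lt_of_lt_of_le (mul_pos hγ0 (Nat.cast_pos.2 (Nat.descFactorial_pos.2 (by omega)))) hcard
  have key : HasDist (fun L => IsPow G (ℓ + 1) (L ++ L.take ℓ) ∧
      (L : Multiset V) = Finset.univ.val) (spr n K) := by
    refine HasDist.outer hcu (m₁ := 0)
      (fun c hc => ⟨injective_of_mem_cliques hc, (mem_cliques.1 hc).1⟩) hC0 (by linarith) hcard
      (K' := K * Real.exp (-a / n)) (δ := 1 - 1 / n) (fun c hc => ?_)
      (fun s₀ s' h1 h2 h3 N c _ h5 h6 h7 =>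
        spread_step (by omega) (by omega) hγ0 hγ1 le_rfl
          (by rw [hK]; have : 0 < Real.exp a * K₁ := by positivity
              linarith) h1 h2 h3 h5 h6 h7)
    have hinj := injective_of_mem_cliques hc
    obtain ⟨hcA, hcq, hcadj⟩ := mem_cliques.1 hc
    have hBc : #(Finset.univ.image c) = ℓ := by rw [Finset.card_image_of_injective _ hinj]; simp
    have hA'c : #(univ \ Finset.univ.image c) = n - ℓ := by
      rw [Finset.card_sdiff_of_subset (Finset.subset_univ _), hBc, hcu]
    have hcl : (List.ofFn c).length = ℓ := List.length_ofFn
    have hcp : IsPow G (ℓ + 1) (List.ofFn c) := by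
      intro i j x y hij _ hx hy
      rw [List.getElem?_eq_some_iff] at hx hy
      obtain ⟨hi, rfl⟩ := hx
      obtain ⟨hj, rfl⟩ := hy
      rw [List.getElem_ofFn, List.getElem_ofFn]
      exact hcadj _ _ (by simp; omega)
    have hct : ∀ v ∈ List.ofFn c, lev v = q := by
      simp only [List.mem_ofFn]
      rintro _ ⟨i, rfl⟩
      exact hcq i
    have hgood := hG.sdiff (B := Finset.univ.image c) hq1 (by omega) hμ hν0 (by linarith) hBc (by
      rw [hA'c]; exact hm₂.trans (by exact_mod_cast (by omega : m₂ ≤ n - ℓ)))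
    have hfr : Frame G lev ℓ q μ ν (List.ofFn c) (univ \ Finset.univ.image c) (List.ofFn c) := by
      refine ⟨hcl, hcl, hcp, hcp, hct, hct, ?_⟩
      have := inv_nonneg.2 (rt_nonneg (m := #(univ \ Finset.univ.image c)))
      exact hgood.mono (fun _ _ => trivial) (fun v hv => by
        rw [Finset.mem_union, Finset.mem_union]; exact Or.inl (Or.inl hv)) (by linarith) (by linarith)
    have hd := hm₁ V G lev _ _ _ (by rw [hA'c]; omega) hfr
    rw [hA'c] at hd
    have hKe : K₁ ≤ K * Real.exp (-a / n) := by
      have h1 : a / n ≤ a := div_le_self ha0 (by linarith)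
      calc K₁ ≤ Real.exp (a + -a / n) * K₁ := by
            refine le_mul_of_one_le_left (by linarith) (Real.one_le_exp ?_)
            rw [neg_div]; linarith
        _ = (Real.exp a * K₁) * Real.exp (-a / n) := by rw [Real.exp_add]; ring
        _ ≤ _ := by
            gcongr
            rw [hK]
            have : 0 < 2 / γ := by positivity
            linarith
    have hKe0 : 0 ≤ K * Real.exp (-a / n) := by linarith
    have hin := HasDist.inner (ℓ := ℓ) (A := univ \ Finset.univ.image c) c
      (fun i hi => (Finset.mem_sdiff.1 hi).2 (Finset.mem_image_of_mem _ (Finset.mem_univ i)))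
      (m₁ := 0) (m₂ := n - ℓ) (by omega) (𝒢 := {∅}) (by simp) hδ
      (by
        have : (0 : ℝ) < 1 / n := by positivity
        simp)
      (Φ₁ := fun _ _ => True)
      (Φ₂ := fun _ L => IsPow G (ℓ + 1) (List.ofFn c ++ L ++ List.ofFn c))
      hKe0
      (fun S hS => by
        rw [Finset.mem_singleton.1 hS]
        have := hasDist_nil (V := V) (K * Real.exp (-a / n))
        rwa [abs_of_nonneg hKe0] at this)
      (fun S hS => by
        rw [Finset.mem_singleton.1 hS, Finset.sdiff_empty]
        exact hd.spr_mono (by linarith) hKe)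
    rw [zero_add] at hin
    have hKp : 0 < K := by linarith
    refine hin.mono ?_ (fun I y => by split_ifs <;> positivity) (fun I y L _ _ => Or.inl le_rfl)
    rintro L ⟨S, hS, L₁, L₂, ⟨-, h2⟩, ⟨h3, h4⟩, rfl⟩
    rw [Finset.mem_singleton.1 hS] at h2 h4
    have h2' : L₁ = [] := by simpa using h2
    subst h2'
    constructor
    · rw [List.nil_append, List.take_append_of_le_length hcl.ge, List.take_of_length_le hcl.le]
      exact h3
    · rw [List.nil_append, ← Multiset.coe_add, h4, Finset.sdiff_empty,
        ← val_add_ofFn (A := univ) hinj hcA]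
      abel
  refine key.mono (fun _ h => h) (fun I y => by positivity) fun I y L hL hag => Or.inl ?_
  have hlen : L.length = n := by rw [← hcu, ← Multiset.coe_card, hL.2]; rfl
  have hI : #I ≤ n := by rw [← hlen]; exact hag.card_le
  have h1 := pow_le_exp_mul_descFactorial n #I hI
  have h2 : (0 : ℝ) < (n.descFactorial #I : ℕ) := Nat.cast_pos.2 (Nat.descFactorial_pos.2 hI)
  unfold spr
  rw [div_pow, div_le_div_iff₀ h2 (by positivity), mul_pow, ← Real.exp_nat_mul, mul_one]
  have hKp : 0 < K ^ #I := by positivity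
  nlinarith

end cyclic

section cycles
open Classical

variable {V : Type} {ℓ n : ℕ}

/-- A cyclic enumeration without repetitions. -/
structure Cyclic (n : ℕ) (g : ℕ → V) : Prop where
  periodic : Function.Periodic g n
  injOn : Set.InjOn g (Set.Iio n)

/-- The edges of the `ℓ`th power of a cycle. -/
noncomputable def cycleEdges (ℓ n : ℕ) (g : ℕ → V) : Finset (Finset V) :=
  (range n ×ˢ Icc 1 ℓ).image fun x => {g x.1, g (x.1 + x.2)}

/-- The edges of the `ℓ`th power of a path. -/
noncomputable def pathEdges (ℓ n : ℕ) (g : ℕ → V) : Finset (Finset V) :=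
  {x ∈ range n ×ˢ Icc 1 ℓ | x.1 + x.2 < n}.image fun x => {g x.1, g (x.1 + x.2)}

lemma Cyclic.apply_mod {g : ℕ → V} (hg : Cyclic n g) (k : ℕ) : g (k % n) = g k :=
  hg.periodic.map_mod_nat k

lemma Cyclic.eq_iff {g : ℕ → V} (hg : Cyclic n g) (hn : 0 < n) {i j : ℕ} :
    g i = g j ↔ i % n = j % n := by
  constructor
  · intro h
    rw [← hg.apply_mod i, ← hg.apply_mod j] at h
    exact hg.injOn (Nat.mod_lt _ hn) (Nat.mod_lt _ hn) h
  · intro h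
    rw [← hg.apply_mod i, h, hg.apply_mod]

lemma Cyclic.add {g : ℕ → V} (hg : Cyclic n g) (r : ℕ) : Cyclic n fun k => g (k + r) := by
  rcases Nat.eq_zero_or_pos n with rfl | hn
  · exact ⟨fun k => rfl, fun i hi => by simp at hi⟩
  refine ⟨fun k => ?_, fun i hi j hj hij => ?_⟩
  · have := hg.periodic (k + r)
    simpa [add_right_comm] using this
  · have h1 : (i + r) ≡ (j + r) [MOD n] := (hg.eq_iff hn).1 hij
    have h2 := Nat.ModEq.add_right_cancel' r h1
    rwa [Nat.ModEq, Nat.mod_eq_of_lt hi, Nat.mod_eq_of_lt hj] at h2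

lemma Cyclic.exists_eq [Fintype V] {g : ℕ → V} (hg : Cyclic n g) (hV : Fintype.card V = n) (v : V) :
    ∃ k : Fin n, g k = v := by
  have h : Function.Injective fun k : Fin n => g k := fun i j hij =>
    Fin.ext (hg.injOn i.2 j.2 hij)
  exact ((Fintype.bijective_iff_injective_and_card _).2 ⟨h, by simp [hV]⟩).2 v

lemma mem_cycleEdges {g : ℕ → V} {e : Finset V} :
    e ∈ cycleEdges ℓ n g ↔ ∃ i d, i < n ∧ 1 ≤ d ∧ d ≤ ℓ ∧ e = {g i, g (i + d)} := by
  simp only [cycleEdges, Finset.mem_image, Finset.mem_product, Finset.mem_range, Finset.mem_Icc,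
    Prod.exists]
  constructor
  · rintro ⟨i, d, ⟨h1, h2, h3⟩, rfl⟩; exact ⟨i, d, h1, h2, h3, rfl⟩
  · rintro ⟨i, d, h1, h2, h3, rfl⟩; exact ⟨i, d, ⟨h1, h2, h3⟩, rfl⟩

lemma mem_pathEdges {g : ℕ → V} {e : Finset V} :
    e ∈ pathEdges ℓ n g ↔ ∃ i d, i + d < n ∧ 1 ≤ d ∧ d ≤ ℓ ∧ e = {g i, g (i + d)} := by
  simp only [pathEdges, Finset.mem_image, Finset.mem_filter, Finset.mem_product, Finset.mem_range,
    Finset.mem_Icc, Prod.exists]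
  constructor
  · rintro ⟨i, d, ⟨⟨h1, h2, h3⟩, h4⟩, rfl⟩; exact ⟨i, d, h4, h2, h3, rfl⟩
  · rintro ⟨i, d, h1, h2, h3, rfl⟩; exact ⟨i, d, ⟨⟨by omega, h2, h3⟩, h1⟩, rfl⟩

lemma card_cycleEdges_sdiff_le (g : ℕ → V) : #(cycleEdges ℓ n g \ pathEdges ℓ n g) ≤ ℓ * ℓ := by
  have h : cycleEdges ℓ n g \ pathEdges ℓ n g ⊆
      (Ico (n - ℓ) n ×ˢ Icc 1 ℓ).image fun x => {g x.1, g (x.1 + x.2)} := by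
    intro e he
    obtain ⟨h1, h2⟩ := Finset.mem_sdiff.1 he
    obtain ⟨i, d, hi, hd, hdℓ, rfl⟩ := mem_cycleEdges.1 h1
    refine Finset.mem_image.2 ⟨(i, d), ?_, rfl⟩
    by_contra h3
    refine h2 (mem_pathEdges.2 ⟨i, d, ?_, hd, hdℓ, rfl⟩)
    simp only [Finset.mem_product, Finset.mem_Ico, Finset.mem_Icc] at h3
    omega
  refine (Finset.card_le_card h).trans (Finset.card_image_le.trans ?_)
  rw [Finset.card_product, Nat.card_Ico, Nat.card_Icc]
  exact Nat.mul_le_mul (by omega) (by omega)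

lemma card_pathEdges_le (g : ℕ → V) : #(pathEdges ℓ n g) ≤ n * ℓ := by
  refine Finset.card_image_le.trans ((Finset.card_filter_le _ _).trans ?_)
  rw [Finset.card_product, Finset.card_range, Nat.card_Icc]
  exact Nat.mul_le_mul le_rfl (by omega)

/-- Few edges of a cycle power all lie on a path power. -/
lemma Cyclic.exists_cut {g : ℕ → V} (hg : Cyclic n g) {T : Finset (Finset V)}
    (hT : T ⊆ cycleEdges ℓ n g) (hTn : #T * ℓ < n) : ∃ r, T ⊆ pathEdges ℓ n fun k => g (k + r) := by
  have hn : 0 < n := by omega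
  have h1 : ∀ e : Finset V, ∃ x : ℕ × ℕ, e ∈ T →
      x.1 < n ∧ 1 ≤ x.2 ∧ x.2 ≤ ℓ ∧ e = {g x.1, g (x.1 + x.2)} := by
    intro e
    by_cases he : e ∈ T
    · obtain ⟨i, d, h⟩ := mem_cycleEdges.1 (hT he)
      exact ⟨(i, d), fun _ => h⟩
    · exact ⟨(0, 0), fun h => absurd h he⟩
  choose x hx using h1
  have h2 : #(T.biUnion fun e => (Icc 1 ℓ).image fun h => ((x e).1 + h) % n) < #(range n) := by
    rw [Finset.card_range]
    refine lt_of_le_of_lt (Finset.card_biUnion_le_card_mul _ _ ℓ fun e _ => ?_) hTn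
    exact Finset.card_image_le.trans (by simp)
  obtain ⟨r, hr, hrB⟩ := Finset.exists_mem_notMem_of_card_lt_card h2
  have hrn := Finset.mem_range.1 hr
  refine ⟨r, fun e he => ?_⟩
  obtain ⟨hi, hd, hdℓ, hee⟩ := hx e he
  set i := (x e).1
  set d := (x e).2
  have hmod : ((i + n - r) % n + r) % n = i := by
    rw [Nat.mod_add_mod, Nat.sub_add_cancel (by omega), Nat.add_mod_right, Nat.mod_eq_of_lt hi]
  have hlt : (i + n - r) % n < n := Nat.mod_lt _ hn
  set i' := (i + n - r) % n with hi'
  refine mem_pathEdges.2 ⟨i', d, ?_, hd, hdℓ, ?_⟩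
  · by_contra hge
    refine hrB (Finset.mem_biUnion.2 ⟨e, he, Finset.mem_image.2 ⟨n - i', ?_, ?_⟩⟩)
    · rw [Finset.mem_Icc]; omega
    · change (i + (n - i')) % n = r
      rw [← hmod, Nat.mod_add_mod, show i' + r + (n - i') = r + n by omega, Nat.add_mod_right,
        Nat.mod_eq_of_lt hrn]
  · rw [hee]
    have e1 : g (i' + r) = g i := (hg.eq_iff hn).2 (by rw [hmod, Nat.mod_eq_of_lt hi])
    have e2 : g (i' + d + r) = g (i + d) := (hg.eq_iff hn).2 (by
      rw [show i' + d + r = i' + r + d by omega, ← Nat.mod_add_mod, hmod])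
    rw [e1, e2]

/-- Cyclic closeness of positions. -/
def Close (ℓ n : ℕ) (a b : Fin n) : Prop :=
  ∃ d, 1 ≤ d ∧ d ≤ ℓ ∧ ((a + d) % n = b ∨ (b + d) % n = a)

lemma Close.symm {a b : Fin n} (h : Close ℓ n a b) : Close ℓ n b a := by
  obtain ⟨d, h1, h2, h3⟩ := h
  exact ⟨d, h1, h2, h3.symm⟩

lemma card_close_le (hℓn : ℓ < n) (a : Fin n) : #{b | Close ℓ n a b} ≤ 2 * ℓ := by
  have hn : 0 < n := by omega
  have h : ({b | Close ℓ n a b} : Finset (Fin n)) ⊆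
      ((Icc 1 ℓ).image fun d => (⟨(a + d) % n, Nat.mod_lt _ hn⟩ : Fin n)) ∪
      (Icc 1 ℓ).image fun d => (⟨(a + n - d) % n, Nat.mod_lt _ hn⟩ : Fin n) := by
    intro b hb
    obtain ⟨d, h1, h2, h3⟩ := (Finset.mem_filter.1 hb).2
    rw [Finset.mem_union, Finset.mem_image, Finset.mem_image]
    have hb := b.2
    rcases h3 with h3 | h3
    · exact Or.inl ⟨d, Finset.mem_Icc.2 ⟨h1, h2⟩, Fin.ext h3⟩
    · refine Or.inr ⟨d, Finset.mem_Icc.2 ⟨h1, h2⟩, Fin.ext ?_⟩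
      change (a + n - d) % n = b
      rcases lt_or_ge (b + d : ℕ) n with hlt | hge
      · rw [Nat.mod_eq_of_lt hlt] at h3
        rw [← h3, show (b : ℕ) + d + n - d = b + n by omega, Nat.add_mod_right, Nat.mod_eq_of_lt hb]
      · rw [Nat.mod_eq_sub_mod hge, Nat.mod_eq_of_lt (by omega)] at h3
        rw [← h3, show (b : ℕ) + d - n + n - d = b by omega, Nat.mod_eq_of_lt hb]
  refine (Finset.card_le_card h).trans ((Finset.card_union_le _ _).trans ?_)
  have h1 := Finset.card_image_le (s := Icc 1 ℓ)
    (f := fun d => (⟨(a + d) % n, Nat.mod_lt _ hn⟩ : Fin n))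
  have h2 := Finset.card_image_le (s := Icc 1 ℓ)
    (f := fun d => (⟨(a + n - d) % n, Nat.mod_lt _ hn⟩ : Fin n))
  rw [Nat.card_Icc] at h1 h2
  omega

lemma pair_eq {x y z w : V} (h : ({x, y} : Finset V) = {z, w}) : x = z ∧ y = w ∨ x = w ∧ y = z := by
  rw [← Finset.coe_inj] at h
  push_cast at h
  exact Set.pair_eq_pair_iff.1 h

set_option maxHeartbeats 1000000 in
/-- The exponential moment of the overlap of a random cycle power with part of a fixed path power. -/
lemma moment_cycles [Fintype V] (hV : Fintype.card V = n) (hℓ : 1 ≤ ℓ) (hℓn : ℓ < n) {ι : Type}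
    [Fintype ι] {w : ι → ℝ} (hw : ∀ i, 0 ≤ w i) {g : ι → ℕ → V} (hg : ∀ i, Cyclic n (g i))
    {N s C a : ℝ} (hN : 1 ≤ N) (hNn : N ^ ℓ = n) (hs : 1 ≤ s) (hC : 0 ≤ C)
    (ha : a = 2 ^ ℓ * (2 * ℓ * C / s)) (hal : 2 * a * ℓ ≤ 1)
    (hspread : ∀ I ⊆ range n, ∀ y : ℕ → V, prob w (fun i => ∀ j ∈ I, g i j = y j) ≤ (C / n) ^ #I)
    {f : ℕ → V} (hf : Cyclic n f) {T : Finset (Finset V)} (hT : T ⊆ pathEdges ℓ n f) :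
    ∑ i, w i * (1 + N / s ^ 2) ^ #(T ∩ cycleEdges ℓ n (g i)) ≤
      (1 + 2 * a * (N ^ (ℓ - 1))⁻¹) ^ (2 * #T) := by
  have hn : 0 < n := by omega
  have h1 : ∀ e : Finset V, ∃ x : ℕ × ℕ, e ∈ T →
      x.1 < x.2 ∧ x.2 ≤ x.1 + ℓ ∧ x.2 < n ∧ e = {f x.1, f x.2} := by
    intro e
    by_cases he : e ∈ T
    · obtain ⟨i, d, h1, h2, h3, h4⟩ := mem_pathEdges.1 (hT he)
      exact ⟨(i, i + d), fun _ => ⟨by dsimp only; omega, by dsimp only; omega, h1, h4⟩⟩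
    · exact ⟨(0, 0), fun h => absurd h he⟩
  choose x hx using h1
  choose pos hpos using fun i v => (hg i).exists_eq hV v
  have hpos_eq : ∀ i v (k : ℕ), g i k = v → (pos i v : ℕ) = k % n := by
    intro i v k hk
    have := ((hg i).eq_iff hn).1 ((hpos i v).trans hk.symm)
    rwa [Nat.mod_eq_of_lt (pos i v).2] at this
  have ha0 : 0 ≤ a := by rw [ha]; positivity
  have hends : ∀ k ∈ ends (T.image x), k < n := by
    intro k hk
    obtain ⟨y, hy⟩ := mem_ends.1 hk
    rcases hy with hy | hy <;> obtain ⟨e, he, hxe⟩ := Finset.mem_image.1 hy <;>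
      obtain ⟨h1, -, h2, -⟩ := hx e he <;> rw [hxe] at h1 h2 <;> dsimp only at h1 h2 <;> omega
  have key := moment_bound (Close ℓ n) hw (fun i k => pos i (f k)) hℓ (by simp)
    (fun _ _ h => h.symm) (fun a => by convert card_close_le hℓn a) (T.image x)
    (fun e he => by
      obtain ⟨e', he', rfl⟩ := Finset.mem_image.1 he
      exact ⟨(hx e' he').1, (hx e' he').2.1⟩) hN hNn hs hC ha hal
    (fun U hU τ => by
      have hUn : ∀ v ∈ U, v < n := fun v hv => hends v (hU hv)
      by_cases hinj : Set.InjOn τ U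
      · have hleft := hinj.leftInvOn_invFunOn
        have hspr := hspread (U.image fun v => (τ v : ℕ)) (Finset.image_subset_iff.2 fun v _ =>
          Finset.mem_range.2 (τ v).2)
          (fun k => f (Function.invFunOn (fun v => (τ v : ℕ)) U k))
        have hinj' : Set.InjOn (fun v => (τ v : ℕ)) U := fun u hu v hv huv =>
          hinj hu hv (Fin.ext huv)
        rw [Finset.card_image_of_injOn hinj'] at hspr
        refine le_trans (prob_mono hw fun i hi => ?_) hspr
        intro j hj
        obtain ⟨v, hv, rfl⟩ := Finset.mem_image.1 hj
        rw [hinj'.leftInvOn_invFunOn hv, ← hi v hv]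
        exact hpos i (f v)
      · have h0 : prob w (fun i => ∀ v ∈ U, pos i (f v) = τ v) = 0 := by
          refine Finset.sum_eq_zero fun i _ => if_neg fun hi => hinj fun u hu v hv huv => ?_
          rw [← hi u hu, ← hi v hv] at huv
          have h2 : f u = f v := by rw [← hpos i (f u), huv, hpos]
          exact hf.injOn (hUn u hu) (hUn v hv) h2
        rw [h0]; positivity)
  have hb : (0 : ℝ) ≤ 2 * a * (N ^ (ℓ - 1))⁻¹ := by positivity
  calc ∑ i, w i * (1 + N / s ^ 2) ^ #(T ∩ cycleEdges ℓ n (g i)) ≤ _ := by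
        refine Finset.sum_le_sum fun i _ => mul_le_mul_of_nonneg_left ?_ (hw i)
        refine pow_le_pow_right₀ (by have : 0 ≤ N / s ^ 2 := by positivity
                                     linarith) ?_
        refine Finset.card_le_card_of_injOn x (fun e he => ?_) fun e he e' he' hee => ?_
        · obtain ⟨heT, heg⟩ := Finset.mem_inter.1 he
          obtain ⟨-, -, -, h4⟩ := hx e heT
          obtain ⟨k, d, hk, hd, hdℓ, hkd⟩ := mem_cycleEdges.1 heg
          refine Finset.mem_coe.2 (Finset.mem_filter.2 ⟨Finset.mem_image_of_mem _ heT, d, hd, hdℓ, ?_⟩)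
          rcases pair_eq (h4.symm.trans hkd) with ⟨e1, e2⟩ | ⟨e1, e2⟩
          · left
            rw [hpos_eq i _ k e1.symm, hpos_eq i _ (k + d) e2.symm, Nat.mod_add_mod]
          · right
            rw [hpos_eq i _ k e2.symm, hpos_eq i _ (k + d) e1.symm, Nat.mod_add_mod]
        · rw [(hx e (Finset.mem_inter.1 he).1).2.2.2, (hx e' (Finset.mem_inter.1 he').1).2.2.2, hee]
    _ ≤ _ := key
    _ ≤ _ := by
        refine pow_le_pow_right₀ (by linarith) ((card_ends_le _).trans ?_)
        exact Nat.mul_le_mul_left _ Finset.card_image_le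

end cycles

section sparse
open Classical

variable {V : Type} {ℓ n : ℕ}

/-- A spread distribution on lists gives a spread distribution on cycle powers. -/
lemma HasDist.exists_cycles [Fintype V] (hV : Fintype.card V = n) (hℓn : ℓ < n) {G : SimpleGraph V}
    {C : ℝ} (h : HasDist (fun L => IsPow G (ℓ + 1) (L ++ L.take ℓ) ∧
      (L : Multiset V) = Finset.univ.val) (fun I _ => (C / n) ^ #I)) :
    ∃ (ι : Type) (_ : Fintype ι) (w : ι → ℝ) (g : ι → ℕ → V), (∀ i, 0 ≤ w i) ∧ ∑ i, w i = 1 ∧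
      (∀ i, Cyclic n (g i)) ∧
      (∀ i k d, k < n → 1 ≤ d → d ≤ ℓ → G.Adj (g i k) (g i (k + d))) ∧
      ∀ I ⊆ range n, ∀ y : ℕ → V, prob w (fun i => ∀ j ∈ I, g i j = y j) ≤ (C / n) ^ #I := by
  obtain ⟨ι, hι, w, L, hw, hw1, hL, hspr⟩ := h
  have hn : 0 < n := by omega
  have hlen : ∀ i, (L i).length = n := fun i => by
    rw [← hV, ← Finset.card_univ, ← Multiset.coe_card, (hL i).2]; rfl
  have hnd : ∀ i, (L i).Nodup := fun i => by
    rw [← Multiset.coe_nodup, (hL i).2]; exact Finset.univ.nodup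
  have hlt : ∀ i k, k % n < (L i).length := fun i k => by rw [hlen]; exact Nat.mod_lt _ hn
  have hget : ∀ i k, k < n → (L i)[k]? = some ((L i)[k % n]'(hlt i k)) := by
    intro i k hk
    rw [List.getElem?_eq_getElem (by rw [hlen]; exact hk)]
    simp only [Nat.mod_eq_of_lt hk]
  refine ⟨ι, hι, w, fun i k => (L i)[k % n]'(hlt i k), hw, hw1, fun i => ⟨fun k => ?_, ?_⟩, ?_, ?_⟩
  · simp only [Nat.add_mod_right]
  · intro a ha b hb hab
    have := (hnd i).getElem_inj_iff.1 hab
    rwa [Nat.mod_eq_of_lt ha, Nat.mod_eq_of_lt hb] at this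
  · intro i k d hk hd hdℓ
    refine (hL i).1 k (k + d) _ _ (by omega) (by omega) ?_ ?_
    · rw [List.getElem?_append_left (by rw [hlen]; exact hk)]
      exact hget i k hk
    · rcases lt_or_ge (k + d) n with h1 | h1
      · rw [List.getElem?_append_left (by rw [hlen]; exact h1)]
        exact hget i _ h1
      · rw [List.getElem?_append_right (by rw [hlen]; exact h1), hlen,
          List.getElem?_take_of_lt (by omega), hget i _ (by omega)]
        congr 2
        rw [← Nat.mod_eq_sub_mod h1]
  · intro I hI y
    refine le_trans (prob_mono hw fun i hi => ?_) (hspr I y)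
    intro j hj
    rw [hget i j (Finset.mem_range.1 (hI hj))]
    exact congrArg some (hi j hj)

set_option maxHeartbeats 1000000 in
/-- A spread distribution on cycle powers makes the sparsification contain one of them. -/
theorem sparse_of_spread {ℓ : ℕ} (hℓ : 2 ≤ ℓ) {C ε : ℝ} (hC : 1 ≤ C) (hε : 0 < ε) :
    ∃ R N₀ : ℝ, ∀ (V : Type) [Fintype V] (n : ℕ) (N : ℝ), Fintype.card V = n → N₀ ≤ N → N ^ ℓ = n →
      ∀ (ι : Type) [Fintype ι] (w : ι → ℝ) (g : ι → ℕ → V), (∀ i, 0 ≤ w i) → ∑ i, w i = 1 →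
      (∀ i, Cyclic n (g i)) →
      (∀ I ⊆ range n, ∀ y : ℕ → V, prob w (fun i => ∀ j ∈ I, g i j = y j) ≤ (C / n) ^ #I) →
      ∀ E : Finset (Finset V), (∀ i, cycleEdges ℓ n (g i) ⊆ E) →
      ∀ p q : ℝ, 0 < p → p ≤ 1 → 1 - q = (1 - p) * (1 - p) → R ≤ p * N →
      1 - ε ≤ ∑ W ∈ E.powerset, wt E q W * if ∃ i, cycleEdges ℓ n (g i) ⊆ W then 1 else 0 := by
  have hℓ1 : (2 : ℝ) ≤ ℓ := by exact_mod_cast hℓ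
  have hlog : 0 < Real.log (1 + ε / 2) := Real.log_pos (by linarith)
  set A : ℝ := 2 ^ ℓ * (2 * ℓ * C) with hA
  have hA0 : 0 < A := by positivity
  set D : ℝ := 8 * ℓ + 4 / Real.log (1 + ε / 2) with hD
  have hD0 : 0 < D := by positivity
  set s : ℝ := 1 + A * D with hs
  have hs1 : 1 ≤ s := by rw [hs]; have := mul_pos hA0 hD0; linarith
  set a : ℝ := 2 ^ ℓ * (2 * ℓ * C / s) with ha
  have ha' : a = A / s := by rw [ha, hA]; ring
  have ha0 : 0 < a := by rw [ha']; positivity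
  have haD : a * D ≤ 1 := by
    rw [ha', div_mul_eq_mul_div, div_le_one (by linarith)]
    linarith
  have haℓ : 8 * ℓ * a ≤ 1 := by
    have : 0 ≤ a * (4 / Real.log (1 + ε / 2)) := by positivity
    rw [hD] at haD
    nlinarith
  have haε : Real.exp (4 * a) ≤ 1 + ε / 2 := by
    rw [← Real.le_log_iff_exp_le (by linarith)]
    have h1 : a * (4 / Real.log (1 + ε / 2)) ≤ 1 := by
      have : 0 ≤ a * (8 * ℓ) := by positivity
      rw [hD] at haD
      nlinarith
    rw [← mul_div_assoc, div_le_one hlog] at h1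
    linarith
  have htend := Real.tendsto_pow_mul_exp_neg_atTop_nhds_zero (ℓ * ℓ)
  obtain ⟨N₁, hN₁⟩ := Filter.eventually_atTop.1
    (htend.eventually (ge_mem_nhds (show 0 < ε / 4 / 2 ^ (ℓ * ℓ) by positivity)))
  refine ⟨s ^ 2 * Real.exp 2, max N₁ (ℓ + 1), ?_⟩
  intro V _ n N hV hN₀ hNn ι _ w g hw hw1 hg hspr E hE p q hp hp1 hpq hR
  have hN1 := hN₁ N ((le_max_left _ _).trans hN₀)
  have hNℓ : (ℓ : ℝ) + 1 ≤ N := (le_max_right _ _).trans hN₀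
  have hN : 1 ≤ N := by linarith
  have hN2 : N ^ 2 ≤ n := by rw [← hNn]; exact pow_le_pow_right₀ hN hℓ
  have hℓn : ℓ < n := by
    have : (ℓ : ℝ) < n := by nlinarith
    exact_mod_cast this
  have hNN : N ≤ N ^ (ℓ - 1) := le_self_pow₀ hN (by omega)
  have hNN' : N ^ (ℓ - 1) * N = n := by rw [← pow_succ, Nat.sub_add_cancel (by omega), hNn]
  have hNp : 0 < N ^ (ℓ - 1) := by positivity
  set lam : ℝ := N / s ^ 2 with hlam
  have hlam0 : 0 ≤ lam := by positivity
  have hs2 : 1 ≤ s ^ 2 := one_le_pow₀ hs1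
  have hlamN : lam ≤ N := div_le_self (by linarith) hs2
  have hlp : Real.exp 2 ≤ lam * p := by
    rw [hlam, div_mul_eq_mul_div, le_div_iff₀ (by linarith)]
    linarith
  have hexp2 : (1 : ℝ) ≤ Real.exp 2 := Real.one_le_exp (by norm_num)
  have hal : 2 * a * ℓ ≤ 1 := by nlinarith [mul_pos ha0 (by linarith : (0 : ℝ) < ℓ)]
  have hmom : ∀ (f : ℕ → V), Cyclic n f → ∀ T ⊆ pathEdges ℓ n f,
      ∑ i, w i * (1 + lam) ^ #(T ∩ cycleEdges ℓ n (g i)) ≤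
        Real.exp (4 * a * (#T / N ^ (ℓ - 1))) := by
    intro f hf T hT
    refine (moment_cycles hV (by omega) hℓn hw hg hN hNn hs1 (by linarith) ha hal hspr hf hT).trans ?_
    calc (1 + 2 * a * (N ^ (ℓ - 1))⁻¹) ^ (2 * #T) ≤
        Real.exp (2 * a * (N ^ (ℓ - 1))⁻¹) ^ (2 * #T) := by
          gcongr
          rw [add_comm]
          exact Real.add_one_le_exp _
      _ = _ := by
          rw [← Real.exp_nat_mul]
          congr 1
          push_cast
          ring
  have hmain := two_round (E := E) w hw hw1 (fun i => cycleEdges ℓ n (g i)) hE hp hp1 hpq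
    (hexp2.trans hlp) (show 0 ≤ ε / 2 by linarith) ⌈N⌉₊ (M := (2 * N) ^ (ℓ * ℓ) * Real.exp N)
    (fun j => by
      have h1 := hmom (g j) (hg j) _ Finset.Subset.rfl
      calc ∑ i, w i * (1 + lam) ^ #(cycleEdges ℓ n (g i) ∩ cycleEdges ℓ n (g j)) ≤
          ∑ i, (1 + lam) ^ (ℓ * ℓ) *
            (w i * (1 + lam) ^ #(pathEdges ℓ n (g j) ∩ cycleEdges ℓ n (g i))) := by
            refine Finset.sum_le_sum fun i _ => ?_
            rw [mul_left_comm, ← pow_add]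
            refine mul_le_mul_of_nonneg_left (pow_le_pow_right₀ (by linarith) ?_) (hw i)
            calc #(cycleEdges ℓ n (g i) ∩ cycleEdges ℓ n (g j)) ≤
                #((cycleEdges ℓ n (g j) \ pathEdges ℓ n (g j)) ∪
                  (pathEdges ℓ n (g j) ∩ cycleEdges ℓ n (g i))) := by
                  refine Finset.card_le_card fun e he => ?_
                  simp only [Finset.mem_inter, Finset.mem_union, Finset.mem_sdiff] at he ⊢
                  tauto
              _ ≤ _ := (Finset.card_union_le _ _).trans
                  (Nat.add_le_add_right (card_cycleEdges_sdiff_le _) _)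
        _ ≤ (2 * N) ^ (ℓ * ℓ) * Real.exp N := by
            rw [← Finset.mul_sum]
            refine mul_le_mul (pow_le_pow_left₀ (by linarith) (by linarith) _) (h1.trans ?_)
              (Finset.sum_nonneg fun i _ => mul_nonneg (hw i) (by positivity)) (by positivity)
            refine Real.exp_le_exp.2 ?_
            have h2 : (#(pathEdges ℓ n (g j)) : ℝ) ≤ n * ℓ := by
              exact_mod_cast card_pathEdges_le (g j)
            have h3 : (#(pathEdges ℓ n (g j)) : ℝ) / N ^ (ℓ - 1) ≤ N * ℓ := by
              rw [div_le_iff₀ hNp]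
              calc (#(pathEdges ℓ n (g j)) : ℝ) ≤ n * ℓ := h2
                _ = _ := by rw [← hNN']; ring
            calc 4 * a * (#(pathEdges ℓ n (g j)) / N ^ (ℓ - 1)) ≤ 4 * a * (N * ℓ) := by gcongr
              _ = 8 * ℓ * a * (N / 2) := by ring
              _ ≤ 1 * (N / 2) := by gcongr
              _ ≤ N := by linarith)
    (fun i T hT hTt => by
      have hTN : (#T : ℝ) < N := Nat.lt_ceil.1 hTt
      have hTn : #T * ℓ < n := by
        have : (#T * ℓ : ℝ) < n := by nlinarith [(Nat.cast_nonneg #T : (0 : ℝ) ≤ #T)]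
        exact_mod_cast this
      obtain ⟨r, hr⟩ := (hg i).exists_cut hT hTn
      have h1 := hmom _ ((hg i).add r) T hr
      calc ∑ j, w j * (1 + p⁻¹) ^ #(T ∩ cycleEdges ℓ n (g j)) ≤
          ∑ j, w j * (1 + lam) ^ #(T ∩ cycleEdges ℓ n (g j)) := by
            refine Finset.sum_le_sum fun j _ => mul_le_mul_of_nonneg_left ?_ (hw j)
            have h2 : p⁻¹ ≤ lam := by
              rw [inv_le_iff_one_le_mul₀ hp]; exact hexp2.trans hlp
            gcongr
        _ ≤ _ := h1
        _ ≤ Real.exp (4 * a * 1) := by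
            gcongr
            rw [div_le_one hNp]
            linarith
        _ ≤ 1 + ε / 2 := by rw [mul_one]; exact haε)
  refine le_trans ?_ hmain
  have hpow : Real.exp (2 * N) ≤ (lam * p) ^ ⌈N⌉₊ := by
    calc Real.exp (2 * N) ≤ Real.exp (⌈N⌉₊ * 2) := by
          refine Real.exp_le_exp.2 ?_
          have := Nat.le_ceil N
          linarith
      _ = Real.exp 2 ^ ⌈N⌉₊ := Real.exp_nat_mul _ _
      _ ≤ _ := by gcongr
  have hfin : ((lam * p) ^ ⌈N⌉₊)⁻¹ * ((2 * N) ^ (ℓ * ℓ) * Real.exp N) ≤ ε / 4 := by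
    calc _ ≤ (Real.exp (2 * N))⁻¹ * ((2 * N) ^ (ℓ * ℓ) * Real.exp N) := by gcongr
      _ = 2 ^ (ℓ * ℓ) * (N ^ (ℓ * ℓ) * Real.exp (-N)) := by
          rw [mul_pow, ← Real.exp_neg,
            show Real.exp (-N) = Real.exp (-(2 * N)) * Real.exp N by rw [← Real.exp_add]; congr 1; ring]
          ring
      _ ≤ 2 ^ (ℓ * ℓ) * (ε / 4 / 2 ^ (ℓ * ℓ)) := by gcongr
      _ = ε / 4 := by field_simp
  linarith

end sparse

section degrees
open Classical

variable {ℓ n : ℕ}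

/-- The simple graph given by a set of pairs. -/
def pairGraph (G : Finset (Finset (Fin n))) : SimpleGraph (Fin n) where
  Adj u v := u ≠ v ∧ ({u, v} : Finset (Fin n)) ∈ G
  symm := ⟨fun u v h => ⟨h.1.symm, by rw [Finset.pair_comm]; exact h.2⟩⟩
  loopless := ⟨fun _ h => h.1 rfl⟩

lemma degOf_le {G : Finset (Finset (Fin n))} (hG : IsHG 2 n G) (v : Fin n) :
    degOf G v ≤ #{u | (pairGraph G).Adj v u} := by
  refine (Finset.card_le_card fun e he => ?_).trans
    (Finset.card_image_le (s := ({u | (pairGraph G).Adj v u} : Finset (Fin n)))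
      (f := fun u => ({v, u} : Finset (Fin n))))
  obtain ⟨heG, hv⟩ := Finset.mem_filter.1 he
  obtain ⟨x, y, hxy, rfl⟩ := Finset.card_eq_two.1 (hG e heG)
  rw [Finset.mem_image]
  rcases Finset.mem_insert.1 hv with rfl | h
  · exact ⟨y, Finset.mem_filter.2 ⟨Finset.mem_univ _, hxy, heG⟩, rfl⟩
  · obtain rfl := Finset.mem_singleton.1 h
    exact ⟨x, Finset.mem_filter.2 ⟨Finset.mem_univ _, hxy.symm, by rwa [Finset.pair_comm]⟩,
      Finset.pair_comm _ _⟩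

/-- The degree sequence condition organises the vertices into levels. -/
lemma exists_good {G : Finset (Finset (Fin n))} (hG : IsHG 2 n G) {q : ℕ} (hq1 : 1 ≤ q)
    {μ μ₁ : ℝ} (hμ : 1 ≤ (μ - 2 * μ₁) * n) (hn : ℓ + 1 ≤ n)
    (hdeg : ∃ σ : Equiv.Perm (Fin n),
      (∀ i j : Fin n, i ≤ j → degOf G (σ i) ≤ degOf G (σ j)) ∧
      (∀ i : Fin n, ((i : ℕ) + 1 : ℝ) ≤ (n : ℝ) / ((ℓ : ℝ) + 1) →
        ((ℓ : ℝ) - 1) * (n : ℝ) / ((ℓ : ℝ) + 1) + ((i : ℕ) + 1 : ℝ) + μ * n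
          < (degOf G (σ i) : ℝ))) :
    ∃ lev : Fin n → ℕ, Good (pairGraph G) lev ℓ q (2 * μ₁) 0 (fun _ => True) univ := by
  obtain ⟨σ, hσ, hσd⟩ := hdeg
  have hn0 : (0 : ℝ) < n := Nat.cast_pos.2 (by omega)
  have hq0 : (0 : ℝ) < q := Nat.cast_pos.2 (by omega)
  have hℓ0 : (0 : ℝ) < (ℓ : ℝ) + 1 := by positivity
  set P : Fin n → ℕ → Prop := fun v c =>
    (((ℓ : ℝ) - 1) / (ℓ + 1) + (c : ℕ) / ((ℓ + 1) * q) + 2 * μ₁) * n ≤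
      #{u | (pairGraph G).Adj v u} with hP
  have hbound : ∀ c ≤ q, ∀ i : Fin n, ⌊(c : ℝ) / ((ℓ + 1) * q) * n⌋₊ ≤ (i : ℕ) + 1 → P (σ i) c := by
    intro c hc i hi
    set k := ⌊(c : ℝ) / ((ℓ + 1) * q) * n⌋₊ with hk
    have hcq : (c : ℝ) / ((ℓ + 1) * q) * n ≤ n / (ℓ + 1) := by
      have : (c : ℝ) ≤ q := by exact_mod_cast hc
      rw [div_mul_eq_mul_div, div_le_div_iff₀ (by positivity) hℓ0]
      nlinarith [mul_pos hn0 hℓ0]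
    have hkle : (k : ℝ) ≤ c / ((ℓ + 1) * q) * n := Nat.floor_le (by positivity)
    have hklt : (c : ℝ) / ((ℓ + 1) * q) * n < k + 1 := Nat.lt_floor_add_one _
    have h1n : (1 : ℝ) ≤ n / (ℓ + 1) := by
      rw [le_div_iff₀ hℓ0, one_mul]; exact_mod_cast hn
    have hi2 := i.2
    have hmono := hσ ⟨k - 1, by omega⟩ i (by rw [Fin.le_def]; dsimp only; omega)
    have hcast : ((k - 1 : ℕ) : ℝ) + 1 ≤ n / (ℓ + 1) ∧ (k : ℝ) ≤ ((k - 1 : ℕ) : ℝ) + 1 := by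
      rcases Nat.eq_zero_or_pos k with h | h
      · rw [h]; simpa using h1n
      · rw [Nat.cast_sub h]
        push_cast
        constructor <;> linarith
    have hd := hσd ⟨k - 1, by omega⟩ hcast.1
    have hd2 : (degOf G (σ ⟨k - 1, by omega⟩) : ℝ) ≤ degOf G (σ i) := by exact_mod_cast hmono
    have hd3 : (degOf G (σ i) : ℝ) ≤ #{u | (pairGraph G).Adj (σ i) u} := by
      exact_mod_cast degOf_le hG (σ i)
    have e1 : ((ℓ : ℝ) - 1) / (ℓ + 1) * n = (ℓ - 1) * n / (ℓ + 1) := by ring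
    change (((ℓ : ℝ) - 1) / (ℓ + 1) + (c : ℕ) / ((ℓ + 1) * q) + 2 * μ₁) * n ≤ _
    dsimp only at hd
    have h2 := hcast.2
    calc _ = ((ℓ : ℝ) - 1) / (ℓ + 1) * n + (c : ℝ) / ((ℓ + 1) * q) * n + 2 * μ₁ * n := by ring
      _ ≤ _ := by rw [e1]; linarith
  refine ⟨fun v => Nat.findGreatest (P v) q, fun _ _ => trivial, fun v => Nat.findGreatest_le q,
    fun v _ => ?_, fun c hc => ?_⟩
  · have h0 : P v 0 := by
      have := hbound 0 (by omega) (σ.symm v) (by simp)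
      rwa [Equiv.apply_symm_apply] at this
    have h1 := Nat.findGreatest_spec (P := P v) (Nat.zero_le q) h0
    rw [Finset.card_univ, Fintype.card_fin]
    exact h1
  · rw [Finset.card_univ, Fintype.card_fin, add_zero]
    have hsub : #{v ∈ (univ : Finset (Fin n)) | Nat.findGreatest (P v) q < c} ≤
        ⌊(c : ℝ) / ((ℓ + 1) * q) * n⌋₊ := by
      rw [← Finset.card_range ⌊(c : ℝ) / ((ℓ + 1) * q) * n⌋₊]
      refine Finset.card_le_card_of_injOn (fun v => ((σ.symm v : Fin n) : ℕ)) (fun v hv => ?_)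
        fun u _ v _ huv => σ.symm.injective (Fin.ext huv)
      have hv2 := (Finset.mem_filter.1 hv).2
      by_contra hge
      rw [Finset.mem_coe, Finset.mem_range, not_lt] at hge
      have h1 := hbound c hc (σ.symm v) (by dsimp only at hge; omega)
      rw [Equiv.apply_symm_apply] at h1
      exact absurd (Nat.le_findGreatest hc h1) (not_le.2 hv2)
    exact (Nat.cast_le.2 hsub).trans (Nat.floor_le (by positivity))

lemma hasPowHamCycle_of_subset {g : ℕ → Fin n} (hn : 0 < n) (hg : Cyclic n g)
    {W : Finset (Finset (Fin n))} (h : cycleEdges ℓ n g ⊆ W) : HasPowHamCycle ℓ n W := by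
  refine ⟨g, hg.periodic, hg.injOn, fun v => ?_, fun i j hj hjℓ => ?_⟩
  · obtain ⟨k, hk⟩ := hg.exists_eq (by simp) v
    exact ⟨k, k.2, hk⟩
  · have h1 := h (mem_cycleEdges.2 ⟨i % n, j, Nat.mod_lt _ hn, hj, hjℓ, rfl⟩)
    have e1 : g (i % n + j) = g (i + j) := (hg.eq_iff hn).2 (by rw [Nat.mod_add_mod])
    rw [hg.apply_mod, e1] at h1
    convert h1

lemma wt_sum_le_sparsProb {G : Finset (Finset (Fin n))} {p : ℝ} (hp0 : 0 ≤ p) (hp1 : p ≤ 1)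
    {Q R : Finset (Finset (Fin n)) → Prop} (h : ∀ W, R W → Q W) :
    ∑ W ∈ G.powerset, wt G p W * (if R W then 1 else 0) ≤ sparsProb G p Q := by
  unfold sparsProb
  refine Finset.sum_le_sum fun W _ => ?_
  have h0 : 0 ≤ wt G p W := wt_nonneg hp0 hp1
  unfold wt at *
  by_cases hR : R W
  · rw [if_pos hR, if_pos (h W hR), mul_one]
  · rw [if_neg hR, mul_zero]
    split_ifs
    · exact h0
    · exact le_rfl

end degrees

section main
open Classical

/-- The threshold in `n` past which everything needed about `p n` and `n` holds. -/
lemma eventually_large {ℓ : ℕ} (hℓ : 2 ≤ ℓ) {p : ℕ → ℝ}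
    (hω : Filter.Tendsto (fun n : ℕ => p n * (n : ℝ) ^ ((1 : ℝ) / (ℓ : ℝ)))
      Filter.atTop Filter.atTop) (R N₀ : ℝ) (μ : ℝ) (hμ : 0 < μ) (M : ℕ) :
    ∀ᶠ n : ℕ in Filter.atTop, (max (2 * R) 1 ≤ p n * (n : ℝ) ^ ((1 : ℝ) / (ℓ : ℝ)) ∧
      N₀ ≤ (n : ℝ) ^ ((1 : ℝ) / (ℓ : ℝ))) ∧ 1 ≤ μ * n ∧ M ≤ n := by
  have h1 : Filter.Tendsto (fun n : ℕ => (n : ℝ) ^ ((1 : ℝ) / (ℓ : ℝ)))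
      Filter.atTop Filter.atTop :=
    (tendsto_rpow_atTop (by positivity)).comp tendsto_natCast_atTop_atTop
  have h2 : Filter.Tendsto (fun n : ℕ => μ * (n : ℝ)) Filter.atTop Filter.atTop :=
    tendsto_natCast_atTop_atTop.const_mul_atTop hμ
  exact ((hω.eventually_ge_atTop _).and (h1.eventually_ge_atTop _)).and
    ((h2.eventually_ge_atTop _).and (Filter.eventually_ge_atTop M))

/-- Exposing the edges in two independent rounds of equal density. -/
lemma exists_half_density {q : ℝ} (h0 : 0 < q) (h1 : q ≤ 1) :
    ∃ r : ℝ, 0 < r ∧ r ≤ 1 ∧ 1 - q = (1 - r) * (1 - r) ∧ q ≤ 2 * r := by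
  have hs := Real.mul_self_sqrt (sub_nonneg.2 h1)
  have hs0 := Real.sqrt_nonneg (1 - q)
  refine ⟨1 - √(1 - q), ?_, by linarith, by rw [sub_sub_cancel, hs], ?_⟩ <;>
    nlinarith [sq_nonneg (1 - √(1 - q))]

lemma exists_threshold {ℓ : ℕ} (hℓ : 2 ≤ ℓ) {μ : ℝ} (hμ : 0 < μ) {p : ℕ → ℝ}
    (hp : ∀ n, 0 ≤ p n ∧ p n ≤ 1)
    (hω : Filter.Tendsto (fun n : ℕ => p n * (n : ℝ) ^ ((1 : ℝ) / (ℓ : ℝ)))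
      Filter.atTop Filter.atTop) {ε : ℝ} (hε : 0 < ε) :
    ∃ n₀ : ℕ, ∀ n, n₀ ≤ n →
      ∀ G : Finset (Finset (Fin n)), IsHG 2 n G →
        (∃ σ : Equiv.Perm (Fin n),
          (∀ i j : Fin n, i ≤ j → degOf G (σ i) ≤ degOf G (σ j)) ∧
          (∀ i : Fin n, ((i : ℕ) + 1 : ℝ) ≤ (n : ℝ) / ((ℓ : ℝ) + 1) →
            ((ℓ : ℝ) - 1) * (n : ℝ) / ((ℓ : ℝ) + 1) + ((i : ℕ) + 1 : ℝ) + μ * n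
              < (degOf G (σ i) : ℝ))) →
        1 - ε ≤ sparsProb G (p n) (fun E => HasPowHamCycle ℓ n E) := by
  set μ₁ : ℝ := min μ 1 / 4 with hμ₁
  have hm0 : 0 < min μ 1 := lt_min hμ one_pos
  have hμ₁0 : 0 < μ₁ := by positivity
  have hmμ : min μ 1 ≤ μ := min_le_left _ _
  have hm1 : min μ 1 ≤ 1 := min_le_right _ _
  obtain ⟨q, hq⟩ := exists_nat_ge (64 / μ₁ + 1)
  have hq64 : 64 / μ₁ ≤ q := by linarith
  have hq0 : (1 : ℝ) ≤ q := by have : 0 < 64 / μ₁ := by positivity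
                               linarith
  have hq1 : 1 ≤ q := by exact_mod_cast hq0
  have hqμ : 1 / (((ℓ : ℝ) + 1) * q) ≤ μ₁ / 64 := by
    rw [div_le_iff₀ hμ₁0] at hq64
    rw [div_le_div_iff₀ (by positivity) (by norm_num)]
    nlinarith [mul_nonneg (Nat.cast_nonneg (α := ℝ) ℓ) (mul_nonneg hμ₁0.le (zero_le_one.trans hq0))]
  obtain ⟨M, K, hK, hdist⟩ := hasDist_cycles hℓ hq1 hμ₁0 (by linarith) (ν := μ₁ / 128)
    (by positivity) le_rfl hqμ
  obtain ⟨R, N₀, hsparse⟩ := sparse_of_spread hℓ hK hε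
  obtain ⟨n₀, hn₀⟩ := Filter.eventually_atTop.1
    (eventually_large hℓ hω R N₀ (μ / 2) (by positivity) (max M (ℓ + 1)))
  refine ⟨n₀, fun n hn G hG hdeg => ?_⟩
  obtain ⟨⟨hpN, hN⟩, hμn, hMn⟩ := hn₀ n hn
  have hℓn : ℓ + 1 ≤ n := (le_max_right _ _).trans hMn
  have hnpos : 0 < n := by omega
  have hn0 : (0 : ℝ) < n := Nat.cast_pos.2 hnpos
  set N : ℝ := (n : ℝ) ^ ((1 : ℝ) / (ℓ : ℝ)) with hNdef
  have hN0 : 0 < N := Real.rpow_pos_of_pos hn0 _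
  have hNℓ : N ^ ℓ = n := by
    rw [hNdef, one_div]
    exact Real.rpow_inv_natCast_pow hn0.le (by omega)
  have hp0 : 0 < p n := by
    have h1 : 1 ≤ p n * N := (le_max_right _ _).trans hpN
    by_contra h
    nlinarith [mul_nonneg (sub_nonneg.2 (not_lt.1 h)) hN0.le]
  obtain ⟨r, hr0, hr1, hrp, hrq⟩ := exists_half_density hp0 (hp n).2
  have hRr : R ≤ r * N := by
    have h1 : 2 * R ≤ p n * N := (le_max_left _ _).trans hpN
    nlinarith [mul_le_mul_of_nonneg_right hrq hN0.le]
  have hcard : Fintype.card (Fin n) = n := Fintype.card_fin n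
  obtain ⟨lev, hlev⟩ := exists_good (μ₁ := μ₁) hG hq1
    (hμn.trans (mul_le_mul_of_nonneg_right (by linarith) hn0.le)) hℓn hdeg
  have hgood : Good (pairGraph G) lev ℓ q (2 * μ₁) (μ₁ / 128 / 2) (fun _ => True) univ :=
    hlev.mono (fun _ h => h) (fun _ _ => trivial) le_rfl (by positivity)
  have hd := hdist (Fin n) (pairGraph G) lev (by rw [hcard]; exact (le_max_left _ _).trans hMn) hgood
  rw [hcard] at hd
  obtain ⟨ι, _, w, g, hw0, hw1, hcyc, hadj, hspread⟩ := hd.exists_cycles hcard (by omega)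
  have hE : ∀ i, cycleEdges ℓ n (g i) ⊆ G := by
    intro i e he
    obtain ⟨k, d, hk, hd1, hdℓ, rfl⟩ := mem_cycleEdges.1 he
    convert (hadj i k d hk hd1 hdℓ).2
  refine (hsparse (Fin n) n N hcard hN hNℓ ι w g hw0 hw1 hcyc hspread G hE r (p n) hr0 hr1 hrp hRr).trans ?_
  convert wt_sum_le_sparsProb (G := G) (hp n).1 (hp n).2
    (R := fun W => ∃ i, cycleEdges ℓ n (g i) ⊆ W)
    (fun W ⟨i, hi⟩ => hasPowHamCycle_of_subset hnpos (hcyc i) hi)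
  rfl

end main

end PowHam

/-- **Powers of Hamilton cycles — degree sequence.**
If `ℓ ≥ 2`, `μ > 0`, `p = ω(n^{-1/ℓ})` and `G` is an `n`-vertex graph whose
increasing degree sequence `d₁ ≤ … ≤ d_n` satisfies
`d_i > (ℓ-1)n/(ℓ+1) + i + μn` for all `i ≤ n/(ℓ+1)`, then `G_p` contains the
`ℓ`-th power of a Hamilton cycle with high probability. -/
theorem power_hamilton_cycles_degree_sequence
    (ℓ : ℕ) (hℓ : 2 ≤ ℓ) (μ : ℝ) (hμ : 0 < μ)
    (p : ℕ → ℝ) (hp : ∀ n, 0 ≤ p n ∧ p n ≤ 1)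
    (hω : Filter.Tendsto (fun n : ℕ => p n * (n : ℝ) ^ ((1 : ℝ) / (ℓ : ℝ)))
      Filter.atTop Filter.atTop) :
    ∀ ε : ℝ, 0 < ε → ∃ n₀ : ℕ, ∀ n, n₀ ≤ n →
      ∀ G : Finset (Finset (Fin n)), IsHG 2 n G →
        (∃ σ : Equiv.Perm (Fin n),
          (∀ i j : Fin n, i ≤ j → degOf G (σ i) ≤ degOf G (σ j)) ∧
          (∀ i : Fin n, ((i : ℕ) + 1 : ℝ) ≤ (n : ℝ) / ((ℓ : ℝ) + 1) →
            ((ℓ : ℝ) - 1) * (n : ℝ) / ((ℓ : ℝ) + 1) + ((i : ℕ) + 1 : ℝ) + μ * n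
              < (degOf G (σ i) : ℝ))) →
        1 - ε ≤ sparsProb G (p n) (fun E => HasPowHamCycle ℓ n E) := by
  exact fun _ hε => PowHam.exists_threshold hℓ hμ hp hω hε
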